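/- Let 𝔽 be a fixed quadratic number field and let 3 ≤ X < Y be real numbers with Y > X^2. Then C_{𝔽,2}(X,Y) = (ρ_𝔽^2/(2ζ_𝔽(2)))·X^2·Y + (ζ_𝔽(0)·ρ_𝔽^2/(4ζ_𝔽(2)^2))·X^4 + O(X^{24/5}·Y^{-2/5} + X^2·Y^{2/3}·(log Y)^5 + X^{3/2}·Y·(log Y)^3), where the implied constant depends only on 𝔽. -/

import Mathlib

/-!
Ramanujan sums over a quadratic number field: `C_{𝔽,1}(X,Y) = ρ_𝔽·Y + O(X·Y^{1/2}·(log Y)^7 + X^2)`.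
-/

open NumberField Classical

/-- The Möbius function of a nonzero integral ideal: `0` if the ideal is not squarefree,
and `(-1)^r` if it is a product of `r` distinct prime ideals. -/
noncomputable def idealMu {F : Type} [Field F] [NumberField F] (I : Ideal (𝓞 F)) : ℤ :=
  if Squarefree I then (-1) ^ Multiset.card (UniqueFactorizationMonoid.factors I) else 0

/-- The Ramanujan sum `c_m(n) = Σ_{d ∣ m, d ∣ n} N(d)·μ(m/d)`, written as a sum over
factorizations `m = d·e` with `d ∣ n` of `N(d)·μ(e)`. -/
noncomputable def ramanujanSum {F : Type} [Field F] [NumberField F]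
    (m n : Ideal (𝓞 F)) : ℤ :=
  ∑ᶠ p ∈ {p : Ideal (𝓞 F) × Ideal (𝓞 F) | p.1 * p.2 = m ∧ p.1 ∣ n},
    (Ideal.absNorm p.1 : ℤ) * idealMu p.2

/-- `C_{𝔽,1}(X,Y) = Σ_{0 ≠ n, N(n) ≤ Y} Σ_{0 ≠ m, N(m) ≤ X} c_m(n)`. -/
noncomputable def C1 (F : Type) [Field F] [NumberField F] (X Y : ℝ) : ℤ :=
  ∑ᶠ n ∈ {n : Ideal (𝓞 F) | n ≠ 0 ∧ (Ideal.absNorm n : ℝ) ≤ Y},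
    ∑ᶠ m ∈ {m : Ideal (𝓞 F) | m ≠ 0 ∧ (Ideal.absNorm m : ℝ) ≤ X}, ramanujanSum m n


/-- `C_{𝔽,2}(X,Y) = Σ_{0 ≠ n, N(n) ≤ Y} (Σ_{0 ≠ m, N(m) ≤ X} c_m(n))^2`. -/
noncomputable def C2 (F : Type) [Field F] [NumberField F] (X Y : ℝ) : ℤ :=
  ∑ᶠ n ∈ {n : Ideal (𝓞 F) | n ≠ 0 ∧ (Ideal.absNorm n : ℝ) ≤ Y},
    (∑ᶠ m ∈ {m : Ideal (𝓞 F) | m ≠ 0 ∧ (Ideal.absNorm m : ℝ) ≤ X}, ramanujanSum m n) ^ 2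

/-- The Dedekind zeta function of `F` as a Dirichlet series over nonzero integral ideals,
valid for `Re s > 1`. -/
noncomputable def dzeta (F : Type) [Field F] [NumberField F] (s : ℂ) : ℂ :=
  ∑' I : {I : Ideal (𝓞 F) // I ≠ 0}, (Ideal.absNorm I.1 : ℂ) ^ (-s)

/-- `Z` is the meromorphic continuation of the Dedekind zeta function of `F`:
it is differentiable away from the (simple) pole `s = 1` and agrees with the
Dirichlet series on `Re s > 1`.  These properties determine `Z` uniquely away from `1`. -/
def IsDedekindZeta (F : Type) [Field F] [NumberField F] (Z : ℂ → ℂ) : Prop :=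
  (∀ s : ℂ, s ≠ 1 → DifferentiableAt ℂ Z s) ∧ ∀ s : ℂ, 1 < s.re → Z s = dzeta F s

namespace RS

theorem exists_omega_aux {R : Type} [CommRing R] [IsDomain R] [CharZero R] [Module.Finite ℤ R]
    (hrank : Module.finrank ℤ R = 2)
    (hintg : ∀ (n a : ℤ) (y : R), n ≠ 0 → (a : R) = n * y → ∃ b : ℤ, (b : R) = y) :
    ∃ ω : R, (∀ x : R, ∃ a b : ℤ, x = a + b * ω) ∧
      (∀ a b : ℤ, (a : R) + b * ω = 0 → a = 0 ∧ b = 0) := by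
  obtain ⟨N, hN⟩ : ∃ N : Submodule ℤ R, N = Submodule.span ℤ {1} := ⟨_, rfl⟩
  have hmem : ∀ x : R, x ∈ N ↔ ∃ a : ℤ, (a : R) = x := by
    intro x
    rw [hN, Submodule.mem_span_singleton]
    simp
  have htf : Module.IsTorsionFree ℤ (R ⧸ N) := by
    apply Module.IsTorsionFree.of_smul_eq_zero
    intro n x hx
    by_cases hn : n = 0
    · exact Or.inl hn
    right
    obtain ⟨y, rfl⟩ := Submodule.Quotient.mk_surjective N x
    rw [← Submodule.Quotient.mk_smul, Submodule.Quotient.mk_eq_zero, hmem] at hx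
    rw [Submodule.Quotient.mk_eq_zero, hmem]
    obtain ⟨a, ha⟩ := hx
    exact hintg n a y hn (by simpa using ha)
  have hfree : Module.Free ℤ (R ⧸ N) := Module.free_of_finite_type_torsion_free'
  have hN1 : Module.finrank ℤ N = 1 := by 
    rw [hN, ← (LinearEquiv.toSpanNonzeroSingleton ℤ R (1 : R) one_ne_zero).finrank_eq]
    exact Module.finrank_self ℤ
  have hq : Module.finrank ℤ (R ⧸ N) = 1 := by
    have := N.finrank_quotient_add_finrank
    omega
  obtain ⟨w, hw0, hw⟩ := finrank_eq_one_iff'.mp hq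
  obtain ⟨ω, rfl⟩ := Submodule.Quotient.mk_surjective N w
  refine ⟨ω, ?_, ?_⟩
  · intro x
    obtain ⟨b, hb⟩ := hw (Submodule.Quotient.mk x)
    have : x - b • ω ∈ N := by
      rw [← Submodule.Quotient.mk_eq_zero, Submodule.Quotient.mk_sub, Submodule.Quotient.mk_smul,
        hb, sub_self]
    obtain ⟨a, ha⟩ := (hmem _).mp this
    refine ⟨a, b, ?_⟩
    rw [ha]; simp
  · intro a b hab
    have hb : b = 0 := by
      have h1 : b • ω ∈ N := by
        rw [hmem]
        refine ⟨-a, ?_⟩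
        rw [zsmul_eq_mul]
        push_cast
        linear_combination (-1 : R) * hab
      rw [← Submodule.Quotient.mk_eq_zero, Submodule.Quotient.mk_smul] at h1
      rcases smul_eq_zero.mp h1 with h | h
      · exact h
      · exact absurd h hw0
    subst hb
    refine ⟨?_, rfl⟩
    simpa using hab

/-- integral basis `1, ω`, stated by hand -/
theorem exists_omega {F : Type} [Field F] [NumberField F] (hdeg : Module.finrank ℚ F = 2) :
    ∃ ω : 𝓞 F, (∀ x : 𝓞 F, ∃ a b : ℤ, x = a + b * ω) ∧
      (∀ a b : ℤ, (a : 𝓞 F) + b * ω = 0 → a = 0 ∧ b = 0) := by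
  apply exists_omega_aux
  · rw [RingOfIntegers.rank, hdeg]
  intro n a y hn ha
  have h1 : (a : F) = n * (y : F) := by
    have := congrArg (fun z : 𝓞 F => (z : F)) ha
    simpa using this
  have h2 : (y : F) = algebraMap ℚ F ((a : ℚ) / n) := by
    have : (n : F) ≠ 0 := by exact_mod_cast hn
    rw [map_div₀]
    simp only [map_intCast]
    field_simp
    rw [h1]; ring
  have h3 : IsIntegral ℤ (algebraMap ℚ F ((a : ℚ) / n)) := by
    rw [← h2]; exact y.isIntegral_coe
  rw [isIntegral_algebraMap_iff (algebraMap ℚ F).injective] at h3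
  obtain ⟨b, hb⟩ := IsIntegrallyClosed.isIntegral_iff.mp h3
  refine ⟨b, ?_⟩
  apply RingOfIntegers.coe_injective
  refine Eq.trans ?_ h2.symm
  rw [← hb]
  simp

end RS

namespace RS
section
variable {F : Type} [Field F] [NumberField F]

theorem root_hom {ω : 𝓞 F} {t n : ℤ} (h1 : ∀ x : 𝓞 F, ∃ a b : ℤ, x = a + b * ω)
    (h2 : ∀ a b : ℤ, (a : 𝓞 F) + b * ω = 0 → a = 0 ∧ b = 0)
    (hω : ω ^ 2 = t * ω - n) (p : ℕ) (r : ZMod p) (hr : r ^ 2 = t * r - n) :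
    ∃ φ : 𝓞 F →+* ZMod p, ∀ a b : ℤ, φ (a + b * ω) = a + b * r := by
  choose α β hαβ using h1
  have huniq : ∀ (x : 𝓞 F) (a b : ℤ), x = a + b * ω → α x = a ∧ β x = b := by
    intro x a b h
    have := h2 (α x - a) (β x - b) (by
      push_cast
      have := hαβ x
      linear_combination h - this)
    omega
  refine ⟨{ toFun := fun x => α x + β x * r, map_one' := ?_, map_mul' := ?_, map_zero' := ?_,
            map_add' := ?_ }, ?_⟩
  · obtain ⟨e1, e2⟩ := huniq 1 1 0 (by simp)
    simp [e1, e2]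
  · intro x y
    obtain ⟨e1, e2⟩ := huniq (x * y) (α x * α y - β x * β y * n)
      (α x * β y + β x * α y + β x * β y * t) (by
        conv_lhs => rw [hαβ x, hαβ y]
        push_cast
        linear_combination (β x * β y : 𝓞 F) * hω)
    rw [e1, e2]
    push_cast
    linear_combination -(β x * β y : ZMod p) * hr
  · obtain ⟨e1, e2⟩ := huniq 0 0 0 (by simp)
    simp [e1, e2]
  · intro x y
    obtain ⟨e1, e2⟩ := huniq (x + y) (α x + α y) (β x + β y) (by
        conv_lhs => rw [hαβ x, hαβ y]
        push_cast
        ring)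
    rw [e1, e2]
    push_cast
    ring
  · intro a b
    obtain ⟨e1, e2⟩ := huniq (a + b * ω) a b rfl
    change ((α (a + b * ω) : ℤ) : ZMod p) + (β (a + b * ω) : ℤ) * r = _
    rw [e1, e2]

theorem absNorm_ker {p : ℕ} (φ : 𝓞 F →+* ZMod p) : Ideal.absNorm (RingHom.ker φ) = p := by
  rw [Ideal.absNorm_apply, Submodule.cardQuot_apply]
  have hs : Function.Surjective φ := ZMod.ringHom_surjective φ
  rw [show Nat.card (𝓞 F ⧸ RingHom.ker φ) = Nat.card (ZMod p) from
    Nat.card_congr (RingHom.quotientKerEquivOfSurjective hs).toEquiv, Nat.card_zmod]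

theorem absNorm_span_p (hdeg : Module.finrank ℚ F = 2) (p : ℕ) :
    Ideal.absNorm (Ideal.span {(p : 𝓞 F)}) = p ^ 2 := by
  rw [Ideal.absNorm_span_natCast, RingOfIntegers.rank, hdeg]

theorem dvd_eq_of_absNorm {I J : Ideal (𝓞 F)} (h : I ∣ J) (hJ : Ideal.absNorm J ≠ 0)
    (hn : Ideal.absNorm I = Ideal.absNorm J) : I = J := by
  obtain ⟨K, rfl⟩ := h
  rw [map_mul] at hn hJ
  have : Ideal.absNorm K = 1 := by
    have h0 : Ideal.absNorm I ≠ 0 := left_ne_zero_of_mul hJ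
    exact Nat.eq_of_mul_eq_mul_left (Nat.pos_of_ne_zero h0) (by rw [← hn, mul_one])
  rw [Ideal.absNorm_eq_one_iff] at this
  rw [this, Ideal.mul_top]

theorem dvd_span_pow {I : Ideal (𝓞 F)} {p k : ℕ} (h : Ideal.absNorm I = p ^ k) :
    I ∣ Ideal.span {(p : 𝓞 F)} ^ k := by
  rw [Ideal.span_singleton_pow, Ideal.dvd_span_singleton]
  have := Ideal.absNorm_mem I
  rw [h] at this
  exact_mod_cast this

theorem ker_mul_ker (hdeg : Module.finrank ℚ F = 2) {ω : 𝓞 F} {t n : ℤ}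
    (h1 : ∀ x : 𝓞 F, ∃ a b : ℤ, x = a + b * ω)
    (hω : ω ^ 2 = t * ω - n) {p : ℕ} (hp : p.Prime) {r r' : ZMod p}
    (hs : r + r' = t) (hm : r * r' = n) (φ φ' : 𝓞 F →+* ZMod p)
    (hφ : ∀ a b : ℤ, φ (a + b * ω) = a + b * r)
    (hφ' : ∀ a b : ℤ, φ' (a + b * ω) = a + b * r') :
    RingHom.ker φ * RingHom.ker φ' = Ideal.span {(p : 𝓞 F)} := by
  symm
  apply dvd_eq_of_absNorm
  · rw [Ideal.dvd_iff_le, Ideal.mul_le]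
    intro x hx y hy
    obtain ⟨a, b, rfl⟩ := h1 x
    obtain ⟨c, d, rfl⟩ := h1 y
    rw [RingHom.mem_ker, hφ] at hx
    rw [RingHom.mem_ker, hφ'] at hy
    have e1 : ((a * c - b * d * n : ℤ) : ZMod p) = 0 := by
      push_cast
      linear_combination (c : ZMod p) * hx - b * r * hy + (b * d : ZMod p) * hm
    have e2 : ((a * d + b * c + b * d * t : ℤ) : ZMod p) = 0 := by
      push_cast
      linear_combination (d : ZMod p) * hx + b * hy - (b * d : ZMod p) * hs
    rw [ZMod.intCast_zmod_eq_zero_iff_dvd] at e1 e2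
    obtain ⟨u, hu⟩ := e1
    obtain ⟨v, hv⟩ := e2
    rw [Ideal.mem_span_singleton]
    refine ⟨u + v * ω, ?_⟩
    have hu' : ((a * c - b * d * n : ℤ) : 𝓞 F) = ((p * u : ℤ) : 𝓞 F) := by rw [hu]
    have hv' : ((a * d + b * c + b * d * t : ℤ) : 𝓞 F) = ((p * v : ℤ) : 𝓞 F) := by rw [hv]
    push_cast at hu' hv'
    linear_combination hu' + ω * hv' + (b * d : 𝓞 F) * hω
  · rw [map_mul, absNorm_ker, absNorm_ker]
    exact mul_ne_zero hp.ne_zero hp.ne_zero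
  · rw [map_mul, absNorm_ker, absNorm_ker, absNorm_span_p hdeg, sq]

theorem prime_of_absNorm {p : ℕ} (hp : p.Prime) {I : Ideal (𝓞 F)} (h : Ideal.absNorm I = p) :
    Prime I := by
  have h0 : I ≠ ⊥ := by
    rintro rfl
    simp at h
    exact hp.ne_zero h.symm
  have : I.IsPrime := Ideal.isPrime_of_irreducible_absNorm (by rw [h]; exact hp)
  exact Ideal.prime_of_isPrime h0 this

theorem card_ramified (hdeg : Module.finrank ℚ F = 2) {p : ℕ} (hp : p.Prime) {P : Ideal (𝓞 F)}
    (hP : Ideal.absNorm P = p) (hPP : P * P = Ideal.span {(p : 𝓞 F)}) (k : ℕ) :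
    Nat.card {I : Ideal (𝓞 F) // Ideal.absNorm I = p ^ k} = 1 := by
  have hprime := prime_of_absNorm hp hP
  rw [Nat.card_eq_one_iff_unique]
  refine ⟨⟨?_⟩, ⟨⟨P ^ k, by rw [map_pow, hP]⟩⟩⟩
  have key : ∀ I : Ideal (𝓞 F), Ideal.absNorm I = p ^ k → I = P ^ k := by
    intro I hI
    have := dvd_span_pow hI
    rw [← hPP, ← sq, ← pow_mul] at this
    obtain ⟨i, -, hi⟩ := (dvd_prime_pow hprime _).mp this
    rw [associated_iff_eq] at hi
    rw [hi, map_pow, hP] at hI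
    rw [hi, Nat.pow_right_injective hp.two_le hI]
  rintro ⟨I, hI⟩ ⟨J, hJ⟩
  rw [Subtype.mk.injEq, key I hI, key J hJ]

theorem card_inert {p : ℕ} (hp : p.Prime)
    (hprime : Prime (Ideal.span {(p : 𝓞 F)})) (hN : Ideal.absNorm (Ideal.span {(p : 𝓞 F)}) = p ^ 2)
    (k : ℕ) :
    Nat.card {I : Ideal (𝓞 F) // Ideal.absNorm I = p ^ k} = if Even k then 1 else 0 := by
  have key : ∀ I : Ideal (𝓞 F), Ideal.absNorm I = p ^ k →
      ∃ i, k = 2 * i ∧ I = Ideal.span {(p : 𝓞 F)} ^ i := by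
    intro I hI
    obtain ⟨i, -, hi⟩ := (dvd_prime_pow hprime _).mp (dvd_span_pow hI)
    rw [associated_iff_eq] at hi
    rw [hi, map_pow, hN, ← pow_mul] at hI
    exact ⟨i, (Nat.pow_right_injective hp.two_le hI).symm, hi⟩
  split_ifs with hk
  · obtain ⟨i, hi⟩ := hk
    rw [Nat.card_eq_one_iff_unique]
    refine ⟨⟨?_⟩, ⟨⟨Ideal.span {(p : 𝓞 F)} ^ i, by rw [map_pow, hN, ← pow_mul]; congr 1; omega⟩⟩⟩
    rintro ⟨I, hI⟩ ⟨J, hJ⟩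
    obtain ⟨i1, h1, rfl⟩ := key I hI
    obtain ⟨i2, h2, rfl⟩ := key J hJ
    have : i1 = i2 := by omega
    subst this; rfl
  · rw [Nat.card_eq_zero]
    left
    refine ⟨fun ⟨I, hI⟩ => ?_⟩
    obtain ⟨i, h, -⟩ := key I hI
    exact hk ⟨i, by omega⟩

theorem card_split {p : ℕ} (hp : p.Prime) {P Q : Ideal (𝓞 F)}
    (hP : Ideal.absNorm P = p) (hQ : Ideal.absNorm Q = p) (hne : P ≠ Q)
    (hPQ : P * Q = Ideal.span {(p : 𝓞 F)}) (k : ℕ) :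
    Nat.card {I : Ideal (𝓞 F) // Ideal.absNorm I = p ^ k} = k + 1 := by
  have hPp := prime_of_absNorm hp hP
  have hQp := prime_of_absNorm hp hQ
  have hf : Function.Bijective (fun i : Fin (k + 1) =>
      (⟨P ^ (i : ℕ) * Q ^ (k - i), by
        rw [map_mul, map_pow, map_pow, hP, hQ, ← pow_add]; congr 1; omega⟩ :
        {I : Ideal (𝓞 F) // Ideal.absNorm I = p ^ k})) := by
    constructor
    · have aux : ∀ i j : ℕ, i < j → j ≤ k → P ^ i * Q ^ (k - i) ≠ P ^ j * Q ^ (k - j) := by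
        intro i j hij hj h
        obtain ⟨d, rfl⟩ := Nat.exists_eq_add_of_lt hij
        rw [show i + d + 1 = i + (d + 1) by ring, pow_add, mul_assoc] at h
        have h' := mul_left_cancel₀ (pow_ne_zero i hPp.ne_zero) h
        have : P ∣ Q ^ (k - i) := by
          rw [h', pow_succ]
          exact ((dvd_mul_left _ _).mul_right _)
        have := hPp.dvd_of_dvd_pow this
        exact hne (dvd_eq_of_absNorm this (by rw [hQ]; exact hp.ne_zero) (by rw [hP, hQ]))
      intro i j hij
      simp only [Subtype.mk.injEq] at hij
      rcases lt_trichotomy (i : ℕ) j with h | h | h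
      · exact absurd hij (aux i j h (by omega))
      · exact Fin.ext h
      · exact absurd hij.symm (aux j i h (by omega))
    · rintro ⟨I, hI⟩
      have := dvd_span_pow hI
      rw [← hPQ, mul_pow] at this
      obtain ⟨A, B, hA, hB, rfl⟩ := exists_dvd_and_dvd_of_dvd_mul this
      obtain ⟨i, -, hi⟩ := (dvd_prime_pow hPp _).mp hA
      obtain ⟨j, -, hj⟩ := (dvd_prime_pow hQp _).mp hB
      rw [associated_iff_eq] at hi hj
      subst hi hj
      rw [map_mul, map_pow, map_pow, hP, hQ, ← pow_add] at hI
      have := Nat.pow_right_injective hp.two_le hI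
      refine ⟨⟨i, by omega⟩, ?_⟩
      simp only [Subtype.mk.injEq]
      rw [show k - i = j by omega]
  rw [← Nat.card_congr (Equiv.ofBijective _ hf)]
  simp

end
end RS

namespace RS
section
variable {F : Type} [Field F] [NumberField F]

theorem inert_prime (hdeg : Module.finrank ℚ F = 2) {ω : 𝓞 F} {t n : ℤ}
    (hω : ω ^ 2 = t * ω - n) {p : ℕ} (hp : p.Prime)
    (hno : ∀ r : ZMod p, r ^ 2 ≠ t * r - n) : Prime (Ideal.span {(p : 𝓞 F)}) := by
  have hN := absNorm_span_p hdeg p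
  have hp1 := hp.one_lt
  have htop : Ideal.span {(p : 𝓞 F)} ≠ ⊤ := by
    intro h
    rw [h, Ideal.absNorm_top] at hN
    nlinarith
  obtain ⟨P, hPmax, hPle⟩ := Ideal.exists_le_maximal _ htop
  have hdvd : P ∣ Ideal.span {(p : 𝓞 F)} := Ideal.dvd_iff_le.mpr hPle
  have hnd : Ideal.absNorm P ∣ p ^ 2 := by
    rw [← hN]; exact map_dvd Ideal.absNorm hdvd
  have hbot : P ≠ ⊥ := by
    rintro rfl
    rw [Ideal.absNorm_bot, zero_dvd_iff] at hnd
    exact hp.ne_zero (by simpa using hnd)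
  have hPp : Prime P := Ideal.prime_of_isPrime hbot hPmax.isPrime
  obtain ⟨i, hi, hPi⟩ := (Nat.dvd_prime_pow hp).mp hnd
  interval_cases i
  · rw [pow_zero, Ideal.absNorm_eq_one_iff] at hPi
    exact absurd hPi hPmax.ne_top
  · exfalso
    rw [pow_one] at hPi
    have hc : Nat.card (𝓞 F ⧸ P) = p := by
      rw [← Submodule.cardQuot_apply, ← Ideal.absNorm_apply, hPi]
    have : Finite (𝓞 F ⧸ P) := Nat.finite_of_card_ne_zero (by rw [hc]; exact hp.ne_zero)
    have : Fintype (𝓞 F ⧸ P) := Fintype.ofFinite _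
    rw [Nat.card_eq_fintype_card] at hc
    let e := ZMod.ringEquivOfPrime (𝓞 F ⧸ P) hp hc
    let φ : 𝓞 F →+* ZMod p := (e.symm : (𝓞 F ⧸ P) →+* ZMod p).comp (Ideal.Quotient.mk P)
    apply hno (φ ω)
    rw [← map_pow, hω]
    simp
  · have := dvd_eq_of_absNorm hdvd (by rw [hN]; exact pow_ne_zero _ hp.ne_zero) (by rw [hPi, hN])
    rwa [← this]

/-- number of ideals of norm `n` -/
noncomputable def aI (F : Type) [Field F] [NumberField F] (n : ℕ) : ℕ :=
  Nat.card {I : Ideal (𝓞 F) // Ideal.absNorm I = n}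

theorem sup_mul_left {m n : ℕ} (hmn : m.Coprime n) {I J : Ideal (𝓞 F)} (hI : Ideal.absNorm I = m)
    (hJ : Ideal.absNorm J = n) : I * J ⊔ Ideal.span {(m : 𝓞 F)} = I := by
  have hmI : (m : 𝓞 F) ∈ I := by rw [← hI]; exact Ideal.absNorm_mem I
  have hnJ : (n : 𝓞 F) ∈ J := by rw [← hJ]; exact Ideal.absNorm_mem J
  apply le_antisymm
  · rw [sup_le_iff, Ideal.span_singleton_le_iff_mem]
    exact ⟨Ideal.mul_le_left, hmI⟩
  · intro x hx
    obtain ⟨u, v, huv⟩ : ∃ u v : ℤ, u * m + v * n = 1 := by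
      have := Nat.isCoprime_iff_coprime.mpr hmn
      exact this
    have e : x = (x * (v * n)) + (x * u) * m := by
      have : ((u * m + v * n : ℤ) : 𝓞 F) = 1 := by rw [huv]; simp
      push_cast at this
      linear_combination (-x) * this
    rw [e]
    apply Submodule.add_mem_sup
    · exact Ideal.mul_mem_mul hx (J.mul_mem_left _ hnJ)
    · exact Ideal.mul_mem_left _ _ (Ideal.mem_span_singleton_self _)

theorem sup_mul_sup {m n : ℕ} (hmn : m.Coprime n) {K : Ideal (𝓞 F)}
    (hK : Ideal.absNorm K = m * n) :
    (K ⊔ Ideal.span {(m : 𝓞 F)}) * (K ⊔ Ideal.span {(n : 𝓞 F)}) = K := by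
  have hmem : (m * n : 𝓞 F) ∈ K := by
    have := Ideal.absNorm_mem K
    rw [hK] at this
    exact_mod_cast this
  apply le_antisymm
  · rw [Ideal.sup_mul, Ideal.mul_sup, Ideal.mul_sup]
    refine sup_le (sup_le Ideal.mul_le_left Ideal.mul_le_left) (sup_le Ideal.mul_le_right ?_)
    rw [Ideal.span_singleton_mul_span_singleton, Ideal.span_singleton_le_iff_mem]
    exact hmem
  · intro x hx
    obtain ⟨u, v, huv⟩ : ∃ u v : ℤ, u * m + v * n = 1 := by
      have := Nat.isCoprime_iff_coprime.mpr hmn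
      exact this
    have e : x = u * (m * x) + v * (x * n) := by
      have : ((u * m + v * n : ℤ) : 𝓞 F) = 1 := by rw [huv]; simp
      push_cast at this
      linear_combination (-x) * this
    rw [e]
    apply Ideal.add_mem
    · refine Ideal.mul_mem_left _ _ (Ideal.mul_mem_mul ?_ ?_)
      · exact Ideal.mem_sup_right (Ideal.mem_span_singleton_self _)
      · exact Ideal.mem_sup_left hx
    · refine Ideal.mul_mem_left _ _ (Ideal.mul_mem_mul ?_ ?_)
      · exact Ideal.mem_sup_left hx
      · exact Ideal.mem_sup_right (Ideal.mem_span_singleton_self _)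

theorem absNorm_sup {m n : ℕ} (hmn : m.Coprime n) {K : Ideal (𝓞 F)}
    (hK : Ideal.absNorm K = m * n) :
    Ideal.absNorm (K ⊔ Ideal.span {(m : 𝓞 F)}) = m := by
  have h1 := congrArg Ideal.absNorm (sup_mul_sup hmn hK)
  rw [map_mul, hK] at h1
  have key : ∀ k : ℕ, ∃ j, Ideal.absNorm (K ⊔ Ideal.span {(k : 𝓞 F)}) ∣ k ^ j := by
    intro k
    refine ⟨Module.finrank ℤ (𝓞 F), ?_⟩
    rw [← Ideal.absNorm_span_natCast (S := 𝓞 F)]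
    exact map_dvd Ideal.absNorm (Ideal.dvd_iff_le.mpr le_sup_right)
  obtain ⟨i, hi⟩ := key m
  obtain ⟨j, hj⟩ := key n
  set A := Ideal.absNorm (K ⊔ Ideal.span {(m : 𝓞 F)})
  set B := Ideal.absNorm (K ⊔ Ideal.span {(n : 𝓞 F)})
  have hAn : A.Coprime n := Nat.Coprime.coprime_dvd_left hi (Nat.Coprime.pow_left i hmn)
  have hBm : B.Coprime m := Nat.Coprime.coprime_dvd_left hj (Nat.Coprime.pow_left j hmn.symm)
  apply Nat.dvd_antisymm
  · exact hAn.dvd_of_dvd_mul_right (h1 ▸ dvd_mul_right A B)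
  · exact hBm.symm.dvd_of_dvd_mul_right (h1 ▸ dvd_mul_right m n)

theorem aI_mul {m n : ℕ} (hmn : m.Coprime n) : aI F (m * n) = aI F m * aI F n := by
  rw [aI, aI, aI, ← Nat.card_prod]
  symm
  apply Nat.card_congr
  refine { toFun := fun x => ⟨x.1.1 * x.2.1, by rw [map_mul, x.1.2, x.2.2]⟩
           invFun := fun K => ⟨⟨K.1 ⊔ Ideal.span {(m : 𝓞 F)}, absNorm_sup hmn K.2⟩,
            ⟨K.1 ⊔ Ideal.span {(n : 𝓞 F)}, absNorm_sup hmn.symm (K.2.trans (mul_comm m n))⟩⟩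
           left_inv := ?_
           right_inv := ?_ }
  · rintro ⟨⟨I, hI⟩, ⟨J, hJ⟩⟩
    simp only [Prod.mk.injEq, Subtype.mk.injEq]
    refine ⟨sup_mul_left hmn hI hJ, ?_⟩
    rw [mul_comm I J]
    exact sup_mul_left hmn.symm hJ hI
  · rintro ⟨K, hK⟩
    simp only [Subtype.mk.injEq]
    exact sup_mul_sup hmn hK

theorem aI_one : aI F 1 = 1 := by
  rw [aI, Nat.card_eq_one_iff_unique]
  refine ⟨⟨?_⟩, ⟨⟨⊤, Ideal.absNorm_top⟩⟩⟩
  rintro ⟨I, hI⟩ ⟨J, hJ⟩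
  rw [Ideal.absNorm_eq_one_iff] at hI hJ
  simp [hI, hJ]

end
end RS

namespace RS
section
variable {F : Type} [Field F] [NumberField F]

/-- local data at p -/
def LocalChi (t n : ℤ) (p : ℕ) (c : ℤ) : Prop :=
  (c = 1 ∧ ∃ r r' : ZMod p, r ≠ r' ∧ r + r' = t ∧ r * r' = n) ∨
  (c = 0 ∧ ∃ r : ZMod p, r + r = t ∧ r * r = n) ∨
  (c = -1 ∧ ∀ r : ZMod p, r ^ 2 ≠ t * r - n)

theorem localChi_odd (t n : ℤ) {p : ℕ} (hp : p.Prime) (h2 : p ≠ 2) :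
    LocalChi t n p (jacobiSym (t ^ 2 - 4 * n) p) := by
  have : Fact p.Prime := ⟨hp⟩
  have h20 : (2 : ZMod p) ≠ 0 := by
    intro h
    have : ((2 : ℕ) : ZMod p) = 0 := by exact_mod_cast h
    rw [ZMod.natCast_eq_zero_iff] at this
    exact h2 ((Nat.prime_dvd_prime_iff_eq hp Nat.prime_two).mp this)
  rw [← jacobiSym.legendreSym.to_jacobiSym]
  set D := t ^ 2 - 4 * n with hD
  have hDc : (D : ZMod p) = t ^ 2 - 4 * n := by rw [hD]; push_cast; ring
  by_cases h0 : (D : ZMod p) = 0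
  · right; left
    refine ⟨(legendreSym.eq_zero_iff p D).mpr h0, t / 2, by field_simp; ring, ?_⟩
    rw [h0] at hDc
    field_simp
    linear_combination -hDc
  rcases legendreSym.eq_one_or_neg_one p h0 with h | h
  · left
    refine ⟨h, ?_⟩
    obtain ⟨s, hs⟩ := (legendreSym.eq_one_iff p h0).mp h
    have hs0 : s ≠ 0 := by
      rintro rfl
      exact h0 (by simpa using hs)
    refine ⟨(t + s) / 2, (t - s) / 2, ?_, by field_simp; ring, ?_⟩
    · intro h
      field_simp at h
      have : 2 * s = 0 := by linear_combination h
      rcases mul_eq_zero.mp this with h | h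
      · exact h20 h
      · exact hs0 h
    · rw [hDc] at hs
      field_simp
      linear_combination hs
  · right; right
    refine ⟨h, ?_⟩
    intro r hr
    have := (legendreSym.eq_neg_one_iff p).mp h
    apply this
    refine ⟨2 * r - t, ?_⟩
    rw [hDc]
    linear_combination (-4 : ZMod p) * hr

theorem aI_prime_pow (hdeg : Module.finrank ℚ F = 2) {ω : 𝓞 F} {t n : ℤ}
    (h1 : ∀ x : 𝓞 F, ∃ a b : ℤ, x = a + b * ω)
    (h2 : ∀ a b : ℤ, (a : 𝓞 F) + b * ω = 0 → a = 0 ∧ b = 0)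
    (hω : ω ^ 2 = t * ω - n) {p : ℕ} (hp : p.Prime) {c : ℤ} (hc : LocalChi t n p c) (k : ℕ) :
    (aI F (p ^ k) : ℤ) = ∑ j ∈ Finset.range (k + 1), c ^ j := by
  rcases hc with ⟨rfl, r, r', hne, hs, hm⟩ | ⟨rfl, r, hs, hm⟩ | ⟨rfl, hno⟩
  · obtain ⟨φ, hφ⟩ := root_hom h1 h2 hω p r (by rw [← hs, ← hm]; ring)
    obtain ⟨φ', hφ'⟩ := root_hom h1 h2 hω p r' (by rw [← hs, ← hm]; ring)
    rw [aI, card_split hp (absNorm_ker φ) (absNorm_ker φ') ?_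
      (ker_mul_ker hdeg h1 hω hp hs hm φ φ' hφ hφ')]
    · simp
    · intro h
      obtain ⟨z, hz⟩ := ZMod.intCast_surjective r
      have hmem : ((-z : ℤ) : 𝓞 F) + ((1 : ℤ) : 𝓞 F) * ω ∈ RingHom.ker φ := by
        rw [RingHom.mem_ker, hφ]
        push_cast
        rw [hz]; ring
      rw [h, RingHom.mem_ker, hφ'] at hmem
      push_cast at hmem
      rw [hz] at hmem
      exact hne (by linear_combination -hmem)
  · obtain ⟨φ, hφ⟩ := root_hom h1 h2 hω p r (by rw [← hs, ← hm]; ring)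
    rw [aI, card_ramified hdeg hp (absNorm_ker φ) (ker_mul_ker hdeg h1 hω hp hs hm φ φ hφ hφ)]
    rw [Finset.sum_range_succ']
    simp
  · rw [aI, card_inert hp (inert_prime hdeg hω hp hno) (absNorm_span_p hdeg p)]
    induction k with
    | zero => simp
    | succ k ih =>
      rw [Finset.sum_range_succ, ← ih]
      rcases Nat.even_or_odd k with h | h
      · have h' : ¬ Even (k + 1) := by simpa using h.add_one
        rw [if_neg h', if_pos h, Odd.neg_one_pow (h.add_one)]; simp
      · have h' : Even (k + 1) := h.add_one
        rw [if_pos h', if_neg (by simpa using h), Even.neg_one_pow h']; simp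

/-- structure of the character -/
structure IsChi (q : ℕ) (χ : ℕ → ℤ) : Prop where
  pos : 0 < q
  per : ∀ n, χ (n + q) = χ n
  bdd : ∀ n, |χ n| ≤ 1
  one : χ 1 = 1
  mul : ∀ m n, χ (m * n) = χ m * χ n

theorem jacobi_abs_le (a : ℤ) (b : ℕ) : |jacobiSym a b| ≤ 1 := by
  rcases jacobiSym.trichotomy a b with h | h | h <;> rw [h] <;> simp

theorem exists_isChi (t n : ℤ) (hD : t ^ 2 - 4 * n ≠ 0) :
    ∃ (q : ℕ) (χ : ℕ → ℤ), IsChi q χ ∧ ∀ p : ℕ, p.Prime → LocalChi t n p (χ p) := by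
  rcases Int.even_or_odd t with ht | ht
  · obtain ⟨u, rfl⟩ := ht
    set D' := u ^ 2 - n with hD'
    have hD0 : D' ≠ 0 := by
      intro h; apply hD; rw [hD'] at h; linear_combination 4 * h
    refine ⟨4 * D'.natAbs, fun m => if Odd m then jacobiSym D' m else 0, ⟨?_, ?_, ?_, ?_, ?_⟩, ?_⟩
    · have := Int.natAbs_pos.mpr hD0; omega
    · intro m
      have e : Odd (m + 4 * D'.natAbs) ↔ Odd m := by
        rw [Nat.odd_iff, Nat.odd_iff]; omega
      simp only [e]
      split_ifs with h
      · rw [jacobiSym.mod_right D' (e.mpr h), Nat.add_mod_right, ← jacobiSym.mod_right D' h]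
      · rfl
    · intro m
      split_ifs
      · exact jacobi_abs_le _ _
      · simp
    · simp
    · intro a b
      simp only [Nat.odd_mul]
      by_cases ha : Odd a <;> by_cases hb : Odd b <;> simp only [ha, hb, and_true, and_false, and_self, if_true, if_false, mul_zero, zero_mul]
      have : NeZero a := ⟨by rintro rfl; simp at ha⟩
      have : NeZero b := ⟨by rintro rfl; simp at hb⟩
      exact jacobiSym.mul_right D' a b
    · intro p hp
      rcases hp.eq_two_or_odd' with rfl | hodd
      · right; left
        refine ⟨by simp, (n : ZMod 2), ?_, ?_⟩
        · push_cast
          generalize (n : ZMod 2) = x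
          generalize (u : ZMod 2) = y
          revert x y; decide
        · generalize (n : ZMod 2) = x
          revert x; decide
      · dsimp only
        rw [if_pos hodd]
        have hp2 : p ≠ 2 := by rintro rfl; exact absurd hodd (by decide)
        have := localChi_odd (u + u) n hp hp2
        rw [show (u + u) ^ 2 - 4 * n = 2 ^ 2 * D' by rw [hD']; ring, jacobiSym.mul_left,
          jacobiSym.sq_one', one_mul] at this
        · exact this
        · rw [← Int.isCoprime_iff_gcd_eq_one]
          have : Nat.Coprime 2 p := (Nat.coprime_primes Nat.prime_two hp).mpr (Ne.symm hp2)
          exact_mod_cast Nat.isCoprime_iff_coprime.mpr this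
  · set D := t ^ 2 - 4 * n with hDdef
    obtain ⟨u, hu⟩ := ht
    have hD4 : D % 4 = 1 := by
      rw [hDdef, hu]; ring_nf; omega
    have hodd : Odd D.natAbs := by rw [Nat.odd_iff]; omega
    refine ⟨D.natAbs, fun m => jacobiSym m D.natAbs, ⟨by omega, ?_, ?_, ?_, ?_⟩, ?_⟩
    · intro m
      rw [jacobiSym.mod_left, jacobiSym.mod_left (m : ℤ)]
      congr 1
      rw [Nat.cast_add, Int.add_emod_right]
    · intro m; exact jacobi_abs_le _ _
    · simp
    · intro a b
      push_cast
      exact jacobiSym.mul_left _ _ _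
    · intro p hp
      rcases hp.eq_two_or_odd' with rfl | hpo
      · have h8 : D % 8 = 1 ∨ D % 8 = 5 := by omega
        beta_reduce
        rw [show ((2 : ℕ) : ℤ) = 2 from rfl, jacobiSym.at_two hodd]
        rcases Int.even_or_odd n with hn | hn
        · left
          obtain ⟨v, hv⟩ := hn
          have h1 : D % 8 = 1 := by
            have : ∃ w, u * (u + 1) = 2 * w := by
              obtain ⟨w, hw⟩ := Int.even_mul_succ_self u
              exact ⟨w, by rw [hw]; ring⟩
            obtain ⟨w, hw⟩ := this
            have : D = 8 * (w - v) + 1 := by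
              rw [hDdef, hu, hv]; linear_combination 4 * hw
            omega
          constructor
          · rw [ZMod.χ₈_nat_eq_if_mod_eight]
            have : D.natAbs % 8 = 1 ∨ D.natAbs % 8 = 7 := by omega
            have h2 : D.natAbs % 2 ≠ 0 := by omega
            rw [if_neg h2, if_pos this]
          · refine ⟨0, 1, by decide, ?_, ?_⟩
            · rw [hu]; push_cast
              generalize (u : ZMod 2) = x
              revert x; decide
            · rw [hv]; push_cast
              generalize (v : ZMod 2) = x
              revert x; decide
        · right; right
          obtain ⟨v, hv⟩ := hn
          have h1 : D % 8 = 5 := by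
            have : ∃ w, u * (u + 1) = 2 * w := by
              obtain ⟨w, hw⟩ := Int.even_mul_succ_self u
              exact ⟨w, by rw [hw]; ring⟩
            obtain ⟨w, hw⟩ := this
            have : D = 8 * (w - v - 1) + 5 := by
              rw [hDdef, hu, hv]; linear_combination 4 * hw
            omega
          constructor
          · rw [ZMod.χ₈_nat_eq_if_mod_eight]
            have h3 : ¬ (D.natAbs % 8 = 1 ∨ D.natAbs % 8 = 7) := by omega
            have h2 : D.natAbs % 2 ≠ 0 := by omega
            rw [if_neg h2, if_neg h3]
          · intro r
            rw [hu, hv]; push_cast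
            generalize (u : ZMod 2) = x
            generalize (v : ZMod 2) = y
            revert r x y; decide
      · have hp2 : p ≠ 2 := by rintro rfl; exact absurd hpo (by decide)
        have := localChi_odd t n hp hp2
        rw [← hDdef] at this
        convert this using 1
        beta_reduce
        rcases le_total 0 D with hs | hs
        · have e : (D.natAbs : ℤ) = D := Int.natAbs_of_nonneg hs
          rw [jacobiSym.quadratic_reciprocity_one_mod_four' hpo (by omega), e]
        · have e : (D.natAbs : ℤ) = -D := by omega
          have hm : D = -1 * (D.natAbs : ℤ) := by rw [e]; ring
          conv_rhs => rw [hm]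
          rw [jacobiSym.mul_left, jacobiSym.at_neg_one hpo]
          rcases Nat.odd_mod_four_iff.mp (Nat.odd_iff.mp hpo) with h | h
          · rw [jacobiSym.quadratic_reciprocity_one_mod_four h hodd, ZMod.χ₄_nat_one_mod_four h,
              one_mul]
          · rw [jacobiSym.quadratic_reciprocity_three_mod_four h (by omega),
              ZMod.χ₄_nat_three_mod_four h]
            ring

theorem exists_chi (hdeg : Module.finrank ℚ F = 2) :
    ∃ (q : ℕ) (χ : ℕ → ℤ), IsChi q χ ∧
      ∀ n, n ≠ 0 → (aI F n : ℤ) = ∑ d ∈ n.divisors, χ d := by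
  obtain ⟨ω, h1, h2⟩ := exists_omega hdeg
  obtain ⟨m, t, hω⟩ := h1 (ω ^ 2)
  have hω' : ω ^ 2 = t * ω - ((-m : ℤ) : 𝓞 F) := by rw [hω]; push_cast; ring
  have hD : t ^ 2 - 4 * (-m) ≠ 0 := by
    intro h
    have : (((-t : ℤ) : 𝓞 F) + ((2 : ℤ) : 𝓞 F) * ω) ^ 2 = 0 := by
      have h' : ((t ^ 2 - 4 * (-m) : ℤ) : 𝓞 F) = 0 := by rw [h]; simp
      push_cast at h' ⊢
      linear_combination h' + 4 * hω
    have := h2 _ _ (pow_eq_zero_iff (two_ne_zero) |>.mp this)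
    omega
  obtain ⟨q, χ, hχ, hloc⟩ := exists_isChi t (-m) hD
  refine ⟨q, χ, hχ, ?_⟩
  let fa : ArithmeticFunction ℤ := ⟨fun n => if n = 0 then 0 else (aI F n : ℤ), by simp⟩
  let fc : ArithmeticFunction ℤ := ⟨fun n => if n = 0 then 0 else χ n, by simp⟩
  have hfa : fa.IsMultiplicative := by
    rw [ArithmeticFunction.IsMultiplicative.iff_ne_zero]
    refine ⟨by simp [fa, aI_one], ?_⟩
    intro a b ha hb hab
    simp [fa, ha, hb, aI_mul hab]
  have hfc : fc.IsMultiplicative := by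
    rw [ArithmeticFunction.IsMultiplicative.iff_ne_zero]
    refine ⟨by simp [fc, hχ.one], ?_⟩
    intro a b ha hb hab
    simp [fc, ha, hb, hχ.mul]
  have hz : (((ArithmeticFunction.zeta : ArithmeticFunction ℕ) : ArithmeticFunction ℤ) * fc).IsMultiplicative :=
    (ArithmeticFunction.isMultiplicative_zeta.natCast).mul hfc
  have heq : fa = ((ArithmeticFunction.zeta : ArithmeticFunction ℕ) : ArithmeticFunction ℤ) * fc := by
    rw [ArithmeticFunction.IsMultiplicative.eq_iff_eq_on_prime_powers _ hfa _ hz]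
    intro p k hp
    rw [ArithmeticFunction.coe_zeta_mul_apply, Nat.sum_divisors_prime_pow hp]
    have e : fa (p ^ k) = aI F (p ^ k) := by simp [fa, hp.ne_zero]
    rw [e, aI_prime_pow hdeg h1 h2 hω' hp (hloc p hp)]
    apply Finset.sum_congr rfl
    intro j _
    have e : fc (p ^ j) = χ (p ^ j) := by simp [fc, hp.ne_zero]
    rw [e]
    clear e
    induction j with
    | zero => simp [hχ.one]
    | succ j ih =>
      rw [pow_succ, pow_succ, hχ.mul, ih (by simp at *; omega)]
  intro n hn
  have := congrArg (fun f => f n) heq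
  rw [ArithmeticFunction.coe_zeta_mul_apply] at this
  have e : fa n = aI F n := by simp [fa, hn]
  rw [← e, this]
  apply Finset.sum_congr rfl
  intro d hd
  have : d ≠ 0 := by rintro rfl; simp at hd
  simp [fc, this]

end
end RS

namespace RS
open Finset

noncomputable def SA (a : ℕ → ℝ) (x : ℝ) : ℝ := ∑ n ∈ Ioc 0 ⌊x⌋₊, a n

structure Setup (a : ℕ → ℝ) (χ : ℕ → ℝ) (q : ℕ) (ρ c : ℝ) : Prop where
  qpos : 0 < q
  per : ∀ n, χ (n + q) = χ n
  bdd : ∀ n, |χ n| ≤ 1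
  zero : a 0 = 0
  conv : ∀ n ≠ 0, a n = ∑ d ∈ n.divisors, χ d
  nonneg : ∀ n, 0 ≤ a n
  cpos : 0 < c
  asym : ∀ x : ℝ, 1 ≤ x → |SA a x - ρ * x| ≤ c * x ^ ((1 : ℝ) / 3)

theorem sum_conv {R : Type*} [AddCommMonoid R] (N : ℕ) (G : ℕ → ℕ → R) :
    ∑ n ∈ Ioc 0 N, ∑ d ∈ n.divisors, G d (n / d)
      = ∑ d ∈ Ioc 0 N, ∑ k ∈ Ioc 0 (N / d), G d k := by
  rw [Finset.sum_sigma', Finset.sum_sigma']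
  refine Finset.sum_bij' (fun p _ => ⟨p.2, p.1 / p.2⟩) (fun p _ => ⟨p.1 * p.2, p.1⟩) ?_ ?_ ?_ ?_ ?_
  · rintro ⟨n, d⟩ h
    simp only [mem_sigma, mem_Ioc, Nat.mem_divisors] at h ⊢
    obtain ⟨⟨h1, h2⟩, ⟨k, rfl⟩, h3⟩ := h
    have hd : 0 < d := Nat.pos_of_ne_zero (by rintro rfl; simp at h3)
    have hk : 0 < k := Nat.pos_of_ne_zero (by rintro rfl; simp at h3)
    rw [Nat.mul_div_cancel_left _ hd]
    exact ⟨⟨hd, le_trans (Nat.le_mul_of_pos_right _ hk) h2⟩, hk,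
      (Nat.le_div_iff_mul_le hd).2 (by rw [mul_comm]; exact h2)⟩
  · rintro ⟨d, k⟩ h
    simp only [mem_sigma, mem_Ioc, Nat.mem_divisors] at h ⊢
    obtain ⟨⟨h1, h2⟩, h3, h4⟩ := h
    have := (Nat.le_div_iff_mul_le h1).1 h4
    exact ⟨⟨Nat.mul_pos h1 h3, by rw [mul_comm]; exact this⟩, ⟨k, rfl⟩, (Nat.mul_pos h1 h3).ne'⟩
  · rintro ⟨n, d⟩ h
    simp only [mem_sigma, mem_Ioc, Nat.mem_divisors] at h ⊢
    rw [Nat.mul_div_cancel' h.2.1]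
  · rintro ⟨d, k⟩ h
    simp only [mem_sigma, mem_Ioc, Nat.mem_divisors] at h ⊢
    rw [Nat.mul_div_cancel_left _ h.1.1]
  · rintro ⟨n, d⟩ h
    rfl

theorem sum_Ioc_add {R : Type*} [AddCommMonoid R] (M N : ℕ) (f : ℕ → R) :
    ∑ m ∈ Ioc 0 (M + N), f m = ∑ m ∈ Ioc 0 M, f m + ∑ m ∈ Ioc 0 N, f (m + M) := by
  induction N with
  | zero => simp
  | succ n ih =>
    rw [← add_assoc, Finset.sum_Ioc_succ_top (by omega), ih, Finset.sum_Ioc_succ_top (by omega),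
      add_assoc]
    congr 3
    omega

theorem sum_Ioc_mul {R : Type*} [AddCommMonoid R] (q j : ℕ) (f : ℕ → R) :
    ∑ m ∈ Ioc 0 (q * j), f m = ∑ i ∈ range j, ∑ r ∈ Ioc 0 q, f (r + q * i) := by
  induction j with
  | zero => simp
  | succ n ih =>
    rw [Nat.mul_succ, sum_Ioc_add, ih, Finset.sum_range_succ]

namespace Setup
variable {a χ : ℕ → ℝ} {q : ℕ} {ρ c : ℝ}

theorem per_mul (h : Setup a χ q ρ c) (n i : ℕ) : χ (n + q * i) = χ n := by
  induction i with
  | zero => simp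
  | succ k ih => rw [Nat.mul_succ, ← add_assoc, h.per, ih]

theorem SA_eq (h : Setup a χ q ρ c) (N : ℕ) :
    ∑ n ∈ Ioc 0 N, a n = ∑ m ∈ Ioc 0 N, χ m * ((N / m : ℕ) : ℝ) := by
  have := sum_conv N (fun d _ => χ d)
  calc ∑ n ∈ Ioc 0 N, a n = ∑ n ∈ Ioc 0 N, ∑ d ∈ n.divisors, χ d := by
        refine sum_congr rfl fun n hn => h.conv n ?_
        simp at hn; omega
    _ = _ := this
    _ = _ := by
        refine sum_congr rfl fun m _ => ?_
        simp [mul_comm]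

theorem h_bdd (h : Setup a χ q ρ c) (N : ℕ) (hN : 1 ≤ N) :
    |∑ m ∈ Ioc 0 N, χ m / m| ≤ |ρ| + c + 1 := by
  have hN' : (1:ℝ) ≤ N := by exact_mod_cast hN
  have h1 := h.asym N hN'
  rw [SA, Nat.floor_natCast, h.SA_eq] at h1
  have h2 : |∑ m ∈ Ioc 0 N, χ m * ((N / m : ℕ) : ℝ) - N * ∑ m ∈ Ioc 0 N, χ m / m| ≤ N := by
    rw [mul_sum, ← sum_sub_distrib]
    refine (abs_sum_le_sum_abs _ _).trans ?_
    calc _ ≤ ∑ m ∈ Ioc 0 N, (1:ℝ) := by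
          refine sum_le_sum fun m hm => ?_
          simp only [mem_Ioc] at hm
          have hm0 : (0:ℝ) < m := by exact_mod_cast hm.1
          have : χ m * ((N / m : ℕ) : ℝ) - N * (χ m / m) = χ m * (((N / m : ℕ) : ℝ) - (N:ℝ) / m) := by
            field_simp
          rw [this, abs_mul]
          refine mul_le_one₀ (h.bdd m) (abs_nonneg _) ?_
          rw [abs_le]
          have h3 : ((N / m : ℕ) : ℝ) ≤ (N:ℝ) / m := Nat.cast_div_le
          have h4 : (N:ℝ) / m < ((N / m : ℕ) : ℝ) + 1 := by
            rw [div_lt_iff₀ hm0]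
            have := Nat.lt_div_mul_add (a := N) (b := m) hm.1
            have : (N:ℝ) < ((N / m : ℕ):ℝ) * m + m := by exact_mod_cast this
            linarith
          constructor <;> linarith
      _ = N := by simp
  have h3 : (N:ℝ) ^ ((1:ℝ)/3) ≤ N := by
    calc (N:ℝ) ^ ((1:ℝ)/3) ≤ (N:ℝ) ^ (1:ℝ) := Real.rpow_le_rpow_of_exponent_le hN' (by norm_num)
      _ = N := Real.rpow_one _
  have h4 : |N * ∑ m ∈ Ioc 0 N, χ m / m| ≤ N * (|ρ| + c + 1) := by
    have := h.cpos
    have h5 : c * (N:ℝ) ^ ((1:ℝ)/3) ≤ c * N := by gcongr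
    have h6 : |ρ * N| = |ρ| * N := by rw [abs_mul, abs_of_nonneg (by linarith : (0:ℝ) ≤ N)]
    have h7 := abs_le.1 h2
    have h8 := abs_le.1 h1
    have h9 := abs_le.1 h6.le
    rw [abs_le]
    constructor <;> nlinarith
  rw [abs_mul, abs_of_nonneg (by linarith : (0:ℝ) ≤ N)] at h4
  exact le_of_mul_le_mul_left h4 (by linarith)

theorem mean_zero (h : Setup a χ q ρ c) : ∑ m ∈ Ioc 0 q, χ m = 0 := by
  by_contra hne
  set σ := ∑ m ∈ Ioc 0 q, χ m with hσ
  have hq : (1:ℝ) ≤ q := by exact_mod_cast h.qpos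
  have key : ∀ j : ℕ, |∑ r ∈ Ioc 0 q, χ (r + q * j) / ((r + q * j : ℕ):ℝ) - σ / q * (1 / ((j:ℝ) + 1))|
      ≤ q * (1 / ((j:ℝ)+1) ^ 2) := by
    intro j
    have hj : (0:ℝ) ≤ j := by positivity
    rw [show σ / q * (1 / ((j:ℝ) + 1)) = ∑ r ∈ Ioc 0 q, χ r * (1 / (q * (j + 1))) by
      rw [← sum_mul, ← hσ]; field_simp, ← sum_sub_distrib]
    refine (abs_sum_le_sum_abs _ _).trans ?_
    calc _ ≤ ∑ m ∈ Ioc 0 q, (1 / ((j:ℝ)+1) ^ 2) := by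
          refine sum_le_sum fun r hr => ?_
          simp only [mem_Ioc] at hr
          have hr1 : (1:ℝ) ≤ r := by exact_mod_cast hr.1
          have hr2 : (r:ℝ) ≤ q := by exact_mod_cast hr.2
          rw [h.per_mul]
          have e : χ r / ((r + q * j : ℕ):ℝ) - χ r * (1 / (q * (j + 1)))
              = χ r * ((q - r) / ((r + q * j) * (q * (j+1)))) := by
            push_cast
            have : (r:ℝ) + q * j ≠ 0 := by positivity
            field_simp
            ring
          rw [e, abs_mul]
          have h1 : 0 ≤ ((q:ℝ) - r) / ((r + q * j) * (q * (j+1))) :=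
            div_nonneg (by linarith) (by positivity)
          rw [abs_of_nonneg h1]
          refine (mul_le_of_le_one_left h1 (h.bdd r)).trans ?_
          rw [div_le_div_iff₀ (by positivity) (by positivity)]
          have h2 : (j:ℝ) + 1 ≤ r + q * j := by nlinarith
          have h3 : ((q:ℝ) - r) * (j+1) ≤ q * (r + q * j) := by
            apply mul_le_mul (by linarith) h2 (by positivity) (by positivity)
          nlinarith
      _ = _ := by simp
  have hsum : Summable (fun j : ℕ => (q:ℝ) * (1 / ((j:ℝ)+1) ^ 2)) := by
    apply Summable.mul_left
    have := (summable_nat_add_iff 1).2 (Real.summable_one_div_nat_pow.2 (by norm_num : 1 < 2))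
    simpa using this
  have hb : ∀ J : ℕ, |σ / q| * ∑ j ∈ range J, (1 / ((j:ℝ) + 1)) ≤
      |ρ| + c + 1 + ∑' j : ℕ, (q:ℝ) * (1 / ((j:ℝ)+1) ^ 2) := by
    intro J
    have hc := h.cpos
    have h1 : |∑ m ∈ Ioc 0 (q * J), χ m / m| ≤ |ρ| + c + 1 := by
      rcases Nat.eq_zero_or_pos J with rfl | hJ
      · simp; positivity
      · exact h.h_bdd _ (Nat.mul_pos h.qpos hJ)
    rw [sum_Ioc_mul] at h1
    have h2 : |∑ j ∈ range J, (∑ r ∈ Ioc 0 q, χ (r + q * j) / ((r + q * j : ℕ):ℝ) - σ / q * (1 / ((j:ℝ) + 1)))|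
      ≤ ∑' j : ℕ, (q:ℝ) * (1 / ((j:ℝ)+1) ^ 2) := by
      refine (abs_sum_le_sum_abs _ _).trans ((sum_le_sum fun j _ => key j).trans ?_)
      exact hsum.sum_le_tsum _ (fun _ _ => by positivity)
    rw [sum_sub_distrib, ← mul_sum] at h2
    have h3 : |σ / q * ∑ j ∈ range J, (1 / ((j:ℝ) + 1))| = |σ / q| * ∑ j ∈ range J, (1 / ((j:ℝ) + 1)) := by
      rw [abs_mul, abs_of_nonneg (sum_nonneg fun _ _ => by positivity : (0:ℝ) ≤ ∑ j ∈ range J, (1 / ((j:ℝ) + 1)))]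
    rw [← h3]
    have h4 := abs_le.1 h1
    have h5 := abs_le.1 h2
    rw [abs_le]
    constructor <;> linarith
  have ht := Real.tendsto_sum_range_one_div_nat_succ_atTop
  have hpos : 0 < |σ / q| := abs_pos.2 (div_ne_zero hne (by positivity))
  obtain ⟨J, hJ⟩ := (ht.eventually_gt_atTop
    ((|ρ| + c + 1 + ∑' j : ℕ, (q:ℝ) * (1 / ((j:ℝ)+1) ^ 2)) / |σ / q|)).exists
  have := hb J
  rw [div_lt_iff₀ hpos] at hJ
  linarith

end Setup
end RS

namespace RS
open Finset MeasureTheory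

theorem SA_eq_indicator (a : ℕ → ℝ) {x s : ℝ} (hs : s ≤ x) (hs0 : 0 ≤ s) :
    SA a s = ∑ n ∈ Ioc 0 ⌊x⌋₊, if (n:ℝ) ≤ s then a n else 0 := by
  rw [SA, ← Finset.sum_filter]
  congr 1
  ext n
  simp only [mem_Ioc, mem_filter]
  rw [Nat.le_floor_iff hs0]
  constructor
  · rintro ⟨h1, h2⟩
    exact ⟨⟨h1, Nat.le_floor (h2.trans hs)⟩, h2⟩
  · rintro ⟨⟨h1, -⟩, h2⟩
    exact ⟨h1, h2⟩

theorem abelInt_aux {x : ℝ} (g : ℝ → ℝ)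
    (hg : IntervalIntegrable g volume 1 x) (s : ℝ) (hs : 1 ≤ s) (hsx : s ≤ x) :
    IntervalIntegrable (fun t => if s ≤ t then g t else 0) volume 1 x ∧
    ∫ t in (1:ℝ)..x, (if s ≤ t then g t else 0) = ∫ t in s..x, g t := by
  have h1x : 1 ≤ x := hs.trans hsx
  have e1 : ∀ t ∈ Set.Ioc s x, (if s ≤ t then g t else 0) = g t := fun t ht => if_pos ht.1.le
  have e2 : ∀ t ∈ Set.Ioo 1 s, (if s ≤ t then g t else 0) = 0 := fun t ht => if_neg (not_le.2 ht.2)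
  have g1 : IntervalIntegrable g volume s x := hg.mono_set (by
    rw [Set.uIcc_of_le hsx, Set.uIcc_of_le h1x]; exact Set.Icc_subset_Icc hs le_rfl)
  have i2 : IntervalIntegrable (fun t => if s ≤ t then g t else 0) volume s x := by
    refine (intervalIntegrable_congr ?_).2 g1
    intro t ht
    rw [Set.uIoc_of_le hsx] at ht
    exact e1 t ht
  have i1 : IntervalIntegrable (fun t => if s ≤ t then g t else 0) volume 1 s := by
    refine (IntervalIntegrable.congr_ae (f := fun _ => (0:ℝ)) ?_ ?_)
    · simp
    · rw [Set.uIoc_of_le hs, ← restrict_Ioo_eq_restrict_Ioc]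
      filter_upwards [ae_restrict_mem measurableSet_Ioo] with t ht
      exact (e2 t ht).symm
  refine ⟨i1.trans i2, ?_⟩
  rw [← intervalIntegral.integral_add_adjacent_intervals i1 i2]
  have z : ∫ t in (1:ℝ)..s, (if s ≤ t then g t else 0) = 0 := by
    rw [intervalIntegral.integral_of_le hs, ← restrict_Ioo_eq_restrict_Ioc,
      setIntegral_congr_fun measurableSet_Ioo e2]
    simp
  rw [z, zero_add]
  apply intervalIntegral.integral_congr_ae
  refine Filter.Eventually.of_forall fun t ht => ?_
  rw [Set.uIoc_of_le hsx] at ht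
  exact e1 t ht

theorem abelInt (a : ℕ → ℝ) {x : ℝ} (hx : 1 ≤ x) (g : ℝ → ℝ)
    (hg : IntervalIntegrable g volume 1 x) :
    IntervalIntegrable (fun s => SA a s * g s) volume 1 x ∧
    ∑ n ∈ Ioc 0 ⌊x⌋₊, a n * ∫ s in (n:ℝ)..x, g s = ∫ s in (1:ℝ)..x, SA a s * g s := by
  have hn : ∀ n ∈ Ioc 0 ⌊x⌋₊, (1:ℝ) ≤ n ∧ (n:ℝ) ≤ x := by
    intro n hn
    rw [mem_Ioc] at hn
    exact ⟨by exact_mod_cast hn.1, (Nat.le_floor_iff (by linarith)).1 hn.2⟩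
  have e : Set.EqOn (fun s => ∑ n ∈ Ioc 0 ⌊x⌋₊, a n * (if (n:ℝ) ≤ s then g s else 0))
      (fun s => SA a s * g s) (Set.uIcc 1 x) := by
    intro s hs
    rw [Set.uIcc_of_le hx] at hs
    simp only
    rw [SA_eq_indicator a hs.2 (by linarith [hs.1]), sum_mul]
    refine sum_congr rfl fun n _ => ?_
    split_ifs <;> simp
  have i : ∀ n ∈ Ioc 0 ⌊x⌋₊,
      IntervalIntegrable (fun s => a n * (if (n:ℝ) ≤ s then g s else 0)) volume 1 x := fun n h =>
    (abelInt_aux g hg n (hn n h).1 (hn n h).2).1.const_mul _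
  constructor
  · refine (intervalIntegrable_congr (e.mono Set.uIoc_subset_uIcc)).1 ?_
    have := IntervalIntegrable.sum _ i
    rwa [show (∑ i ∈ Ioc 0 ⌊x⌋₊, fun s : ℝ => a i * if (i:ℝ) ≤ s then g s else 0) =
      (fun s => ∑ n ∈ Ioc 0 ⌊x⌋₊, a n * if (n:ℝ) ≤ s then g s else 0) by ext s; simp] at this
  · rw [← intervalIntegral.integral_congr e, intervalIntegral.integral_finsetSum i]
    refine sum_congr rfl fun n h => ?_
    rw [intervalIntegral.integral_const_mul, (abelInt_aux g hg n (hn n h).1 (hn n h).2).2]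

theorem SA_intervalIntegrable (a : ℕ → ℝ) {u v : ℝ} (hu : 1 ≤ u) (hv : 1 ≤ v) :
    IntervalIntegrable (SA a) volume u v := by
  have h : ∀ w : ℝ, 1 ≤ w → IntervalIntegrable (SA a) volume 1 w := fun w hw => by
    simpa using (abelInt a hw (fun _ => 1) (by simp)).1
  exact (h u hu).symm.trans (h v hv)

/-- The quadratic Riesz sum. -/
noncomputable def RR (g : ℕ → ℝ) (z : ℝ) : ℝ := ∑ n ∈ Ioc 0 ⌊z⌋₊, g n * (z - n) ^ 2

theorem RR_eq_integral (a : ℕ → ℝ) {x : ℝ} (hx : 1 ≤ x) :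
    RR a x = ∫ s in (1:ℝ)..x, SA a s * (2 * (x - s)) := by
  rw [← (abelInt a hx (fun s => 2 * (x - s)) (by
    apply Continuous.intervalIntegrable; fun_prop)).2]
  refine sum_congr rfl fun n _ => ?_
  congr 1
  have : ∀ s ∈ Set.uIcc (n:ℝ) x, HasDerivAt (fun s => -(x - s) ^ 2) (2 * (x - s)) s := by
    intro s _
    have := (((hasDerivAt_id s).const_sub x).pow 2).neg
    convert! this using 1
    simp
  rw [intervalIntegral.integral_eq_sub_of_hasDerivAt this
    (by apply Continuous.intervalIntegrable; fun_prop)]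
  ring

theorem sum_Ioc_hyper (N M : ℕ) (hM : 0 < M) (G : ℕ → ℕ → ℝ) :
    ∑ d ∈ Ioc 0 N, ∑ k ∈ Ioc 0 (N / d), G d k =
      ∑ d ∈ Ioc 0 M, ∑ k ∈ Ioc 0 (N / d), G d k
        + ∑ k ∈ Ioc 0 (N / M), ∑ d ∈ Ioc 0 (N / k - M), G (d + M) k := by
  have h1 : ∑ d ∈ Ioc 0 N, ∑ k ∈ Ioc 0 (N / d), G d k
      = ∑ d ∈ Ioc 0 (M + N), ∑ k ∈ Ioc 0 (N / d), G d k := by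
    refine sum_subset (Ioc_subset_Ioc_right (by omega)) fun d h1 h2 => ?_
    simp only [mem_Ioc] at h1 h2
    rw [Nat.div_eq_of_lt (by omega)]
    simp
  rw [h1, sum_Ioc_add]
  congr 1
  refine sum_comm' fun d k => ?_
  simp only [mem_Ioc]
  constructor
  · rintro ⟨⟨h1, h2⟩, h3, h4⟩
    have h5 := (Nat.le_div_iff_mul_le (by omega)).1 h4
    refine ⟨⟨h1, Nat.le_sub_of_add_le ((Nat.le_div_iff_mul_le h3).2 (by rw [mul_comm]; exact h5))⟩, h3,
      (Nat.le_div_iff_mul_le hM).2 (le_trans (Nat.mul_le_mul_left _ (by omega)) h5)⟩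
  · rintro ⟨⟨h1, h2⟩, h3, h4⟩
    have h5 : d + M ≤ N / k := by omega
    have h6 := (Nat.le_div_iff_mul_le h3).1 h5
    have h7 : d ≤ N := by
      have := Nat.div_le_self N k
      omega
    exact ⟨⟨h1, h7⟩, h3, (Nat.le_div_iff_mul_le (by omega)).2 (by rw [mul_comm]; exact h6)⟩

theorem RR_one_est (z : ℝ) (hz : 0 ≤ z) :
    |RR (fun _ => 1) z - (z ^ 3 / 3 - z ^ 2 / 2 + z / 6)| ≤ 1 := by
  have h1 : ∀ K : ℕ, ∀ z : ℝ, ∑ n ∈ Ioc 0 K, (1:ℝ) * (z - n) ^ 2 =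
      K * z ^ 2 - z * K * (K + 1) + K * (K + 1) * (2 * K + 1) / 6 := by
    intro K z
    induction K with
    | zero => simp
    | succ k ih => rw [sum_Ioc_succ_top (by omega), ih]; push_cast; ring
  rw [RR, h1]
  have h2 := Nat.floor_le hz
  have h3 := Nat.lt_floor_add_one z
  set K : ℝ := (⌊z⌋₊ : ℝ)
  obtain ⟨θ, hθ⟩ : ∃ θ, θ = z - K := ⟨_, rfl⟩
  have : z = K + θ := by linarith
  rw [this]
  have h4 : 0 ≤ θ := by linarith
  have h5 : θ ≤ 1 := by linarith
  have e : K * (K + θ) ^ 2 - (K + θ) * K * (K + 1) + K * (K + 1) * (2 * K + 1) / 6 -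
      ((K + θ) ^ 3 / 3 - (K + θ) ^ 2 / 2 + (K + θ) / 6) = -(θ ^ 3 / 3 - θ ^ 2 / 2 + θ / 6) := by ring
  rw [e, abs_le]
  have h6 : 0 ≤ θ ^ 2 := by positivity
  have h7 : 0 ≤ θ ^ 3 := by positivity
  have h8 : θ ^ 2 ≤ 1 := by nlinarith
  have h9 : θ ^ 3 ≤ 1 := by nlinarith
  constructor <;> linarith

theorem Q_est (z : ℝ) (hz : 0 ≤ z) :
    |∑ n ∈ Ioc 0 ⌊z⌋₊, (n:ℝ) * (z - n) - z ^ 3 / 6| ≤ z + 1 := by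
  have h1 : ∀ K : ℕ, ∀ z : ℝ, ∑ n ∈ Ioc 0 K, (n:ℝ) * (z - n) =
      z * K * (K + 1) / 2 - K * (K + 1) * (2 * K + 1) / 6 := by
    intro K z
    induction K with
    | zero => simp
    | succ k ih => rw [sum_Ioc_succ_top (by omega), ih]; push_cast; ring
  rw [h1]
  have h2 := Nat.floor_le hz
  have h3 := Nat.lt_floor_add_one z
  have hK : (0:ℝ) ≤ (⌊z⌋₊ : ℝ) := by positivity
  set K : ℝ := (⌊z⌋₊ : ℝ)
  obtain ⟨θ, hθ⟩ : ∃ θ, θ = z - K := ⟨_, rfl⟩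
  have hz' : K = z - θ := by linarith
  rw [hz']
  have h4 : 0 ≤ θ := by linarith
  have h5 : θ ≤ 1 := by linarith
  have e : z * (z - θ) * (z - θ + 1) / 2 - (z - θ) * (z - θ + 1) * (2 * (z - θ) + 1) / 6 - z ^ 3 / 6
    = z * ((θ ^ 2 - θ) / 2 - ((1 - 2 * θ) ^ 2 + 2 * (θ ^ 2 - θ)) / 6) - (θ ^ 2 - θ) * (1 - 2 * θ) / 6 := by
    ring
  rw [e]
  have h6 : |(θ ^ 2 - θ) / 2 - ((1 - 2 * θ) ^ 2 + 2 * (θ ^ 2 - θ)) / 6| ≤ 1 := by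
    rw [abs_le]; constructor <;> nlinarith
  have h7 : |(θ ^ 2 - θ) * (1 - 2 * θ) / 6| ≤ 1 := by
    have a1 : |θ ^ 2 - θ| ≤ 1 := by rw [abs_le]; constructor <;> nlinarith
    have a2 : |1 - 2 * θ| ≤ 1 := by rw [abs_le]; constructor <;> nlinarith
    rw [abs_div, abs_mul]
    have := mul_le_one₀ a1 (abs_nonneg _) a2
    rw [abs_of_pos (by norm_num : (0:ℝ) < 6)]
    linarith
  refine (abs_sub _ _).trans (add_le_add ?_ h7)
  rw [abs_mul, abs_of_nonneg hz]
  exact mul_le_of_le_one_right hz h6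

end RS

namespace RS
open Finset MeasureTheory

noncomputable def kap (χ : ℕ → ℝ) (q : ℕ) : ℝ := -(∑ r ∈ Ioc 0 q, (r:ℝ) * χ r) / q
noncomputable def bet (χ : ℕ → ℝ) (q : ℕ) : ℝ :=
  (∑ r ∈ Ioc 0 q, (r:ℝ) ^ 2 * χ r - q * ∑ r ∈ Ioc 0 q, (r:ℝ) * χ r) / q
noncomputable def lam (χ : ℕ → ℝ) (q j : ℕ) : ℝ :=
  ∑ m ∈ Ioc 0 (q * j), χ m / m + kap χ q / (q * j : ℕ) + bet χ q / (2 * ((q * j : ℕ):ℝ) ^ 2)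

namespace Setup
variable {a χ : ℕ → ℝ} {q : ℕ} {ρ c : ℝ}

theorem G_per (h : Setup a χ q ρ c) (y : ℝ) (hy : 0 ≤ y) :
    RR χ (y + q) - kap χ q * (y + q) ^ 2 - bet χ q * (y + q) =
      RR χ y - kap χ q * y ^ 2 - bet χ q * y := by
  have hq : (0:ℝ) < q := by exact_mod_cast h.qpos
  have h1 : RR χ (y + q) = ∑ m ∈ Ioc 0 q, χ m * (y + q - m) ^ 2 + RR χ y := by
    rw [RR, Nat.floor_add_natCast hy, add_comm ⌊y⌋₊ q, sum_Ioc_add, RR]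
    congr 1
    refine sum_congr rfl fun m _ => ?_
    rw [h.per]
    push_cast
    ring
  have h2 : ∑ m ∈ Ioc 0 q, χ m * (y + q - m) ^ 2 = (y + q) ^ 2 * ∑ m ∈ Ioc 0 q, χ m
      - 2 * (y + q) * ∑ r ∈ Ioc 0 q, (r:ℝ) * χ r + ∑ r ∈ Ioc 0 q, (r:ℝ) ^ 2 * χ r := by
    rw [mul_sum, mul_sum, ← sum_sub_distrib, ← sum_add_distrib]
    refine sum_congr rfl fun m _ => ?_
    ring
  rw [h1, h2, h.mean_zero, kap, bet]
  field_simp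
  ring

theorem G_bdd (h : Setup a χ q ρ c) : ∃ C : ℝ, 0 ≤ C ∧ ∀ y : ℝ, 0 ≤ y →
    |RR χ y - kap χ q * y ^ 2 - bet χ q * y| ≤ C := by
  have hq : (0:ℝ) < q := by exact_mod_cast h.qpos
  refine ⟨q * (q:ℝ) ^ 2 + |kap χ q| * q ^ 2 + |bet χ q| * q, by positivity, ?_⟩
  have key : ∀ n : ℕ, ∀ y : ℝ, 0 ≤ y → y < q * (n + 1) → 
    |RR χ y - kap χ q * y ^ 2 - bet χ q * y| ≤ q * (q:ℝ) ^ 2 + |kap χ q| * q ^ 2 + |bet χ q| * q := by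
    intro n
    induction n with
    | zero =>
      intro y hy hyq
      simp only [Nat.cast_zero, zero_add, mul_one] at hyq
      have h1 : |RR χ y| ≤ q * (q:ℝ) ^ 2 := by
        rw [RR]
        refine (abs_sum_le_sum_abs _ _).trans ?_
        calc _ ≤ ∑ n ∈ Ioc 0 ⌊y⌋₊, (q:ℝ) ^ 2 := by
              refine sum_le_sum fun m hm => ?_
              rw [mem_Ioc] at hm
              have : (m:ℝ) ≤ y := (Nat.le_floor_iff hy).1 hm.2
              rw [abs_mul, abs_of_nonneg (sq_nonneg (y - m))]
              refine (mul_le_of_le_one_left (sq_nonneg _) (h.bdd m)).trans ?_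
              have : (0:ℝ) ≤ m := by positivity
              apply pow_le_pow_left₀ <;> linarith
          _ = ⌊y⌋₊ * (q:ℝ) ^ 2 := by simp
          _ ≤ _ := by
              have h9 : (⌊y⌋₊:ℝ) ≤ q := (Nat.floor_le hy).trans hyq.le
              exact mul_le_mul_of_nonneg_right h9 (by positivity)
      refine (abs_sub _ _).trans (add_le_add ((abs_sub _ _).trans (add_le_add h1 ?_)) ?_)
      · rw [abs_mul, abs_of_nonneg (by positivity : 0 ≤ y ^ 2)]
        gcongr
      · rw [abs_mul, abs_of_nonneg hy]
        gcongr
    | succ k ih =>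
      intro y hy hyq
      by_cases hlt : y < q
      · exact ih y hy (by have : (0:ℝ) ≤ k := by positivity
                          nlinarith)
      · push Not at hlt
        have := h.G_per (y - q) (by linarith)
        rw [sub_add_cancel] at this
        rw [this]
        exact ih _ (by linarith) (by push_cast at hyq; linarith)
  intro y hy
  obtain ⟨n, hn⟩ := exists_nat_gt (y / q)
  refine key n y hy ?_
  rw [div_lt_iff₀ hq] at hn
  linarith

theorem sum_zero_mul (h : Setup a χ q ρ c) (j : ℕ) : ∑ m ∈ Ioc 0 (q * j), χ m = 0 := by
  rw [sum_Ioc_mul]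
  refine sum_eq_zero fun i _ => ?_
  rw [← h.mean_zero]
  exact sum_congr rfl fun r _ => h.per_mul _ _

theorem sum_id_mul (h : Setup a χ q ρ c) (j : ℕ) :
    ∑ m ∈ Ioc 0 (q * j), (m:ℝ) * χ m = - kap χ q * (q * j : ℕ) := by
  have hq : (0:ℝ) < q := by exact_mod_cast h.qpos
  rw [sum_Ioc_mul]
  have : ∀ i ∈ range j, ∑ r ∈ Ioc 0 q, ((r + q * i : ℕ):ℝ) * χ (r + q * i)
      = ∑ r ∈ Ioc 0 q, (r:ℝ) * χ r := by
    intro i _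
    have e : ∑ r ∈ Ioc 0 q, ((r + q * i : ℕ):ℝ) * χ (r + q * i) =
      ∑ r ∈ Ioc 0 q, (r:ℝ) * χ r + q * i * ∑ r ∈ Ioc 0 q, χ r := by
      rw [mul_sum, ← sum_add_distrib]
      refine sum_congr rfl fun r _ => ?_
      rw [h.per_mul]; push_cast; ring
    rw [e, h.mean_zero]; ring
  rw [sum_congr rfl this, kap]
  simp only [sum_const, card_range, nsmul_eq_mul]
  push_cast
  field_simp

theorem RR_hyper (h : Setup a χ q ρ c) (T : ℝ) (hT : 0 ≤ T) (j : ℕ) (hj : 0 < j) :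
    RR a T = ∑ m ∈ Ioc 0 (q * j), χ m * (m:ℝ) ^ 2 * RR (fun _ => 1) (T / m) +
      ∑ n ∈ Ioc 0 ⌊T / (q * j : ℕ)⌋₊, (n:ℝ) ^ 2 * RR χ (T / n - (q * j : ℕ)) := by
  have h1 : RR a T = ∑ n ∈ Ioc 0 ⌊T⌋₊, ∑ d ∈ n.divisors, χ d * (T - (d:ℝ) * (n / d : ℕ)) ^ 2 := by
    refine sum_congr rfl fun n hn => ?_
    rw [mem_Ioc] at hn
    rw [h.conv n (by omega), sum_mul]
    refine sum_congr rfl fun d hd => ?_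
    rw [← Nat.cast_mul, Nat.mul_div_cancel' (Nat.dvd_of_mem_divisors hd)]
  rw [h1, sum_conv ⌊T⌋₊ (fun d k => χ d * (T - (d:ℝ) * k) ^ 2),
    sum_Ioc_hyper _ (q * j) (Nat.mul_pos h.qpos hj)]
  congr 1
  · refine sum_congr rfl fun m hm => ?_
    rw [mem_Ioc] at hm
    have hm0 : (0:ℝ) < m := by exact_mod_cast hm.1
    rw [RR, mul_sum, Nat.floor_div_natCast]
    refine sum_congr rfl fun n _ => ?_
    field_simp
  · rw [Nat.floor_div_natCast]
    refine sum_congr rfl fun n hn => ?_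
    rw [mem_Ioc] at hn
    have hn0 : (0:ℝ) < n := by exact_mod_cast hn.1
    rw [RR, mul_sum, Nat.floor_sub_natCast, Nat.floor_div_natCast]
    refine sum_congr rfl fun d _ => ?_
    rw [mul_comm q j, mul_comm j q, h.per_mul]
    push_cast
    field_simp
    ring

theorem riesz_est (h : Setup a χ q ρ c) : ∃ C : ℝ, 0 ≤ C ∧ ∀ T : ℝ, 0 ≤ T → ∀ j : ℕ, 0 < j →
    |RR a T - T ^ 3 / 3 * lam χ q j + kap χ q * T ^ 2 / 2| ≤
      C * (T * (q * j : ℕ) + ((q * j : ℕ):ℝ) ^ 3 + (T / (q * j : ℕ)) ^ 3) := by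
  obtain ⟨CG, hCG, hG⟩ := h.G_bdd
  refine ⟨2 * |kap χ q| + 2 * |bet χ q| + 1 + CG, by positivity, ?_⟩
  intro T hT j hj
  rw [h.RR_hyper T hT j hj, lam]
  have hM1 : 1 ≤ q * j := Nat.mul_pos h.qpos hj
  have sz := h.sum_zero_mul j
  have si := h.sum_id_mul j
  set Mn : ℕ := q * j
  have hM : (1:ℝ) ≤ (Mn:ℝ) := by exact_mod_cast hM1
  set M : ℝ := (Mn:ℝ) with hMdef
  set κ := kap χ q
  set β := bet χ q
  -- m part
  have hm : |∑ m ∈ Ioc 0 Mn, χ m * (m:ℝ) ^ 2 * RR (fun _ => 1) (T / m) -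
      (T ^ 3 / 3 * ∑ m ∈ Ioc 0 Mn, χ m / m - T / 6 * (κ * M))| ≤ M ^ 3 := by
    have e : T ^ 3 / 3 * ∑ m ∈ Ioc 0 Mn, χ m / m - T / 6 * (κ * M) =
        ∑ m ∈ Ioc 0 Mn, χ m * (m:ℝ) ^ 2 * ((T / m) ^ 3 / 3 - (T / m) ^ 2 / 2 + (T / m) / 6) := by
      have : T ^ 3 / 3 * ∑ m ∈ Ioc 0 Mn, χ m / m - T / 6 * (κ * M) =
        T ^ 3 / 3 * ∑ m ∈ Ioc 0 Mn, χ m / m - T ^ 2 / 2 * ∑ m ∈ Ioc 0 Mn, χ m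
          + T / 6 * ∑ m ∈ Ioc 0 Mn, (m:ℝ) * χ m := by rw [sz, si]; ring
      rw [this, mul_sum, mul_sum, mul_sum, ← sum_sub_distrib, ← sum_add_distrib]
      refine sum_congr rfl fun m hm => ?_
      rw [mem_Ioc] at hm
      have hm0 : (0:ℝ) < m := by exact_mod_cast hm.1
      field_simp
    rw [e, ← sum_sub_distrib]
    refine (abs_sum_le_sum_abs _ _).trans ?_
    calc _ ≤ ∑ m ∈ Ioc 0 Mn, M ^ 2 := by
          refine sum_le_sum fun m hm => ?_
          rw [mem_Ioc] at hm
          have hmM : (m:ℝ) ≤ M := by rw [hMdef]; exact_mod_cast hm.2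
          rw [← mul_sub, abs_mul, abs_mul, abs_of_nonneg (by positivity : (0:ℝ) ≤ (m:ℝ) ^ 2)]
          have := RR_one_est (T / m) (by positivity)
          calc _ ≤ 1 * (m:ℝ) ^ 2 * 1 := by
                gcongr
                exact h.bdd m
            _ ≤ M ^ 2 := by rw [one_mul, mul_one]; gcongr
      _ = M ^ 3 := by simp; ring
  -- n part
  obtain ⟨z, hz⟩ : ∃ z, z = T / M := ⟨_, rfl⟩
  have hz0 : 0 ≤ z := by rw [hz]; positivity
  have hTz : T = M * z := by rw [hz]; field_simp
  have hn : |∑ n ∈ Ioc 0 ⌊T / M⌋₊, (n:ℝ) ^ 2 * RR χ (T / n - M) -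
      (κ * M ^ 2 * RR (fun _ => 1) z + β * M * ∑ n ∈ Ioc 0 ⌊z⌋₊, (n:ℝ) * (z - n))| ≤ CG * z ^ 3 := by
    rw [← hz, RR, mul_sum, mul_sum, ← sum_add_distrib, ← sum_sub_distrib]
    refine (abs_sum_le_sum_abs _ _).trans ?_
    calc _ ≤ ∑ n ∈ Ioc 0 ⌊z⌋₊, CG * z ^ 2 := by
          refine sum_le_sum fun n hn => ?_
          rw [mem_Ioc] at hn
          have hn0 : (0:ℝ) < n := by exact_mod_cast hn.1
          have hnz : (n:ℝ) ≤ z := (Nat.le_floor_iff hz0).1 hn.2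
          have hy : 0 ≤ T / n - M := by
            rw [sub_nonneg, le_div_iff₀ hn0, hTz]
            gcongr
          have e : (n:ℝ) ^ 2 * RR χ (T / n - M) - (κ * M ^ 2 * (1 * (z - n) ^ 2) + β * M * (n * (z - n)))
            = n ^ 2 * (RR χ (T / n - M) - κ * (T / n - M) ^ 2 - β * (T / n - M)) := by
            have : T / n - M = M * (z - n) / n := by rw [hTz]; field_simp
            rw [mul_sub ((n:ℝ) ^ 2), mul_sub ((n:ℝ) ^ 2)]
            have e1 : (n:ℝ) ^ 2 * (κ * (T / n - M) ^ 2) = κ * M ^ 2 * (1 * (z - n) ^ 2) := by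
              rw [this]; field_simp
            have e2 : (n:ℝ) ^ 2 * (β * (T / n - M)) = β * M * (n * (z - n)) := by
              rw [this]; field_simp
            rw [e1, e2]; ring
          rw [e, abs_mul, abs_of_nonneg (by positivity), mul_comm]
          have := hG _ hy
          gcongr
      _ = ⌊z⌋₊ * (CG * z ^ 2) := by simp
      _ ≤ z * (CG * z ^ 2) := by
          have := Nat.floor_le hz0
          gcongr
      _ = _ := by ring
  have hR := RR_one_est z hz0
  have hQ := Q_est z hz0
  set R1 := RR (fun _ => 1) z
  set Q1 := ∑ n ∈ Ioc 0 ⌊z⌋₊, (n:ℝ) * (z - n)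
  set S1 := ∑ m ∈ Ioc 0 Mn, χ m * (m:ℝ) ^ 2 * RR (fun _ => 1) (T / m)
  set S2 := ∑ n ∈ Ioc 0 ⌊T / M⌋₊, (n:ℝ) ^ 2 * RR χ (T / n - M)
  set H := ∑ m ∈ Ioc 0 Mn, χ m / m
  have e : S1 + S2 - T ^ 3 / 3 * (H + κ / M + β / (2 * M ^ 2)) + κ * T ^ 2 / 2 =
      (S1 - (T ^ 3 / 3 * H - T / 6 * (κ * M))) + (S2 - (κ * M ^ 2 * R1 + β * M * Q1))
      + κ * M ^ 2 * (R1 - (z ^ 3 / 3 - z ^ 2 / 2 + z / 6)) + β * M * (Q1 - z ^ 3 / 6) := by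
    rw [hTz]
    field_simp
    ring
  rw [e, ← hz]
  have b1 : |κ * M ^ 2 * (R1 - (z ^ 3 / 3 - z ^ 2 / 2 + z / 6))| ≤ |κ| * M ^ 2 := by
    rw [abs_mul, abs_mul, abs_of_nonneg (by positivity : 0 ≤ M ^ 2)]
    exact mul_le_of_le_one_right (by positivity) hR
  have b2 : |β * M * (Q1 - z ^ 3 / 6)| ≤ |β| * M * (z + 1) := by
    rw [abs_mul, abs_mul, abs_of_nonneg (by positivity : 0 ≤ M)]
    gcongr
  have k0 := abs_nonneg κ
  have k1 := abs_nonneg β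
  have m2 : M ^ 2 ≤ M ^ 3 := pow_le_pow_right₀ hM (by norm_num)
  have m3 : M ≤ M ^ 3 := by simpa using pow_le_pow_right₀ hM (by norm_num : 1 ≤ 3)
  have m4 : M * z ≤ T * M := by rw [← hTz]; nlinarith
  have z3 : 0 ≤ z ^ 3 := by positivity
  have tm : 0 ≤ T * M := by positivity
  have M3 : 0 ≤ M ^ 3 := by positivity
  calc _ ≤ M ^ 3 + CG * z ^ 3 + |κ| * M ^ 2 + |β| * M * (z + 1) :=
        (abs_add_le _ _).trans (add_le_add ((abs_add_le _ _).trans (add_le_add ((abs_add_le _ _).trans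
          (add_le_add hm hn)) b1)) b2)
    _ = M ^ 3 + CG * z ^ 3 + |κ| * M ^ 2 + |β| * (M * z + M) := by ring
    _ ≤ M ^ 3 + CG * z ^ 3 + |κ| * M ^ 3 + |β| * (T * M + M ^ 3) := by gcongr
    _ ≤ _ := by
      have p1 := mul_nonneg k0 tm
      have p2 := mul_nonneg k0 M3
      have p3 := mul_nonneg k0 z3
      have p4 := mul_nonneg k1 tm
      have p5 := mul_nonneg k1 M3
      have p6 := mul_nonneg k1 z3
      have p7 := mul_nonneg hCG tm
      have p8 := mul_nonneg hCG M3
      nlinarith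

end Setup
end RS

namespace RS
open Finset MeasureTheory

noncomputable def EE (a : ℕ → ℝ) (ρ x : ℝ) : ℝ := SA a x - ρ * x

theorem SA_lt_one (a : ℕ → ℝ) {x : ℝ} (hx : x < 1) : SA a x = 0 := by
  rw [SA, Nat.floor_eq_zero.2 hx]; simp

theorem SA_continuousWithinAt (a : ℕ → ℝ) (x : ℝ) (hx : 0 ≤ x) :
    ContinuousWithinAt (SA a) (Set.Ici x) x := by
  have : SA a =ᶠ[nhdsWithin x (Set.Ici x)] fun _ => SA a x := by
    have h1 := Nat.lt_floor_add_one x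
    filter_upwards [self_mem_nhdsWithin, mem_nhdsWithin_of_mem_nhds (Iio_mem_nhds h1)] with y hy hy2
    have : ⌊y⌋₊ = ⌊x⌋₊ := by
      rw [Nat.floor_eq_iff (hx.trans hy)]
      exact ⟨(Nat.floor_le hx).trans hy, hy2⟩
    rw [SA, SA, this]
  exact (continuousWithinAt_const).congr_of_eventuallyEq this rfl

theorem EE_continuousWithinAt (a : ℕ → ℝ) (ρ x : ℝ) (hx : 0 ≤ x) :
    ContinuousWithinAt (EE a ρ) (Set.Ici x) x :=
  (SA_continuousWithinAt a x hx).sub (by fun_prop)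

theorem SA_measurable (a : ℕ → ℝ) : Measurable (SA a) := by
  have : SA a = (fun n : ℕ => ∑ n ∈ Ioc 0 n, a n) ∘ (fun x : ℝ => ⌊x⌋₊) := rfl
  rw [this]
  exact (measurable_of_countable _).comp Nat.measurable_floor

theorem EE_measurable (a : ℕ → ℝ) (ρ : ℝ) : Measurable (EE a ρ) :=
  (SA_measurable a).sub (by fun_prop)

theorem EE_intervalIntegrable (a : ℕ → ℝ) (ρ : ℝ) {u v : ℝ} (hu : 1 ≤ u) (hv : 1 ≤ v) :
    IntervalIntegrable (EE a ρ) volume u v :=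
  (SA_intervalIntegrable a hu hv).sub (by apply Continuous.intervalIntegrable; fun_prop)

/-- First primitive of `E - γ`. -/
noncomputable def D1 (a : ℕ → ℝ) (ρ γ x : ℝ) : ℝ := ∫ t in (1:ℝ)..x, (EE a ρ t - γ)
noncomputable def D2 (a : ℕ → ℝ) (ρ γ x : ℝ) : ℝ := ∫ t in (1:ℝ)..x, D1 a ρ γ t

theorem D_int (a : ℕ → ℝ) (ρ γ : ℝ) {u v : ℝ} (hu : 1 ≤ u) (hv : 1 ≤ v) :
    IntervalIntegrable (fun t => EE a ρ t - γ) volume u v :=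
  (EE_intervalIntegrable a ρ hu hv).sub (by simp)

theorem D1_continuousOn (a : ℕ → ℝ) (ρ γ : ℝ) : ContinuousOn (D1 a ρ γ) (Set.Ici 1) := by
  intro x hx
  have hx : 1 ≤ x := hx
  have h2 : IntegrableOn (fun t => EE a ρ t - γ) (Set.uIcc 1 (x+1)) := by
    have := (D_int a ρ γ le_rfl (by linarith : 1 ≤ x + 1))
    rw [Set.uIcc_of_le (by linarith)]
    rw [intervalIntegrable_iff_integrableOn_Icc_of_le (by linarith)] at this
    exact this
  have := intervalIntegral.continuousOn_primitive_interval h2 x (by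
    rw [Set.uIcc_of_le (by linarith)]; constructor <;> linarith)
  refine this.mono_of_mem_nhdsWithin ?_
  rw [Set.uIcc_of_le (by linarith)]
  have : Set.Icc 1 (x+1) = Set.Ici 1 ∩ Set.Iic (x+1) := rfl
  rw [this]
  exact Filter.inter_mem self_mem_nhdsWithin (mem_nhdsWithin_of_mem_nhds (Iic_mem_nhds (by linarith)))

theorem D1_deriv (a : ℕ → ℝ) (ρ γ : ℝ) {x : ℝ} (hx : 1 ≤ x) :
    HasDerivWithinAt (D1 a ρ γ) (EE a ρ x - γ) (Set.Ioi x) x := by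
  have hm : Measurable (fun t => EE a ρ t - γ) := (EE_measurable a ρ).sub_const _
  refine intervalIntegral.integral_hasDerivWithinAt_right (D_int a ρ γ le_rfl hx)
    (s := Set.Ici x) (t := Set.Ioi x) hm.stronglyMeasurable.stronglyMeasurableAtFilter ?_ |>.mono Set.Ioi_subset_Ici_self
  exact ((EE_continuousWithinAt a ρ x (by linarith)).mono Set.Ioi_subset_Ici_self).sub continuousWithinAt_const

theorem D1_intInt (a : ℕ → ℝ) (ρ γ : ℝ) {u v : ℝ} (hu : 1 ≤ u) (hv : 1 ≤ v) :
    IntervalIntegrable (D1 a ρ γ) volume u v := by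
  apply ContinuousOn.intervalIntegrable
  refine (D1_continuousOn a ρ γ).mono fun t ht => ?_
  exact le_trans (le_min hu hv) ht.1

theorem D2_deriv (a : ℕ → ℝ) (ρ γ : ℝ) {x : ℝ} (hx : 1 ≤ x) :
    HasDerivWithinAt (D2 a ρ γ) (D1 a ρ γ x) (Set.Ioi x) x := by
  have hc := D1_continuousOn a ρ γ
  refine intervalIntegral.integral_hasDerivWithinAt_right (D1_intInt a ρ γ le_rfl hx)
    (s := Set.Ici x) (t := Set.Ioi x) ?_ ?_ |>.mono Set.Ioi_subset_Ici_self
  · refine ⟨Set.Ioi x, self_mem_nhdsWithin, ?_⟩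
    exact (hc.mono fun y (hy : x < y) => hx.trans hy.le).aestronglyMeasurable measurableSet_Ioi
  · exact (hc x hx).mono fun y (hy : x < y) => hx.trans hy.le

theorem D2_continuousOn (a : ℕ → ℝ) (ρ γ : ℝ) : ContinuousOn (D2 a ρ γ) (Set.Ici 1) := by
  intro x hx
  have hx : 1 ≤ x := hx
  have h2 : IntegrableOn (D1 a ρ γ) (Set.uIcc 1 (x+1)) := by
    have := (D1_intInt a ρ γ le_rfl (by linarith : 1 ≤ x + 1))
    rw [Set.uIcc_of_le (by linarith)]
    rw [intervalIntegrable_iff_integrableOn_Icc_of_le (by linarith)] at this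
    exact this
  have := intervalIntegral.continuousOn_primitive_interval h2 x (by
    rw [Set.uIcc_of_le (by linarith)]; constructor <;> linarith)
  refine this.mono_of_mem_nhdsWithin ?_
  rw [Set.uIcc_of_le (by linarith)]
  have : Set.Icc 1 (x+1) = Set.Ici 1 ∩ Set.Iic (x+1) := rfl
  rw [this]
  exact Filter.inter_mem self_mem_nhdsWithin (mem_nhdsWithin_of_mem_nhds (Iic_mem_nhds (by linarith)))

/-- Integration by parts against a `C¹` function, for `D` and `D1`. -/
theorem D_parts (a : ℕ → ℝ) (ρ γ : ℝ) {u v : ℝ} (hu : 1 ≤ u) (huv : u ≤ v) (f f' : ℝ → ℝ)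
    (hf : ∀ x, 1 ≤ x → HasDerivAt f (f' x) x) (hf' : ContinuousOn f' (Set.Ici 1)) :
    ∫ x in u..v, f x * (EE a ρ x - γ) =
      f v * D1 a ρ γ v - f u * D1 a ρ γ u - ∫ x in u..v, f' x * D1 a ρ γ x := by
  have hs : Set.uIcc u v ⊆ Set.Ici 1 := by
    rw [Set.uIcc_of_le huv]; intro x hx; exact hu.trans hx.1
  refine intervalIntegral.integral_mul_deriv_eq_deriv_mul_of_hasDeriv_right ?_ ?_ ?_ ?_ ?_ ?_
  · exact fun x hx => (hf x (hs hx)).continuousAt.continuousWithinAt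
  · exact (D1_continuousOn a ρ γ).mono hs
  · intro x hx
    rw [min_eq_left huv] at hx
    exact (hf x (hu.trans hx.1.le)).hasDerivWithinAt
  · intro x hx
    rw [min_eq_left huv] at hx
    exact D1_deriv a ρ γ (hu.trans hx.1.le)
  · exact (hf'.mono hs).intervalIntegrable
  · exact D_int a ρ γ hu (hu.trans huv)

theorem D1_parts (a : ℕ → ℝ) (ρ γ : ℝ) {u v : ℝ} (hu : 1 ≤ u) (huv : u ≤ v) (f f' : ℝ → ℝ)
    (hf : ∀ x, 1 ≤ x → HasDerivAt f (f' x) x) (hf' : ContinuousOn f' (Set.Ici 1)) :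
    ∫ x in u..v, f x * D1 a ρ γ x =
      f v * D2 a ρ γ v - f u * D2 a ρ γ u - ∫ x in u..v, f' x * D2 a ρ γ x := by
  have hs : Set.uIcc u v ⊆ Set.Ici 1 := by
    rw [Set.uIcc_of_le huv]; intro x hx; exact hu.trans hx.1
  refine intervalIntegral.integral_mul_deriv_eq_deriv_mul_of_hasDeriv_right ?_ ?_ ?_ ?_ ?_ ?_
  · exact fun x hx => (hf x (hs hx)).continuousAt.continuousWithinAt
  · exact (D2_continuousOn a ρ γ).mono hs
  · intro x hx
    rw [min_eq_left huv] at hx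
    exact (hf x (hu.trans hx.1.le)).hasDerivWithinAt
  · intro x hx
    rw [min_eq_left huv] at hx
    exact D2_deriv a ρ γ (hu.trans hx.1.le)
  · exact (hf'.mono hs).intervalIntegrable
  · exact D1_intInt a ρ γ hu (hu.trans huv)

theorem D2_eq (a : ℕ → ℝ) (ρ γ : ℝ) {T : ℝ} (hT : 1 ≤ T) :
    2 * D2 a ρ γ T = RR a T - (ρ * T ^ 3 / 3 + γ * T ^ 2 - (ρ + 2 * γ) * T + 2 * ρ / 3 + γ) := by
  have h1 := D_parts a ρ γ le_rfl hT (fun x => T - x) (fun _ => -1)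
    (fun x _ => by simpa using (hasDerivAt_id x).const_sub T) continuousOn_const
  have h2 : D1 a ρ γ 1 = 0 := by simp [D1]
  simp only [sub_self, zero_mul, h2, mul_zero, neg_mul, one_mul, zero_sub,
    intervalIntegral.integral_neg, neg_neg] at h1
  have h3 : D2 a ρ γ T = ∫ x in (1:ℝ)..T, (T - x) * (EE a ρ x - γ) := by rw [h1, D2]
  rw [h3, RR_eq_integral a hT]
  have h4 : ∫ s in (1:ℝ)..T, 2 * (T - s) * (ρ * s + γ) =
      ρ * T ^ 3 / 3 + γ * T ^ 2 - (ρ + 2 * γ) * T + 2 * ρ / 3 + γ := by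
    have : ∀ s ∈ Set.uIcc (1:ℝ) T, HasDerivAt
      (fun s => 2 * (T * (ρ * s ^ 2 / 2 + γ * s) - (ρ * s ^ 3 / 3 + γ * s ^ 2 / 2))) (2 * (T - s) * (ρ * s + γ)) s := by
      intro s _
      have h1 := ((((hasDerivAt_pow 2 s).const_mul ρ).div_const 2).add ((hasDerivAt_id s).const_mul γ)).const_mul T
      have h2 := (((hasDerivAt_pow 3 s).const_mul ρ).div_const 3).add (((hasDerivAt_pow 2 s).const_mul γ).div_const 2)
      have := (h1.sub h2).const_mul 2
      refine this.congr_deriv ?_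
      simp
      ring
    rw [intervalIntegral.integral_eq_sub_of_hasDerivAt this (by apply Continuous.intervalIntegrable; fun_prop)]
    ring
  rw [← h4, ← intervalIntegral.integral_const_mul, ← intervalIntegral.integral_sub]
  · apply intervalIntegral.integral_congr
    intro s _
    simp only [EE]
    ring
  · exact (abelInt a hT (fun s => 2 * (T - s)) (by apply Continuous.intervalIntegrable; fun_prop)).1
  · apply Continuous.intervalIntegrable; fun_prop

namespace Setup
variable {a χ : ℕ → ℝ} {q : ℕ} {ρ c : ℝ}

theorem E_le (h : Setup a χ q ρ c) {t : ℝ} (ht : 1 ≤ t) : |EE a ρ t| ≤ c * t ^ ((1:ℝ)/3) := h.asym t ht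

theorem E_le' (h : Setup a χ q ρ c) {t T : ℝ} (ht : 0 ≤ t) (htT : t ≤ T) (hT : 1 ≤ T) :
    |EE a ρ t| ≤ (c + |ρ|) * T ^ ((1:ℝ)/3) := by
  have hc := h.cpos
  have hT1 : 1 ≤ T ^ ((1:ℝ)/3) := Real.one_le_rpow hT (by norm_num)
  rcases le_or_gt 1 t with h1 | h1
  · have := h.E_le h1
    have h2 : t ^ ((1:ℝ)/3) ≤ T ^ ((1:ℝ)/3) := Real.rpow_le_rpow ht htT (by norm_num)
    have h3 : c * t ^ ((1:ℝ)/3) ≤ c * T ^ ((1:ℝ)/3) := by gcongr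
    have := mul_nonneg (abs_nonneg ρ) (zero_le_one.trans hT1)
    nlinarith
  · rw [EE, SA_lt_one a h1, zero_sub, abs_neg, abs_mul, abs_of_nonneg ht]
    have := abs_nonneg ρ
    nlinarith [mul_nonneg hc.le (zero_le_one.trans hT1), mul_nonneg this ht]

theorem D1_le (h : Setup a χ q ρ c) (γ : ℝ) {x : ℝ} (hx : 1 ≤ x) :
    |D1 a ρ γ x| ≤ (c + |γ|) * x ^ ((4:ℝ)/3) := by
  have hc := h.cpos
  have : ‖∫ t in (1:ℝ)..x, (EE a ρ t - γ)‖ ≤ ((c + |γ|) * x ^ ((1:ℝ)/3)) * |x - 1| := by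
    apply intervalIntegral.norm_integral_le_of_norm_le_const
    intro t ht
    rw [Set.uIoc_of_le hx] at ht
    have h1 := h.E_le ht.1.le
    have h2 : t ^ ((1:ℝ)/3) ≤ x ^ ((1:ℝ)/3) := Real.rpow_le_rpow (by linarith [ht.1]) ht.2 (by norm_num)
    have h3 : 1 ≤ x ^ ((1:ℝ)/3) := Real.one_le_rpow hx (by norm_num)
    rw [Real.norm_eq_abs]
    refine (abs_sub _ _).trans ?_
    have h4 : c * t ^ ((1:ℝ)/3) ≤ c * x ^ ((1:ℝ)/3) := by gcongr
    have := le_mul_of_one_le_right (abs_nonneg γ) h3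
    linarith
  rw [Real.norm_eq_abs] at this
  refine this.trans ?_
  rw [mul_assoc]
  have e : x ^ ((4:ℝ)/3) = x ^ ((1:ℝ)/3) * x := by
    rw [← Real.rpow_add_one (by linarith)]; norm_num
  rw [e, abs_of_nonneg (by linarith : 0 ≤ x - 1)]
  have : 0 < x ^ ((1:ℝ)/3) := by positivity
  gcongr
  linarith

theorem lam_aux (h : Setup a χ q ρ c) : ∃ C : ℝ, 0 ≤ C ∧ ∀ j : ℕ, 0 < j →
    |lam χ q j - ρ| ≤ C / (q * j : ℕ) := by
  obtain ⟨C, hC, hR⟩ := h.riesz_est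
  have hc := h.cpos
  have k0 := abs_nonneg (kap χ q)
  have r0 := abs_nonneg ρ
  refine ⟨9 * C + 2 * |kap χ q| + 10 * (c + |ρ|), by positivity, ?_⟩
  intro j hj
  have hM1 : 1 ≤ q * j := Nat.mul_pos h.qpos hj
  have hR := hR (((q * j : ℕ):ℝ) ^ 2) (by positivity) j hj
  set M : ℝ := ((q * j : ℕ):ℝ) with hMdef
  have hM : (1:ℝ) ≤ M := by rw [hMdef]; exact_mod_cast hM1
  have hT : 1 ≤ M ^ 2 := one_le_pow₀ hM
  have h1 := D2_eq a ρ 0 hT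
  have h2 : |D2 a ρ 0 (M ^ 2)| ≤ c * M ^ 5 := by
    have : ‖∫ t in (1:ℝ)..(M ^ 2), D1 a ρ 0 t‖ ≤ (c * (M ^ 2) ^ ((4:ℝ)/3)) * |M ^ 2 - 1| := by
      apply intervalIntegral.norm_integral_le_of_norm_le_const
      intro t ht
      rw [Set.uIoc_of_le hT] at ht
      have h1 := h.D1_le 0 ht.1.le
      rw [abs_zero, add_zero] at h1
      rw [Real.norm_eq_abs]
      refine h1.trans ?_
      have := ht.1
      have := ht.2
      gcongr
    rw [Real.norm_eq_abs] at this
    refine this.trans ?_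
    have e : (M ^ 2) ^ ((4:ℝ)/3) ≤ M ^ 3 := by
      rw [← Real.rpow_natCast M 3, ← Real.rpow_natCast M 2, ← Real.rpow_mul (by linarith)]
      exact Real.rpow_le_rpow_of_exponent_le hM (by norm_num)
    rw [abs_of_nonneg (by linarith)]
    calc c * (M ^ 2) ^ ((4:ℝ)/3) * (M ^ 2 - 1) ≤ c * M ^ 3 * M ^ 2 := by gcongr; linarith
      _ = c * M ^ 5 := by ring
  have e1 : (M ^ 2 / M) ^ 3 = M ^ 3 := by field_simp
  rw [e1] at hR
  have p0 : M ≤ M ^ 5 := by simpa using pow_le_pow_right₀ hM (by norm_num : 1 ≤ 5)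
  have p2 : M ^ 2 ≤ M ^ 5 := pow_le_pow_right₀ hM (by norm_num : 2 ≤ 5)
  have p3 : M ^ 3 ≤ M ^ 5 := pow_le_pow_right₀ hM (by norm_num : 3 ≤ 5)
  have p4 : M ^ 4 ≤ M ^ 5 := pow_le_pow_right₀ hM (by norm_num : 4 ≤ 5)
  have key : |M ^ 6 / 3 * (lam χ q j - ρ)| ≤ M ^ 5 * ((9 * C + 2 * |kap χ q| + 10 * (c + |ρ|)) / 3) := by
    have e2 : M ^ 6 / 3 * (lam χ q j - ρ) =
      -(RR a (M ^ 2) - (M ^ 2) ^ 3 / 3 * lam χ q j + kap χ q * (M ^ 2) ^ 2 / 2)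
        + kap χ q * M ^ 4 / 2 + 2 * D2 a ρ 0 (M ^ 2) + ρ * (2 / 3 - M ^ 2) := by
      rw [h1]; ring
    rw [e2]
    have t1 : |kap χ q * M ^ 4 / 2| ≤ |kap χ q| * M ^ 5 / 2 := by
      rw [abs_div, abs_mul, abs_of_nonneg (by positivity : 0 ≤ M ^ 4), abs_two]
      gcongr
    have t2 : |ρ * (2 / 3 - M ^ 2)| ≤ |ρ| * M ^ 5 := by
      rw [abs_mul]
      gcongr
      rw [abs_le]; constructor <;> linarith
    have t3 : |2 * D2 a ρ 0 (M ^ 2)| ≤ 2 * (c * M ^ 5) := by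
      rw [abs_mul, abs_two]; gcongr
    have t4 : C * (M ^ 2 * M + M ^ 3 + M ^ 3) ≤ 3 * C * M ^ 5 := by
      have := mul_le_mul_of_nonneg_left p3 hC
      nlinarith
    have p5 : 0 ≤ M ^ 5 := by positivity
    calc _ ≤ 3 * C * M ^ 5 + |kap χ q| * M ^ 5 / 2 + 2 * (c * M ^ 5) + |ρ| * M ^ 5 :=
          (abs_add_le _ _).trans (add_le_add ((abs_add_le _ _).trans (add_le_add ((abs_add_le _ _).trans
          (add_le_add (by rw [abs_neg]; exact hR.trans t4) t1)) t3)) t2)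
      _ ≤ _ := by nlinarith [mul_nonneg k0 p5, mul_nonneg r0 p5, mul_nonneg hc.le p5]
  rw [abs_mul, abs_of_nonneg (by positivity)] at key
  rw [le_div_iff₀ (by linarith)]
  have : (M ^ 5 / 3) * (|lam χ q j - ρ| * M) ≤ (M ^ 5 / 3) * (9 * C + 2 * |kap χ q| + 10 * (c + |ρ|)) := by
    nlinarith
  exact le_of_mul_le_mul_left this (by positivity)

theorem lam_est (h : Setup a χ q ρ c) : ∃ C : ℝ, 0 ≤ C ∧ ∀ j : ℕ, 0 < j →
    |lam χ q j - ρ| ≤ C / ((q * j : ℕ):ℝ) ^ 3 := by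
  obtain ⟨C, hC, hR⟩ := h.riesz_est
  obtain ⟨C', hC', hL⟩ := h.lam_aux
  have step : ∀ j : ℕ, 0 < j → |lam χ q j - lam χ q (2 * j)| ≤ 45 * C / ((q * j : ℕ):ℝ) ^ 3 := by
    intro j hj
    have hM1 : 1 ≤ q * j := Nat.mul_pos h.qpos hj
    have h1 := hR (((q * j : ℕ):ℝ) ^ 2) (by positivity) j hj
    have h2 := hR (((q * j : ℕ):ℝ) ^ 2) (by positivity) (2 * j) (by omega)
    have e : ((q * (2 * j) : ℕ):ℝ) = 2 * ((q * j : ℕ):ℝ) := by push_cast; ring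
    rw [e] at h2
    set M : ℝ := ((q * j : ℕ):ℝ) with hMdef
    have hM : (1:ℝ) ≤ M := by rw [hMdef]; exact_mod_cast hM1
    have e1 : (M ^ 2 / M) ^ 3 = M ^ 3 := by field_simp
    have e2 : (M ^ 2 / (2 * M)) ^ 3 = M ^ 3 / 8 := by field_simp; norm_num
    rw [e1] at h1
    rw [e2] at h2
    have p3 : 0 ≤ C * M ^ 3 := by positivity
    have key : |M ^ 6 / 3 * (lam χ q j - lam χ q (2 * j))| ≤ 15 * C * M ^ 3 := by
      have := abs_le.1 h1
      have := abs_le.1 h2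
      rw [abs_le]
      constructor <;> nlinarith
    rw [abs_mul, abs_of_nonneg (by positivity)] at key
    rw [le_div_iff₀ (by positivity)]
    have : (M ^ 3 / 3) * (|lam χ q j - lam χ q (2 * j)| * M ^ 3) ≤ (M ^ 3 / 3) * (45 * C) := by
      nlinarith
    exact le_of_mul_le_mul_left this (by positivity)
  have ind : ∀ k j : ℕ, 0 < j → |lam χ q j - ρ| ≤ 90 * C / ((q * j : ℕ):ℝ) ^ 3 + C' / (2 ^ k * (q * j : ℕ)) := by
    intro k
    induction k with
    | zero =>
      intro j hj
      have := hL j hj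
      have h2 : 0 ≤ 90 * C / ((q * j : ℕ):ℝ) ^ 3 := by positivity
      simp only [pow_zero, one_mul]
      linarith
    | succ k ih =>
      intro j hj
      have h1 := ih (2 * j) (by omega)
      have h2 := step j hj
      have e : ((q * (2 * j) : ℕ):ℝ) = 2 * ((q * j : ℕ):ℝ) := by push_cast; ring
      rw [e] at h1
      have hM1 : 1 ≤ q * j := Nat.mul_pos h.qpos hj
      set M : ℝ := ((q * j : ℕ):ℝ) with hMdef
      have hM : (1:ℝ) ≤ M := by rw [hMdef]; exact_mod_cast hM1
      have e3 : 90 * C / (2 * M) ^ 3 = 90 * C / M ^ 3 / 8 := by field_simp; norm_num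
      have e4 : C' / (2 ^ k * (2 * M)) = C' / (2 ^ (k+1) * M) := by rw [pow_succ]; ring_nf
      rw [e3, e4] at h1
      have e5 : 45 * C / M ^ 3 = 90 * C / M ^ 3 / 2 := by ring
      rw [e5] at h2
      have h3 : 0 ≤ 90 * C / M ^ 3 := by positivity
      have h4 := abs_sub_le (lam χ q j) (lam χ q (2 * j)) ρ
      linarith
  refine ⟨90 * C, by positivity, fun j hj => ?_⟩
  have hM1 : 1 ≤ q * j := Nat.mul_pos h.qpos hj
  have ht : Filter.Tendsto (fun k : ℕ => 90 * C / ((q * j : ℕ):ℝ) ^ 3 + C' / (2 ^ k * (q * j : ℕ)))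
      Filter.atTop (nhds (90 * C / ((q * j : ℕ):ℝ) ^ 3 + 0)) := by
    refine tendsto_const_nhds.add ?_
    refine Filter.Tendsto.div_atTop tendsto_const_nhds ?_
    refine Filter.Tendsto.atTop_mul_const ?_ (tendsto_pow_atTop_atTop_of_one_lt (by norm_num))
    exact_mod_cast hM1
  rw [add_zero] at ht
  exact ge_of_tendsto' ht fun k => ind k j hj

theorem D2_le (h : Setup a χ q ρ c) : ∃ C : ℝ, 0 ≤ C ∧ ∀ T : ℝ, 1 ≤ T →
    |D2 a ρ (-kap χ q / 2) T| ≤ C * T ^ ((3:ℝ)/2) := by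
  obtain ⟨C, hC, hR⟩ := h.riesz_est
  obtain ⟨C', hC', hL⟩ := h.lam_est
  have hq : (1:ℝ) ≤ q := by exact_mod_cast h.qpos
  refine ⟨C * (2 * q + 8 * q ^ 3 + 1) + C' + 3 * |ρ| + 3 * |kap χ q|, by positivity, fun T hT => ?_⟩
  set s := Real.sqrt T with hs
  have hs1 : 1 ≤ s := Real.one_le_sqrt.2 hT
  have hsT : T = s ^ 2 := (Real.sq_sqrt (by linarith)).symm
  have e32 : T ^ ((3:ℝ)/2) = s ^ 3 := by
    rw [hsT, ← Real.rpow_natCast s 2, ← Real.rpow_natCast s 3, ← Real.rpow_mul (by linarith)]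
    norm_num
  obtain ⟨j, hj⟩ : ∃ j, j = ⌈s⌉₊ := ⟨_, rfl⟩
  have hj1 : s ≤ j := by rw [hj]; exact Nat.le_ceil s
  have hj2 : (j:ℝ) ≤ 2 * s := by
    rw [hj]; have := Nat.ceil_lt_add_one (by linarith : 0 ≤ s); linarith
  have hj0 : 0 < j := by
    have : (0:ℝ) < j := by linarith
    exact_mod_cast this
  have h1 := hR T (by linarith) j hj0
  have h2 := hL j hj0
  have hMe : ((q * j : ℕ):ℝ) = q * j := by push_cast; ring
  rw [hMe] at h1 h2
  set M : ℝ := (q:ℝ) * j with hM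
  have hM1 : s ≤ M := by nlinarith
  have hM2 : M ≤ 2 * q * s := by nlinarith
  have hMp : 0 < M := by linarith
  have h3 := D2_eq a ρ (-kap χ q / 2) hT
  have b1 : T * M + M ^ 3 + (T / M) ^ 3 ≤ (2 * q + 8 * q ^ 3 + 1) * s ^ 3 := by
    have c1 : T * M ≤ s ^ 2 * (2 * q * s) := by rw [hsT]; gcongr
    have c2 : M ^ 3 ≤ (2 * q * s) ^ 3 := by gcongr
    have c3 : (T / M) ^ 3 ≤ s ^ 3 := by
      gcongr
      rw [div_le_iff₀ hMp, hsT]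
      nlinarith
    nlinarith
  have b2 : |T ^ 3 / 3 * (lam χ q j - ρ)| ≤ C' * s ^ 3 := by
    rw [abs_mul, abs_of_nonneg (by positivity)]
    calc T ^ 3 / 3 * |lam χ q j - ρ| ≤ T ^ 3 / 3 * (C' / M ^ 3) := by gcongr
      _ ≤ T ^ 3 / 3 * (C' / s ^ 3) := by gcongr
      _ = C' * s ^ 3 / 3 := by rw [hsT]; field_simp
      _ ≤ _ := by have : 0 ≤ C' * s ^ 3 := by positivity
                  linarith
  have b3 := h1.trans (mul_le_mul_of_nonneg_left b1 hC)
  have s2 : s ^ 2 ≤ s ^ 3 := pow_le_pow_right₀ hs1 (by norm_num)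
  have s3 : 1 ≤ s ^ 3 := one_le_pow₀ hs1
  have b4 : |ρ * (T - 2 / 3)| ≤ |ρ| * s ^ 3 := by
    rw [abs_mul]; gcongr; rw [abs_le]; constructor <;> linarith
  have b5 : |kap χ q * (T - 1 / 2)| ≤ |kap χ q| * s ^ 3 := by
    rw [abs_mul]; gcongr; rw [abs_le]; constructor <;> linarith
  have e : 2 * D2 a ρ (-kap χ q / 2) T = (RR a T - T ^ 3 / 3 * lam χ q j + kap χ q * T ^ 2 / 2)
     + T ^ 3 / 3 * (lam χ q j - ρ) + ρ * (T - 2 / 3) - kap χ q * (T - 1 / 2) := by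
    rw [h3]; ring
  have b6 : |2 * D2 a ρ (-kap χ q / 2) T| ≤ C * ((2 * q + 8 * q ^ 3 + 1) * s ^ 3) + C' * s ^ 3
      + |ρ| * s ^ 3 + |kap χ q| * s ^ 3 := by
    rw [e]
    exact (abs_sub _ _).trans (add_le_add ((abs_add_le _ _).trans (add_le_add ((abs_add_le _ _).trans
          (add_le_add b3 b2)) b4)) b5)
  rw [abs_mul, abs_two] at b6
  rw [e32]
  have k0 := mul_nonneg (abs_nonneg (kap χ q)) (zero_le_one.trans s3)
  have r0 := mul_nonneg (abs_nonneg ρ) (zero_le_one.trans s3)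
  have k1 : 0 ≤ C * ((2 * q + 8 * q ^ 3 + 1) * s ^ 3) := by positivity
  have k2 : 0 ≤ C' * s ^ 3 := by positivity
  nlinarith [abs_nonneg (D2 a ρ (-kap χ q / 2) T)]

end Setup
end RS

namespace RS
open Finset MeasureTheory

noncomputable def psi (t : ℝ) : ℝ := Int.fract t - 1 / 2
noncomputable def B2 (t : ℝ) : ℝ := (Int.fract t ^ 2 - Int.fract t + 1 / 6) / 2
noncomputable def B3 (t : ℝ) : ℝ := Int.fract t ^ 3 / 6 - Int.fract t ^ 2 / 4 + Int.fract t / 12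

theorem abs_psi_le (t : ℝ) : |psi t| ≤ 1 / 2 := by
  have := Int.fract_nonneg t
  have := (Int.fract_lt_one t).le
  rw [psi, abs_le]; constructor <;> linarith

theorem abs_B2_le (t : ℝ) : |B2 t| ≤ 1 := by
  have := Int.fract_nonneg t
  have := (Int.fract_lt_one t).le
  rw [B2, abs_le]; constructor <;> nlinarith

theorem abs_B3_le (t : ℝ) : |B3 t| ≤ 1 := by
  have h0 := Int.fract_nonneg t
  have h1 := (Int.fract_lt_one t).le
  rw [B3]
  have h2 : Int.fract t ^ 2 ≤ 1 := by nlinarith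
  have h3 : Int.fract t ^ 3 ≤ 1 := by nlinarith
  have h4 : 0 ≤ Int.fract t ^ 2 := by positivity
  have h5 : 0 ≤ Int.fract t ^ 3 := by positivity
  rw [abs_le]; constructor <;> linarith

theorem B2_continuous : Continuous B2 := by
  have : B2 = (fun y : ℝ => (y ^ 2 - y + 1 / 6) / 2) ∘ Int.fract := rfl
  rw [this]
  apply ContinuousOn.comp_fract''
  · fun_prop
  · norm_num

theorem B3_continuous : Continuous B3 := by
  have : B3 = (fun y : ℝ => y ^ 3 / 6 - y ^ 2 / 4 + y / 12) ∘ Int.fract := rfl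
  rw [this]
  apply ContinuousOn.comp_fract''
  · fun_prop
  · norm_num

theorem fract_deriv_right (x : ℝ) : HasDerivWithinAt Int.fract (1:ℝ) (Set.Ioi x) x := by
  have h1 : HasDerivAt (fun y : ℝ => y - (⌊x⌋ : ℝ)) 1 x := (hasDerivAt_id x).sub_const _
  refine h1.hasDerivWithinAt.congr_of_eventuallyEq ?_ rfl
  have := Int.lt_floor_add_one x
  filter_upwards [self_mem_nhdsWithin, mem_nhdsWithin_of_mem_nhds (Iio_mem_nhds this)] with y hy hy2
  have : ⌊y⌋ = ⌊x⌋ := by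
    rw [Int.floor_eq_iff]
    exact ⟨(Int.floor_le x).trans (le_of_lt hy), hy2⟩
  rw [Int.fract, this]

theorem B2_deriv_right (x : ℝ) : HasDerivWithinAt B2 (psi x) (Set.Ioi x) x := by
  have h := fract_deriv_right x
  have := (((h.pow 2).sub h).add_const (1/6)).div_const 2
  refine this.congr_deriv ?_
  rw [psi]; simp; ring

theorem B3_deriv_right (x : ℝ) : HasDerivWithinAt B3 (B2 x) (Set.Ioi x) x := by
  have h := fract_deriv_right x
  have := (((h.pow 3).div_const 6).sub ((h.pow 2).div_const 4)).add (h.div_const 12)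
  refine this.congr_deriv ?_
  rw [B2]; simp; ring

theorem deriv_right_scale {f f' : ℝ → ℝ} (hf : ∀ x, HasDerivWithinAt f (f' x) (Set.Ioi x) x)
    {m : ℝ} (hm : 0 < m) (β x : ℝ) :
    HasDerivWithinAt (fun x => m * f (x / m + β)) (f' (x / m + β)) (Set.Ioi x) x := by
  have h1 : HasDerivAt (fun x : ℝ => x / m + β) (1 / m) x := ((hasDerivAt_id x).div_const m).add_const β
  have h2 := (hf (x / m + β)).scomp (h := fun x : ℝ => x / m + β) (s := Set.Ioi x) x h1.hasDerivWithinAt (by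
    intro y hy
    have : x < y := hy
    show x / m + β < y / m + β
    gcongr)
  refine (h2.const_mul m).congr_deriv ?_
  simp only [smul_eq_mul]
  field_simp

theorem psi_measurable : Measurable psi := measurable_fract.sub_const _

theorem psi_intInt (m β a b : ℝ) : IntervalIntegrable (fun x => psi (x / m + β)) volume a b := by
  rw [intervalIntegrable_iff]
  refine Integrable.mono' (g := fun _ => (1/2:ℝ)) (by
    have := (intervalIntegrable_const (c := (1/2:ℝ)) (μ := volume) (a := a) (b := b))
    rwa [intervalIntegrable_iff] at this) ?_ ?_
  · exact (psi_measurable.comp (by fun_prop)).aestronglyMeasurable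
  · exact Filter.Eventually.of_forall fun x => abs_psi_le _

theorem integral_psi {m : ℝ} (hm : 0 < m) (β a b : ℝ) :
    ∫ x in a..b, psi (x / m + β) = m * B2 (b / m + β) - m * B2 (a / m + β) :=
  intervalIntegral.integral_eq_sub_of_hasDeriv_right (f := fun x => m * B2 (x / m + β))
    (by have := B2_continuous; fun_prop) (fun x _ => deriv_right_scale B2_deriv_right hm β x) (psi_intInt m β a b)

theorem integral_B2 {m : ℝ} (hm : 0 < m) (β a b : ℝ) :
    ∫ x in a..b, B2 (x / m + β) = m * B3 (b / m + β) - m * B3 (a / m + β) :=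
  intervalIntegral.integral_eq_sub_of_hasDeriv_right (f := fun x => m * B3 (x / m + β))
    (by have := B3_continuous; fun_prop) (fun x _ => deriv_right_scale B3_deriv_right hm β x)
    (by have := B2_continuous; apply Continuous.intervalIntegrable; fun_prop)

theorem int_step {l x : ℝ} (g : ℝ → ℝ)
    (hg : IntervalIntegrable g volume l x) (s : ℝ) (hs : l ≤ s) (hsx : s ≤ x) :
    IntervalIntegrable (fun t => if s ≤ t then g t else 0) volume l x ∧
    ∫ t in l..x, (if s ≤ t then g t else 0) = ∫ t in s..x, g t := by
  have h1x : l ≤ x := hs.trans hsx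
  have e1 : ∀ t ∈ Set.Ioc s x, (if s ≤ t then g t else 0) = g t := fun t ht => if_pos ht.1.le
  have e2 : ∀ t ∈ Set.Ioo l s, (if s ≤ t then g t else 0) = 0 := fun t ht => if_neg (not_le.2 ht.2)
  have g1 : IntervalIntegrable g volume s x := hg.mono_set (by
    rw [Set.uIcc_of_le hsx, Set.uIcc_of_le h1x]; exact Set.Icc_subset_Icc hs le_rfl)
  have i2 : IntervalIntegrable (fun t => if s ≤ t then g t else 0) volume s x := by
    refine (intervalIntegrable_congr ?_).2 g1
    intro t ht
    rw [Set.uIoc_of_le hsx] at ht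
    exact e1 t ht
  have i1 : IntervalIntegrable (fun t => if s ≤ t then g t else 0) volume l s := by
    refine (IntervalIntegrable.congr_ae (f := fun _ => (0:ℝ)) ?_ ?_)
    · simp
    · rw [Set.uIoc_of_le hs, ← restrict_Ioo_eq_restrict_Ioc]
      filter_upwards [ae_restrict_mem measurableSet_Ioo] with t ht
      exact (e2 t ht).symm
  refine ⟨i1.trans i2, ?_⟩
  rw [← intervalIntegral.integral_add_adjacent_intervals i1 i2]
  have z : ∫ t in l..s, (if s ≤ t then g t else 0) = 0 := by
    rw [intervalIntegral.integral_of_le hs, ← restrict_Ioo_eq_restrict_Ioc,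
      setIntegral_congr_fun measurableSet_Ioo e2]
    simp
  rw [z, zero_add]
  apply intervalIntegral.integral_congr_ae
  refine Filter.Eventually.of_forall fun t ht => ?_
  rw [Set.uIoc_of_le hsx] at ht
  exact e1 t ht

theorem corr_eq {m m' : ℝ} (hm : 0 < m) (hm' : 0 < m') (β β' : ℝ) {a b : ℝ} (hab : a ≤ b) :
    ∫ x in a..b, psi (x / m + β) * psi (x / m' + β') =
      m * B2 (b / m + β) * psi (b / m' + β') - m * B2 (a / m + β) * psi (a / m' + β')
      + ∑ j ∈ Ioc ⌊a / m' + β'⌋ ⌊b / m' + β'⌋, m * B2 (m' * ((j:ℝ) - β') / m + β)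
      - (m / m') * ∫ x in a..b, B2 (x / m + β) := by
  set j0 := ⌊a / m' + β'⌋ with hj0
  set j1 := ⌊b / m' + β'⌋ with hj1
  have hj01 : j0 ≤ j1 := Int.floor_mono (by gcongr)
  set f := fun x => psi (x / m + β) with hf
  set F := fun x => m * B2 (x / m + β) with hF
  have hB := B2_continuous
  have fint : ∀ s t, IntervalIntegrable f volume s t := fun s t => psi_intInt m β s t
  -- linear part
  have L : ∫ x in a..b, (x / m' + β' - 1 / 2) * f x = (b / m' + β' - 1 / 2) * F b
      - (a / m' + β' - 1 / 2) * F a - ∫ x in a..b, (1 / m') * F x := by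
    refine intervalIntegral.integral_mul_deriv_eq_deriv_mul_of_hasDeriv_right (u := fun x => x / m' + β' - 1 / 2)
      (u' := fun _ => 1 / m') (v := F) (v' := f) ?_ ?_ ?_ ?_ ?_ ?_
    · fun_prop
    · fun_prop
    · intro x _
      exact ((((hasDerivAt_id x).div_const m').add_const β').sub_const _).hasDerivWithinAt
    · intro x _
      exact deriv_right_scale B2_deriv_right hm β x
    · simp
    · exact fint a b
  -- floor decomposition
  have hx : ∀ j ∈ Ioc j0 j1, a ≤ m' * ((j:ℝ) - β') ∧ m' * ((j:ℝ) - β') ≤ b := by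
    intro j hj
    rw [mem_Ioc] at hj
    have h1 : a / m' + β' < j := Int.floor_lt.1 hj.1
    have h2 : (j:ℝ) ≤ b / m' + β' := Int.le_floor.1 hj.2
    constructor
    · have : a / m' ≤ j - β' := by linarith
      rw [div_le_iff₀ hm'] at this
      linarith
    · have : (j:ℝ) - β' ≤ b / m' := by linarith
      rw [le_div_iff₀ hm'] at this
      linarith
  have fl : ∀ x ∈ Set.uIcc a b, (⌊x / m' + β'⌋:ℝ) * f x = j0 * f x +
      ∑ j ∈ Ioc j0 j1, (if m' * ((j:ℝ) - β') ≤ x then f x else 0) := by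
    intro x hxab
    rw [Set.uIcc_of_le hab] at hxab
    have hc : ∀ j : ℤ, m' * ((j:ℝ) - β') ≤ x ↔ j ≤ ⌊x / m' + β'⌋ := by
      intro j
      rw [Int.le_floor, ← sub_le_iff_le_add, le_div_iff₀ hm', mul_comm]
    have h0 : j0 ≤ ⌊x / m' + β'⌋ := Int.floor_mono (by have := hxab.1; gcongr)
    have h1 : ⌊x / m' + β'⌋ ≤ j1 := Int.floor_mono (by have := hxab.2; gcongr)
    have : ∑ j ∈ Ioc j0 j1, (if m' * ((j:ℝ) - β') ≤ x then f x else 0) =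
        ∑ j ∈ Ioc j0 ⌊x / m' + β'⌋, f x := by
      rw [← Finset.sum_filter]
      refine sum_congr ?_ fun _ _ => rfl
      ext j
      simp only [mem_filter, mem_Ioc, hc]
      omega
    rw [this, sum_const, Int.card_Ioc, nsmul_eq_mul]
    have : (((⌊x / m' + β'⌋ - j0).toNat : ℕ) : ℝ) = (⌊x / m' + β'⌋:ℝ) - j0 := by
      have : (((⌊x / m' + β'⌋ - j0).toNat : ℕ) : ℤ) = ⌊x / m' + β'⌋ - j0 := Int.toNat_of_nonneg (by omega)
      exact_mod_cast this
    rw [this]; ring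
  have st : ∀ j ∈ Ioc j0 j1, IntervalIntegrable (fun x => if m' * ((j:ℝ) - β') ≤ x then f x else 0) volume a b ∧
      ∫ x in a..b, (if m' * ((j:ℝ) - β') ≤ x then f x else 0) = F b - F (m' * ((j:ℝ) - β')) := by
    intro j hj
    have := int_step f (fint a b) _ (hx j hj).1 (hx j hj).2
    refine ⟨this.1, this.2.trans ?_⟩
    exact integral_psi hm β _ _
  have stsum : IntervalIntegrable (fun x => ∑ j ∈ Ioc j0 j1, (if m' * ((j:ℝ) - β') ≤ x then f x else 0)) volume a b := by
    have := IntervalIntegrable.sum _ fun j hj => (st j hj).1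
    rwa [show (∑ j ∈ Ioc j0 j1, fun x : ℝ => if m' * ((j:ℝ) - β') ≤ x then f x else 0) =
      (fun x => ∑ j ∈ Ioc j0 j1, (if m' * ((j:ℝ) - β') ≤ x then f x else 0)) by ext s; simp] at this
  have Fl : ∫ x in a..b, (j0 * f x + ∑ j ∈ Ioc j0 j1, (if m' * ((j:ℝ) - β') ≤ x then f x else 0))
      = j1 * F b - j0 * F a - ∑ j ∈ Ioc j0 j1, F (m' * ((j:ℝ) - β')) := by
    rw [intervalIntegral.integral_add ((fint a b).const_mul _) stsum, intervalIntegral.integral_const_mul,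
      intervalIntegral.integral_finsetSum fun j hj => (st j hj).1, sum_congr rfl fun j hj => (st j hj).2,
      sum_sub_distrib, sum_const, Int.card_Ioc, nsmul_eq_mul, integral_psi hm β a b]
    have : (((j1 - j0).toNat : ℕ) : ℝ) = (j1:ℝ) - j0 := by
      have : (((j1 - j0).toNat : ℕ) : ℤ) = j1 - j0 := Int.toNat_of_nonneg (by omega)
      exact_mod_cast this
    rw [this]
    simp only [hF]
    ring
  have tot : ∫ x in a..b, psi (x / m + β) * psi (x / m' + β') =
      ∫ x in a..b, ((x / m' + β' - 1 / 2) * f x -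
        (j0 * f x + ∑ j ∈ Ioc j0 j1, (if m' * ((j:ℝ) - β') ≤ x then f x else 0))) := by
    apply intervalIntegral.integral_congr
    intro x hxab
    simp only
    rw [← fl x hxab, psi, Int.fract, hf]
    simp only [psi, Int.fract]
    ring
  rw [tot, intervalIntegral.integral_sub, L, Fl, intervalIntegral.integral_const_mul]
  · have e1 : ∫ x in a..b, F x = m * ∫ x in a..b, B2 (x / m + β) := by
      rw [← intervalIntegral.integral_const_mul]
    rw [e1]
    have e2 : ∀ j ∈ Ioc j0 j1, F (m' * ((j:ℝ) - β')) = m * B2 (m' * ((j:ℝ) - β') / m + β) := fun j _ => rfl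
    rw [sum_congr rfl e2]
    simp only [psi, Int.fract, ← hj0, ← hj1, hF]
    ring
  · exact (fint a b).continuousOn_mul (by fun_prop)
  · exact ((fint a b).const_mul _).add stsum

end RS

namespace RS
open Finset MeasureTheory

theorem bernoulli_two_eval (x : ℝ) : ((Polynomial.bernoulli 2).map (algebraMap ℚ ℝ)).eval x = x ^ 2 - x + 1 / 6 := by
  simp_rw [Polynomial.bernoulli, sum_range_succ, Polynomial.map_add, Polynomial.map_monomial, Polynomial.eval_add,
    Polynomial.eval_monomial]
  simp [_root_.bernoulli_two, _root_.bernoulli_one, Nat.choose]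
  ring

theorem B2_hasSum (t : ℝ) : HasSum (fun h : ℕ => 1 / (2 * Real.pi ^ 2) * (1 / (h:ℝ) ^ 2 * Real.cos (2 * Real.pi * h * t))) (B2 t) := by
  have h := hasSum_one_div_nat_pow_mul_cos (k := 1) one_ne_zero (x := Int.fract t)
    ⟨Int.fract_nonneg t, (Int.fract_lt_one t).le⟩
  rw [show 2 * 1 = 2 from rfl, bernoulli_two_eval] at h
  have h2 := h.mul_left (1 / (2 * Real.pi ^ 2))
  have hpi := Real.pi_pos.ne'
  convert! h2 using 1
  · ext n
    have : Real.cos (2 * Real.pi * n * t) = Real.cos (2 * Real.pi * n * Int.fract t) := by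
      rw [← Int.self_sub_floor, show 2 * Real.pi * n * (t - ⌊t⌋) = 2 * Real.pi * n * t - ((n * ⌊t⌋ : ℤ):ℝ) * (2 * Real.pi) by
        push_cast; ring, Real.cos_sub_int_mul_two_pi]
    rw [this]
  · rw [B2]
    norm_num [Nat.factorial]
    field_simp

theorem cos_tel (θ φ : ℝ) (j0 j1 : ℤ) (h : j0 ≤ j1) :
    (∑ j ∈ Ioc j0 j1, Real.cos (2 * j * θ + φ)) * (2 * Real.sin θ) =
      Real.sin ((2 * j1 + 1) * θ + φ) - Real.sin ((2 * j0 + 1) * θ + φ) := by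
  induction j1, h using Int.leInduction with
  | base => simp
  | succ n hn ih =>
    have : Ioc j0 (n+1) = insert (n+1) (Ioc j0 n) := by
      ext x; simp only [mem_insert, mem_Ioc]; omega
    rw [this, sum_insert (by simp), add_mul, ih]
    push_cast
    rw [show (2 * ((n:ℝ) + 1) + 1) * θ + φ = (2 * (n+1) * θ + φ) + θ by ring,
      show (2 * (n:ℝ) + 1) * θ + φ = (2 * (n+1) * θ + φ) - θ by ring]
    generalize 2 * ((n:ℝ)+1) * θ + φ = y
    rw [Real.sin_add y, Real.sin_sub y]
    ring

noncomputable def phim (J : ℝ) (m r : ℕ) : ℝ := if r = 0 then J else m / r + m / (m - r)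

theorem sin_lower (m N : ℕ) (hm : 0 < m) (hr : N % m ≠ 0) :
    1 ≤ |Real.sin (Real.pi * N / m)| * ((m:ℝ) / (N % m : ℕ) + m / (m - (N % m : ℕ))) := by
  set r := N % m with hrdef
  have hrm : r < m := Nat.mod_lt _ hm
  have hr0 : 0 < r := Nat.pos_of_ne_zero hr
  have hmR : (0:ℝ) < m := by exact_mod_cast hm
  have hrR : (0:ℝ) < r := by exact_mod_cast hr0
  have hrmR : (r:ℝ) < m := by exact_mod_cast hrm
  have e : |Real.sin (Real.pi * N / m)| = |Real.sin (Real.pi * r / m)| := by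
    have h1 : (N:ℝ) = r + m * (N / m : ℕ) := by exact_mod_cast (Nat.mod_add_div N m).symm
    have h2 : Real.pi * N / m = Real.pi * r / m + (N / m : ℕ) * Real.pi := by
      rw [h1]; field_simp
    rw [h2, Real.sin_add_nat_mul_pi, abs_mul, abs_pow]
    simp
  rw [e]
  have hp := Real.pi_pos
  have p1 : 0 < (m:ℝ) / r := by positivity
  have p2 : 0 < (m:ℝ) / (m - r) := div_pos hmR (by linarith)
  by_cases hc : 2 * (r:ℝ) ≤ m
  · have h := Real.mul_le_sin (x := Real.pi * r / m) (by positivity) (by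
      rw [div_le_div_iff₀ hmR two_pos]; nlinarith)
    have e2 : 2 / Real.pi * (Real.pi * r / m) = 2 * (r / m) := by field_simp
    rw [e2] at h
    have : 1 = ((r:ℝ)/m) * (m / r) := by field_simp
    have h0 : 0 < (r:ℝ)/m := by positivity
    have h3 := le_abs_self (Real.sin (Real.pi * r / m))
    nlinarith
  · have h := Real.mul_le_sin (x := Real.pi * (m - r) / m) (div_nonneg (mul_nonneg hp.le (by linarith)) hmR.le) (by
      rw [div_le_div_iff₀ hmR two_pos]; nlinarith)
    have e2 : 2 / Real.pi * (Real.pi * (m - r) / m) = 2 * ((m - r) / m) := by field_simp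
    rw [e2, show Real.pi * ((m:ℝ) - r) / m = Real.pi - Real.pi * r / m by field_simp, Real.sin_pi_sub] at h
    have hmr : (0:ℝ) < m - r := by linarith
    have : 1 = (((m:ℝ)-r)/m) * (m / (m - r)) := by field_simp
    have h0 : 0 < ((m:ℝ) - r)/m := by positivity
    have h3 := le_abs_self (Real.sin (Real.pi * r / m))
    nlinarith

theorem cos_sum_le (m N : ℕ) (hm : 0 < m) (φ J : ℝ) (j0 j1 : ℤ) (h : j0 ≤ j1) (hJ : (j1:ℝ) - j0 ≤ J) :
    |∑ j ∈ Ioc j0 j1, Real.cos (2 * j * (Real.pi * N / m) + φ)| ≤ phim J m (N % m) := by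
  unfold phim
  split_ifs with hr
  · refine (abs_sum_le_sum_abs _ _).trans ((sum_le_sum fun j _ => Real.abs_cos_le_one _).trans ?_)
    rw [sum_const, Int.card_Ioc, nsmul_eq_mul, mul_one]
    have : (((j1 - j0).toNat : ℕ) : ℤ) = j1 - j0 := Int.toNat_of_nonneg (by omega)
    have : (((j1 - j0).toNat : ℕ) : ℝ) = (j1:ℝ) - j0 := by exact_mod_cast this
    linarith
  · have h1 := cos_tel (Real.pi * N / m) φ j0 j1 h
    have h2 := sin_lower m N hm hr
    set S := ∑ j ∈ Ioc j0 j1, Real.cos (2 * j * (Real.pi * N / m) + φ)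
    have h3 : |S| * |Real.sin (Real.pi * N / m)| ≤ 1 := by
      have := congrArg abs h1
      rw [abs_mul, abs_mul, abs_two] at this
      have b1 := Real.abs_sin_le_one ((2 * j1 + 1) * (Real.pi * N / m) + φ)
      have b2 := Real.abs_sin_le_one ((2 * j0 + 1) * (Real.pi * N / m) + φ)
      have b3 := abs_sub (Real.sin ((2 * j1 + 1) * (Real.pi * N / m) + φ)) (Real.sin ((2 * j0 + 1) * (Real.pi * N / m) + φ))
      linarith
    have hrm : N % m < m := Nat.mod_lt _ hm
    have hpos : 0 ≤ ((m:ℝ) / (N % m : ℕ) + m / (m - (N % m : ℕ))) := by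
      have : ((N % m : ℕ):ℝ) < m := by exact_mod_cast hrm
      have : (0:ℝ) < m - (N % m : ℕ) := by linarith
      positivity
    calc |S| ≤ |S| * (|Real.sin (Real.pi * N / m)| * ((m:ℝ) / (N % m : ℕ) + m / (m - (N % m : ℕ)))) :=
          le_mul_of_one_le_right (abs_nonneg _) h2
      _ = (|S| * |Real.sin (Real.pi * N / m)|) * ((m:ℝ) / (N % m : ℕ) + m / (m - (N % m : ℕ))) := by ring
      _ ≤ 1 * _ := by gcongr
      _ = _ := one_mul _

theorem phim_le (J : ℝ) (hJ : 0 ≤ J) (m r : ℕ) (hr : r < m) : phim J m r ≤ J + 2 * m := by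
  unfold phim
  have hm0 : (0:ℝ) ≤ m := by positivity
  split_ifs with h
  · linarith
  · have h1 : (1:ℝ) ≤ r := by exact_mod_cast Nat.pos_of_ne_zero h
    have h2 : (1:ℝ) ≤ m - r := by
      have : (r:ℝ) + 1 ≤ m := by exact_mod_cast hr
      linarith
    have := div_le_self hm0 h1
    have := div_le_self hm0 h2
    linarith

theorem phim_nonneg (J : ℝ) (hJ : 0 ≤ J) (m r : ℕ) (hr : r < m) : 0 ≤ phim J m r := by
  unfold phim
  split_ifs with h
  · exact hJ
  · have : (r:ℝ) < m := by exact_mod_cast hr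
    have : (0:ℝ) < m - r := by linarith
    positivity

theorem phim_summable (J : ℝ) (hJ : 0 ≤ J) (m m' : ℕ) (hm : 0 < m) :
    Summable fun h : ℕ => 1 / (h:ℝ) ^ 2 * phim J m ((h * m') % m) := by
  refine Summable.of_nonneg_of_le (fun h => mul_nonneg (by positivity) (phim_nonneg J hJ _ _ (Nat.mod_lt _ hm)))
    (fun h => mul_le_mul_of_nonneg_left (phim_le J hJ m _ (Nat.mod_lt _ hm)) (by positivity)) ?_
  exact (Real.summable_one_div_nat_pow.2 (by norm_num)).mul_right _

theorem B2_sum_le (m m' : ℕ) (hm : 0 < m) (φ J : ℝ) (j0 j1 : ℤ) (h : j0 ≤ j1) (hJ : (j1:ℝ) - j0 ≤ J) :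
    |∑ j ∈ Ioc j0 j1, B2 (m' * j / m + φ)| ≤ ∑' h : ℕ, 1 / (h:ℝ) ^ 2 * phim J m ((h * m') % m) := by
  have hJ0 : 0 ≤ J := le_trans (by have : (j0:ℝ) ≤ j1 := by exact_mod_cast h
                                   linarith) hJ
  have hs := hasSum_sum (s := Ioc j0 j1) (fun j _ => B2_hasSum (m' * j / m + φ))
  rw [← hs.tsum_eq, ← Real.norm_eq_abs]
  refine (norm_tsum_le_tsum_norm hs.summable.norm).trans ?_
  refine hs.summable.norm.tsum_le_tsum (fun n => ?_) (phim_summable J hJ0 m m' hm)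
  rw [← mul_sum, ← mul_sum, Real.norm_eq_abs, abs_mul, abs_mul, abs_of_nonneg (by positivity : (0:ℝ) ≤ 1 / (n:ℝ)^2)]
  have e : ∑ j ∈ Ioc j0 j1, Real.cos (2 * Real.pi * n * (m' * j / m + φ)) =
      ∑ j ∈ Ioc j0 j1, Real.cos (2 * j * (Real.pi * (n * m' : ℕ) / m) + 2 * Real.pi * n * φ) := by
    refine sum_congr rfl fun j _ => ?_
    congr 1; push_cast; ring
  rw [e]
  have h1 := cos_sum_le m (n * m') hm (2 * Real.pi * n * φ) J j0 j1 h hJ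
  have h2 : |1 / (2 * Real.pi ^ 2)| ≤ 1 := by
    rw [abs_of_nonneg (by positivity), div_le_one (by positivity)]
    nlinarith [Real.pi_gt_three]
  calc |1 / (2 * Real.pi ^ 2)| * (1 / (n:ℝ)^2 * _) ≤ 1 * (1 / (n:ℝ)^2 * _) := by gcongr
    _ ≤ _ := by rw [one_mul]; gcongr

/-- correlation bound -/
theorem corr_le (m m' : ℕ) (hm : 0 < m) (hmm : m ≤ m') (β β' : ℝ) {a b V : ℝ} (hab : a ≤ b) (hV : b - a ≤ V) :
    |∫ x in a..b, psi (x / m + β) * psi (x / m' + β')| ≤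
      3 * m + m * ∑' h : ℕ, 1 / (h:ℝ) ^ 2 * phim (V / m + 1) m ((h * m') % m) := by
  have hmR : (0:ℝ) < m := by exact_mod_cast hm
  have hmmR : (m:ℝ) ≤ m' := by exact_mod_cast hmm
  have hmR' : (0:ℝ) < m' := by linarith
  rw [corr_eq hmR hmR' β β' hab, integral_B2 hmR]
  set j0 := ⌊a / m' + β'⌋
  set j1 := ⌊b / m' + β'⌋
  have hj : j0 ≤ j1 := Int.floor_mono (by gcongr)
  have hJ : (j1:ℝ) - j0 ≤ V / m + 1 := by
    have h1 : (j1:ℝ) ≤ b / m' + β' := Int.floor_le _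
    have h2 : a / m' + β' < j0 + 1 := Int.lt_floor_add_one _
    have h3 : b / m' - a / m' ≤ V / m := by
      rw [← sub_div]
      have : 0 ≤ b - a := by linarith
      calc (b - a) / m' ≤ (b-a) / m := by gcongr
        _ ≤ _ := by gcongr
    linarith
  have hS := B2_sum_le m m' hm (β - m' * β' / m) (V / m + 1) j0 j1 hj hJ
  have e : ∑ j ∈ Ioc j0 j1, (m:ℝ) * B2 (m' * ((j:ℝ) - β') / m + β) =
      m * ∑ j ∈ Ioc j0 j1, B2 (m' * j / m + (β - m' * β' / m)) := by
    rw [mul_sum]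
    refine sum_congr rfl fun j _ => ?_
    congr 2; ring
  rw [e]
  set S := ∑ j ∈ Ioc j0 j1, B2 (m' * j / m + (β - m' * β' / m))
  set R := ∑' h : ℕ, 1 / (h:ℝ) ^ 2 * phim (V / m + 1) m ((h * m') % m)
  have k1 : |B2 (b / m + β) * psi (b / m' + β')| ≤ 1 * (1/2) := by
    rw [abs_mul]; exact mul_le_mul (abs_B2_le _) (abs_psi_le _) (abs_nonneg _) zero_le_one
  have k2 : |B2 (a / m + β) * psi (a / m' + β')| ≤ 1 * (1/2) := by
    rw [abs_mul]; exact mul_le_mul (abs_B2_le _) (abs_psi_le _) (abs_nonneg _) zero_le_one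
  have k3 : |(m:ℝ) / m' * (B3 (b / m + β) - B3 (a / m + β))| ≤ 1 * 2 := by
    rw [abs_mul]
    refine mul_le_mul ?_ ?_ (abs_nonneg _) zero_le_one
    · rw [abs_of_nonneg (by positivity)]; exact div_le_one_of_le₀ hmmR hmR'.le
    · have := abs_sub (B3 (b / m + β)) (B3 (a / m + β))
      have := abs_B3_le (b / m + β)
      have := abs_B3_le (a / m + β)
      linarith
  have : |B2 (b / m + β) * psi (b / m' + β') - B2 (a / m + β) * psi (a / m' + β') + S
      - (m:ℝ) / m' * (B3 (b / m + β) - B3 (a / m + β))| ≤ 3 + R := by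
    rw [abs_le] at *
    constructor <;> linarith
  calc _ = |(m:ℝ) * (B2 (b / m + β) * psi (b / m' + β') - B2 (a / m + β) * psi (a / m' + β') + S
      - (m:ℝ) / m' * (B3 (b / m + β) - B3 (a / m + β)))| := by congr 1; ring
    _ = m * _ := by rw [abs_mul, abs_of_pos hmR]
    _ ≤ m * (3 + R) := by gcongr
    _ = _ := by ring

end RS

namespace RS
open Finset MeasureTheory

theorem fiber_card (h m n0 r : ℕ) (hm : 0 < m) :
    #{i ∈ range m | (h * (n0 + i)) % m = r} ≤ Nat.gcd m h := by
  have hg : 0 < Nat.gcd m h := Nat.gcd_pos_of_pos_left _ hm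
  set g := Nat.gcd m h with hgdef
  have hgm : g ∣ m := Nat.gcd_dvd_left _ _
  have hmg : 0 < m / g := Nat.div_pos (Nat.le_of_dvd hm hgm) hg
  rw [← card_range g]
  refine card_le_card_of_injOn (fun i => i / (m / g)) ?_ ?_
  · intro i hi
    simp only [coe_filter, Set.mem_setOf_eq, mem_range] at hi
    simp only [coe_range, Set.mem_Iio]
    rw [Nat.div_lt_iff_lt_mul hmg, Nat.mul_div_cancel' hgm]
    exact hi.1
  · intro i hi j hj hij
    simp only [coe_filter, Set.mem_setOf_eq, mem_range] at hi hj hij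
    have h1 : h * (n0 + i) ≡ h * (n0 + j) [MOD m] := hi.2.trans hj.2.symm
    have h2 := Nat.ModEq.cancel_left_div_gcd hm h1
    have h3 : i ≡ j [MOD m / g] := Nat.ModEq.add_left_cancel' n0 h2
    have h4 : i % (m / g) = j % (m / g) := h3
    rw [← Nat.div_add_mod i (m/g), ← Nat.div_add_mod j (m/g), hij, h4]

theorem fiber_sum (h m n0 : ℕ) (hm : 0 < m) (f : ℕ → ℝ) (hf : ∀ r < m, 0 ≤ f r) :
    ∑ i ∈ range m, f ((h * (n0 + i)) % m) ≤ Nat.gcd m h * ∑ r ∈ range m, f r := by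
  rw [← sum_fiberwise_of_maps_to (s := range m) (t := range m) (g := fun i => (h * (n0 + i)) % m)
    (fun i _ => mem_range.2 (Nat.mod_lt _ hm)), mul_sum]
  refine sum_le_sum fun r hr => ?_
  rw [sum_congr rfl (g := fun _ => f r) (fun i hi => by rw [(mem_filter.1 hi).2]), sum_const, nsmul_eq_mul]
  have := hf r (mem_range.1 hr)
  have := fiber_card h m n0 r hm
  gcongr

theorem phim_sum (J : ℝ) (m : ℕ) (hm : 0 < m) :
    ∑ r ∈ range m, phim J m r ≤ J + 2 * m * (1 + Real.log m) := by
  obtain ⟨n, rfl⟩ : ∃ n, m = n + 1 := ⟨m - 1, by omega⟩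
  rw [sum_range_succ']
  have e0 : phim J (n+1) 0 = J := by simp [phim]
  have e1 : ∀ i ∈ range n, phim J (n+1) (i+1) = ((n+1:ℕ):ℝ) * (1 / ((i+1:ℕ):ℝ)) + ((n+1:ℕ):ℝ) * (1 / ((n - 1 - i + 1:ℕ):ℝ)) := by
    intro i hi
    have hi := mem_range.1 hi
    have : ((n - 1 - i + 1 : ℕ):ℝ) = ((n+1:ℕ):ℝ) - ((i+1:ℕ):ℝ) := by
      rw [← Nat.cast_sub (by omega)]; congr 1; omega
    rw [this, phim, if_neg (by omega)]
    ring
  rw [e0, sum_congr rfl e1, sum_add_distrib, ← mul_sum, ← mul_sum,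
    sum_range_reflect (fun i => 1 / ((i+1:ℕ):ℝ))]
  have hh : ∑ i ∈ range n, 1 / ((i+1:ℕ):ℝ) ≤ 1 + Real.log ((n+1:ℕ):ℝ) := by
    have h1 := harmonic_le_one_add_log (n+1)
    have h2 : ((harmonic (n+1) : ℚ) : ℝ) = ∑ i ∈ range (n+1), 1 / ((i+1:ℕ):ℝ) := by
      simp [harmonic]
    rw [h2, sum_range_succ] at h1
    have : 0 ≤ 1 / ((n+1:ℕ):ℝ) := by positivity
    linarith
  have : (0:ℝ) ≤ ((n+1:ℕ):ℝ) := by positivity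
  nlinarith

theorem block_sum (h m K : ℕ) (hm : 0 < m) (hmK : m ≤ K) (J : ℝ) (hJ : 0 ≤ J) :
    ∑ m' ∈ Icc m K, phim J m ((h * m') % m) ≤ 2 * K / m * (Nat.gcd m h * (J + 2 * m * (1 + Real.log m))) := by
  have hmR : (0:ℝ) < m := by exact_mod_cast hm
  have nn : ∀ m', 0 ≤ phim J m ((h * m') % m) := fun m' => phim_nonneg J hJ m _ (Nat.mod_lt _ hm)
  set B := Nat.gcd m h * (J + 2 * m * (1 + Real.log m)) with hB
  have hB0 : 0 ≤ B := by
    have : 0 ≤ Real.log m := Real.log_natCast_nonneg m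
    positivity
  have hb : ∀ k : ℕ, ∑ m' ∈ range (m * k), phim J m ((h * m') % m) ≤ k * B := by
    intro k
    induction k with
    | zero => simp
    | succ k ih =>
      rw [mul_add, mul_one, sum_range_add]
      have := fiber_sum h m (m * k) hm (phim J m) (fun r hr => phim_nonneg J hJ m r hr)
      have h2 := phim_sum J m hm
      have : ∑ i ∈ range m, phim J m ((h * (m * k + i)) % m) ≤ B :=
        this.trans (mul_le_mul_of_nonneg_left h2 (by positivity))
      push_cast
      linarith
  have hsub : Icc m K ⊆ range (m * (K / m + 1)) := by
    intro x hx
    rw [mem_Icc] at hx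
    rw [mem_range]
    have := Nat.lt_mul_div_succ K hm
    omega
  refine (sum_le_sum_of_subset_of_nonneg hsub fun x _ _ => nn x).trans ((hb _).trans ?_)
  have : ((K / m + 1 : ℕ):ℝ) ≤ 2 * K / m := by
    have h1 : ((K / m : ℕ):ℝ) ≤ K / m := Nat.cast_div_le
    have h2 : (1:ℝ) ≤ K / m := by rw [le_div_iff₀ hmR, one_mul]; exact_mod_cast hmK
    push_cast
    rw [mul_div_assoc]; linarith
  gcongr

noncomputable def bd (V : ℝ) (m m' : ℕ) : ℝ :=
  3 * m + m * ∑' h : ℕ, 1 / (h:ℝ) ^ 2 * phim (V / m + 1) m ((h * m') % m)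

theorem bd_nonneg (V : ℝ) (hV : 0 ≤ V) (m m' : ℕ) (hm : 0 < m) : 0 ≤ bd V m m' := by
  have : 0 ≤ ∑' h : ℕ, 1 / (h:ℝ) ^ 2 * phim (V / m + 1) m ((h * m') % m) :=
    tsum_nonneg fun h => mul_nonneg (by positivity) (phim_nonneg _ (by positivity) _ _ (Nat.mod_lt _ hm))
  unfold bd; positivity

theorem bd_sum1 {ε : ℝ} (hε : 0 < ε) (hε1 : ε < 1) : ∃ C : ℝ, 0 ≤ C ∧ ∀ (V : ℝ) (m K : ℕ), 0 ≤ V → 0 < m → m ≤ K →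
    ∑ m' ∈ Icc m K, bd V m m' ≤ 3 * m * K + C * K * (m:ℝ) ^ ε * (V / m + 1 + 2 * m * (1 + Real.log m)) := by
  have hsum : Summable fun h : ℕ => 1 / (h:ℝ) ^ (1 + ε) := Real.summable_one_div_nat_rpow.2 (by linarith)
  refine ⟨2 * ∑' h : ℕ, 1 / (h:ℝ) ^ (1 + ε), by
    have : 0 ≤ ∑' h : ℕ, 1 / (h:ℝ) ^ (1 + ε) := tsum_nonneg fun h => by positivity
    positivity, fun V m K hV hm hmK => ?_⟩
  have hmR : (0:ℝ) < m := by exact_mod_cast hm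
  unfold bd
  rw [sum_add_distrib, sum_const, nsmul_eq_mul, ← mul_sum,
    ← Summable.tsum_finsetSum (fun m' _ => phim_summable _ (by positivity) m m' hm)]
  have hJ : 0 ≤ V / m + 1 := by positivity
  have hlog : 0 ≤ Real.log m := Real.log_natCast_nonneg m
  set L := V / m + 1 + 2 * m * (1 + Real.log m) with hL
  have hL0 : 0 ≤ L := by positivity
  have key : ∀ h : ℕ, ∑ m' ∈ Icc m K, 1 / (h:ℝ) ^ 2 * phim (V / m + 1) m ((h * m') % m) ≤
      1 / (h:ℝ) ^ (1 + ε) * (2 * K / m * (m:ℝ) ^ ε * L) := by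
    intro h
    rw [← mul_sum]
    rcases Nat.eq_zero_or_pos h with rfl | hh
    · simp; positivity
    have hhR : (0:ℝ) < h := by exact_mod_cast hh
    have h1 := block_sum h m K hm hmK (V / m + 1) hJ
    have h2 : (Nat.gcd m h : ℝ) ≤ (h:ℝ) ^ (1 - ε) * (m:ℝ) ^ ε := by
      have g1 : (Nat.gcd m h : ℝ) ≤ h := by exact_mod_cast Nat.gcd_le_right m hh
      have g2 : (Nat.gcd m h : ℝ) ≤ m := by exact_mod_cast Nat.gcd_le_left h hm
      have g0 : (0:ℝ) < Nat.gcd m h := by exact_mod_cast Nat.gcd_pos_of_pos_left _ hm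
      calc (Nat.gcd m h : ℝ) = (Nat.gcd m h : ℝ) ^ (1 - ε) * (Nat.gcd m h : ℝ) ^ ε := by
            rw [← Real.rpow_add g0]; simp
        _ ≤ _ := by
            have : 0 ≤ 1 - ε := by linarith
            gcongr
    have h3 : 1 / (h:ℝ) ^ 2 * (h:ℝ) ^ (1 - ε) = 1 / (h:ℝ) ^ (1 + ε) := by
      rw [one_div, one_div, ← Real.rpow_natCast, ← Real.rpow_neg hhR.le, ← Real.rpow_neg hhR.le, ← Real.rpow_add hhR]
      congr 1; push_cast; ring
    calc _ ≤ 1 / (h:ℝ) ^ 2 * (2 * K / m * (((h:ℝ) ^ (1 - ε) * (m:ℝ) ^ ε) * L)) := by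
          refine mul_le_mul_of_nonneg_left (h1.trans ?_) (by positivity)
          gcongr
      _ = (1 / (h:ℝ) ^ 2 * (h:ℝ) ^ (1 - ε)) * (2 * K / m * (m:ℝ) ^ ε * L) := by ring
      _ = _ := by rw [h3]
  have hsumL : Summable fun h : ℕ => ∑ m' ∈ Icc m K, 1 / (h:ℝ) ^ 2 * phim (V / m + 1) m ((h * m') % m) :=
    summable_sum fun m' _ => phim_summable _ hJ m m' hm
  have := hsumL.tsum_le_tsum key (hsum.mul_right _)
  rw [tsum_mul_right] at this
  have hc : ((#(Icc m K) : ℕ):ℝ) ≤ K := by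
    rw [Nat.card_Icc]; exact_mod_cast (by omega : K + 1 - m ≤ K)
  have h4 : (#(Icc m K) : ℝ) * (3 * m) ≤ 3 * m * K := by nlinarith
  have h5 := mul_le_mul_of_nonneg_left this hmR.le
  calc _ ≤ 3 * m * K + m * ((∑' h : ℕ, 1 / (h:ℝ) ^ (1 + ε)) * (2 * K / m * (m:ℝ) ^ ε * L)) := add_le_add h4 h5
    _ = _ := by field_simp

theorem one_add_log_le {ε : ℝ} (hε : 0 < ε) {x : ℝ} (hx : 1 ≤ x) : 1 + Real.log x ≤ (1 + 1 / ε) * x ^ ε := by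
  have h1 := Real.log_le_rpow_div (by linarith : 0 ≤ x) hε
  have h2 := Real.one_le_rpow hx hε.le
  rw [add_mul, one_mul, one_div_mul_eq_div]
  linarith

theorem bd_sum {ε : ℝ} (hε : 0 < ε) (hε1 : ε < 1) : ∃ C : ℝ, 0 ≤ C ∧ ∀ (V : ℝ) (K : ℕ), 0 ≤ V →
    ∑ m ∈ Ioc 0 K, ∑ m' ∈ Icc m K, bd V m m' ≤ C * (K:ℝ) ^ (1 + 2 * ε) * (V + (K:ℝ) ^ 2) := by
  obtain ⟨C, hC, h⟩ := bd_sum1 hε hε1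
  set D := 1 + 1 / ε with hD
  have hD1 : 1 ≤ D := by rw [hD]; have : 0 < 1 / ε := by positivity
                         linarith
  refine ⟨3 + C * (D + 1 + 2 * D), by positivity, fun V K hV => ?_⟩
  rcases Nat.eq_zero_or_pos K with rfl | hK
  · simp; positivity
  have hKR : (1:ℝ) ≤ K := by exact_mod_cast hK
  have hK0 : (0:ℝ) < K := by linarith
  set P := (K:ℝ) ^ ε with hP
  have hP1 : 1 ≤ P := Real.one_le_rpow hKR hε.le
  have hlogK : 1 + Real.log K ≤ D * P := one_add_log_le hε hKR
  have h1 : ∀ m ∈ Ioc 0 K, ∑ m' ∈ Icc m K, bd V m m' ≤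
      3 * K * K + (C * K * P * V) * (1 / m) + C * K * P * (1 + 2 * K * (D * P)) := by
    intro m hm
    rw [mem_Ioc] at hm
    refine (h V m K hV hm.1 hm.2).trans ?_
    have hm1 : (1:ℝ) ≤ m := by exact_mod_cast hm.1
    have hm2 : (m:ℝ) ≤ K := by exact_mod_cast hm.2
    have hl : Real.log m ≤ Real.log K := Real.log_le_log (by linarith) hm2
    have hl0 : 0 ≤ Real.log m := Real.log_nonneg hm1
    calc _ ≤ 3 * (K:ℝ) * K + C * K * P * (V / m + 1 + 2 * K * (D * P)) := by
          rw [hP]; gcongr; rw [← hP]; linarith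
      _ = _ := by ring
  refine (sum_le_sum h1).trans ?_
  rw [sum_add_distrib, sum_add_distrib, sum_const, sum_const, ← mul_sum, Nat.card_Ioc, nsmul_eq_mul, nsmul_eq_mul, Nat.sub_zero]
  have hh : ∑ i ∈ Ioc 0 K, 1 / (i:ℝ) ≤ D * P := by
    refine le_trans ?_ hlogK
    have h1 := harmonic_le_one_add_log K
    have h2 : ((harmonic K : ℚ) : ℝ) = ∑ i ∈ Ioc 0 K, 1 / (i:ℝ) := by
      rw [harmonic_eq_sum_Icc]; push_cast
      refine sum_congr (by ext; simp [Nat.lt_iff_add_one_le]) (by simp)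
    linarith
  have e : (K:ℝ) ^ (1 + 2 * ε) = K * P ^ 2 := by
    rw [Real.rpow_add hK0, Real.rpow_one, hP, ← Real.rpow_natCast, ← Real.rpow_mul hK0.le]
    congr 2; push_cast; ring
  rw [e]
  have hPP : P ≤ P ^ 2 := by nlinarith
  have a1 : K * (3 * (K:ℝ) * K) ≤ 3 * (K * P ^ 2) * (V + K ^ 2) := by
    have : (1:ℝ) ≤ P^2 := by nlinarith
    calc K * (3 * (K:ℝ) * K) = 3 * (K * 1) * (0 + K^2) := by ring
      _ ≤ _ := by gcongr
  have a2 : C * K * P * V * ∑ i ∈ Ioc 0 K, 1 / (i:ℝ) ≤ C * D * (K * P ^ 2) * (V + K ^ 2) := by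
    calc _ ≤ C * K * P * V * (D * P) := by gcongr
      _ = C * D * (K * P ^ 2) * (V + 0) := by ring
      _ ≤ _ := by gcongr; positivity
  have a3 : K * (C * K * P * (1 + 2 * K * (D * P))) ≤ C * (1 + 2 * D) * (K * P ^ 2) * (V + K ^ 2) := by
    have : 1 + 2 * K * (D * P) ≤ (1 + 2 * D) * (K * P) := by
      have : 1 ≤ K * P := by nlinarith
      nlinarith
    calc _ ≤ K * (C * K * P * ((1 + 2 * D) * (K * P))) := by gcongr
      _ = C * (1 + 2 * D) * (K * P ^ 2) * (0 + K ^ 2) := by ring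
      _ ≤ _ := by gcongr
  calc _ ≤ _ := add_le_add (add_le_add a1 a2) a3
    _ = _ := by ring

theorem L2_pair (k k' : ℕ) (hk : 0 < k) (hk' : 0 < k') (β β' τ τ' V : ℝ) (hV : 0 ≤ V) :
    IntervalIntegrable (fun x => (if τ ≤ x then psi (x / k + β) else 0) * (if τ' ≤ x then psi (x / k' + β') else 0)) volume V (2*V) ∧
    |∫ x in V..(2*V), (if τ ≤ x then psi (x / k + β) else 0) * (if τ' ≤ x then psi (x / k' + β') else 0)| ≤
      (if k ≤ k' then bd V k k' else 0) + (if k' ≤ k then bd V k' k else 0) := by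
  have hVV : V ≤ 2 * V := by linarith
  have pint : ∀ a b, IntervalIntegrable (fun x => psi (x / k + β) * psi (x / k' + β')) volume a b := by
    intro a b
    rw [intervalIntegrable_iff]
    refine Integrable.mono' (g := fun _ => (1/4:ℝ)) (by
      have := (intervalIntegrable_const (c := (1/4:ℝ)) (μ := volume) (a := a) (b := b))
      rwa [intervalIntegrable_iff] at this) ?_ ?_
    · exact ((psi_measurable.comp (by fun_prop)).mul (psi_measurable.comp (by fun_prop))).aestronglyMeasurable
    · refine Filter.Eventually.of_forall fun x => ?_
      rw [norm_mul]
      calc _ ≤ (1/2:ℝ) * (1/2) := mul_le_mul (abs_psi_le _) (abs_psi_le _) (abs_nonneg _) (by norm_num)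
        _ = _ := by norm_num
  set s := max V (max τ τ')
  have e : ∀ x ∈ Set.uIcc V (2*V), (if s ≤ x then psi (x / k + β) * psi (x / k' + β') else 0) =
    (if τ ≤ x then psi (x / k + β) else 0) * (if τ' ≤ x then psi (x / k' + β') else 0) := by
    intro x hx
    rw [Set.uIcc_of_le hVV] at hx
    have : s ≤ x ↔ τ ≤ x ∧ τ' ≤ x := by
      simp only [s, max_le_iff]; exact ⟨fun h => h.2, fun h => ⟨hx.1, h⟩⟩
    by_cases h1 : τ ≤ x <;> by_cases h2 : τ' ≤ x <;> simp [this, h1, h2]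
  have bnn : 0 ≤ (if k ≤ k' then bd V k k' else 0) + (if k' ≤ k then bd V k' k else 0) := by
    have := bd_nonneg V hV k k' hk
    have := bd_nonneg V hV k' k hk'
    split_ifs <;> linarith
  by_cases hs : s ≤ 2 * V
  · have := int_step _ (pint V (2*V)) s (le_max_left _ _) hs
    refine ⟨(intervalIntegrable_congr (fun x hx => e x (Set.uIoc_subset_uIcc hx))).1 this.1, ?_⟩
    rw [← intervalIntegral.integral_congr e, this.2]
    have hVs : V ≤ s := le_max_left _ _
    rcases le_total k k' with hkk | hkk
    · have h1 : _ ≤ bd V k k' := corr_le k k' hk hkk β β' hs (V := V) (by linarith)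
      have := bd_nonneg V hV k' k hk'
      rw [if_pos hkk]
      refine h1.trans ?_
      split_ifs <;> linarith
    · have h1 : _ ≤ bd V k' k := corr_le k' k hk' hkk β' β hs (V := V) (by linarith)
      have := bd_nonneg V hV k k' hk
      rw [if_pos hkk]
      simp_rw [mul_comm (psi (_ / (k:ℝ) + β))]
      refine h1.trans ?_
      split_ifs <;> linarith
  · have e0 : ∀ x ∈ Set.uIcc V (2*V), (if τ ≤ x then psi (x / k + β) else 0) * (if τ' ≤ x then psi (x / k' + β') else 0) = (0:ℝ) := by
      intro x hx
      rw [← e x hx, if_neg]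
      rw [Set.uIcc_of_le hVV] at hx
      intro h
      exact hs (h.trans hx.2)
    refine ⟨(intervalIntegrable_congr (fun x hx => e0 x (Set.uIoc_subset_uIcc hx))).2 (by simp), ?_⟩
    rw [intervalIntegral.integral_congr e0]
    simpa using bnn

theorem L2_bound {ε : ℝ} (hε : 0 < ε) (hε1 : ε < 1) : ∃ C : ℝ, 0 ≤ C ∧ ∀ (V : ℝ) (K : ℕ) (c β τ : ℕ → ℝ), 0 ≤ V →
    (∀ k, |c k| ≤ 1) →
    IntervalIntegrable (fun x => (∑ k ∈ Ioc 0 K, c k * (if τ k ≤ x then psi (x / k + β k) else 0)) ^ 2) volume V (2*V) ∧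
    ∫ x in V..(2*V), (∑ k ∈ Ioc 0 K, c k * (if τ k ≤ x then psi (x / k + β k) else 0)) ^ 2 ≤
      C * (K:ℝ) ^ (1 + 2 * ε) * (V + (K:ℝ) ^ 2) := by
  obtain ⟨C, hC, h⟩ := bd_sum hε hε1
  refine ⟨2 * C, by positivity, fun V K c β τ hV hc => ?_⟩
  have hB := h V K hV
  have hpair : ∀ k ∈ Ioc 0 K, ∀ k' ∈ Ioc 0 K, _ := fun k hk k' hk' =>
    L2_pair k k' (mem_Ioc.1 hk).1 (mem_Ioc.1 hk').1 (β k) (β k') (τ k) (τ k') V hV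
  have e : (fun x => (∑ k ∈ Ioc 0 K, c k * (if τ k ≤ x then psi (x / k + β k) else 0)) ^ 2) = fun x =>
      ∑ k ∈ Ioc 0 K, ∑ k' ∈ Ioc 0 K, (c k * c k') * ((if τ k ≤ x then psi (x / k + β k) else 0) *
        (if τ k' ≤ x then psi (x / k' + β k') else 0)) := by
    ext x
    rw [sq, sum_mul_sum]
    refine sum_congr rfl fun k _ => sum_congr rfl fun k' _ => by ring
  have i1 : ∀ k ∈ Ioc 0 K, ∀ k' ∈ Ioc 0 K, IntervalIntegrable (fun x => (c k * c k') * ((if τ k ≤ x then psi (x / k + β k) else 0) *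
        (if τ k' ≤ x then psi (x / k' + β k') else 0))) volume V (2*V) := fun k hk k' hk' =>
    (hpair k hk k' hk').1.const_mul _
  have i2 : ∀ k ∈ Ioc 0 K, IntervalIntegrable (fun x => ∑ k' ∈ Ioc 0 K, (c k * c k') * ((if τ k ≤ x then psi (x / k + β k) else 0) *
        (if τ k' ≤ x then psi (x / k' + β k') else 0))) volume V (2*V) := by
    intro k hk
    have := IntervalIntegrable.sum (Ioc 0 K) fun k' hk' => i1 k hk k' hk'
    convert! this using 1
    ext x; simp
  rw [e]
  constructor
  · have := IntervalIntegrable.sum (Ioc 0 K) i2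
    convert! this using 1
    ext x; simp
  rw [intervalIntegral.integral_finsetSum i2]
  calc _ ≤ ∑ k ∈ Ioc 0 K, ∑ k' ∈ Ioc 0 K, ((if k ≤ k' then bd V k k' else 0) + (if k' ≤ k then bd V k' k else 0)) := by
        refine sum_le_sum fun k hk => ?_
        rw [intervalIntegral.integral_finsetSum (i1 k hk)]
        refine sum_le_sum fun k' hk' => ?_
        rw [intervalIntegral.integral_const_mul]
        refine (le_abs_self _).trans ?_
        rw [abs_mul, abs_mul]
        refine le_trans ?_ (hpair k hk k' hk').2
        refine mul_le_of_le_one_left (abs_nonneg _) ?_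
        exact mul_le_one₀ (hc k) (abs_nonneg _) (hc k')
    _ = 2 * ∑ m ∈ Ioc 0 K, ∑ m' ∈ Icc m K, bd V m m' := by
        have e1 : ∀ k ∈ Ioc 0 K, ∑ k' ∈ Ioc 0 K, (if k ≤ k' then bd V k k' else 0) = ∑ m' ∈ Icc k K, bd V k m' := by
          intro k hk
          rw [← sum_filter]
          refine sum_congr ?_ fun _ _ => rfl
          ext x; simp only [mem_filter, mem_Ioc, mem_Icc] at hk ⊢; omega
        simp_rw [sum_add_distrib]
        rw [sum_comm (f := fun k k' => if k' ≤ k then bd V k' k else 0), sum_congr rfl e1]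
        ring
    _ ≤ 2 * (C * (K:ℝ) ^ (1 + 2 * ε) * (V + (K:ℝ) ^ 2)) := by gcongr
    _ = _ := by ring

end RS

namespace RS
open Finset MeasureTheory

namespace Setup
variable {a χ : ℕ → ℝ} {q : ℕ} {ρ c : ℝ}

theorem S_formula (h : Setup a χ q ρ c) (hz0 : ∀ j, ∑ m ∈ Ioc 0 (q * j), χ m = 0) {z : ℝ} (hz : 0 ≤ z) :
    ∑ d ∈ Ioc 0 ⌊z⌋₊, χ d = kap χ q - ∑ r ∈ Ioc 0 q, χ r * psi (z / q + (-(r:ℝ) / q)) := by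
  have hq := h.qpos
  have hqR : (0:ℝ) < q := by exact_mod_cast hq
  set y := ⌊z⌋₊ with hy
  set t := y / q with ht
  set s := y % q with hs
  have hsq : s < q := Nat.mod_lt _ hq
  have hyt : y = q * t + s := (Nat.div_add_mod y q).symm
  have hzy : (y:ℝ) ≤ z := Nat.floor_le hz
  have hzy2 : z < y + 1 := Nat.lt_floor_add_one z
  have hyR : (y:ℝ) = q * t + s := by exact_mod_cast hyt
  have e1 : ∑ d ∈ Ioc 0 y, χ d = ∑ r ∈ Ioc 0 q, χ r * (if r ≤ s then 1 else 0) := by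
    rw [hyt, sum_Ioc_add, hz0, zero_add]
    simp_rw [mul_ite, mul_one, mul_zero]
    rw [← sum_filter, sum_congr rfl fun m _ => h.per_mul m t]
    refine sum_congr ?_ fun _ _ => rfl
    ext r; simp only [mem_filter, mem_Ioc]; omega
  have e2 : ∀ r ∈ Ioc 0 q, χ r * psi (z / q + (-(r:ℝ) / q)) =
      χ r * (z / q - t + 1 / 2) - r * χ r / q - χ r * (if r ≤ s then 1 else 0) := by
    intro r hr
    rw [mem_Ioc] at hr
    have hr1 : (1:ℝ) ≤ r := by exact_mod_cast hr.1
    have hr2 : (r:ℝ) ≤ q := by exact_mod_cast hr.2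
    have hsR : (s:ℝ) + 1 ≤ q := by exact_mod_cast hsq
    have hfl : ⌊z / q + (-(r:ℝ) / q)⌋ = (t:ℤ) - 1 + (if r ≤ s then 1 else 0) := by
      rw [Int.floor_eq_iff, ← add_div, le_div_iff₀ hqR, div_lt_iff₀ hqR]
      split_ifs with hrs
      · have : (r:ℝ) ≤ s := by exact_mod_cast hrs
        push_cast
        constructor <;> nlinarith
      · have : (s:ℝ) + 1 ≤ r := by exact_mod_cast (by omega : s + 1 ≤ r)
        have : (0:ℝ) ≤ s := by positivity
        push_cast
        constructor <;> nlinarith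
    rw [psi, Int.fract, hfl]
    split_ifs <;> push_cast <;> ring
  rw [e1, sum_congr rfl e2, sum_sub_distrib, sum_sub_distrib, ← sum_mul, h.mean_zero, kap, ← sum_div]
  ring

theorem E_formula (h : Setup a χ q ρ c) (hz0 : ∀ j, ∑ m ∈ Ioc 0 (q * j), χ m = 0) (j : ℕ) (hj : 0 < j) {x : ℝ} (hx : 0 ≤ x) :
    EE a ρ x = -(∑ m ∈ Ioc 0 (q * j), χ m * psi (x / m))
      - ∑ r ∈ Ioc 0 q, χ r * ∑ n ∈ Ioc 0 ⌊x / (q * j : ℕ)⌋₊, psi (x / (n * q : ℕ) + (-(r:ℝ) / q))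
      + (x * (lam χ q j - ρ) - kap χ q * (x / (q * j : ℕ) - ⌊x / (q * j : ℕ)⌋₊) - bet χ q * (x / (2 * ((q * j : ℕ):ℝ)^2))) := by
  have hq := h.qpos
  have hqR : (0:ℝ) < q := by exact_mod_cast hq
  set M := q * j with hM
  have hM0 : 0 < M := Nat.mul_pos hq hj
  have hMR : (0:ℝ) < M := by exact_mod_cast hM0
  set N := ⌊x⌋₊ with hN
  have e1 : SA a x = ∑ d ∈ Ioc 0 N, ∑ k ∈ Ioc 0 (N / d), χ d := by
    rw [SA, ← sum_conv N (fun d _ => χ d)]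
    refine sum_congr rfl fun n hn => h.conv n (by have := (mem_Ioc.1 hn).1; omega)
  have e2 : ∀ d ∈ Ioc 0 M, ∑ k ∈ Ioc 0 (N / d), χ d = x * (χ d / d) - χ d * psi (x / d) - χ d / 2 := by
    intro d hd
    have hd0 : (0:ℝ) < d := by exact_mod_cast (mem_Ioc.1 hd).1
    have : ((N / d : ℕ):ℝ) = (⌊x / d⌋ : ℝ) := by
      rw [hN, ← Nat.floor_div_natCast]
      exact natCast_floor_eq_intCast_floor (by positivity)
    rw [sum_const, Nat.card_Ioc, nsmul_eq_mul, Nat.sub_zero, this, psi, Int.fract]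
    ring
  have e3 : ∀ k ∈ Ioc 0 (N / M), ∑ d ∈ Ioc 0 (N / k - M), χ (d + M) =
      kap χ q - ∑ r ∈ Ioc 0 q, χ r * psi (x / (k * q : ℕ) + (-(r:ℝ) / q)) := by
    intro k hk
    rw [mem_Ioc] at hk
    have hMk : M ≤ N / k := by
      rw [Nat.le_div_iff_mul_le hk.1, mul_comm, ← Nat.le_div_iff_mul_le hM0]; exact hk.2
    have h1 := sum_Ioc_add M (N / k - M) χ
    rw [hz0, zero_add, Nat.add_sub_cancel' hMk, hN, ← Nat.floor_div_natCast] at h1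
    rw [hN, ← Nat.floor_div_natCast, ← h1, h.S_formula hz0 (by positivity)]
    congr 1
    refine sum_congr rfl fun r _ => ?_
    rw [Nat.cast_mul, div_div]
  rw [EE, e1, sum_Ioc_hyper N M hM0, sum_congr rfl e2, sum_congr rfl e3, sum_sub_distrib, sum_sub_distrib, ← mul_sum,
    ← sum_div, hz0, sum_sub_distrib, sum_const, Nat.card_Ioc, Nat.sub_zero, nsmul_eq_mul, sum_comm, hN, ← Nat.floor_div_natCast, lam, ← hM]
  simp_rw [← mul_sum]
  generalize ∑ r ∈ Ioc 0 q, χ r * ∑ n ∈ Ioc 0 ⌊x / (M : ℕ)⌋₊, psi (x / (n * q : ℕ) + (-(r:ℝ) / q)) = s1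
  generalize ∑ m ∈ Ioc 0 M, χ m * psi (x / m) = s2
  generalize ∑ m ∈ Ioc 0 M, χ m / m = s3
  generalize (⌊x / (M : ℕ)⌋₊ : ℝ) = s4
  field_simp
  ring

set_option maxHeartbeats 1000000 in
theorem E_sq (h : Setup a χ q ρ c) (hz0 : ∀ j, ∑ m ∈ Ioc 0 (q * j), χ m = 0) {ε : ℝ} (hε : 0 < ε) (hε1 : ε < 1) :
    ∃ C : ℝ, 0 ≤ C ∧ ∀ V : ℝ, (q:ℝ) ^ 2 ≤ V →
      ∃ g : ℝ → ℝ, IntervalIntegrable g volume V (2 * V) ∧ (∀ x ∈ Set.Icc V (2 * V), EE a ρ x ^ 2 ≤ g x) ∧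
      ∫ x in V..(2*V), g x ≤ C * V ^ ((3:ℝ)/2 + ε) := by
  have hq := h.qpos
  have hqR : (0:ℝ) < q := by exact_mod_cast hq
  have hq1 : (1:ℝ) ≤ q := by exact_mod_cast hq
  obtain ⟨C1, hC1, hlam⟩ := h.lam_est
  obtain ⟨C2, hC2, hL⟩ := L2_bound hε hε1
  set C0 := 16 * C1 + |kap χ q| + 4 * |bet χ q| with hC0
  refine ⟨(q + 2) * (C2 * 2 + q * (C2 * (4 * q) ^ (1 + 2 * ε) * (1 + (4*q)^2)) + C0 ^ 2), by positivity, fun V hV => ?_⟩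
  have hV1 : 1 ≤ V := by nlinarith
  have hV0 : 0 < V := by linarith
  set w := Real.sqrt V with hw
  have hw2 : w ^ 2 = V := Real.sq_sqrt hV0.le
  have hqw : (q:ℝ) ≤ w := Real.le_sqrt_of_sq_le hV
  have hw1 : 1 ≤ w := by linarith
  set j := ⌊w / q⌋₊ with hj
  have hwq : 1 ≤ w / q := by rwa [le_div_iff₀ hqR, one_mul]
  have hj0 : 0 < j := Nat.floor_pos.2 hwq
  have hj1R : (1:ℝ) ≤ j := by exact_mod_cast hj0
  have hjle : (j:ℝ) ≤ w / q := Nat.floor_le (by positivity)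
  have hjge : w / q < j + 1 := Nat.lt_floor_add_one _
  set M := q * j with hM
  have hMle : (M:ℝ) ≤ w := by
    rw [hM]; push_cast; rw [le_div_iff₀ hqR] at hjle; linarith
  have hMge : w ≤ 2 * M := by
    rw [hM]; push_cast; rw [div_lt_iff₀ hqR] at hjge; nlinarith
  have hM0 : (0:ℝ) < M := by linarith
  set N2 := ⌊2 * V / M⌋₊ with hN2
  set K2 := q * N2 with hK2
  have hK2le : (K2:ℝ) ≤ 4 * q * w := by
    have h1 : (N2:ℝ) ≤ 2 * V / M := Nat.floor_le (by positivity)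
    have h2 : 2 * V / M ≤ 4 * w := by
      rw [div_le_iff₀ hM0, ← hw2]; nlinarith
    rw [hK2]; push_cast; nlinarith
  -- the two types of sums
  set f1 : ℝ → ℝ := fun x => ∑ k ∈ Ioc 0 M, χ k * (if (0:ℝ) ≤ x then psi (x / k + 0) else 0) with hf1
  set f2 : ℕ → ℝ → ℝ := fun r x => ∑ k ∈ Ioc 0 K2, (if q ∣ k then 1 else 0) *
    (if ((k / q : ℕ):ℝ) * M ≤ x then psi (x / k + (-(r:ℝ)/q)) else 0) with hf2
  have L1 := hL V M χ (fun _ => 0) (fun _ => 0) hV0.le h.bdd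
  have L2 := fun r : ℕ => hL V K2 (fun k => if q ∣ k then 1 else 0) (fun _ => -(r:ℝ)/q) (fun k => ((k / q : ℕ):ℝ) * M) hV0.le
    (fun k => by split_ifs <;> simp)
  refine ⟨fun x => (q + 2) * (f1 x ^ 2 + ∑ r ∈ Ioc 0 q, f2 r x ^ 2 + C0 ^ 2), ?_, ?_, ?_⟩
  · refine IntervalIntegrable.const_mul ((L1.1.add ?_).add (by simp)) _
    have := IntervalIntegrable.sum (Ioc 0 q) fun r _ => (L2 r).1
    convert! this using 1
    ext x; simp [hf2]
  · intro x hx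
    have hx0 : 0 ≤ x := by linarith [hx.1]
    have hE := h.E_formula hz0 j hj0 hx0
    have g1 : ∑ m ∈ Ioc 0 (q * j), χ m * psi (x / m) = f1 x := by
      rw [hf1]; simp [hx0, hM]
    have g2 : ∀ r : ℕ, ∑ n ∈ Ioc 0 ⌊x / (q * j : ℕ)⌋₊, psi (x / (n * q : ℕ) + (-(r:ℝ) / q)) = f2 r x := by
      intro r
      rw [hf2]
      simp only
      have : ∀ k, ((if q ∣ k then (1:ℝ) else 0) * (if ((k / q : ℕ):ℝ) * M ≤ x then psi (x / k + (-(r:ℝ)/q)) else 0)) =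
        if (q ∣ k ∧ ((k / q : ℕ):ℝ) * M ≤ x) then psi (x / k + (-(r:ℝ)/q)) else 0 := by
        intro k; by_cases h1 : q ∣ k <;> simp [h1]
      simp_rw [this]
      rw [← sum_filter]
      have key : ∀ n : ℕ, n ≤ ⌊x / (M : ℕ)⌋₊ ↔ (n:ℝ) * M ≤ x := by
        intro n
        rw [Nat.le_floor_iff (by positivity), le_div_iff₀ hM0]
      refine sum_bij (fun n _ => n * q) ?_ ?_ ?_ ?_
      · intro n hn
        rw [mem_Ioc] at hn
        have h1 := (key n).1 hn.2
        rw [mem_filter, mem_Ioc, Nat.mul_div_cancel _ hq]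
        refine ⟨⟨Nat.mul_pos hn.1 hq, ?_⟩, dvd_mul_left _ _, h1⟩
        rw [hK2, mul_comm]
        refine Nat.mul_le_mul_left _ (hn.2.trans (Nat.floor_mono ?_))
        have := hx.2
        gcongr
      · intro n _ n' _ hnn
        exact Nat.eq_of_mul_eq_mul_right hq hnn
      · intro k hk
        rw [mem_filter, mem_Ioc] at hk
        refine ⟨k / q, ?_, Nat.div_mul_cancel hk.2.1⟩
        rw [mem_Ioc]
        exact ⟨Nat.div_pos (Nat.le_of_dvd hk.1.1 hk.2.1) hq, (key _).2 hk.2.2⟩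
      · intro n _; rfl
    simp_rw [g1, g2] at hE
    set b := (x * (lam χ q j - ρ) - kap χ q * (x / (q * j : ℕ) - ⌊x / (q * j : ℕ)⌋₊) - bet χ q * (x / (2 * ((q * j : ℕ):ℝ)^2))) with hb
    have hbC : |b| ≤ C0 := by
      have hM2 : (0:ℝ) < M ^ 2 := by positivity
      have hVM : V ≤ 4 * M ^ 2 := by rw [← hw2]; nlinarith
      have hx2 := hx.2
      have t1 : |x * (lam χ q j - ρ)| ≤ 16 * C1 := by
        rw [abs_mul, abs_of_nonneg hx0]
        have hM1 : (1:ℝ) ≤ M := by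
          have : 0 < M := by exact_mod_cast hM0
          exact_mod_cast this
        calc x * |lam χ q j - ρ| ≤ (2 * (4 * M ^ 2)) * (C1 / (M:ℝ)^3) := by
              gcongr
              · linarith
              · exact hlam j hj0
          _ = 8 * C1 / M := by field_simp; ring
          _ ≤ 8 * C1 := div_le_self (by positivity) hM1
          _ ≤ _ := by linarith
      have t2 : |kap χ q * (x / (q * j : ℕ) - ⌊x / (q * j : ℕ)⌋₊)| ≤ |kap χ q| := by
        rw [abs_mul]
        refine mul_le_of_le_one_right (abs_nonneg _) ?_
        have h1 := Nat.floor_le (a := x / (q * j : ℕ)) (by positivity)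
        have h2 := Nat.lt_floor_add_one (x / (q * j : ℕ))
        rw [abs_le]; constructor <;> linarith
      have t3 : |bet χ q * (x / (2 * ((q * j : ℕ):ℝ)^2))| ≤ 4 * |bet χ q| := by
        rw [abs_mul, abs_of_nonneg (by positivity : 0 ≤ x / (2 * ((q * j : ℕ):ℝ)^2)), mul_comm]
        refine mul_le_mul_of_nonneg_right ?_ (abs_nonneg _)
        rw [← hM, div_le_iff₀ (by positivity)]
        linarith
      rw [hb, hC0]
      rw [abs_le] at *
      constructor <;> linarith
    have hb2 : b ^ 2 ≤ C0 ^ 2 := by rw [← sq_abs b]; gcongr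
    rw [hE]
    -- Cauchy for three parts
    set T := ∑ r ∈ Ioc 0 q, χ r * f2 r x with hT
    have hT2 : T ^ 2 ≤ q * ∑ r ∈ Ioc 0 q, f2 r x ^ 2 := by
      have := sq_sum_le_card_mul_sum_sq (s := Ioc 0 q) (f := fun r => χ r * f2 r x)
      rw [Nat.card_Ioc, Nat.sub_zero] at this
      refine this.trans (mul_le_mul_of_nonneg_left (sum_le_sum fun r _ => ?_) hqR.le)
      rw [mul_pow]
      refine mul_le_of_le_one_left (sq_nonneg _) ?_
      rw [← sq_abs]; exact pow_le_one₀ (abs_nonneg _) (h.bdd r)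
    set U := ∑ r ∈ Ioc 0 q, f2 r x ^ 2
    have hU : 0 ≤ U := sum_nonneg fun r _ => sq_nonneg _
    -- (A + T + b)^2 ≤ (1+1+q)(A^2 + T^2/q + b^2)
    have hTq : T ^ 2 / q ≤ U := by rw [div_le_iff₀ hqR]; linarith
    have cs : (-f1 x - T + b) ^ 2 ≤ (q + 2) * (f1 x ^ 2 + T ^ 2 / q + b ^ 2) := by
      set A := f1 x
      have e : (q + 2) * (A ^ 2 + T ^ 2 / q + b ^ 2) - (-A - T + b) ^ 2 = (q * A - T) ^ 2 / q + (q * b + T) ^ 2 / q + (A + b) ^ 2 := by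
        field_simp; ring
      have : 0 ≤ (q * A - T) ^ 2 / q + (q * b + T) ^ 2 / q + (A + b) ^ 2 := by positivity
      linarith
    refine cs.trans ?_
    show _ ≤ (q + 2) * (f1 x ^ 2 + U + C0 ^ 2)
    gcongr
  · have i2 : IntervalIntegrable (fun x => ∑ r ∈ Ioc 0 q, f2 r x ^ 2) volume V (2*V) := by
      have := IntervalIntegrable.sum (Ioc 0 q) fun r _ => (L2 r).1
      convert! this using 1
      ext x; simp [hf2]
    rw [intervalIntegral.integral_const_mul, intervalIntegral.integral_add (L1.1.add i2) (by simp),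
      intervalIntegral.integral_add L1.1 i2, intervalIntegral.integral_finsetSum fun r _ => (L2 r).1,
      intervalIntegral.integral_const]
    have hwV : w = V ^ ((1:ℝ)/2) := Real.sqrt_eq_rpow V
    have hp : w ^ (1 + 2 * ε) * V = V ^ ((3:ℝ)/2 + ε) := by
      rw [hwV, ← Real.rpow_mul hV0.le]
      nth_rw 2 [← Real.rpow_one V]
      rw [← Real.rpow_add hV0]; congr 1; ring
    set P := V ^ ((3:ℝ)/2 + ε) with hP
    have q1 : ∫ x in V..(2*V), f1 x ^ 2 ≤ C2 * 2 * P := by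
      refine L1.2.trans ?_
      calc _ ≤ C2 * w ^ (1 + 2 * ε) * (V + w ^ 2) := by gcongr
        _ = C2 * 2 * (w ^ (1 + 2 * ε) * V) := by rw [hw2]; ring
        _ = _ := by rw [hp]
    have q2 : ∀ r ∈ Ioc 0 q, ∫ x in V..(2*V), f2 r x ^ 2 ≤ C2 * (4 * q) ^ (1 + 2 * ε) * (1 + (4*q)^2) * P := by
      intro r _
      refine (L2 r).2.trans ?_
      calc _ ≤ C2 * (4 * q * w) ^ (1 + 2 * ε) * (V + (4 * q * w) ^ 2) := by gcongr
        _ = C2 * (4 * q) ^ (1 + 2 * ε) * (1 + (4*q)^2) * (w ^ (1 + 2 * ε) * V) := by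
          rw [Real.mul_rpow (by positivity) (by positivity), mul_pow, hw2]; ring
        _ = _ := by rw [hp]
    have q3 : (2 * V - V) • C0 ^ 2 ≤ C0 ^ 2 * P := by
      have : V ≤ P := by
        nth_rw 1 [← Real.rpow_one V]
        rw [hP]
        exact Real.rpow_le_rpow_of_exponent_le hV1 (by linarith)
      rw [smul_eq_mul, mul_comm, show 2 * V - V = V by ring]
      gcongr
    have q4 := sum_le_sum q2
    rw [sum_const, Nat.card_Ioc, Nat.sub_zero, nsmul_eq_mul] at q4
    calc _ ≤ (q + 2) * (C2 * 2 * P + q * (C2 * (4 * q) ^ (1 + 2 * ε) * (1 + (4*q)^2) * P) + C0 ^ 2 * P) := by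
          gcongr
      _ = _ := by ring

end Setup

end RS

namespace RS
open Finset MeasureTheory

namespace Setup
variable {a χ : ℕ → ℝ} {q : ℕ} {ρ c : ℝ}

theorem E_dyad (h : Setup a χ q ρ c) {ε : ℝ} (hε : 0 < ε) (hε1 : ε < 1) :
    ∃ C : ℝ, 0 ≤ C ∧ ∀ V : ℝ, 1 ≤ V → ∫ x in V..(2*V), |EE a ρ x| ≤ C * V ^ ((5:ℝ)/4 + ε) := by
  obtain ⟨C, hC, hE⟩ := h.E_sq h.sum_zero_mul hε hε1
  have hc := h.cpos
  refine ⟨C + 1 + 2 * c * q ^ 2, by positivity, fun V hV => ?_⟩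
  have hV0 : 0 < V := by linarith
  have hVV : V ≤ 2 * V := by linarith
  have hEi : IntervalIntegrable (EE a ρ) volume V (2*V) := EE_intervalIntegrable a ρ hV (by linarith)
  set P := V ^ ((5:ℝ)/4 + ε) with hP
  have hP0 : 0 < P := by positivity
  have hVP : ∀ s : ℝ, s ≤ 5/4 → V ^ s ≤ P := fun s hs =>
    Real.rpow_le_rpow_of_exponent_le hV (by linarith)
  by_cases hq : (q:ℝ) ^ 2 ≤ V
  · obtain ⟨g, hg, hEg, hgi⟩ := hE V hq
    set l := V ^ (-(1:ℝ)/4) with hl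
    set m := V ^ ((1:ℝ)/4) with hm
    have hlm : l * m = 1 := by rw [hl, hm, ← Real.rpow_add hV0]; norm_num
    have hl0 : 0 < l := by positivity
    have hm0 : 0 < m := by positivity
    calc _ ≤ ∫ x in V..(2*V), (l * g x + m) := by
          refine intervalIntegral.integral_mono_on hVV hEi.abs ((hg.const_mul _).add (by simp)) fun x hx => ?_
          have h1 := hEg x hx
          have h2 : |EE a ρ x| ≤ l * EE a ρ x ^ 2 + m := by
            rw [← sq_abs]
            set e := |EE a ρ x|
            have he : 0 ≤ e := abs_nonneg _
            have h3 : 0 ≤ l * (e - m/2) ^ 2 := by positivity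
            have : l * (e - m/2) ^ 2 = l * e ^ 2 - (l * m) * e + (l * m) * m / 4 := by ring
            rw [this, hlm] at h3
            linarith
          have := mul_le_mul_of_nonneg_left h1 hl0.le
          linarith
      _ = l * (∫ x in V..(2*V), g x) + V * m := by
          rw [intervalIntegral.integral_add (hg.const_mul _) (by simp), intervalIntegral.integral_const_mul,
            intervalIntegral.integral_const, smul_eq_mul]
          ring
      _ ≤ l * (C * V ^ ((3:ℝ)/2 + ε)) + P := by
          gcongr
          have : V * m = V ^ ((5:ℝ)/4) := by
            rw [hm]; nth_rw 1 [← Real.rpow_one V]; rw [← Real.rpow_add hV0]; norm_num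
          rw [this]
          exact hVP _ le_rfl
      _ = C * P + P := by
          congr 1
          rw [mul_left_comm, hl, ← Real.rpow_add hV0, hP]; congr 2; ring
      _ ≤ _ := by
          have : 0 ≤ 2 * c * q ^ 2 * P := by positivity
          nlinarith
  · push Not at hq
    calc _ ≤ ∫ x in V..(2*V), (c * (2 * V)) := by
          refine intervalIntegral.integral_mono_on hVV hEi.abs (by simp) fun x hx => ?_
          refine (h.E_le (by linarith [hx.1])).trans ?_
          gcongr
          calc x ^ ((1:ℝ)/3) ≤ x ^ (1:ℝ) := Real.rpow_le_rpow_of_exponent_le (by linarith [hx.1]) (by norm_num)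
            _ = x := Real.rpow_one x
            _ ≤ _ := hx.2
      _ = 2 * c * V * V ^ (1:ℝ) := by
          rw [intervalIntegral.integral_const, smul_eq_mul, Real.rpow_one]; ring
      _ ≤ 2 * c * q ^ 2 * P := by
          gcongr; exact hVP _ (by norm_num)
      _ ≤ _ := by nlinarith

theorem E_mean (h : Setup a χ q ρ c) {ε : ℝ} (hε : 0 < ε) (hε1 : ε < 1) :
    ∃ C : ℝ, 0 ≤ C ∧ ∀ z : ℝ, 1 ≤ z → ∫ x in (1:ℝ)..z, |EE a ρ x| * x ^ (-(5:ℝ)/4) ≤ C * z ^ ε := by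
  obtain ⟨C, hC, hE⟩ := h.E_dyad hε hε1
  have hc := h.cpos
  have h2 : (1:ℝ) < 2 ^ ε := Real.one_lt_rpow (by norm_num) hε
  set C' := 2 * c + C / (2 ^ ε - 1) with hC'
  have hd : 0 < (2:ℝ) ^ ε - 1 := by linarith
  have hC'0 : 0 ≤ C' := by positivity
  have fi : ∀ u v : ℝ, 1 ≤ u → 1 ≤ v → IntervalIntegrable (fun x => |EE a ρ x| * x ^ (-(5:ℝ)/4)) volume u v := by
    intro u v hu hv
    refine (EE_intervalIntegrable a ρ hu hv).abs.mul_continuousOn ?_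
    intro x hx
    have : 0 < x := by
      have := hx.1
      have : 1 ≤ min u v := le_min hu hv
      linarith
    exact (Real.continuousAt_rpow_const _ _ (Or.inl this.ne')).continuousWithinAt
  have main : ∀ n : ℕ, ∀ z : ℝ, 1 ≤ z → z ≤ 2 ^ (n+1) → ∫ x in (1:ℝ)..z, |EE a ρ x| * x ^ (-(5:ℝ)/4) ≤ C' * z ^ ε := by
    intro n
    induction n with
    | zero =>
      intro z hz hz2
      have : ∫ x in (1:ℝ)..z, |EE a ρ x| * x ^ (-(5:ℝ)/4) ≤ ∫ x in (1:ℝ)..z, 2 * c := by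
        refine intervalIntegral.integral_mono_on hz (fi _ _ le_rfl hz) (by simp) fun x hx => ?_
        have h1 : |EE a ρ x| ≤ 2 * c := by
          refine (h.E_le hx.1).trans ?_
          have : x ^ ((1:ℝ)/3) ≤ 2 := by
            calc x ^ ((1:ℝ)/3) ≤ x ^ (1:ℝ) := Real.rpow_le_rpow_of_exponent_le hx.1 (by norm_num)
              _ = x := Real.rpow_one x
              _ ≤ _ := by have := hx.2; norm_num at hz2; linarith
          nlinarith
        have h3 : x ^ (-(5:ℝ)/4) ≤ 1 := Real.rpow_le_one_of_one_le_of_nonpos hx.1 (by norm_num)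
        calc _ ≤ (2 * c) * 1 := by
              have : 0 ≤ x ^ (-(5:ℝ)/4) := Real.rpow_nonneg (by linarith [hx.1]) _
              gcongr
          _ = _ := mul_one _
      rw [intervalIntegral.integral_const, smul_eq_mul] at this
      have hz3 : 1 ≤ z ^ ε := Real.one_le_rpow hz hε.le
      norm_num at hz2
      have h5 : 2 * c ≤ C' := by have : 0 ≤ C / (2 ^ ε - 1) := by positivity
                                 linarith
      nlinarith
    | succ n ih =>
      intro z hz hz2
      by_cases hz3 : z ≤ 2
      · refine ih z hz (hz3.trans ?_)
        have : (1:ℝ) ≤ 2 ^ n := one_le_pow₀ (by norm_num)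
        rw [pow_succ]; linarith
      push Not at hz3
      have hV : 1 ≤ z / 2 := by linarith
      have e : 2 * (z / 2) = z := by ring
      have i1 := ih (z/2) hV (by rw [pow_succ] at hz2; linarith)
      have i2 := hE (z/2) hV
      set V := z / 2 with hVd
      have hV0 : 0 < V := by linarith
      rw [← e] at *
      rw [← intervalIntegral.integral_add_adjacent_intervals (fi 1 V le_rfl hV) (fi V (2*V) hV (by linarith))]
      have i3 : ∫ x in V..(2*V), |EE a ρ x| * x ^ (-(5:ℝ)/4) ≤ C * V ^ ε := by
        calc _ ≤ ∫ x in V..(2*V), |EE a ρ x| * V ^ (-(5:ℝ)/4) := by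
              refine intervalIntegral.integral_mono_on (by linarith) (fi _ _ hV (by linarith))
                ((EE_intervalIntegrable a ρ hV (by linarith)).abs.mul_const _) fun x hx => ?_
              have : x ^ (-(5:ℝ)/4) ≤ V ^ (-(5:ℝ)/4) := Real.rpow_le_rpow_of_nonpos hV0 hx.1 (by norm_num)
              gcongr
          _ = (∫ x in V..(2*V), |EE a ρ x|) * V ^ (-(5:ℝ)/4) := intervalIntegral.integral_mul_const _ _
          _ ≤ C * V ^ ((5:ℝ)/4 + ε) * V ^ (-(5:ℝ)/4) := by gcongr
          _ = _ := by rw [mul_assoc, ← Real.rpow_add hV0]; congr 2; ring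
      rw [Real.mul_rpow (by norm_num) hV0.le]
      have hVe : 0 < V ^ ε := by positivity
      have : C' + C ≤ C' * 2 ^ ε := by
        have : C / (2 ^ ε - 1) * (2 ^ ε - 1) = C := by field_simp
        have h6 : C ≤ C' * (2 ^ ε - 1) := by
          rw [hC', add_mul, this]
          have : 0 ≤ 2 * c * (2 ^ ε - 1) := by positivity
          linarith
        linarith
      nlinarith
  refine ⟨C', hC'0, fun z hz => ?_⟩
  obtain ⟨n, hn⟩ := pow_unbounded_of_one_lt z (by norm_num : (1:ℝ) < 2)
  refine main n z hz (hn.le.trans ?_)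
  rw [pow_succ]; have : (0:ℝ) < 2 ^ n := by positivity
  linarith

end Setup

end RS

namespace RS
open Finset MeasureTheory

namespace Setup
variable {a χ : ℕ → ℝ} {q : ℕ} {ρ c : ℝ}

theorem SA_le (h : Setup a χ q ρ c) {x : ℝ} (hx : 1 ≤ x) : SA a x ≤ (c + |ρ|) * x := by
  have h1 := h.E_le hx
  have h2 : x ^ ((1:ℝ)/3) ≤ x := by
    conv_rhs => rw [← Real.rpow_one x]
    exact Real.rpow_le_rpow_of_exponent_le hx (by norm_num)
  have h3 := mul_le_mul_of_nonneg_left h2 h.cpos.le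
  have h4 := mul_le_mul_of_nonneg_right (le_abs_self ρ) (by linarith : 0 ≤ x)
  have := (abs_le.1 h1).2
  rw [EE] at this
  nlinarith

theorem summable (h : Setup a χ q ρ c) {s : ℝ} (hs : 1 < s) :
    Summable fun n : ℕ => a n * (n:ℝ) ^ (-s) := by
  have h1 : LSeriesSummable (fun n => (a n : ℂ)) (s:ℂ) := by
    refine LSeriesSummable_of_sum_norm_bigO_and_nonneg (r := 1) ?_ h.nonneg zero_le_one
      (by simpa using hs)
    refine Asymptotics.IsBigO.of_bound (c + |ρ|) ?_
    filter_upwards [Filter.eventually_ge_atTop 1] with n hn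
    have := h.SA_le (x := n) (by exact_mod_cast hn)
    rw [SA, Nat.floor_natCast] at this
    have e : Icc 1 n = Ioc 0 n := by ext; simp [Nat.succ_le_iff]
    rw [e, Real.norm_of_nonneg (sum_nonneg fun i _ => h.nonneg i), Real.rpow_one,
      Real.norm_of_nonneg (by positivity)]
    exact this
  have h2 := h1.norm
  refine h2.congr fun n => ?_
  rw [LSeries.norm_term_eq]
  split_ifs with hn
  · simp [hn, h.zero]
  · simp only [Complex.norm_real, Complex.ofReal_re, Real.norm_of_nonneg (h.nonneg n)]
    rw [Real.rpow_neg (by positivity), div_eq_mul_inv]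

end Setup

theorem tendsto_partial (f : ℕ → ℝ) (h0 : f 0 = 0) (hs : Summable f) :
    Filter.Tendsto (fun T : ℝ => ∑ n ∈ Ioc 0 ⌊T⌋₊, f n) Filter.atTop (nhds (∑' n, f n)) := by
  have h1 := hs.hasSum.tendsto_sum_nat
  have h2 : Filter.Tendsto (fun T : ℝ => ⌊T⌋₊ + 1) Filter.atTop Filter.atTop :=
    (Filter.tendsto_add_atTop_nat 1).comp tendsto_nat_floor_atTop
  refine (h1.comp h2).congr fun T => ?_
  simp only [Function.comp]
  symm
  refine sum_subset (fun n hn => ?_) (fun n hn hn' => ?_)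
  · simp only [mem_Ioc, mem_range] at *; omega
  · have : n = 0 := by simp only [mem_Ioc, mem_range] at *; omega
    rw [this, h0]

namespace Setup
variable {a χ : ℕ → ℝ} {q : ℕ} {ρ c : ℝ}

theorem finite_formula (h : Setup a χ q ρ c) (γ : ℝ) {s T : ℝ} (hs : 1 < s) (hT : 1 ≤ T) :
    ∑ n ∈ Ioc 0 ⌊T⌋₊, a n * (n:ℝ) ^ (-s) =
      T ^ (-s) * SA a T + (ρ * s / (s - 1)) * (1 - T ^ (1 - s)) + γ * (1 - T ^ (-s))
      + s * (T ^ (-s - 1) * D1 a ρ γ T) + s * (s + 1) * (T ^ (-s - 2) * D2 a ρ γ T)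
      + s * (s + 1) * (s + 2) * ∫ t in (1:ℝ)..T, t ^ (-s - 3) * D2 a ρ γ t := by
  have hT0 : 0 < T := by linarith
  have hpos : ∀ n ∈ Ioc 0 ⌊T⌋₊, (0:ℝ) < n ∧ (n:ℝ) ≤ T := fun n hn => by
    rw [mem_Ioc] at hn
    exact ⟨by exact_mod_cast hn.1, (Nat.le_floor_iff hT0.le).1 hn.2⟩
  have h01 : ∀ u v : ℝ, 1 ≤ u → 1 ≤ v → (0:ℝ) ∉ Set.uIcc u v := fun u v hu hv hh => by
    have := le_trans (le_min hu hv) hh.1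
    linarith
  have hcont : ∀ r : ℝ, ContinuousOn (fun t : ℝ => t ^ r) (Set.Ici 1) := fun r t ht =>
    (Real.continuousAt_rpow_const t r (Or.inl (by
      have : (1:ℝ) ≤ t := ht
      linarith))).continuousWithinAt
  have hintg : ∀ r : ℝ, IntervalIntegrable (fun t : ℝ => t ^ r) volume 1 T := fun r => by
    apply ContinuousOn.intervalIntegrable
    refine (hcont r).mono ?_
    rw [Set.uIcc_of_le hT]; exact fun t ht => ht.1
  have hab := (abelInt a hT (fun t => t ^ (-s - 1)) (hintg _))
  have h1 : ∀ n ∈ Ioc 0 ⌊T⌋₊, ∫ t in (n:ℝ)..T, t ^ (-s - 1) = ((n:ℝ) ^ (-s) - T ^ (-s)) / s := by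
    intro n hn
    have hn1 : (1:ℝ) ≤ n := by rw [mem_Ioc] at hn; exact_mod_cast hn.1
    rw [integral_rpow (Or.inr ⟨by linarith, h01 _ _ hn1 hT⟩)]
    have : -s - 1 + 1 = -s := by ring
    rw [this, div_neg, ← neg_div]
    ring
  have h2 : ∫ t in (1:ℝ)..T, SA a t * t ^ (-s - 1) =
      ρ * ((1 - T ^ (1 - s)) / (s - 1)) + γ * ((1 - T ^ (-s)) / s) +
        ∫ t in (1:ℝ)..T, t ^ (-s - 1) * (EE a ρ t - γ) := by
    have e1 : ∫ t in (1:ℝ)..T, t ^ (-s) = (1 - T ^ (1 - s)) / (s - 1) := by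
      rw [integral_rpow (Or.inr ⟨by linarith, h01 _ _ le_rfl hT⟩), Real.one_rpow]
      have : -s + 1 = 1 - s := by ring
      rw [this, ← neg_div_neg_eq]; ring
    have e2 : ∫ t in (1:ℝ)..T, t ^ (-s - 1) = (1 - T ^ (-s)) / s := by
      rw [integral_rpow (Or.inr ⟨by linarith, h01 _ _ le_rfl hT⟩), Real.one_rpow]
      have : -s - 1 + 1 = -s := by ring
      rw [this, ← neg_div_neg_eq]; ring
    rw [← e1, ← e2, ← intervalIntegral.integral_const_mul, ← intervalIntegral.integral_const_mul,
      ← intervalIntegral.integral_add ((hintg _).const_mul _) ((hintg _).const_mul _),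
      ← intervalIntegral.integral_add (((hintg _).const_mul _).add ((hintg _).const_mul _))]
    · refine intervalIntegral.integral_congr fun t ht => ?_
      rw [Set.uIcc_of_le hT] at ht
      have ht0 : 0 < t := by linarith [ht.1]
      have : t ^ (-s) = t * t ^ (-s - 1) := by
        rw [Real.rpow_sub_one ht0.ne']; field_simp
      simp only [EE, this]
      ring
    · refine (D_int a ρ γ le_rfl hT).continuousOn_mul ?_
      refine (hcont _).mono ?_
      rw [Set.uIcc_of_le hT]; exact fun t ht => ht.1
  have hder : ∀ r x : ℝ, 1 ≤ x → HasDerivAt (fun t : ℝ => t ^ r) (r * x ^ (r - 1)) x :=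
    fun r x hx => Real.hasDerivAt_rpow_const (Or.inl (by linarith))
  have h3 := D_parts a ρ γ le_rfl hT (fun t => t ^ (-s - 1)) (fun t => (-s - 1) * t ^ (-s - 1 - 1))
    (hder _) (continuousOn_const.mul (hcont _))
  have h4 := D1_parts a ρ γ le_rfl hT (fun t => t ^ (-s - 2)) (fun t => (-s - 2) * t ^ (-s - 2 - 1))
    (hder _) (continuousOn_const.mul (hcont _))
  have z1 : D1 a ρ γ 1 = 0 := by simp [D1]
  have z2 : D2 a ρ γ 1 = 0 := by simp [D2]
  have x1 : -s - 1 - 1 = -s - 2 := by ring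
  have x2 : -s - 2 - 1 = -s - 3 := by ring
  simp only [z1, z2, mul_zero, sub_zero, x1, x2, mul_assoc,
    intervalIntegral.integral_const_mul] at h3 h4
  rw [sum_congr rfl (fun n hn => by rw [h1 n hn])] at hab
  have h5 : ∑ n ∈ Ioc 0 ⌊T⌋₊, a n * (n:ℝ) ^ (-s) = T ^ (-s) * SA a T +
      s * ∑ n ∈ Ioc 0 ⌊T⌋₊, a n * (((n:ℝ) ^ (-s) - T ^ (-s)) / s) := by
    rw [SA, mul_sum, mul_sum, ← sum_add_distrib]
    refine sum_congr rfl fun n _ => ?_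
    have : s ≠ 0 := by linarith
    field_simp
    ring
  rw [h5, hab.2, h2, h3, h4]
  have : s ≠ 0 := by linarith
  have : s - 1 ≠ 0 := by linarith
  field_simp
  ring

theorem D2_int (h : Setup a χ q ρ c) {r : ℝ} (hr : r < -(5:ℝ)/2) :
    IntegrableOn (fun t => t ^ r * D2 a ρ (-kap χ q / 2) t) (Set.Ioi 1) := by
  obtain ⟨C, hC, hD⟩ := h.D2_le
  have h1 : IntegrableOn (fun t : ℝ => C * t ^ (r + 3/2)) (Set.Ioi 1) :=
    (integrableOn_Ioi_rpow_of_lt (by linarith) zero_lt_one).const_mul C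
  refine Integrable.mono' h1 ?_ ?_
  · apply ContinuousOn.aestronglyMeasurable _ measurableSet_Ioi
    refine ContinuousOn.mul ?_ ((D2_continuousOn a ρ _).mono Set.Ioi_subset_Ici_self)
    exact fun t ht => (Real.continuousAt_rpow_const t r (Or.inl (by
      have : (1:ℝ) < t := ht
      linarith))).continuousWithinAt
  · refine (ae_restrict_iff' measurableSet_Ioi).2 (Filter.Eventually.of_forall fun t ht => ?_)
    have ht : 1 < t := ht
    have := hD t ht.le
    rw [norm_mul, Real.norm_of_nonneg (by positivity), Real.rpow_add (by linarith), Real.norm_eq_abs]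
    calc t ^ r * |D2 a ρ (-kap χ q / 2) t| ≤ t ^ r * (C * t ^ ((3:ℝ)/2)) := by gcongr
      _ = _ := by ring

theorem zeta_formula (h : Setup a χ q ρ c) {s : ℝ} (hs : 1 < s) :
    ∑' n : ℕ, a n * (n:ℝ) ^ (-s) = ρ * s / (s - 1) + (-kap χ q / 2)
      + s * (s + 1) * (s + 2) * ∫ t in Set.Ioi (1:ℝ), t ^ (-s - 3) * D2 a ρ (-kap χ q / 2) t := by
  obtain ⟨C, hC, hD⟩ := h.D2_le
  set γ := -kap χ q / 2
  have h1 := tendsto_partial (fun n : ℕ => a n * (n:ℝ) ^ (-s)) (by simp [h.zero]) (h.summable hs)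
  refine tendsto_nhds_unique h1 ?_
  have t0 : ∀ r : ℝ, r < 0 → Filter.Tendsto (fun T : ℝ => T ^ r) Filter.atTop (nhds 0) := fun r hr => by
    have := tendsto_rpow_neg_atTop (y := -r) (by linarith)
    simpa using this
  have sq : ∀ (f : ℝ → ℝ) (K r e : ℝ), e < -r → (∀ T ≥ (1:ℝ), |f T| ≤ K * T ^ r) →
      Filter.Tendsto (fun T => T ^ e * f T) Filter.atTop (nhds 0) := by
    intro f K r e he hf
    have h2 : Filter.Tendsto (fun T : ℝ => K * T ^ (e + r)) Filter.atTop (nhds 0) := by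
      simpa using (t0 (e + r) (by linarith)).const_mul K
    refine squeeze_zero_norm' ?_ h2
    filter_upwards [Filter.eventually_ge_atTop 1] with T hT
    rw [norm_mul, Real.norm_of_nonneg (by positivity), Real.rpow_add (by linarith), Real.norm_eq_abs]
    calc T ^ e * |f T| ≤ T ^ e * (K * T ^ r) := by gcongr; exact hf T hT
      _ = _ := by ring
  have l1 := sq (SA a) (c + |ρ|) 1 (-s) (by linarith) (fun T hT => by
    rw [abs_of_nonneg (by rw [SA]; exact sum_nonneg fun n _ => h.nonneg n), Real.rpow_one]; exact h.SA_le hT)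
  have l2 := sq (D1 a ρ γ) (c + |γ|) (4/3) (-s - 1) (by linarith) (fun T hT => h.D1_le γ hT)
  have l3 := sq (D2 a ρ γ) C (3/2) (-s - 2) (by linarith) hD
  have l4 := intervalIntegral_tendsto_integral_Ioi (1:ℝ) (h.D2_int (r := -s - 3) (by linarith))
    Filter.tendsto_id
  have l5 := ((t0 (1 - s) (by linarith)).const_sub 1).const_mul (ρ * s / (s - 1))
  have l6 := ((t0 (- s) (by linarith)).const_sub 1).const_mul γ
  have := ((((l1.add l5).add l6).add (l2.const_mul s)).add (l3.const_mul (s * (s + 1)))).add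
    (l4.const_mul (s * (s + 1) * (s + 2)))
  simp only [mul_zero, zero_add, add_zero, sub_zero, mul_one] at this
  refine this.congr' ?_
  filter_upwards [Filter.eventually_ge_atTop 1] with T hT
  rw [h.finite_formula γ hs hT]
  rfl

/-- Analytic continuation: the value at `0`. -/
theorem zeta_zero (h : Setup a χ q ρ c) (Z : ℂ → ℂ) (hZ : ∀ s : ℂ, s ≠ 1 → DifferentiableAt ℂ Z s)
    (hZs : ∀ s : ℝ, 1 < s → Z s = ((∑' n : ℕ, a n * (n:ℝ) ^ (-s) : ℝ) : ℂ)) :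
    Z 0 = ((-kap χ q / 2 : ℝ) : ℂ) := by
  obtain ⟨C, hC, hD⟩ := h.D2_le
  set γ := -kap χ q / 2 with hγ
  set f : ℝ → ℂ := fun t => ((Set.indicator (Set.Ioi 1) (D2 a ρ γ) t : ℝ) : ℂ) with hf
  set W : ℂ → ℂ := fun s => ρ * s / (s - 1) + γ + s * (s + 1) * (s + 2) * mellin f (-s - 2) with hW
  have hmel : ∀ s : ℂ, -(1/2 : ℝ) < s.re → DifferentiableAt ℂ (mellin f) (-s - 2) := by
    intro s hs
    refine mellin_differentiableAt_of_isBigO_rpow (a := -(3/2)) (b := -s.re - 3) ?_ ?_ ?_ ?_ ?_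
    · have hl : LocallyIntegrableOn (fun t => ((D2 a ρ γ t : ℝ) : ℂ)) (Set.Ici 1) := by
        apply ContinuousOn.locallyIntegrableOn _ measurableSet_Ici
        exact Complex.continuous_ofReal.comp_continuousOn (D2_continuousOn a ρ γ)
      intro x hx
      have hcont : IntegrableOn (fun t => ((D2 a ρ γ t : ℝ) : ℂ)) (Set.Icc 1 (x + 1)) := by
        apply ContinuousOn.integrableOn_Icc
        exact Complex.continuous_ofReal.comp_continuousOn
          ((D2_continuousOn a ρ γ).mono fun t ht => ht.1)
      refine ⟨Set.Iic (x + 1), mem_nhdsWithin_of_mem_nhds (Iic_mem_nhds (by linarith)), ?_⟩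
      have e : f = Set.indicator (Set.Ioi 1) (fun t => ((D2 a ρ γ t : ℝ) : ℂ)) := by
        funext t; simp only [hf, Set.indicator]; split_ifs <;> simp
      rw [e, IntegrableOn, integrable_indicator_iff measurableSet_Ioi, IntegrableOn,
        Measure.restrict_restrict measurableSet_Ioi]
      refine hcont.mono_set fun t ht => ⟨ht.1.le, ht.2⟩
    · refine Asymptotics.IsBigO.of_bound C ?_
      filter_upwards [Filter.eventually_gt_atTop 1] with t ht
      have := hD t ht.le
      simp only [hf, Complex.norm_real, neg_neg]
      rw [Set.indicator_of_mem (by exact ht), Real.norm_eq_abs,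
        Real.norm_of_nonneg (by positivity)]
      exact this
    · simp; linarith
    · refine Asymptotics.IsBigO.of_bound 1 ?_
      have : Set.Iio (1:ℝ) ∈ nhdsWithin (0:ℝ) (Set.Ioi 0) :=
        mem_nhdsWithin_of_mem_nhds (Iio_mem_nhds zero_lt_one)
      filter_upwards [this] with t ht
      simp only [hf]
      rw [Set.indicator_of_notMem (by simpa using (show t < 1 from ht).le)]
      simp
    · simp; linarith
  set A : Set ℂ := {s : ℂ | -(1/2 : ℝ) < s.re} ∩ {s : ℂ | s.re < 1/2} with hA
  set B : Set ℂ := {s : ℂ | -(1/2 : ℝ) < s.re} ∩ {s : ℂ | 1/2 < s.im} with hB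
  set D : Set ℂ := {s : ℂ | (3/2 : ℝ) < s.re} with hDD
  set U : Set ℂ := A ∪ B ∪ D with hU
  have hUo' : IsOpen U := by
    refine IsOpen.union (IsOpen.union (IsOpen.inter ?_ ?_) (IsOpen.inter ?_ ?_)) ?_
    · exact isOpen_lt continuous_const Complex.continuous_re
    · exact isOpen_lt Complex.continuous_re continuous_const
    · exact isOpen_lt continuous_const Complex.continuous_re
    · exact isOpen_lt continuous_const Complex.continuous_im
    · exact isOpen_lt continuous_const Complex.continuous_re
  have hconn : IsPreconnected U := by
    have cA : Convex ℝ A := (convex_halfSpace_re_gt _).inter (convex_halfSpace_re_lt _)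
    have cB : Convex ℝ B := (convex_halfSpace_re_gt _).inter (convex_halfSpace_im_gt _)
    have cD : Convex ℝ D := convex_halfSpace_re_gt _
    refine IsPreconnected.union (2 + Complex.I) ?_ ?_
      (IsPreconnected.union Complex.I ?_ ?_ cA.isPreconnected cB.isPreconnected) cD.isPreconnected
    · right; constructor <;> norm_num
    · show (3/2:ℝ) < (2 + Complex.I).re
      norm_num
    · constructor <;> norm_num
    · constructor <;> norm_num
  have hU1 : ∀ s ∈ U, s ≠ 1 := by
    rintro s ((hs | hs) | hs) rfl
    · have : (1:ℂ).re < 1/2 := hs.2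
      norm_num at this
    · have : 1/2 < (1:ℂ).im := hs.2
      norm_num at this
    · have : (3/2:ℝ) < (1:ℂ).re := hs
      norm_num at this
  have hU2 : ∀ s ∈ U, -(1/2:ℝ) < s.re := by
    rintro s ((hs | hs) | hs)
    · exact hs.1
    · exact hs.1
    · have : (3/2:ℝ) < s.re := hs
      linarith
  have hWd : DifferentiableOn ℂ W U := by
    intro s hs
    have h1 : s - 1 ≠ 0 := sub_ne_zero.2 (hU1 s hs)
    have h2 : DifferentiableAt ℂ (fun s : ℂ => mellin f (-s - 2)) s :=
      DifferentiableAt.comp (g := mellin f) s (hmel s (hU2 s hs)) (by fun_prop)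
    apply DifferentiableAt.differentiableWithinAt
    simp only [hW]
    fun_prop (disch := assumption)
  have hZd : DifferentiableOn ℂ Z U := fun s hs => (hZ s (hU1 s hs)).differentiableWithinAt
  have h2U : (2:ℂ) ∈ U := by
    right
    show (3/2:ℝ) < (2:ℂ).re
    norm_num
  have h0U : (0:ℂ) ∈ U := by
    left; left; constructor <;> norm_num
  have hreal : ∀ s : ℝ, 1 < s → Z s = W s := by
    intro s hs
    rw [hZs s hs, h.zeta_formula hs, ← hγ]
    simp only [hW]
    have : mellin f (-(s:ℂ) - 2) = ((∫ t in Set.Ioi (1:ℝ), t ^ (-s - 3) * D2 a ρ γ t : ℝ) : ℂ) := by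
      rw [mellin, ← integral_complex_ofReal]
      have e : ∀ t ∈ Set.Ioi (0:ℝ), (t:ℂ) ^ (-(s:ℂ) - 2 - 1) • f t =
          Set.indicator (Set.Ioi 1) (fun t : ℝ => ((t ^ (-s - 3) * D2 a ρ γ t : ℝ) : ℂ)) t := by
        intro t ht
        have ht : 0 < t := ht
        have e1 : (t:ℂ) ^ (-(s:ℂ) - 2 - 1) = ((t ^ (-s - 3) : ℝ) : ℂ) := by
          rw [Complex.ofReal_cpow ht.le]; push_cast; congr 1; ring
        simp only [hf, e1, Set.indicator]
        split_ifs <;> simp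
      rw [setIntegral_congr_fun measurableSet_Ioi e, setIntegral_indicator measurableSet_Ioi]
      congr 2
      ext t; simp only [Set.mem_inter_iff, Set.mem_Ioi]
      exact ⟨fun hh => hh.2, fun hh => ⟨by linarith, hh⟩⟩
    rw [this]
    push_cast
    ring
  have hfreq : ∃ᶠ z in nhdsWithin (2:ℂ) {2}ᶜ, Z z = W z := by
    have ht : Filter.Tendsto (fun n : ℕ => (((2 + 1 / ((n:ℝ) + 1) : ℝ)) : ℂ)) Filter.atTop
        (nhdsWithin (2:ℂ) {2}ᶜ) := by
      rw [tendsto_nhdsWithin_iff]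
      constructor
      · have h1 : Filter.Tendsto (fun n : ℕ => (2 + 1 / ((n:ℝ) + 1) : ℝ)) Filter.atTop (nhds (2 + 0)) :=
          tendsto_one_div_add_atTop_nhds_zero_nat.const_add 2
        have h2 := (Complex.continuous_ofReal.tendsto (2 + 0)).comp h1
        simpa [Function.comp_def] using h2
      · refine Filter.Eventually.of_forall fun n => ?_
        have : (0:ℝ) < 1 / ((n:ℝ) + 1) := by positivity
        intro hh
        have hh : (((2 + 1 / ((n:ℝ) + 1) : ℝ)) : ℂ) = ((2:ℝ):ℂ) := by simpa using hh
        rw [Complex.ofReal_inj] at hh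
        linarith
    refine ht.frequently (Filter.Eventually.frequently (Filter.Eventually.of_forall fun n => ?_))
    have : (0:ℝ) < 1 / ((n:ℝ) + 1) := by positivity
    exact hreal _ (by linarith)
  have := (hZd.analyticOnNhd hUo').eqOn_of_preconnected_of_frequently_eq
    (hWd.analyticOnNhd hUo') hconn h2U hfreq h0U
  rw [this]
  simp [hW]

end Setup
end RS

namespace RS
open Finset MeasureTheory

variable {F : Type} [Field F] [NumberField F]

/-- nonzero ideals of norm at most `N` -/
noncomputable def idLE (F : Type) [Field F] [NumberField F] (N : ℕ) : Finset (Ideal (𝓞 F)) :=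
  (Ideal.finite_setOfPred_absNorm_le (S := 𝓞 F) N).toFinset.filter (fun I => I ≠ 0)

theorem mem_idLE {N : ℕ} {I : Ideal (𝓞 F)} : I ∈ idLE F N ↔ I ≠ 0 ∧ Ideal.absNorm I ≤ N := by
  simp [idLE, and_comm]

theorem absNorm_pos' {I : Ideal (𝓞 F)} (hI : I ≠ 0) : 0 < Ideal.absNorm I :=
  Nat.pos_of_ne_zero fun h => hI (Ideal.absNorm_eq_zero_iff.1 h)

theorem ne_zero_of_absNorm {I : Ideal (𝓞 F)} (hI : 0 < Ideal.absNorm I) : I ≠ 0 := by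
  rintro rfl
  simp at hI

theorem mu_one : idealMu (1 : Ideal (𝓞 F)) = 1 := by
  rw [idealMu, if_pos squarefree_one, UniqueFactorizationMonoid.factors_eq_normalizedFactors,
    UniqueFactorizationMonoid.normalizedFactors_one]
  simp

theorem mu_prime_mul {P h : Ideal (𝓞 F)} (hP : Prime P) (hh0 : h ≠ 0) (hh : ¬ P ∣ h) :
    idealMu (P * h) = - idealMu h := by
  have hcop : IsRelPrime P h := hP.irreducible.isRelPrime_iff_not_dvd.2 hh
  have hsq : Squarefree (P * h) ↔ Squarefree h := by
    rw [squarefree_mul_iff]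
    exact ⟨fun hx => hx.2.2, fun hx => ⟨hcop, hP.irreducible.squarefree, hx⟩⟩
  rw [idealMu, idealMu]
  simp only [hsq]
  split_ifs with hs
  · rw [UniqueFactorizationMonoid.factors_eq_normalizedFactors,
      UniqueFactorizationMonoid.factors_eq_normalizedFactors,
      UniqueFactorizationMonoid.normalizedFactors_mul hP.ne_zero hh0,
      UniqueFactorizationMonoid.normalizedFactors_irreducible hP.irreducible]
    simp [pow_add]
  · simp

theorem mu_prime_mul' {P h : Ideal (𝓞 F)} (hP : Prime P) (hh : P ∣ h) :
    idealMu (P * h) = 0 := by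
  rw [idealMu, if_neg]
  intro hs
  obtain ⟨k, rfl⟩ := hh
  exact hP.not_isUnit (hs P ⟨k, by ring⟩)

theorem sum_mu {N : ℕ} {I : Ideal (𝓞 F)} (hI : I ∈ idLE F N) :
    ∑ f ∈ (idLE F N).filter (· ∣ I), idealMu f = if I = 1 then 1 else 0 := by
  rw [mem_idLE] at hI
  have hdvd : ∀ f, f ∣ I → f ∈ idLE F N := fun f hf => by
    rw [mem_idLE]
    refine ⟨ne_zero_of_dvd_ne_zero hI.1 hf, le_trans (Nat.le_of_dvd (absNorm_pos' hI.1) ?_) hI.2⟩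
    exact Ideal.absNorm_dvd_absNorm_of_le (Ideal.dvd_iff_le.1 hf)
  split_ifs with h1
  · subst h1
    have : (idLE F N).filter (· ∣ (1 : Ideal (𝓞 F))) = {1} := by
      ext f
      simp only [mem_filter, mem_singleton]
      constructor
      · rintro ⟨_, hf⟩
        exact isUnit_iff_eq_one.1 (isUnit_of_dvd_one hf)
      · rintro rfl
        exact ⟨hdvd 1 dvd_rfl, dvd_rfl⟩
    rw [this, sum_singleton, mu_one]
  · obtain ⟨P, hP, hPI⟩ := WfDvdMonoid.exists_irreducible_factor
      (fun hu => h1 (isUnit_iff_eq_one.1 hu)) hI.1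
    have hP : Prime P := hP.prime
    obtain ⟨J, rfl⟩ := hPI
    rw [← sum_filter_add_sum_filter_not _ (fun f => ¬ P ∣ f)]
    have key : ∑ f ∈ filter (fun f => ¬ P ∣ f) ((idLE F N).filter (· ∣ P * J)), (- idealMu f) =
        ∑ f ∈ filter (fun f => ¬ ¬ P ∣ f) ((idLE F N).filter (· ∣ P * J)), idealMu f := by
      refine sum_of_injOn (fun h => P * h) ?_ ?_ ?_ ?_
      · intro x _ y _ hxy
        exact mul_left_cancel₀ hP.ne_zero hxy
      · intro x hx
        simp only [coe_filter, mem_filter, Set.mem_setOf_eq] at hx ⊢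
        have hx1 : x ∣ J := by
          have : IsRelPrime P x := hP.irreducible.isRelPrime_iff_not_dvd.2 hx.2
          exact this.symm.dvd_of_dvd_mul_left hx.1.2
        have hx2 : P * x ∣ P * J := mul_dvd_mul_left P hx1
        exact ⟨⟨hdvd _ hx2, hx2⟩, by simp⟩
      · intro x hx hx'
        simp only [mem_filter, not_not] at hx
        obtain ⟨h, rfl⟩ := hx.2
        by_cases hh : P ∣ h
        · exact mu_prime_mul' hP hh
        · refine absurd ⟨h, ?_, rfl⟩ hx'
          simp only [coe_filter, mem_filter, Set.mem_setOf_eq]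
          have hx2 : h ∣ P * J := dvd_trans (dvd_mul_left h P) hx.1.2
          exact ⟨⟨hdvd _ hx2, hx2⟩, hh⟩
      · intro x hx
        simp only [mem_filter] at hx
        rw [mu_prime_mul hP (mem_idLE.1 hx.1.1).1 hx.2]
    rw [← key, sum_neg_distrib, add_neg_cancel]

theorem card_idLE_norm {N : ℕ} {n : ℕ} (hn : n ∈ Ioc 0 N) :
    ((idLE F N).filter (fun I => Ideal.absNorm I = n)).card = aI F n := by
  rw [mem_Ioc] at hn
  rw [aI]
  symm
  apply Nat.subtype_card
  intro I
  simp only [mem_filter, mem_idLE]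
  constructor
  · exact fun h => h.2
  · rintro rfl
    exact ⟨⟨ne_zero_of_absNorm hn.1, hn.2⟩, rfl⟩

/-- number of ideals of norm `n`, with value `0` at `0` -/
noncomputable def aR (F : Type) [Field F] [NumberField F] (n : ℕ) : ℝ := if n = 0 then 0 else aI F n

/-- sum of the Moebius function over ideals of norm `n` -/
noncomputable def uR (F : Type) [Field F] [NumberField F] (n : ℕ) : ℝ :=
  ∑ I ∈ (idLE F n).filter (fun I => Ideal.absNorm I = n), (idealMu I : ℝ)

theorem idLE_filter_eq {N n : ℕ} (hn : n ≤ N) :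
    (idLE F N).filter (fun I => Ideal.absNorm I = n) =
      (idLE F n).filter (fun I => Ideal.absNorm I = n) := by
  ext I
  simp only [mem_filter, mem_idLE]
  constructor
  · rintro ⟨⟨h1, h2⟩, h3⟩
    exact ⟨⟨h1, h3.le⟩, h3⟩
  · rintro ⟨⟨h1, h2⟩, h3⟩
    exact ⟨⟨h1, h3.le.trans hn⟩, h3⟩

theorem maps_norm {N : ℕ} : ∀ I ∈ idLE F N, Ideal.absNorm I ∈ Ioc 0 N := fun I hI => by
  rw [mem_idLE] at hI
  rw [mem_Ioc]
  exact ⟨absNorm_pos' hI.1, hI.2⟩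

theorem sum_idLE (N : ℕ) (G : ℕ → ℝ) :
    ∑ I ∈ idLE F N, G (Ideal.absNorm I) = ∑ n ∈ Ioc 0 N, aR F n * G n := by
  rw [← sum_fiberwise_of_maps_to (maps_norm (F := F) (N := N))]
  refine sum_congr rfl fun n hn => ?_
  rw [sum_congr rfl (g := fun _ => G n) (fun I hI => by rw [(mem_filter.1 hI).2]), sum_const,
    card_idLE_norm hn, aR, if_neg (by rw [mem_Ioc] at hn; omega), nsmul_eq_mul]

theorem sum_idLE_mu (N : ℕ) (G : ℕ → ℝ) :
    ∑ I ∈ idLE F N, (idealMu I : ℝ) * G (Ideal.absNorm I) = ∑ n ∈ Ioc 0 N, uR F n * G n := by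
  rw [← sum_fiberwise_of_maps_to (maps_norm (F := F) (N := N))]
  refine sum_congr rfl fun n hn => ?_
  rw [sum_congr rfl (g := fun I => (idealMu I : ℝ) * G n) (fun I hI => by rw [(mem_filter.1 hI).2]),
    ← sum_mul, uR, idLE_filter_eq (by rw [mem_Ioc] at hn; omega)]

theorem abs_mu_le (I : Ideal (𝓞 F)) : |(idealMu I : ℝ)| ≤ 1 := by
  rw [idealMu]
  split_ifs
  · push_cast; rw [abs_pow]; simp
  · simp

theorem abs_uR_le (n : ℕ) : |uR F n| ≤ aR F n := by
  rcases Nat.eq_zero_or_pos n with rfl | hn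
  · have : (idLE F 0).filter (fun I => Ideal.absNorm I = 0) = ∅ := by
      ext I
      simp only [mem_filter, mem_idLE, notMem_empty, iff_false]
      rintro ⟨⟨h1, h2⟩, h3⟩
      have := absNorm_pos' h1
      omega
    rw [uR, this]
    simp [aR]
  · have hn' : n ∈ Ioc 0 n := by simp [hn]
    rw [uR, aR, if_neg hn.ne', ← card_idLE_norm hn']
    refine (abs_sum_le_sum_abs _ _).trans ?_
    refine (sum_le_sum fun I _ => abs_mu_le I).trans ?_
    simp

/-- sum over multiples -/
theorem sum_idLE_dvd (N : ℕ) {h : Ideal (𝓞 F)} (hh : h ≠ 0) (G : Ideal (𝓞 F) → ℝ) :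
    ∑ d ∈ (idLE F N).filter (h ∣ ·), G d = ∑ x ∈ idLE F (N / Ideal.absNorm h), G (h * x) := by
  symm
  refine sum_of_injOn (fun x => h * x) ?_ ?_ ?_ (fun _ _ => rfl)
  · intro x _ y _ hxy
    exact mul_left_cancel₀ hh hxy
  · intro x hx
    have hx := mem_idLE.1 (mem_coe.1 hx)
    simp only [coe_filter, mem_idLE, Set.mem_setOf_eq, map_mul]
    refine ⟨⟨mul_ne_zero hh hx.1, ?_⟩, dvd_mul_right _ _⟩
    rw [mul_comm]
    exact (Nat.le_div_iff_mul_le (absNorm_pos' hh)).1 hx.2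
  · intro d hd hd'
    simp only [mem_filter, mem_idLE] at hd
    obtain ⟨x, rfl⟩ := hd.2
    refine absurd ⟨x, mem_coe.2 (mem_idLE.2 ⟨right_ne_zero_of_mul hd.1.1, ?_⟩), rfl⟩ hd'
    rw [Nat.le_div_iff_mul_le (absNorm_pos' hh), mul_comm]
    simpa using hd.1.2

/-- Moebius inversion -/
theorem moebius_inv {N : ℕ} {g : Ideal (𝓞 F)} (hg : g ∈ idLE F N) (ψ : Ideal (𝓞 F) → ℝ) :
    ∑ e ∈ idLE F N, ∑ f ∈ idLE F N, (if e * f ∣ g then (idealMu f : ℝ) * ψ e else 0) = ψ g := by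
  have hg' := mem_idLE.1 hg
  have h1 : ∀ e ∈ idLE F N, ∑ f ∈ idLE F N, (if e * f ∣ g then (idealMu f : ℝ) * ψ e else 0) =
      if e = g then ψ e else 0 := by
    intro e he
    have he' := mem_idLE.1 he
    by_cases hed : e ∣ g
    · obtain ⟨k, rfl⟩ := hed
      have hk : k ∈ idLE F N := by
        rw [mem_idLE]
        refine ⟨right_ne_zero_of_mul hg'.1, le_trans ?_ hg'.2⟩
        rw [map_mul]
        exact Nat.le_mul_of_pos_left _ (absNorm_pos' he'.1)
      have h2 := sum_mu hk
      have h3 : ∀ f, (e * f ∣ e * k) ↔ f ∣ k := fun f => mul_dvd_mul_iff_left he'.1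
      have h4 : (e = e * k) ↔ k = 1 := by
        constructor
        · intro h
          exact mul_left_cancel₀ he'.1 (by rw [← h, mul_one])
        · rintro rfl; simp
      simp only [h3, h4]
      rw [← sum_filter, ← sum_mul, ← Int.cast_sum, h2]
      split_ifs <;> simp
    · rw [if_neg (fun h : e = g => hed (h ▸ dvd_rfl))]
      refine sum_eq_zero fun f _ => if_neg fun h => hed (dvd_trans (dvd_mul_right e f) h)
  rw [sum_congr rfl h1, sum_ite_eq' _ _ ψ, if_pos hg]

end RS

namespace RS
open Finset MeasureTheory

variable {F : Type} [Field F] [NumberField F]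

theorem setOf_eq_idLE (x : ℝ) (hx : 0 ≤ x) :
    {n : Ideal (𝓞 F) | n ≠ 0 ∧ (Ideal.absNorm n : ℝ) ≤ x} = ↑(idLE F ⌊x⌋₊) := by
  ext I
  simp only [Set.mem_ofPred_eq, mem_coe, mem_idLE, Nat.le_floor_iff hx]

theorem SA_aR (x : ℝ) : ((idLE F ⌊x⌋₊).card : ℝ) = SA (aR F) x := by
  have := sum_idLE (F := F) ⌊x⌋₊ (fun _ => 1)
  simp only [sum_const, nsmul_eq_mul, mul_one] at this
  rw [this, SA]

theorem exists_setup (hdeg : Module.finrank ℚ F = 2) (ρ : ℝ)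
    (hρ : ∃ c : ℝ, ∀ x : ℝ, 1 ≤ x →
      |(Nat.card {I : Ideal (𝓞 F) // I ≠ 0 ∧ (Ideal.absNorm I : ℝ) ≤ x} : ℝ) - ρ * x|
        ≤ c * x ^ ((1 : ℝ) / 3)) : ∃ χ q c, Setup (aR F) χ q ρ c := by
  obtain ⟨c, hc⟩ := hρ
  obtain ⟨q, χ, h1, h2⟩ := exists_chi hdeg
  refine ⟨fun n => (χ n : ℝ), q, |c| + 1, h1.pos, fun n => by simp [h1.per], fun n => ?_, by simp [aR],
    fun n hn => ?_, fun n => ?_, by positivity, fun x hx => ?_⟩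
  · exact_mod_cast h1.bdd n
  · rw [aR, if_neg hn]; exact_mod_cast h2 n hn
  · rw [aR]; split_ifs <;> positivity
  · have e : Nat.card {I : Ideal (𝓞 F) // I ≠ 0 ∧ (Ideal.absNorm I : ℝ) ≤ x} =
        (idLE F ⌊x⌋₊).card := by
      apply Nat.subtype_card
      intro I
      rw [mem_idLE, Nat.le_floor_iff (by linarith)]
    have h3 := hc x hx
    rw [e, SA_aR] at h3
    refine h3.trans ?_
    have : c ≤ |c| + 1 := by linarith [le_abs_self c]
    gcongr

/-- The Dirichlet series at real points. -/
theorem dzeta_real {χ : ℕ → ℝ} {q : ℕ} {ρ c : ℝ} (h : Setup (aR F) χ q ρ c) {s : ℝ} (hs : 1 < s) :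
    dzeta F (s:ℂ) = ((∑' n : ℕ, aR F n * (n:ℝ) ^ (-s) : ℝ) : ℂ) := by
  set g : {I : Ideal (𝓞 F) // I ≠ 0} → ℝ := fun I => (Ideal.absNorm I.1 : ℝ) ^ (-s) with hg
  have h1 : dzeta F (s:ℂ) = ((∑' I, g I : ℝ) : ℂ) := by
    rw [dzeta, Complex.ofReal_tsum]
    refine tsum_congr fun I => ?_
    rw [hg, Complex.ofReal_cpow (by positivity)]
    push_cast
    rfl
  rw [h1]
  congr 1
  let e := Equiv.sigmaFiberEquiv (fun I : {I : Ideal (𝓞 F) // I ≠ 0} => Ideal.absNorm I.1)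
  have hfin : ∀ n : ℕ, Finite {I : {I : Ideal (𝓞 F) // I ≠ 0} // Ideal.absNorm I.1 = n} := by
    intro n
    have : Finite {I : Ideal (𝓞 F) // Ideal.absNorm I = n} :=
      (Ideal.finite_setOfPred_absNorm_eq (S := 𝓞 F) n)
    exact Finite.of_injective (β := {I : Ideal (𝓞 F) // Ideal.absNorm I = n})
      (fun I => ⟨I.1.1, I.2⟩) (fun I J hIJ => by
        apply Subtype.ext; apply Subtype.ext
        have := congrArg (fun K : {I : Ideal (𝓞 F) // Ideal.absNorm I = n} => K.1) hIJ
        exact this)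
  have hfib : ∀ n : ℕ, ∑' I : {I : {I : Ideal (𝓞 F) // I ≠ 0} // Ideal.absNorm I.1 = n}, g (e ⟨n, I⟩) =
      aR F n * (n:ℝ) ^ (-s) := by
    intro n
    have e1 : ∀ I : {I : {I : Ideal (𝓞 F) // I ≠ 0} // Ideal.absNorm I.1 = n},
        g (e ⟨n, I⟩) = (n:ℝ) ^ (-s) := by
      intro I
      show (Ideal.absNorm I.1.1 : ℝ) ^ (-s) = _
      rw [I.2]
    rw [tsum_congr e1, tsum_const, nsmul_eq_mul]
    congr 1
    rw [aR]
    split_ifs with hn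
    · have : IsEmpty {I : {I : Ideal (𝓞 F) // I ≠ 0} // Ideal.absNorm I.1 = n} := ⟨fun I => by
        have := absNorm_pos' I.1.2
        have := I.2
        omega⟩
      simp
    · rw [aI]
      congr 1
      refine Nat.card_congr ⟨fun I => ⟨I.1.1, I.2⟩,
        fun I => ⟨⟨I.1, ne_zero_of_absNorm (by rw [I.2]; omega)⟩, I.2⟩, fun _ => rfl, fun _ => rfl⟩
  have hsum : Summable fun x => g (e x) := by
    rw [summable_sigma_of_nonneg (fun x => by simp only [hg]; positivity)]
    refine ⟨fun n => ?_, ?_⟩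
    · have := hfin n
      exact Summable.of_finite
    · simp only [hfib]
      exact h.summable hs
  rw [← e.tsum_eq, Summable.tsum_sigma' (fun n => by have := hfin n; exact Summable.of_finite) hsum]
  exact tsum_congr hfib

theorem sum_mu_G {N : ℕ} (hN : 1 ≤ N) (G : ℕ → ℝ) :
    ∑ f ∈ Ioc 0 N, uR F f * ∑ x ∈ Ioc 0 (N / f), aR F x * G (f * x) = G 1 := by
  have h1 : ∑ I ∈ idLE F N, ∑ f ∈ (idLE F N).filter (· ∣ I),
      (idealMu f : ℝ) * G (Ideal.absNorm I) = G 1 := by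
    have : ∀ I ∈ idLE F N, ∑ f ∈ (idLE F N).filter (· ∣ I),
      (idealMu f : ℝ) * G (Ideal.absNorm I) = if I = 1 then G (Ideal.absNorm I) else 0 := by
      intro I hI
      rw [← sum_mul, ← Int.cast_sum, sum_mu hI]
      split_ifs <;> simp
    rw [sum_congr rfl this, sum_ite_eq' _ _ (fun I : Ideal (𝓞 F) => G (Ideal.absNorm I)), if_pos]
    · simp
    · rw [mem_idLE]; simpa using hN
  rw [← h1, ← sum_idLE_mu]
  simp only [sum_filter]
  rw [sum_comm]
  refine sum_congr rfl fun f hf => ?_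
  rw [← sum_filter, ← mul_sum]
  congr 1
  rw [sum_idLE_dvd N (mem_idLE.1 hf).1, ← sum_idLE]
  simp

/-- Summatory function of the Moebius function. -/
noncomputable def MM (F : Type) [Field F] [NumberField F] (k : ℕ) : ℝ := ∑ n ∈ Ioc 0 k, uR F n

theorem inner_sum {X : ℝ} (hX : 0 ≤ X) (n : Ideal (𝓞 F)) :
    ((∑ᶠ m ∈ {m : Ideal (𝓞 F) | m ≠ 0 ∧ (Ideal.absNorm m : ℝ) ≤ X}, ramanujanSum m n : ℤ) : ℝ) =
      ∑ d ∈ idLE F ⌊X⌋₊, if d ∣ n then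
        (Ideal.absNorm d : ℝ) * MM F (⌊X⌋₊ / Ideal.absNorm d) else 0 := by
  set N := ⌊X⌋₊
  rw [setOf_eq_idLE X hX, finsum_mem_coe_finset]
  have h1 : ∀ m ∈ idLE F N, ramanujanSum m n = ∑ d ∈ idLE F N, ∑ e ∈ idLE F N,
      if d * e = m ∧ d ∣ n then (Ideal.absNorm d : ℤ) * idealMu e else 0 := by
    intro m hm
    rw [mem_idLE] at hm
    rw [ramanujanSum, ← sum_product', ← sum_filter, ← finsum_mem_coe_finset]
    refine finsum_mem_congr (Set.ext fun p => ?_) fun _ _ => rfl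
    have : p ∈ {p : Ideal (𝓞 F) × Ideal (𝓞 F) | p.1 * p.2 = m ∧ p.1 ∣ n} ↔
        p ∈ (↑(filter (fun x : Ideal (𝓞 F) × Ideal (𝓞 F) => x.1 * x.2 = m ∧ x.1 ∣ n)
          (idLE F N ×ˢ idLE F N)) : Set _) := by
      simp only [coe_filter, mem_product, Set.mem_ofPred_eq, mem_idLE]
      constructor
      · rintro ⟨h1, h2⟩
        refine ⟨?_, h1, h2⟩
        have a1 : p.1 ≠ 0 := fun h => hm.1 (by rw [← h1, h, zero_mul])
        have a2 : p.2 ≠ 0 := fun h => hm.1 (by rw [← h1, h, mul_zero])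
        have a3 := hm.2
        rw [← h1, map_mul] at a3
        exact ⟨⟨a1, (Nat.le_mul_of_pos_right _ (absNorm_pos' a2)).trans a3⟩,
          ⟨a2, (Nat.le_mul_of_pos_left _ (absNorm_pos' a1)).trans a3⟩⟩
      · exact fun h => h.2
    exact this
  rw [sum_congr rfl h1, sum_comm]
  push_cast
  refine sum_congr rfl fun d hd => ?_
  rw [sum_comm]
  have hd' := mem_idLE.1 hd
  split_ifs with hdn
  · have := sum_idLE_mu (F := F) (N / Ideal.absNorm d) (fun _ => 1)
    simp only [mul_one] at this
    rw [MM, ← this, mul_sum]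
    have hsub : idLE F (N / Ideal.absNorm d) ⊆ idLE F N := fun e he => by
      rw [mem_idLE] at *
      exact ⟨he.1, he.2.trans (Nat.div_le_self _ _)⟩
    rw [← sum_subset hsub]
    · refine sum_congr rfl fun e he => ?_
      have he := mem_idLE.1 he
      simp only [hdn, and_true]
      rw [sum_ite_eq, if_pos]
      rw [mem_idLE, map_mul, mul_comm (Ideal.absNorm d)]
      exact ⟨mul_ne_zero hd'.1 he.1,
        (Nat.le_div_iff_mul_le (absNorm_pos' hd'.1)).1 he.2⟩
    · intro e he he'
      refine sum_eq_zero fun m hm => ?_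
      rw [if_neg]
      rintro ⟨h1, _⟩
      have hm := mem_idLE.1 hm
      apply he'
      rw [mem_idLE]
      refine ⟨(mem_idLE.1 he).1, (Nat.le_div_iff_mul_le (absNorm_pos' hd'.1)).2 ?_⟩
      rw [mul_comm, ← map_mul, h1]
      exact hm.2
  · refine sum_eq_zero fun e _ => sum_eq_zero fun m _ => ?_
    rw [if_neg (fun h => hdn h.2)]

theorem count_mult {Y : ℝ} (hY : 0 ≤ Y) {N : ℕ} {d₁ d₂ : Ideal (𝓞 F)} (h₁ : d₁ ∈ idLE F N)
    (h₂ : d₂ ∈ idLE F N) :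
    ∑ n ∈ idLE F ⌊Y⌋₊, (if d₁ ∣ n ∧ d₂ ∣ n then (1:ℝ) else 0) =
      ∑ e ∈ idLE F N, ∑ f ∈ idLE F N, if e * f ∣ d₁ ∧ e * f ∣ d₂ then
        (idealMu f : ℝ) * SA (aR F) (Y * Ideal.absNorm e / (Ideal.absNorm d₁ * Ideal.absNorm d₂))
        else 0 := by
  have n1 := mem_idLE.1 h₁
  have n2 := mem_idLE.1 h₂
  have hprod := Ideal.sup_mul_inf d₁ d₂
  have hne : d₁ * d₂ ≠ 0 := mul_ne_zero n1.1 n2.1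
  have hg0 : d₁ ⊔ d₂ ≠ 0 := fun h => hne (by rw [← hprod, h, zero_mul])
  have hl0 : d₁ ⊓ d₂ ≠ 0 := fun h => hne (by rw [← hprod, h, mul_zero])
  have hg : d₁ ⊔ d₂ ∈ idLE F N := by
    rw [mem_idLE]
    refine ⟨hg0, le_trans (Nat.le_of_dvd (absNorm_pos' n1.1) ?_) n1.2⟩
    exact Ideal.absNorm_dvd_absNorm_of_le le_sup_left
  have e1 : ∀ e f : Ideal (𝓞 F), (e * f ∣ d₁ ∧ e * f ∣ d₂) ↔ e * f ∣ d₁ ⊔ d₂ := fun e f => by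
    simp only [Ideal.dvd_iff_le, sup_le_iff]
  have e2 : ∀ n : Ideal (𝓞 F), (d₁ ∣ n ∧ d₂ ∣ n) ↔ d₁ ⊓ d₂ ∣ n := fun n => by
    simp only [Ideal.dvd_iff_le, le_inf_iff]
  simp only [e1, e2]
  rw [moebius_inv hg (fun e => SA (aR F) (Y * Ideal.absNorm e /
    (Ideal.absNorm d₁ * Ideal.absNorm d₂))), ← sum_filter, sum_idLE_dvd _ hl0]
  simp only [sum_const, nsmul_eq_mul, mul_one]
  rw [← Nat.floor_div_natCast, SA_aR]
  congr 1
  have hn : (Ideal.absNorm (d₁ ⊔ d₂) : ℝ) * Ideal.absNorm (d₁ ⊓ d₂) =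
      Ideal.absNorm d₁ * Ideal.absNorm d₂ := by
    exact_mod_cast (by rw [← map_mul, hprod, map_mul] :
      Ideal.absNorm (d₁ ⊔ d₂) * Ideal.absNorm (d₁ ⊓ d₂) = Ideal.absNorm d₁ * Ideal.absNorm d₂)
  have p1 : (0:ℝ) < Ideal.absNorm (d₁ ⊔ d₂) := by exact_mod_cast absNorm_pos' hg0
  have p2 : (0:ℝ) < Ideal.absNorm (d₁ ⊓ d₂) := by exact_mod_cast absNorm_pos' hl0
  rw [← hn]
  field_simp

theorem C2_formula {X Y : ℝ} (hX : 0 ≤ X) (hY : 0 ≤ Y) : ((C2 F X Y : ℤ) : ℝ) =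
    ∑ e ∈ Ioc 0 ⌊X⌋₊, aR F e * ∑ f ∈ Ioc 0 ⌊X⌋₊, uR F f *
      ∑ x ∈ Ioc 0 (⌊X⌋₊ / (e * f)), aR F x * ∑ y ∈ Ioc 0 (⌊X⌋₊ / (e * f)), aR F y *
        ((e * f * x : ℝ) * MM F (⌊X⌋₊ / (e * f * x)) * ((e * f * y : ℝ) * MM F (⌊X⌋₊ / (e * f * y)))
          * SA (aR F) (Y / (e * f ^ 2 * x * y))) := by
  set N := ⌊X⌋₊ with hN
  set w : ℕ → ℝ := fun k => (k:ℝ) * MM F (N / k) with hw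
  have h1 : ((C2 F X Y : ℤ) : ℝ) = ∑ d₁ ∈ idLE F N, ∑ d₂ ∈ idLE F N,
      w (Ideal.absNorm d₁) * w (Ideal.absNorm d₂) *
        ∑ n ∈ idLE F ⌊Y⌋₊, (if d₁ ∣ n ∧ d₂ ∣ n then (1:ℝ) else 0) := by
    rw [C2, setOf_eq_idLE Y hY, finsum_mem_coe_finset]
    push_cast
    simp only [inner_sum hX, sq, sum_mul_sum, ← hN]
    rw [sum_comm]
    refine sum_congr rfl fun d₁ _ => ?_
    rw [sum_comm]
    refine sum_congr rfl fun d₂ _ => ?_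
    rw [mul_sum]
    refine sum_congr rfl fun n _ => ?_
    by_cases a1 : d₁ ∣ n <;> by_cases a2 : d₂ ∣ n <;> simp [a1, a2, hw]
  have h2 : ((C2 F X Y : ℤ) : ℝ) = ∑ e ∈ idLE F N, ∑ f ∈ idLE F N, (idealMu f : ℝ) *
      ∑ d₁ ∈ (idLE F N).filter (e * f ∣ ·), ∑ d₂ ∈ (idLE F N).filter (e * f ∣ ·),
        w (Ideal.absNorm d₁) * w (Ideal.absNorm d₂) *
          SA (aR F) (Y * Ideal.absNorm e / (Ideal.absNorm d₁ * Ideal.absNorm d₂)) := by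
    rw [h1]
    have : ∀ d₁ ∈ idLE F N, ∀ d₂ ∈ idLE F N, w (Ideal.absNorm d₁) * w (Ideal.absNorm d₂) *
        ∑ n ∈ idLE F ⌊Y⌋₊, (if d₁ ∣ n ∧ d₂ ∣ n then (1:ℝ) else 0) =
        ∑ e ∈ idLE F N, ∑ f ∈ idLE F N, if e * f ∣ d₁ then (if e * f ∣ d₂ then
          (idealMu f : ℝ) * (w (Ideal.absNorm d₁) * w (Ideal.absNorm d₂) *
          SA (aR F) (Y * Ideal.absNorm e / (Ideal.absNorm d₁ * Ideal.absNorm d₂))) else 0) else 0 := by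
      intro d₁ h₁ d₂ h₂
      rw [count_mult hY h₁ h₂, mul_sum]
      refine sum_congr rfl fun e _ => ?_
      rw [mul_sum]
      refine sum_congr rfl fun f _ => ?_
      by_cases a1 : e * f ∣ d₁ <;> by_cases a2 : e * f ∣ d₂ <;> simp [a1, a2]
      ring
    rw [sum_congr rfl fun d₁ h₁ => sum_congr rfl fun d₂ h₂ => this d₁ h₁ d₂ h₂]
    rw [sum_congr rfl fun d₁ _ => sum_comm, sum_comm]
    refine sum_congr rfl fun e _ => ?_
    rw [sum_congr rfl fun d₁ _ => sum_comm, sum_comm]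
    refine sum_congr rfl fun f _ => ?_
    rw [mul_sum, sum_filter]
    refine sum_congr rfl fun d₁ _ => ?_
    split_ifs with a1
    · rw [mul_sum, sum_filter]
    · simp
  rw [h2, ← sum_idLE]
  refine sum_congr rfl fun e he => ?_
  rw [← sum_idLE_mu]
  refine sum_congr rfl fun f hf => ?_
  congr 1
  have he0 := (mem_idLE.1 he).1
  have hf0 := (mem_idLE.1 hf).1
  have p1 : (0:ℝ) < Ideal.absNorm e := by exact_mod_cast absNorm_pos' he0
  have p2 : (0:ℝ) < Ideal.absNorm f := by exact_mod_cast absNorm_pos' hf0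
  have hef : e * f ≠ 0 := mul_ne_zero he0 hf0
  rw [sum_idLE_dvd _ hef, ← sum_idLE, ← map_mul]
  refine sum_congr rfl fun x hx => ?_
  rw [sum_idLE_dvd _ hef, ← sum_idLE]
  refine sum_congr rfl fun y hy => ?_
  have p3 : (0:ℝ) < Ideal.absNorm x := by exact_mod_cast absNorm_pos' (mem_idLE.1 hx).1
  have p4 : (0:ℝ) < Ideal.absNorm y := by exact_mod_cast absNorm_pos' (mem_idLE.1 hy).1
  simp only [hw, map_mul]
  push_cast
  congr 2
  field_simp

end RS

namespace RS
open Finset MeasureTheory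

/-- The Moebius companion of `a`. -/
structure USetup (a u : ℕ → ℝ) : Prop where
  le : ∀ n, |u n| ≤ a n
  inv : ∀ N : ℕ, 1 ≤ N → ∀ G : ℕ → ℝ,
    ∑ f ∈ Ioc 0 N, u f * ∑ x ∈ Ioc 0 (N / f), a x * G (f * x) = G 1

theorem usetup_aR (F : Type) [Field F] [NumberField F] : USetup (aR F) (uR F) :=
  ⟨abs_uR_le, fun _ hN G => sum_mu_G hN G⟩

/-- The core double sum. -/
noncomputable def TT (a : ℕ → ℝ) (ρ A B W : ℝ) : ℝ :=
  ∑ x ∈ Ioc 0 ⌊A⌋₊, ∑ y ∈ Ioc 0 ⌊B⌋₊, a x * a y * (x * y : ℝ) * EE a ρ (W / (x * y))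

theorem sum_Ioc_div (K x : ℕ) (hx : 0 < x) (H : ℕ → ℝ) {L : ℕ} (hL : K / x ≤ L) :
    ∑ y ∈ Ioc 0 (K / x), H y = ∑ y ∈ Ioc 0 L, if x * y ≤ K then H y else 0 := by
  rw [← sum_filter]
  refine sum_congr ?_ fun _ _ => rfl
  ext y
  simp only [mem_Ioc, mem_filter, Nat.le_div_iff_mul_le hx]
  rw [mul_comm x y]
  constructor
  · rintro ⟨h1, h2⟩
    exact ⟨⟨h1, ((Nat.le_div_iff_mul_le hx).2 h2).trans hL⟩, h2⟩
  · rintro ⟨⟨h1, _⟩, h2⟩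
    exact ⟨h1, h2⟩

theorem sum_hyper_swap (K : ℕ) (H : ℕ → ℕ → ℝ) :
    ∑ x ∈ Ioc 0 K, ∑ y ∈ Ioc 0 (K / x), H x y = ∑ y ∈ Ioc 0 K, ∑ x ∈ Ioc 0 (K / y), H x y := by
  have h1 : ∀ x ∈ Ioc 0 K, ∑ y ∈ Ioc 0 (K / x), H x y =
      ∑ y ∈ Ioc 0 K, if x * y ≤ K then H x y else 0 := fun x hx =>
    sum_Ioc_div K x (mem_Ioc.1 hx).1 _ (Nat.div_le_self _ _)
  have h2 : ∀ y ∈ Ioc 0 K, ∑ x ∈ Ioc 0 (K / y), H x y =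
      ∑ x ∈ Ioc 0 K, if x * y ≤ K then H x y else 0 := fun y hy => by
    rw [sum_Ioc_div K y (mem_Ioc.1 hy).1 _ (Nat.div_le_self _ _)]
    refine sum_congr rfl fun x _ => ?_
    rw [mul_comm]
  rw [sum_congr rfl h1, sum_congr rfl h2, sum_comm]

theorem floor_div_eq (X : ℝ) (k : ℕ) : ⌊X / (k:ℝ)⌋₊ = ⌊X⌋₊ / k := Nat.floor_div_natCast X k

variable {a u : ℕ → ℝ}

/-- The purely arithmetic sum which equals `C2`. -/
noncomputable def CC (a u : ℕ → ℝ) (X Y : ℝ) : ℝ :=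
  ∑ e ∈ Ioc 0 ⌊X⌋₊, a e * ∑ f ∈ Ioc 0 ⌊X⌋₊, u f *
      ∑ x ∈ Ioc 0 (⌊X⌋₊ / (e * f)), a x * ∑ y ∈ Ioc 0 (⌊X⌋₊ / (e * f)), a y *
        ((e * f * x : ℝ) * (∑ n ∈ Ioc 0 (⌊X⌋₊ / (e * f * x)), u n) *
        ((e * f * y : ℝ) * (∑ n ∈ Ioc 0 (⌊X⌋₊ / (e * f * y)), u n))
          * SA a (Y / (e * f ^ 2 * x * y)))

theorem C2_eq_CC {F : Type} [Field F] [NumberField F] {X Y : ℝ} (hX : 0 ≤ X) (hY : 0 ≤ Y) :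
    ((C2 F X Y : ℤ) : ℝ) = CC (aR F) (uR F) X Y := C2_formula hX hY

theorem CC_split (hu : USetup a u) (ρ : ℝ) (X Y : ℝ) : CC a u X Y =
    ρ * Y * ∑ f ∈ Ioc 0 ⌊X⌋₊, u f * ∑ e ∈ Ioc 0 (⌊X⌋₊ / f), a e * e +
    ∑ e ∈ Ioc 0 ⌊X⌋₊, ∑ f ∈ Ioc 0 ⌊X⌋₊, ∑ k ∈ Ioc 0 ⌊X⌋₊, ∑ l ∈ Ioc 0 ⌊X⌋₊,
      a e * u f * u k * u l * (e * f : ℝ) ^ 2 *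
        TT a ρ (X / (e * f * k)) (X / (e * f * l)) (Y / (e * f ^ 2)) := by
  set N := ⌊X⌋₊ with hN
  have key : ∀ e ∈ Ioc 0 N, ∀ f ∈ Ioc 0 N,
      ∑ x ∈ Ioc 0 (N / (e * f)), a x * ∑ y ∈ Ioc 0 (N / (e * f)), a y *
        ((e * f * x : ℝ) * (∑ n ∈ Ioc 0 (N / (e * f * x)), u n) *
        ((e * f * y : ℝ) * (∑ n ∈ Ioc 0 (N / (e * f * y)), u n))
          * SA a (Y / (e * f ^ 2 * x * y))) =
      (if f * e ≤ N then ρ * Y * e else 0) + ∑ k ∈ Ioc 0 N, ∑ l ∈ Ioc 0 N,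
        u k * u l * (e * f : ℝ) ^ 2 *
          TT a ρ (X / (e * f * k)) (X / (e * f * l)) (Y / (e * f ^ 2)) := by
    intro e he f hf
    rw [mem_Ioc] at he hf
    set K := N / (e * f) with hK
    have he0 : (0:ℝ) < e := by exact_mod_cast he.1
    have hf0 : (0:ℝ) < f := by exact_mod_cast hf.1
    have hKx : ∀ x, N / (e * f * x) = K / x := fun x => (Nat.div_div_eq_div_mul _ _ _).symm
    simp only [hKx]
    have e1 : ∑ x ∈ Ioc 0 K, a x * ∑ n ∈ Ioc 0 (K / x), u n = if f * e ≤ N then 1 else 0 := by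
      have h1 : ∑ x ∈ Ioc 0 K, a x * ∑ n ∈ Ioc 0 (K / x), u n =
          ∑ n ∈ Ioc 0 K, u n * ∑ x ∈ Ioc 0 (K / n), a x := by
        simp only [mul_sum]
        rw [sum_hyper_swap]
        exact sum_congr rfl fun n _ => sum_congr rfl fun x _ => mul_comm _ _
      rw [h1]
      split_ifs with h2
      · have hK1 : 1 ≤ K := by
          rw [hK, Nat.le_div_iff_mul_le (Nat.mul_pos he.1 hf.1)]
          rw [one_mul, mul_comm]; exact h2
        simpa using hu.inv K hK1 (fun _ => 1)
      · have hK0 : K = 0 := by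
          rw [hK, Nat.div_eq_zero_iff]
          right
          rw [mul_comm]; omega
        rw [hK0]; simp
    have e2 : ∀ x ∈ Ioc 0 K, a x * ∑ y ∈ Ioc 0 K, a y *
        ((e * f * x : ℝ) * (∑ n ∈ Ioc 0 (K / x), u n) *
        ((e * f * y : ℝ) * (∑ n ∈ Ioc 0 (K / y), u n)) * SA a (Y / (e * f ^ 2 * x * y))) =
        ρ * Y * e * ((a x * ∑ n ∈ Ioc 0 (K / x), u n) * ∑ y ∈ Ioc 0 K, (a y * ∑ n ∈ Ioc 0 (K / y), u n))
        + ∑ y ∈ Ioc 0 K, ∑ n ∈ Ioc 0 (K / x), ∑ m ∈ Ioc 0 (K / y), u n * u m * (e * f : ℝ) ^ 2 *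
          (a x * a y * (x * y : ℝ) * EE a ρ (Y / (e * f ^ 2) / (x * y))) := by
      intro x hx
      rw [mul_sum (Ioc 0 K) _ (a x), mul_sum (Ioc 0 K) _ (a x * ∑ n ∈ Ioc 0 (K / x), u n),
        mul_sum (Ioc 0 K) _ (ρ * Y * e), ← sum_add_distrib]
      refine sum_congr rfl fun y hy => ?_
      have hx0 : (0:ℝ) < x := by exact_mod_cast (mem_Ioc.1 hx).1
      have hy0 : (0:ℝ) < y := by exact_mod_cast (mem_Ioc.1 hy).1
      have e3 : ∑ n ∈ Ioc 0 (K / x), ∑ m ∈ Ioc 0 (K / y), u n * u m * (e * f : ℝ) ^ 2 *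
          (a x * a y * (x * y : ℝ) * EE a ρ (Y / (e * f ^ 2) / (x * y))) =
          (∑ n ∈ Ioc 0 (K / x), u n) * (∑ m ∈ Ioc 0 (K / y), u m) * ((e * f : ℝ) ^ 2 *
          (a x * a y * (x * y : ℝ) * EE a ρ (Y / (e * f ^ 2) / (x * y)))) := by
        rw [sum_mul_sum, sum_mul]
        refine sum_congr rfl fun n _ => ?_
        rw [sum_mul]
        refine sum_congr rfl fun m _ => ?_
        ring
      rw [e3]
      have e4 : (Y / (e * f ^ 2) / (x * y)) = Y / (e * f ^ 2 * x * y) := by field_simp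
      rw [e4, EE]
      field_simp
      ring
    rw [sum_congr rfl e2, sum_add_distrib, ← mul_sum, ← sum_mul, e1]
    congr 1
    · split_ifs <;> simp
    · have e5 : ∀ k ∈ Ioc 0 N, K / k ≤ N := fun k _ => (Nat.div_le_self _ _).trans (Nat.div_le_self _ _)
      have hKN : K ≤ N := Nat.div_le_self _ _
      have fl : ∀ k : ℕ, ⌊X / (e * f * k)⌋₊ = K / k := fun k => by
        rw [← hKx, hN, ← floor_div_eq]; push_cast; rfl
      have e6 : ∀ k ∈ Ioc 0 N, ∀ l ∈ Ioc 0 N, u k * u l * (e * f : ℝ) ^ 2 *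
          TT a ρ (X / (e * f * k)) (X / (e * f * l)) (Y / (e * f ^ 2)) =
          ∑ x ∈ Ioc 0 (K / k), ∑ y ∈ Ioc 0 (K / l), u k * u l * (e * f : ℝ) ^ 2 *
          (a x * a y * (x * y : ℝ) * EE a ρ (Y / (e * f ^ 2) / (x * y))) := by
        intro k _ l _
        rw [TT, fl, fl]
        simp only [mul_sum]
      rw [sum_congr rfl fun k hk => sum_congr rfl fun l hl => e6 k hk l hl]
      have e7 : ∀ H : ℕ → ℝ, (∀ k, K / k = 0 → H k = 0) →
          ∑ k ∈ Ioc 0 N, H k = ∑ k ∈ Ioc 0 K, H k := by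
        intro H hH
        symm
        refine sum_subset (Ioc_subset_Ioc_right hKN) fun k hk hk' => hH k ?_
        rw [mem_Ioc] at hk hk'
        rw [Nat.div_eq_zero_iff]
        omega
      rw [e7 _ (fun k hk => by simp [hk])]
      rw [sum_congr rfl fun k _ => e7 _ (fun l hl => by simp [hl])]
      -- both sides: sums over x,n,y,m
      rw [sum_congr rfl fun x _ => sum_comm, sum_hyper_swap K (fun x n => ∑ y ∈ Ioc 0 K,
        ∑ m ∈ Ioc 0 (K / y), u n * u m * (e * f : ℝ) ^ 2 *
          (a x * a y * (x * y : ℝ) * EE a ρ (Y / (e * f ^ 2) / (x * y))))]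
      refine sum_congr rfl fun n _ => ?_
      rw [sum_comm (s := Ioc 0 K)]
      refine sum_congr rfl fun x _ => ?_
      rw [sum_hyper_swap]
  rw [CC, ← hN]
  rw [sum_congr rfl fun e he => by rw [sum_congr rfl fun f hf => by rw [key e he f hf]]]
  simp only [mul_add, sum_add_distrib]
  congr 1
  · simp only [mul_sum]
    rw [sum_comm]
    refine sum_congr rfl fun f hf => ?_
    rw [sum_Ioc_div N f (mem_Ioc.1 hf).1 _ (Nat.div_le_self _ _)]
    refine sum_congr rfl fun e _ => ?_
    split_ifs <;> ring
  · refine sum_congr rfl fun e _ => ?_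
    rw [mul_sum]
    refine sum_congr rfl fun f _ => ?_
    rw [mul_sum, mul_sum]
    refine sum_congr rfl fun k _ => ?_
    rw [mul_sum, mul_sum]
    refine sum_congr rfl fun l _ => ?_
    ring

end RS

namespace RS
open Finset MeasureTheory

theorem div_bound {ε : ℝ} (hε : 0 < ε) : ∃ C : ℝ, 1 ≤ C ∧ ∀ n : ℕ, n ≠ 0 →
    (n.divisors.card : ℝ) ≤ C * (n:ℝ) ^ ε := by
  set K : ℝ := max 1 (1 / (ε * Real.log 2)) with hK
  have hK1 : 1 ≤ K := le_max_left _ _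
  have hl2 : 0 < Real.log 2 := Real.log_pos (by norm_num)
  have h2 : ∀ v : ℕ, (v:ℝ) + 1 ≤ K * (2:ℝ) ^ (ε * v) := by
    intro v
    have h3 : ε * v * Real.log 2 + 1 ≤ (2:ℝ) ^ (ε * v) := by
      rw [Real.rpow_def_of_pos (by norm_num)]
      have := Real.add_one_le_exp (Real.log 2 * (ε * v))
      linarith
    have h4 : 1 ≤ K * (ε * Real.log 2) := by
      have : 1 / (ε * Real.log 2) ≤ K := le_max_right _ _
      rwa [div_le_iff₀ (by positivity)] at this
    have hv : (0:ℝ) ≤ v := v.cast_nonneg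
    calc (v:ℝ) + 1 ≤ v * (K * (ε * Real.log 2)) + K := by nlinarith
      _ = K * (ε * v * Real.log 2 + 1) := by ring
      _ ≤ _ := by gcongr
  set P : ℕ := ⌈(2:ℝ) ^ (1 / ε)⌉₊ with hP
  have h3 : ∀ p : ℕ, P ≤ p → ∀ v : ℕ, (v:ℝ) + 1 ≤ (p:ℝ) ^ (ε * v) := by
    intro p hp v
    have h4 : (2:ℝ) ^ (1 / ε) ≤ p := (Nat.ceil_le.1 hp)
    have h5 : (2:ℝ) ≤ (p:ℝ) ^ ε := by
      have := Real.rpow_le_rpow (by positivity) h4 hε.le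
      rwa [← Real.rpow_mul (by norm_num), one_div_mul_cancel hε.ne', Real.rpow_one] at this
    rw [Real.rpow_mul (Nat.cast_nonneg _), Real.rpow_natCast]
    have h6 : (2:ℝ) ^ v ≤ ((p:ℝ) ^ ε) ^ v := by gcongr
    have h7 : (v:ℝ) + 1 ≤ (2:ℝ) ^ v := by exact_mod_cast Nat.lt_two_pow_self (n := v)
    linarith
  refine ⟨K ^ P, one_le_pow₀ hK1, fun n hn => ?_⟩
  have e1 : (n:ℝ) ^ ε = ∏ p ∈ n.primeFactors, (p:ℝ) ^ (ε * n.factorization p) := by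
    conv_lhs => rw [← Nat.prod_factorization_pow_eq_self hn]
    rw [Finsupp.prod, Nat.support_factorization, Nat.cast_prod, ← Real.finsetProd_rpow _ _ (fun i _ => by positivity)]
    refine prod_congr rfl fun p _ => ?_
    rw [Nat.cast_pow, ← Real.rpow_natCast, ← Real.rpow_mul (Nat.cast_nonneg _), mul_comm]
  have e2 : ∏ p ∈ n.primeFactors, (if p < P then K else 1) ≤ K ^ P := by
    rw [← prod_filter, prod_const]
    refine pow_le_pow_right₀ hK1 ?_
    calc _ ≤ (range P).card := card_le_card fun p hp => by
          rw [mem_filter] at hp; exact mem_range.2 hp.2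
      _ = P := card_range P
  rw [Nat.card_divisors hn, e1]
  push_cast
  calc ∏ p ∈ n.primeFactors, ((n.factorization p : ℝ) + 1)
      ≤ ∏ p ∈ n.primeFactors, ((if p < P then K else 1) * (p:ℝ) ^ (ε * n.factorization p)) := by
        refine prod_le_prod (fun _ _ => by positivity) fun p hp => ?_
        have hp2 : (2:ℝ) ≤ p := by exact_mod_cast (Nat.prime_of_mem_primeFactors hp).two_le
        split_ifs with h
        · refine (h2 _).trans ?_
          gcongr
        · rw [one_mul]; exact h3 p (not_lt.1 h) _
    _ ≤ _ := by
        rw [prod_mul_distrib]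
        gcongr

theorem ii_of_bdd {f : ℝ → ℝ} (hm : Measurable f) {u v M : ℝ} (hb : ∀ t ∈ Set.uIoc u v, |f t| ≤ M) :
    IntervalIntegrable f volume u v := by
  rw [intervalIntegrable_iff]
  refine Measure.integrableOn_of_bounded (M := M) (by simp) hm.aestronglyMeasurable ?_
  exact (ae_restrict_iff' measurableSet_uIoc).2 (Filter.Eventually.of_forall fun t ht => hb t ht)

/-- substitution `v = w / t`. -/
theorem sub_inv (g : ℝ → ℝ) {w p r : ℝ} (hw : 0 < w) (hp : 0 < p) (hpr : p ≤ r) :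
    ∫ t in p..r, g (w / t) = w * ∫ v in (w / r)..(w / p), g v / v ^ 2 := by
  have hpos : ∀ t ∈ Set.uIcc p r, 0 < t := fun t ht => by
    rw [Set.uIcc_of_le hpr] at ht; exact hp.trans_le ht.1
  have hpos' : ∀ t ∈ Set.Ioo (min p r) (max p r), 0 < t := fun t ht => by
    rw [min_eq_left hpr] at ht; exact hp.trans ht.1
  have h := intervalIntegral.integral_comp_mul_deriv_of_deriv_nonpos (a := p) (b := r)
    (f := fun t => w / t) (f' := fun t => - (w / t ^ 2)) (g := fun v => - (w * (g v / v ^ 2)))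
    (fun t ht => (continuousAt_const.div continuousAt_id (hpos t ht).ne').continuousWithinAt)
    (fun t ht => by
      have := (hasDerivAt_inv (hpos' t ht).ne').const_mul w
      convert! this using 1
      field_simp)
    (fun t ht => by have := hpos' t ht; simp only [Left.neg_nonpos_iff]; positivity)
  rw [intervalIntegral.integral_symm (w / r) (w / p), ← intervalIntegral.integral_neg] at h
  simp only [neg_neg] at h
  rw [intervalIntegral.integral_const_mul] at h
  rw [← h]
  refine intervalIntegral.integral_congr fun t ht => ?_
  have := hpos t ht
  simp only [Function.comp]
  field_simp

namespace Setup
variable {a χ : ℕ → ℝ} {q : ℕ} {ρ c : ℝ}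

theorem a_le (h : Setup a χ q ρ c) {ε : ℝ} (hε : 0 < ε) : ∃ C : ℝ, 1 ≤ C ∧ ∀ n : ℕ, a n ≤ C * (n:ℝ) ^ ε := by
  obtain ⟨C, hC, hd⟩ := div_bound hε
  refine ⟨C, hC, fun n => ?_⟩
  rcases eq_or_ne n 0 with rfl | hn
  · rw [h.zero]; positivity
  · refine le_trans ?_ (hd n hn)
    rw [h.conv n hn]
    calc ∑ d ∈ n.divisors, χ d ≤ ∑ d ∈ n.divisors, (1:ℝ) :=
          sum_le_sum fun d _ => (le_abs_self _).trans (h.bdd d)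
      _ = _ := by simp

theorem rr_le (h : Setup a χ q ρ c) {ε : ℝ} (hε : 0 < ε) : ∃ C : ℝ, 1 ≤ C ∧ ∀ n : ℕ,
    ∑ d ∈ n.divisors, a d * a (n / d) ≤ C * (n:ℝ) ^ ε := by
  obtain ⟨C, hC, hd⟩ := div_bound (by positivity : 0 < ε / 3)
  obtain ⟨D, hD, ha⟩ := h.a_le (by positivity : 0 < ε / 3)
  refine ⟨C * (D * D), by nlinarith [mul_le_mul hD hD zero_le_one (by linarith)], fun n => ?_⟩
  rcases eq_or_ne n 0 with rfl | hn
  · simp; positivity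
  have hn0 : (0:ℝ) < n := by exact_mod_cast Nat.pos_of_ne_zero hn
  have ha' : ∀ d, d ≤ n → a d ≤ D * (n:ℝ) ^ (ε / 3) := fun d hd => by
    refine (ha d).trans ?_
    gcongr
  calc ∑ d ∈ n.divisors, a d * a (n / d)
      ≤ ∑ d ∈ n.divisors, (D * (n:ℝ) ^ (ε / 3)) * (D * (n:ℝ) ^ (ε / 3)) := by
        refine sum_le_sum fun d hd => ?_
        exact mul_le_mul (ha' d (Nat.divisor_le hd)) (ha' _ (Nat.div_le_self _ _)) (h.nonneg _) (by positivity)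
    _ = n.divisors.card * ((D * (n:ℝ) ^ (ε / 3)) * (D * (n:ℝ) ^ (ε / 3))) := by simp
    _ ≤ (C * (n:ℝ) ^ (ε / 3)) * ((D * (n:ℝ) ^ (ε / 3)) * (D * (n:ℝ) ^ (ε / 3))) := by
        gcongr; exact hd n hn
    _ = C * (D * D) * ((n:ℝ) ^ (ε / 3) * (n:ℝ) ^ (ε / 3) * (n:ℝ) ^ (ε / 3)) := by ring
    _ = _ := by
        rw [← Real.rpow_add hn0, ← Real.rpow_add hn0]
        congr 2; ring

theorem rho_nonneg (h : Setup a χ q ρ c) : 0 ≤ ρ := by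
  by_contra hn
  push Not at hn
  have hc := h.cpos
  have h1 : ∀ x : ℝ, 1 ≤ x → x ^ ((2:ℝ)/3) ≤ c / (-ρ) := by
    intro x hx
    have h2 := (abs_le.1 (h.asym x hx)).2
    have h3 : 0 ≤ SA a x := sum_nonneg fun n _ => h.nonneg n
    have h4 : x = x ^ ((2:ℝ)/3) * x ^ ((1:ℝ)/3) := by
      rw [← Real.rpow_add (by linarith)]; norm_num
    have h5 : 0 < x ^ ((1:ℝ)/3) := by positivity
    rw [le_div_iff₀ (by linarith)]
    by_contra h6
    push Not at h6
    have : c * x ^ ((1:ℝ)/3) < x ^ ((2:ℝ)/3) * -ρ * x ^ ((1:ℝ)/3) := by gcongr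
    nlinarith
  have h2 := h1 (max 1 (c / (-ρ) + 1) ^ ((3:ℝ)/2)) (Real.one_le_rpow (le_max_left _ _) (by norm_num))
  rw [← Real.rpow_mul (by positivity)] at h2
  norm_num at h2

theorem E_mean_half (h : Setup a χ q ρ c) {ε : ℝ} (hε : 0 < ε) (hε1 : ε < 1) :
    ∃ C : ℝ, 0 ≤ C ∧ ∀ p z : ℝ, 1/2 ≤ p → p ≤ z → 1 ≤ z →
      ∫ x in p..z, |EE a ρ x| * x ^ (-(5:ℝ)/4) ≤ C * z ^ ε := by
  obtain ⟨C, hC, hE⟩ := h.E_mean hε hε1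
  have hc := h.cpos
  have hρ := h.rho_nonneg
  refine ⟨C + 4 * ρ, by positivity, fun p z hp hpz hz => ?_⟩
  have meas : Measurable fun x => |EE a ρ x| * x ^ (-(5:ℝ)/4) := by
    have := EE_measurable a ρ
    fun_prop
  have hb : ∀ u v : ℝ, 1/2 ≤ u → u ≤ v → IntervalIntegrable (fun x => |EE a ρ x| * x ^ (-(5:ℝ)/4)) volume u v := by
    intro u v hu huv
    refine ii_of_bdd meas (M := ((c + |ρ|) * (max v 1) ^ ((1:ℝ)/3)) * (1/2) ^ (-(5:ℝ)/4)) fun t ht => ?_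
    rw [Set.uIoc_of_le huv] at ht
    have ht0 : 0 < t := by linarith [ht.1]
    rw [abs_mul, abs_abs, abs_of_pos (by positivity : 0 < t ^ (-(5:ℝ)/4))]
    have h1 := h.E_le' ht0.le (ht.2.trans (le_max_left v 1)) (le_max_right _ _)
    have h2 : t ^ (-(5:ℝ)/4) ≤ (1/2) ^ (-(5:ℝ)/4) :=
      Real.rpow_le_rpow_of_nonpos (by norm_num) (by linarith [ht.1]) (by norm_num)
    gcongr
  have step : ∫ x in p..z, |EE a ρ x| * x ^ (-(5:ℝ)/4) ≤ ∫ x in (1/2)..z, |EE a ρ x| * x ^ (-(5:ℝ)/4) := by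
    rw [← intervalIntegral.integral_add_adjacent_intervals (hb (1/2) p le_rfl hp) (hb p z hp hpz)]
    have : 0 ≤ ∫ x in (1/2)..p, |EE a ρ x| * x ^ (-(5:ℝ)/4) :=
      intervalIntegral.integral_nonneg hp fun t ht => by
        have : 0 < t := by linarith [ht.1]
        positivity
    linarith
  refine step.trans ?_
  rw [← intervalIntegral.integral_add_adjacent_intervals (hb (1/2) 1 le_rfl (by norm_num)) (hb 1 z (by norm_num) hz)]
  have h2 := hE z hz
  have h3 : ∫ x in (1/2:ℝ)..1, |EE a ρ x| * x ^ (-(5:ℝ)/4) ≤ ∫ x in (1/2:ℝ)..1, 8 * ρ := by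
    refine intervalIntegral.integral_mono_on_of_le_Ioo (by norm_num) (hb _ _ le_rfl (by norm_num)) (by simp) fun t ht => ?_
    have ht0 : 0 < t := by linarith [ht.1]
    have e : EE a ρ t = - (ρ * t) := by rw [EE, SA_lt_one a ht.2]; ring
    rw [e, abs_neg, abs_of_nonneg (by positivity)]
    have h2 : t ^ (-(5:ℝ)/4) ≤ t ^ (-(3:ℝ)) :=
      Real.rpow_le_rpow_of_exponent_ge ht0 ht.2.le (by norm_num)
    have h4 : t ^ (-(3:ℝ)) ≤ (1/2) ^ (-(3:ℝ)) :=
      Real.rpow_le_rpow_of_nonpos (by norm_num) (by linarith [ht.1]) (by norm_num)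
    have h5 : ((1:ℝ)/2) ^ (-(3:ℝ)) = 8 := by
      rw [Real.rpow_neg (by norm_num)]; norm_num
    have h6 : t ^ (-(5:ℝ)/4) ≤ 8 := by linarith
    calc ρ * t * t ^ (-(5:ℝ)/4) ≤ ρ * 1 * 8 := by gcongr; exact ht.2.le
      _ = _ := by ring
  rw [intervalIntegral.integral_const] at h3
  have h7 : 1 ≤ z ^ ε := Real.one_le_rpow hz hε.le
  simp only [smul_eq_mul] at h3
  nlinarith

/-- discretisation of the mean value of `E`. -/
theorem E_disc (h : Setup a χ q ρ c) {W : ℝ} (hW : 1 ≤ W) {n : ℕ} (hn : 2 ≤ n) (hWn : W ≤ 4 * (n - 1 : ℝ) ^ 2) :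
    |EE a ρ (W / n)| ≤ ∫ t in ((n:ℝ) - 1)..((n:ℝ) + 1), (|EE a ρ (W / t)| + 4 * ρ) := by
  have hc := h.cpos
  have hρ := h.rho_nonneg
  have hn2 : (2:ℝ) ≤ n := by exact_mod_cast hn
  have hn0 : (0:ℝ) < n - 1 := by linarith
  have hn0' : (0:ℝ) < n := by linarith
  have meas : Measurable fun t => |EE a ρ (W / t)| + 4 * ρ := by
    have := EE_measurable a ρ
    have h2 : Measurable fun t : ℝ => EE a ρ (W / t) := this.comp (measurable_const.div measurable_id)
    have h3 : Measurable fun t : ℝ => |EE a ρ (W / t)| := by fun_prop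
    exact h3.add_const _
  have hb : ∀ u v : ℝ, 1 ≤ u → u ≤ v → IntervalIntegrable (fun t => |EE a ρ (W / t)| + 4 * ρ) volume u v := by
    intro u v hu huv
    refine ii_of_bdd meas (M := (c + |ρ|) * W ^ ((1:ℝ)/3) + 4 * ρ) fun t ht => ?_
    rw [Set.uIoc_of_le huv] at ht
    have ht0 : 1 ≤ t := by linarith [ht.1]
    have h1 := h.E_le' (by positivity : 0 ≤ W / t) (div_le_self (by linarith) ht0) hW
    rw [abs_of_nonneg (by positivity)]
    linarith
  have mono : ∀ x y : ℝ, x ≤ y → SA a x ≤ SA a y := fun x y hxy =>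
    sum_le_sum_of_subset_of_nonneg (Ioc_subset_Ioc_right (Nat.floor_mono hxy)) fun i _ _ => h.nonneg i
  have d1 : ∀ t ∈ Set.Icc ((n:ℝ) - 1) n, EE a ρ (W / n) ≤ |EE a ρ (W / t)| + 4 * ρ := by
    intro t ht
    have ht0 : 0 < t := by linarith [ht.1]
    have h1 : W / n ≤ W / t := by gcongr; exact ht.2
    have h2 : W / t ≤ W / n + 4 := by
      rw [div_add' _ _ _ hn0'.ne', div_le_div_iff₀ ht0 hn0']
      have := ht.1; have := ht.2
      nlinarith [mul_le_mul ht.1 ht.1 hn0.le ht0.le]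
    have h3 := mono _ _ h1
    have h4 := le_abs_self (EE a ρ (W / t))
    simp only [EE] at h4 ⊢
    nlinarith
  have d2 : ∀ t ∈ Set.Icc (n:ℝ) ((n:ℝ) + 1), - EE a ρ (W / n) ≤ |EE a ρ (W / t)| + 4 * ρ := by
    intro t ht
    have ht0 : 0 < t := by linarith [ht.1]
    have h1 : W / t ≤ W / n := by gcongr; exact ht.1
    have h2 : W / n ≤ W / t + 4 := by
      rw [div_add' _ _ _ ht0.ne', div_le_div_iff₀ hn0' ht0]
      have := ht.1; have := ht.2
      nlinarith
    have h3 := mono _ _ h1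
    have h4 := neg_abs_le (EE a ρ (W / t))
    simp only [EE] at h4 ⊢
    nlinarith
  rw [← intervalIntegral.integral_add_adjacent_intervals (hb (n - 1) n (by linarith) (by linarith))
    (hb n (n + 1) (by linarith) (by linarith))]
  have p1 : 0 ≤ ∫ t in ((n:ℝ) - 1)..n, (|EE a ρ (W / t)| + 4 * ρ) :=
    intervalIntegral.integral_nonneg (by linarith) fun t _ => by positivity
  have p2 : 0 ≤ ∫ t in (n:ℝ)..((n:ℝ) + 1), (|EE a ρ (W / t)| + 4 * ρ) :=
    intervalIntegral.integral_nonneg (by linarith) fun t _ => by positivity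
  have q1 : EE a ρ (W / n) ≤ ∫ t in ((n:ℝ) - 1)..n, (|EE a ρ (W / t)| + 4 * ρ) := by
    have := intervalIntegral.integral_mono_on (by linarith) (by simp : IntervalIntegrable (fun _ => EE a ρ (W / n)) volume ((n:ℝ) - 1) n)
      (hb (n - 1) n (by linarith) (by linarith)) d1
    simpa using this
  have q2 : - EE a ρ (W / n) ≤ ∫ t in (n:ℝ)..((n:ℝ) + 1), (|EE a ρ (W / t)| + 4 * ρ) := by
    have := intervalIntegral.integral_mono_on (by linarith) (by simp : IntervalIntegrable (fun _ => - EE a ρ (W / n)) volume (n:ℝ) ((n:ℝ) + 1))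
      (hb n (n + 1) (by linarith) (by linarith)) d2
    simpa using this
  exact abs_le.2 ⟨by linarith, by linarith⟩

end Setup
end RS

namespace RS
open Finset MeasureTheory

theorem sum_two_step (f : ℝ → ℝ) (P : ℕ) (hf : ∀ u v : ℝ, (P:ℝ) ≤ u → u ≤ v → IntervalIntegrable f volume u v)
    (Q : ℕ) (hPQ : P ≤ Q) : ∑ n ∈ Ioc P Q, ∫ t in ((n:ℝ) - 1)..((n:ℝ) + 1), f t =
      (∫ t in (P:ℝ)..Q, f t) + ∫ t in ((P:ℝ)+1)..((Q:ℝ)+1), f t := by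
  induction Q, hPQ using Nat.le_induction with
  | base => simp
  | succ Q hPQ ih =>
    have hPQ' : (P:ℝ) ≤ Q := by exact_mod_cast hPQ
    rw [← insert_Ioc_right_eq_Ioc_add_one (by omega), sum_insert (by simp), ih]
    push_cast
    have e1 : (Q:ℝ) + 1 - 1 = Q := by ring
    rw [e1]
    rw [← intervalIntegral.integral_add_adjacent_intervals (hf Q (Q + 1) hPQ' (by linarith))
      (hf (Q+1) (Q + 1 + 1) (by linarith) (by linarith)),
      ← intervalIntegral.integral_add_adjacent_intervals (hf P Q le_rfl hPQ')
        (hf Q (Q+1) hPQ' (by linarith)),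
      ← intervalIntegral.integral_add_adjacent_intervals (hf (P+1) (Q+1) (by linarith) (by linarith))
        (hf (Q+1) (Q+1+1) (by linarith) (by linarith))]
    ring

namespace Setup
variable {a χ : ℕ → ℝ} {q : ℕ} {ρ c : ℝ}

theorem E_sum (h : Setup a χ q ρ c) {ε : ℝ} (hε : 0 < ε) (hε1 : ε < 1) :
    ∃ C : ℝ, 0 ≤ C ∧ ∀ W : ℝ, 1 ≤ W → ∀ P Q : ℕ, 1 ≤ P → W ≤ 4 * (P:ℝ) ^ 2 → (Q:ℝ) ≤ W →
      ∑ n ∈ Ioc P Q, (n:ℝ) ^ (-(3:ℝ)/4) * |EE a ρ (W / n)| ≤ C * W ^ ((1:ℝ)/4 + ε) := by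
  obtain ⟨C, hC, hE⟩ := h.E_mean_half hε hε1
  have hc := h.cpos
  have hρ := h.rho_nonneg
  refine ⟨4 * (C + 32 * ρ), by positivity, fun W hW P Q hP hWP hQW => ?_⟩
  have hW0 : 0 < W := by linarith
  rcases le_or_gt Q P with hQP | hQP
  · rw [Ioc_eq_empty (by omega)]; simp; positivity
  have hP1 : (1:ℝ) ≤ P := by exact_mod_cast hP
  have hPQ : (P:ℝ) < Q := by exact_mod_cast hQP
  have mE : Measurable fun t : ℝ => EE a ρ (W / t) :=
    (EE_measurable a ρ).comp (measurable_const.div measurable_id)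
  set f : ℝ → ℝ := fun t => t ^ (-(3:ℝ)/4) * (|EE a ρ (W / t)| + 4 * ρ) with hf
  have mf : Measurable f := by
    have h3 : Measurable fun t : ℝ => |EE a ρ (W / t)| := by fun_prop
    exact (by fun_prop : Measurable fun t : ℝ => t ^ (-(3:ℝ)/4)).mul (h3.add_const _)
  have hb : ∀ u v : ℝ, (P:ℝ) ≤ u → u ≤ v → IntervalIntegrable f volume u v := by
    intro u v hu huv
    refine ii_of_bdd mf (M := 1 * ((c + |ρ|) * W ^ ((1:ℝ)/3) + 4 * ρ)) fun t ht => ?_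
    rw [Set.uIoc_of_le huv] at ht
    have ht0 : 1 ≤ t := by linarith [ht.1]
    have h1 := h.E_le' (by positivity : 0 ≤ W / t) (div_le_self (by linarith) ht0) hW
    rw [hf, abs_of_nonneg (by positivity)]
    have h2 : t ^ (-(3:ℝ)/4) ≤ 1 := Real.rpow_le_one_of_one_le_of_nonpos ht0 (by norm_num)
    change t ^ (-(3:ℝ)/4) * (|EE a ρ (W / t)| + 4 * ρ) ≤ _
    gcongr
  have f0 : ∀ t, 0 < t → 0 ≤ f t := fun t ht => by rw [hf]; positivity
  have s1 : ∀ n ∈ Ioc P Q, (n:ℝ) ^ (-(3:ℝ)/4) * |EE a ρ (W / n)| ≤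
      2 * ∫ t in ((n:ℝ) - 1)..((n:ℝ) + 1), f t := by
    intro n hn
    rw [mem_Ioc] at hn
    have hnP : (P:ℝ) + 1 ≤ n := by exact_mod_cast hn.1
    have d := h.E_disc hW (n := n) (by omega) (by nlinarith)
    have hn0 : (0:ℝ) < n := by linarith
    calc (n:ℝ) ^ (-(3:ℝ)/4) * |EE a ρ (W / n)| ≤ (n:ℝ) ^ (-(3:ℝ)/4) *
          ∫ t in ((n:ℝ) - 1)..((n:ℝ) + 1), (|EE a ρ (W / t)| + 4 * ρ) := by gcongr
      _ = ∫ t in ((n:ℝ) - 1)..((n:ℝ) + 1), (n:ℝ) ^ (-(3:ℝ)/4) * (|EE a ρ (W / t)| + 4 * ρ) := by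
          rw [intervalIntegral.integral_const_mul]
      _ ≤ ∫ t in ((n:ℝ) - 1)..((n:ℝ) + 1), 2 * f t := by
          refine intervalIntegral.integral_mono_on (by linarith) ?_ ((hb _ _ (by linarith) (by linarith)).const_mul 2) fun t ht => ?_
          · have m3 : Measurable fun t : ℝ => |EE a ρ (W / t)| := by fun_prop
            refine ii_of_bdd ((m3.add_const (4 * ρ)).const_mul _) (M := (n:ℝ) ^ (-(3:ℝ)/4) * ((c + |ρ|) * W ^ ((1:ℝ)/3) + 4 * ρ)) fun t ht => ?_
            rw [Set.uIoc_of_le (by linarith)] at ht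
            have ht0 : 1 ≤ t := by linarith [ht.1]
            have h1 := h.E_le' (by positivity : 0 ≤ W / t) (div_le_self (by linarith) ht0) hW
            rw [abs_of_nonneg (by positivity)]
            gcongr
          · have ht0 : 0 < t := by linarith [ht.1]
            rw [hf]
            have h1 : (n:ℝ) ^ (-(3:ℝ)/4) ≤ 2 * t ^ (-(3:ℝ)/4) := by
              have e : -(3:ℝ)/4 = -(3/4) := by ring
              rw [e, Real.rpow_neg hn0.le, Real.rpow_neg ht0.le, inv_eq_one_div, ← div_eq_mul_inv,
                div_le_div_iff₀ (by positivity) (by positivity), one_mul]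
              calc t ^ ((3:ℝ)/4) ≤ (2 * n) ^ ((3:ℝ)/4) := by
                    apply Real.rpow_le_rpow ht0.le _ (by norm_num); linarith [ht.2]
                _ = 2 ^ ((3:ℝ)/4) * (n:ℝ) ^ ((3:ℝ)/4) := Real.mul_rpow (by norm_num) hn0.le
                _ ≤ 2 * (n:ℝ) ^ ((3:ℝ)/4) := by
                    gcongr
                    conv_rhs => rw [← Real.rpow_one 2]
                    exact Real.rpow_le_rpow_of_exponent_le (by norm_num) (by norm_num)
            rw [← mul_assoc]
            gcongr
      _ = _ := by rw [intervalIntegral.integral_const_mul]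
  have s2 : ∫ t in (P:ℝ)..(Q:ℝ)+1, f t ≤ (C + 32 * ρ) * W ^ ((1:ℝ)/4 + ε) := by
    have i1 : IntervalIntegrable (fun t => t ^ (-(3:ℝ)/4) * |EE a ρ (W / t)|) volume P ((Q:ℝ)+1) := by
      have m3 : Measurable fun t : ℝ => t ^ (-(3:ℝ)/4) * |EE a ρ (W / t)| := by fun_prop
      refine ii_of_bdd m3 (M := 1 * ((c + |ρ|) * W ^ ((1:ℝ)/3))) fun t ht => ?_
      rw [Set.uIoc_of_le (by linarith)] at ht
      have ht0 : 1 ≤ t := by linarith [ht.1]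
      have h1 := h.E_le' (by positivity : 0 ≤ W / t) (div_le_self (by linarith) ht0) hW
      rw [abs_of_nonneg (by positivity)]
      have h2 : t ^ (-(3:ℝ)/4) ≤ 1 := Real.rpow_le_one_of_one_le_of_nonpos ht0 (by norm_num)
      gcongr
    have i2 : IntervalIntegrable (fun t : ℝ => t ^ (-(3:ℝ)/4) * (4 * ρ)) volume P ((Q:ℝ)+1) := by
      apply IntervalIntegrable.mul_const
      apply intervalIntegral.intervalIntegrable_rpow
      right
      rw [Set.uIcc_of_le (by linarith)]
      intro h0; linarith [h0.1]
    have e : ∫ t in (P:ℝ)..(Q:ℝ)+1, f t = (∫ t in (P:ℝ)..(Q:ℝ)+1, t ^ (-(3:ℝ)/4) * |EE a ρ (W / t)|)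
        + ∫ t in (P:ℝ)..(Q:ℝ)+1, t ^ (-(3:ℝ)/4) * (4 * ρ) := by
      rw [← intervalIntegral.integral_add i1 i2]
      simp only [hf, mul_add]
    have b1 : ∫ t in (P:ℝ)..(Q:ℝ)+1, t ^ (-(3:ℝ)/4) * |EE a ρ (W / t)| ≤ C * W ^ ((1:ℝ)/4 + ε) := by
      have e1 : ∫ t in (P:ℝ)..(Q:ℝ)+1, t ^ (-(3:ℝ)/4) * |EE a ρ (W / t)| =
          ∫ t in (P:ℝ)..(Q:ℝ)+1, (fun v => (W / v) ^ (-(3:ℝ)/4) * |EE a ρ v|) (W / t) := by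
        refine intervalIntegral.integral_congr fun t ht => ?_
        rw [Set.uIcc_of_le (by linarith)] at ht
        have : t ≠ 0 := by linarith [ht.1]
        simp only
        rw [div_div_cancel₀ hW0.ne']
      rw [e1, sub_inv (fun v => (W / v) ^ (-(3:ℝ)/4) * |EE a ρ v|) hW0 (p := (P:ℝ)) (r := (Q:ℝ)+1) (by linarith) (by linarith)]
      have hle : W / ((Q:ℝ)+1) ≤ W / P := by gcongr; linarith
      have h12 : 1 / 2 ≤ W / ((Q:ℝ)+1) := by
        rw [div_le_div_iff₀ (by norm_num) (by linarith)]; linarith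
      have e2 : ∫ v in (W / ((Q:ℝ)+1))..(W / P), (W / v) ^ (-(3:ℝ)/4) * |EE a ρ v| / v ^ 2 =
          W ^ (-(3:ℝ)/4) * ∫ v in (W / ((Q:ℝ)+1))..(W / P), |EE a ρ v| * v ^ (-(5:ℝ)/4) := by
        rw [← intervalIntegral.integral_const_mul]
        refine intervalIntegral.integral_congr fun v hv => ?_
        rw [Set.uIcc_of_le hle] at hv
        have hv0 : 0 < v := by linarith [hv.1]
        have e3 : v ^ (-(5:ℝ)/4) = (v ^ (-(3:ℝ)/4))⁻¹ * (v ^ 2)⁻¹ := by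
          rw [← Real.rpow_natCast v 2, ← Real.rpow_neg hv0.le, ← Real.rpow_neg hv0.le, ← Real.rpow_add hv0]; norm_num
        rw [Real.div_rpow hW0.le hv0.le, e3, div_eq_mul_inv, div_eq_mul_inv]
        ring
      rw [e2, ← mul_assoc]
      have e4 : W * W ^ (-(3:ℝ)/4) = W ^ ((1:ℝ)/4) := by
        rw [← Real.rpow_one_add' hW0.le (by norm_num)]; norm_num
      rw [e4]
      have hz : 1 ≤ W / P := by rw [le_div_iff₀ (by linarith)]; linarith
      have h3 := hE _ _ h12 hle hz
      calc W ^ ((1:ℝ)/4) * ∫ v in (W / ((Q:ℝ)+1))..(W / P), |EE a ρ v| * v ^ (-(5:ℝ)/4)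
          ≤ W ^ ((1:ℝ)/4) * (C * (W / P) ^ ε) := by gcongr
        _ ≤ W ^ ((1:ℝ)/4) * (C * W ^ ε) := by
            gcongr; exact div_le_self hW0.le hP1
        _ = _ := by rw [Real.rpow_add hW0]; ring
    have b2 : ∫ t in (P:ℝ)..(Q:ℝ)+1, t ^ (-(3:ℝ)/4) * (4 * ρ) ≤ 32 * ρ * W ^ ((1:ℝ)/4 + ε) := by
      rw [intervalIntegral.integral_mul_const, integral_rpow (Or.inl (by norm_num))]
      have e5 : -(3:ℝ)/4 + 1 = 1/4 := by norm_num
      rw [e5]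
      have h1 : ((Q:ℝ)+1) ^ ((1:ℝ)/4) ≤ 2 * W ^ ((1:ℝ)/4) := by
        calc ((Q:ℝ)+1) ^ ((1:ℝ)/4) ≤ (2 * W) ^ ((1:ℝ)/4) := by
              apply Real.rpow_le_rpow (by positivity) (by linarith) (by norm_num)
          _ = 2 ^ ((1:ℝ)/4) * W ^ ((1:ℝ)/4) := Real.mul_rpow (by norm_num) hW0.le
          _ ≤ _ := by
              gcongr
              conv_rhs => rw [← Real.rpow_one 2]
              exact Real.rpow_le_rpow_of_exponent_le (by norm_num) (by norm_num)
      have h2 : 0 ≤ (P:ℝ) ^ ((1:ℝ)/4) := by positivity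
      have h3 : W ^ ((1:ℝ)/4) ≤ W ^ ((1:ℝ)/4 + ε) := Real.rpow_le_rpow_of_exponent_le hW (by linarith)
      calc (((Q:ℝ)+1) ^ ((1:ℝ)/4) - (P:ℝ) ^ ((1:ℝ)/4)) / (1/4) * (4 * ρ)
          ≤ (2 * W ^ ((1:ℝ)/4 + ε) - 0) / (1/4) * (4 * ρ) := by gcongr; linarith
        _ = _ := by ring
    rw [e]; linarith
  calc ∑ n ∈ Ioc P Q, (n:ℝ) ^ (-(3:ℝ)/4) * |EE a ρ (W / n)|
      ≤ ∑ n ∈ Ioc P Q, 2 * ∫ t in ((n:ℝ) - 1)..((n:ℝ) + 1), f t := sum_le_sum s1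
    _ = 2 * ((∫ t in (P:ℝ)..Q, f t) + ∫ t in ((P:ℝ)+1)..((Q:ℝ)+1), f t) := by
        rw [← mul_sum, sum_two_step f P hb Q hQP.le]
    _ ≤ 2 * ((∫ t in (P:ℝ)..(Q:ℝ)+1, f t) + ∫ t in (P:ℝ)..((Q:ℝ)+1), f t) := by
        have j1 := intervalIntegral.integral_add_adjacent_intervals (hb P Q le_rfl hPQ.le) (hb Q (Q+1) hPQ.le (by linarith))
        have j2 := intervalIntegral.integral_add_adjacent_intervals (hb P (P+1) le_rfl (by linarith)) (hb (P+1) (Q+1) (by linarith) (by linarith))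
        have p1 : 0 ≤ ∫ t in (Q:ℝ)..((Q:ℝ) + 1), f t :=
          intervalIntegral.integral_nonneg (by linarith) fun t ht => f0 t (by linarith [ht.1])
        have p2 : 0 ≤ ∫ t in (P:ℝ)..((P:ℝ) + 1), f t :=
          intervalIntegral.integral_nonneg (by linarith) fun t ht => f0 t (by linarith [ht.1])
        linarith
    _ ≤ _ := by linarith

end Setup
end RS

namespace RS
open Finset MeasureTheory

theorem sum_regroup (S : Finset (ℕ × ℕ)) (P Q : ℕ) (hS : ∀ p ∈ S, P < p.1 * p.2 ∧ p.1 * p.2 ≤ Q)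
    (G : ℕ → ℕ → ℝ) (hG : ∀ x y, 0 ≤ G x y) :
    ∑ p ∈ S, G p.1 p.2 ≤ ∑ n ∈ Ioc P Q, ∑ d ∈ n.divisors, G d (n / d) := by
  rw [← sum_fiberwise_of_maps_to (t := Ioc P Q) (g := fun p => p.1 * p.2) (fun p hp => mem_Ioc.2 (hS p hp))]
  refine sum_le_sum fun n hn => ?_
  rw [← Nat.sum_divisorsAntidiagonal (fun x y => G x y)]
  refine sum_le_sum_of_subset_of_nonneg (fun p hp => ?_) fun p _ _ => hG _ _
  rw [mem_filter] at hp
  rw [Nat.mem_divisorsAntidiagonal]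
  have := (mem_Ioc.1 hn).1
  exact ⟨hp.2, by omega⟩

theorem TT_zero (a : ℕ → ℝ) (ρ : ℝ) {A B : ℝ} (W : ℝ) (hAB : A < 1 ∨ B < 1) : TT a ρ A B W = 0 := by
  rw [TT]
  rcases hAB with h | h
  · rw [Nat.floor_eq_zero.2 h]; simp
  · rw [Nat.floor_eq_zero.2 h]; simp

theorem TT_comm (a : ℕ → ℝ) (ρ A B W : ℝ) : TT a ρ A B W = TT a ρ B A W := by
  rw [TT, TT, sum_comm]
  refine sum_congr rfl fun x _ => sum_congr rfl fun y _ => ?_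
  rw [mul_comm (x:ℝ) y]; ring

namespace Setup
variable {a χ : ℕ → ℝ} {q : ℕ} {ρ c : ℝ}

theorem triv0 (h : Setup a χ q ρ c) : ∃ C : ℝ, 0 ≤ C ∧ ∀ A B W : ℝ, 0 < A → 0 < B → A * B ≤ W →
    |TT a ρ A B W| ≤ C * ((A * B) ^ ((5:ℝ)/3) * W ^ ((1:ℝ)/3)) := by
  have hc := h.cpos
  refine ⟨c * (c + |ρ|) ^ 2, by positivity, fun A B W hA hB hW => ?_⟩
  have hAB : 0 < A * B := by positivity
  have hW0 : 0 < W := by linarith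
  by_cases h1 : A < 1 ∨ B < 1
  · rw [TT_zero a ρ W h1, abs_zero]; positivity
  push Not at h1
  have key : ∀ x ∈ Ioc 0 ⌊A⌋₊, ∀ y ∈ Ioc 0 ⌊B⌋₊, |a x * a y * (x * y : ℝ) * EE a ρ (W / (x * y))| ≤
      a x * (a y * (c * ((A * B) ^ ((2:ℝ)/3) * W ^ ((1:ℝ)/3)))) := by
    intro x hx y hy
    rw [mem_Ioc] at hx hy
    have hx0 : (0:ℝ) < x := by exact_mod_cast hx.1
    have hy0 : (0:ℝ) < y := by exact_mod_cast hy.1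
    have hxA : (x:ℝ) ≤ A := (Nat.le_floor_iff hA.le).1 hx.2
    have hyB : (y:ℝ) ≤ B := (Nat.le_floor_iff hB.le).1 hy.2
    have hxy : (x * y : ℝ) ≤ A * B := by gcongr
    have hxy0 : (0:ℝ) < x * y := by positivity
    have hE := h.E_le (t := W / (x * y)) (by rw [le_div_iff₀ hxy0]; linarith)
    rw [abs_mul, abs_of_nonneg (mul_nonneg (mul_nonneg (h.nonneg x) (h.nonneg y)) hxy0.le)]
    have e1 : (x * y : ℝ) * (W / (x * y)) ^ ((1:ℝ)/3) = (x * y : ℝ) ^ ((2:ℝ)/3) * W ^ ((1:ℝ)/3) := by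
      rw [Real.div_rpow hW0.le hxy0.le]
      have : (x * y : ℝ) = (x * y : ℝ) ^ ((2:ℝ)/3) * (x * y : ℝ) ^ ((1:ℝ)/3) := by
        rw [← Real.rpow_add hxy0]; norm_num
      have h3 : (x * y : ℝ) ^ ((1:ℝ)/3) ≠ 0 := by positivity
      field_simp
      rw [mul_comm (_ ^ _)]; exact this
    have hax := h.nonneg x
    have hay := h.nonneg y
    calc a x * a y * (x * y : ℝ) * |EE a ρ (W / (x * y))| ≤ a x * a y * (x * y : ℝ) * (c * (W / (x * y)) ^ ((1:ℝ)/3)) := by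
          gcongr
      _ = a x * (a y * (c * ((x * y : ℝ) * (W / (x * y)) ^ ((1:ℝ)/3)))) := by ring
      _ ≤ _ := by rw [e1]; gcongr
  calc |TT a ρ A B W| ≤ ∑ x ∈ Ioc 0 ⌊A⌋₊, ∑ y ∈ Ioc 0 ⌊B⌋₊,
        a x * (a y * (c * ((A * B) ^ ((2:ℝ)/3) * W ^ ((1:ℝ)/3)))) := by
        rw [TT]
        refine (abs_sum_le_sum_abs _ _).trans (sum_le_sum fun x hx => ?_)
        exact (abs_sum_le_sum_abs _ _).trans (sum_le_sum fun y hy => key x hx y hy)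
    _ = SA a A * (SA a B * (c * ((A * B) ^ ((2:ℝ)/3) * W ^ ((1:ℝ)/3)))) := by
        rw [SA, SA, sum_mul]
        refine sum_congr rfl fun x _ => ?_
        rw [sum_mul, mul_sum]
    _ ≤ ((c + |ρ|) * A) * (((c + |ρ|) * B) * (c * ((A * B) ^ ((2:ℝ)/3) * W ^ ((1:ℝ)/3)))) := by
        have h2 := h.SA_le h1.1
        have h3 := h.SA_le h1.2
        have h4 : 0 ≤ SA a B := sum_nonneg fun n _ => h.nonneg n
        gcongr
    _ = c * (c + |ρ|) ^ 2 * ((A * B) * (A * B) ^ ((2:ℝ)/3) * W ^ ((1:ℝ)/3)) := by ring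
    _ = _ := by
        rw [← Real.rpow_one_add' hAB.le (by norm_num)]; norm_num

theorem triv (h : Setup a χ q ρ c) {ε : ℝ} (hε : 0 < ε) (hε1 : ε < 1) :
    ∃ C : ℝ, 0 ≤ C ∧ ∀ A B W : ℝ, 0 < A → 0 < B → A * B ≤ W →
    |TT a ρ A B W| ≤ C * W ^ ε * ((A * B) ^ ((7:ℝ)/4) * W ^ ((1:ℝ)/4) +
      (A * B) ^ ((5:ℝ)/4) * W ^ ((13:ℝ)/24)) := by
  have hc := h.cpos
  obtain ⟨C1, hC1, hE⟩ := h.E_sum (by positivity : 0 < ε / 2) (by linarith)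
  obtain ⟨C2, hC2, hr⟩ := h.rr_le (by positivity : 0 < ε / 2)
  refine ⟨C2 * C1 + C2 * c, by positivity, fun A B W hA hB hW => ?_⟩
  have hAB : 0 < A * B := by positivity
  have hW0 : 0 < W := by linarith
  by_cases h1 : A < 1 ∨ B < 1
  · rw [TT_zero a ρ W h1, abs_zero]; positivity
  push Not at h1
  have hAB1 : 1 ≤ A * B := by nlinarith
  have hW1 : 1 ≤ W := by linarith
  set N := ⌊A * B⌋₊ with hN
  set P := ⌊√W⌋₊ with hP
  have hsW : 1 ≤ √W := Real.one_le_sqrt.2 hW1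
  have hP1 : 1 ≤ P := Nat.le_floor (by simpa using hsW)
  have hPR : (1:ℝ) ≤ P := by exact_mod_cast hP1
  have hNle : (N:ℝ) ≤ A * B := Nat.floor_le hAB.le
  have hPle : (P:ℝ) ≤ √W := Nat.floor_le (by linarith)
  have hWP : W ≤ 4 * (P:ℝ) ^ 2 := by
    have : √W < P + 1 := Nat.lt_floor_add_one _
    calc W = √W ^ 2 := (Real.sq_sqrt hW0.le).symm
      _ ≤ (2 * P) ^ 2 := by gcongr; linarith
      _ = _ := by ring
  have s1 : |TT a ρ A B W| ≤ ∑ n ∈ Ioc 0 N, (∑ d ∈ n.divisors, a d * a (n / d)) * (n * |EE a ρ (W / n)|) := by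
    have hG := sum_regroup (Ioc 0 ⌊A⌋₊ ×ˢ Ioc 0 ⌊B⌋₊) 0 N (by
      rintro ⟨x, y⟩ hp
      rw [mem_product, mem_Ioc, mem_Ioc] at hp
      refine ⟨Nat.mul_pos hp.1.1 hp.2.1, Nat.le_floor ?_⟩
      push_cast
      have hxA : (x:ℝ) ≤ A := (Nat.le_floor_iff hA.le).1 hp.1.2
      have hyB : (y:ℝ) ≤ B := (Nat.le_floor_iff hB.le).1 hp.2.2
      show (x:ℝ) * y ≤ _
      gcongr)
      (fun x y => a x * a y * ((x * y : ℕ) * |EE a ρ (W / (x * y : ℕ))|))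
      (fun x y => mul_nonneg (mul_nonneg (h.nonneg x) (h.nonneg y)) (by positivity))
    refine le_trans ?_ (hG.trans (le_of_eq ?_))
    · rw [sum_product, TT]
      refine (abs_sum_le_sum_abs _ _).trans (sum_le_sum fun x hx => ?_)
      refine (abs_sum_le_sum_abs _ _).trans (sum_le_sum fun y hy => ?_)
      rw [abs_mul, abs_of_nonneg (mul_nonneg (mul_nonneg (h.nonneg x) (h.nonneg y)) (by positivity))]
      push_cast
      apply le_of_eq; ring
    · refine sum_congr rfl fun n _ => ?_
      rw [sum_mul]
      refine sum_congr rfl fun d hd => ?_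
      rw [Nat.mul_div_cancel' (Nat.dvd_of_mem_divisors hd)]
  have s2 : ∀ n : ℕ, n ∈ Ioc 0 N → (∑ d ∈ n.divisors, a d * a (n / d)) * (n * |EE a ρ (W / n)|) ≤
      C2 * W ^ (ε/2) * (n * |EE a ρ (W / n)|) := by
    intro n hn
    have : (n:ℝ) ≤ W := by
      have : (n:ℝ) ≤ N := by exact_mod_cast (mem_Ioc.1 hn).2
      linarith
    have h2 : (n:ℝ) ^ (ε/2) ≤ W ^ (ε/2) := Real.rpow_le_rpow (by positivity) this (by positivity)
    have := hr n
    have h3 : ∑ d ∈ n.divisors, a d * a (n / d) ≤ C2 * W ^ (ε/2) := this.trans (by gcongr)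
    gcongr
  have hWε : W ^ (ε/2) * W ^ (ε/2) = W ^ ε := by rw [← Real.rpow_add hW0]; ring_nf
  have s3 : ∑ n ∈ Ioc P N, (n:ℝ) * |EE a ρ (W / n)| ≤ C1 * W ^ (ε/2) * ((A * B) ^ ((7:ℝ)/4) * W ^ ((1:ℝ)/4)) := by
    have := hE W hW1 P N hP1 hWP (by linarith)
    calc ∑ n ∈ Ioc P N, (n:ℝ) * |EE a ρ (W / n)| ≤ ∑ n ∈ Ioc P N, (A * B) ^ ((7:ℝ)/4) * ((n:ℝ) ^ (-(3:ℝ)/4) * |EE a ρ (W / n)|) := by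
          refine sum_le_sum fun n hn => ?_
          rw [mem_Ioc] at hn
          have hn0 : (0:ℝ) < n := by exact_mod_cast (by omega : 0 < n)
          have hnN : (n:ℝ) ≤ N := by exact_mod_cast hn.2
          rw [← mul_assoc]
          have : (n:ℝ) = (n:ℝ) ^ ((7:ℝ)/4) * (n:ℝ) ^ (-(3:ℝ)/4) := by
            rw [← Real.rpow_add hn0]; norm_num
          have h4 : (n:ℝ) ≤ (A * B) ^ ((7:ℝ)/4) * (n:ℝ) ^ (-(3:ℝ)/4) := by
            nth_rewrite 1 [this]
            gcongr; linarith
          gcongr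
      _ ≤ (A * B) ^ ((7:ℝ)/4) * (C1 * W ^ ((1:ℝ)/4 + ε/2)) := by rw [← mul_sum]; gcongr
      _ = _ := by rw [Real.rpow_add hW0]; ring
  have s4 : ∑ n ∈ Ioc 0 (min P N), (n:ℝ) * |EE a ρ (W / n)| ≤ c * ((A * B) ^ ((5:ℝ)/4) * W ^ ((13:ℝ)/24)) := by
    set m := min P N with hm
    have hmN : (m:ℝ) ≤ A * B := le_trans (by exact_mod_cast min_le_right _ _) hNle
    have hmP : (m:ℝ) ≤ √W := le_trans (by exact_mod_cast min_le_left _ _) hPle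
    calc ∑ n ∈ Ioc 0 m, (n:ℝ) * |EE a ρ (W / n)| ≤ ∑ n ∈ Ioc 0 m, c * (W ^ ((1:ℝ)/3) * (m:ℝ) ^ ((2:ℝ)/3)) := by
          refine sum_le_sum fun n hn => ?_
          rw [mem_Ioc] at hn
          have hn0 : (0:ℝ) < n := by exact_mod_cast hn.1
          have hnm : (n:ℝ) ≤ m := by exact_mod_cast hn.2
          have hE := h.E_le (t := W / n) (by rw [le_div_iff₀ hn0]; linarith)
          have e1 : (n:ℝ) * (W / n) ^ ((1:ℝ)/3) = W ^ ((1:ℝ)/3) * (n : ℝ) ^ ((2:ℝ)/3) := by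
            rw [Real.div_rpow hW0.le hn0.le]
            have : (n : ℝ) = (n : ℝ) ^ ((2:ℝ)/3) * (n : ℝ) ^ ((1:ℝ)/3) := by
              rw [← Real.rpow_add hn0]; norm_num
            have h3 : (n : ℝ) ^ ((1:ℝ)/3) ≠ 0 := by positivity
            field_simp
            rw [mul_comm (_ ^ _)]; exact this
          calc (n:ℝ) * |EE a ρ (W / n)| ≤ n * (c * (W / n) ^ ((1:ℝ)/3)) := by gcongr
            _ = c * (n * (W / n) ^ ((1:ℝ)/3)) := by ring
            _ ≤ _ := by rw [e1]; gcongr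
      _ = c * (W ^ ((1:ℝ)/3) * (m * (m:ℝ) ^ ((2:ℝ)/3))) := by simp; ring
      _ = c * (W ^ ((1:ℝ)/3) * ((m:ℝ) ^ ((5:ℝ)/4) * (m:ℝ) ^ ((5:ℝ)/12))) := by
          rw [← Real.rpow_one_add' (by positivity) (by norm_num), ← Real.rpow_add_of_nonneg (by positivity) (by norm_num) (by norm_num)]
          norm_num
      _ ≤ c * (W ^ ((1:ℝ)/3) * ((A * B) ^ ((5:ℝ)/4) * (√W) ^ ((5:ℝ)/12))) := by gcongr
      _ = _ := by
          rw [Real.sqrt_eq_rpow, ← Real.rpow_mul hW0.le]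
          have : W ^ ((13:ℝ)/24) = W ^ ((1:ℝ)/3) * W ^ ((1:ℝ)/2 * (5/12)) := by
            rw [← Real.rpow_add hW0]; norm_num
          rw [this]; ring
  calc |TT a ρ A B W| ≤ ∑ n ∈ Ioc 0 N, C2 * W ^ (ε/2) * (n * |EE a ρ (W / n)|) := s1.trans (sum_le_sum s2)
    _ ≤ ∑ n ∈ Ioc 0 (min P N) ∪ Ioc P N, C2 * W ^ (ε/2) * (n * |EE a ρ (W / n)|) := by
        refine sum_le_sum_of_subset_of_nonneg (fun n hn => ?_) fun _ _ _ => by positivity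
        rw [mem_union, mem_Ioc, mem_Ioc]
        rw [mem_Ioc] at hn
        omega
    _ ≤ ∑ n ∈ Ioc 0 (min P N), C2 * W ^ (ε/2) * (n * |EE a ρ (W / n)|) + ∑ n ∈ Ioc P N, C2 * W ^ (ε/2) * (n * |EE a ρ (W / n)|) := by
        rw [← sum_union_inter]
        exact le_add_of_nonneg_right (sum_nonneg fun _ _ => by positivity)
    _ ≤ C2 * W ^ (ε/2) * (c * ((A * B) ^ ((5:ℝ)/4) * W ^ ((13:ℝ)/24))) +
        C2 * W ^ (ε/2) * (C1 * W ^ (ε/2) * ((A * B) ^ ((7:ℝ)/4) * W ^ ((1:ℝ)/4))) := by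
        rw [← mul_sum, ← mul_sum]; gcongr
    _ = C2 * c * W ^ (ε/2) * ((A * B) ^ ((5:ℝ)/4) * W ^ ((13:ℝ)/24)) +
        C2 * C1 * W ^ ε * ((A * B) ^ ((7:ℝ)/4) * W ^ ((1:ℝ)/4)) := by rw [← hWε]; ring
    _ ≤ C2 * c * W ^ ε * ((A * B) ^ ((5:ℝ)/4) * W ^ ((13:ℝ)/24)) +
        C2 * C1 * W ^ ε * ((A * B) ^ ((7:ℝ)/4) * W ^ ((1:ℝ)/4)) := by
        have : W ^ (ε/2) ≤ W ^ ε := Real.rpow_le_rpow_of_exponent_le hW1 (by linarith)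
        gcongr
    _ ≤ _ := by
        have p1 : 0 ≤ C2 * c * W ^ ε * ((A * B) ^ ((7:ℝ)/4) * W ^ ((1:ℝ)/4)) := by positivity
        have p2 : 0 ≤ C2 * C1 * W ^ ε * ((A * B) ^ ((5:ℝ)/4) * W ^ ((13:ℝ)/24)) := by positivity
        linarith

end Setup
end RS

namespace RS
open Finset MeasureTheory

theorem inner_D (a : ℕ → ℝ) (ρ γ : ℝ) {w B : ℝ} (hB : 1 ≤ B) (hw : B ≤ w) :
    ∫ t in (1:ℝ)..B, t * (EE a ρ (w / t) - γ) = D1 a ρ γ w / w - B ^ 3 * D1 a ρ γ (w / B) / w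
      + 3 / w * ∫ t in (1:ℝ)..B, t ^ 2 * D1 a ρ γ (w / t) := by
  have hB0 : 0 < B := by linarith
  have hw0 : 0 < w := by linarith
  have h1 : 1 ≤ w / B := by rwa [le_div_iff₀ hB0, one_mul]
  have h2 : w / B ≤ w := div_le_self hw0.le hB
  have e1 : ∫ t in (1:ℝ)..B, t * (EE a ρ (w / t) - γ) =
      ∫ t in (1:ℝ)..B, (fun v => (w / v) * (EE a ρ v - γ)) (w / t) := by
    refine intervalIntegral.integral_congr fun t ht => ?_
    simp only
    rw [div_div_cancel₀ hw0.ne']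
  have e2 : ∫ t in (1:ℝ)..B, t ^ 2 * D1 a ρ γ (w / t) =
      ∫ t in (1:ℝ)..B, (fun v => (w / v) ^ 2 * D1 a ρ γ v) (w / t) := by
    refine intervalIntegral.integral_congr fun t ht => ?_
    simp only
    rw [div_div_cancel₀ hw0.ne']
  rw [e1, e2, sub_inv (fun v => (w / v) * (EE a ρ v - γ)) hw0 one_pos hB,
    sub_inv (fun v => (w / v) ^ 2 * D1 a ρ γ v) hw0 one_pos hB, div_one]
  have hpos : ∀ v ∈ Set.uIcc (w / B) w, 0 < v := fun v hv => by
    rw [Set.uIcc_of_le h2] at hv; linarith [hv.1]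
  have e3 : ∫ v in (w / B)..w, w / v * (EE a ρ v - γ) / v ^ 2 =
      w * ∫ v in (w / B)..w, (v ^ 3)⁻¹ * (EE a ρ v - γ) := by
    rw [← intervalIntegral.integral_const_mul]
    refine intervalIntegral.integral_congr fun v hv => ?_
    have := hpos v hv
    try simp only
    field_simp
  have e4 : ∫ v in (w / B)..w, (w / v) ^ 2 * D1 a ρ γ v / v ^ 2 =
      w ^ 2 * ∫ v in (w / B)..w, (v ^ 4)⁻¹ * D1 a ρ γ v := by
    rw [← intervalIntegral.integral_const_mul]
    refine intervalIntegral.integral_congr fun v hv => ?_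
    have := hpos v hv
    try simp only
    field_simp
  have hp := D_parts a ρ γ h1 h2 (fun v => (v ^ 3)⁻¹) (fun v => -3 * (v ^ 4)⁻¹)
    (fun x hx => by
      have hx0 : x ≠ 0 := by linarith
      have := (hasDerivAt_pow 3 x).inv (pow_ne_zero 3 hx0)
      convert! this using 1
      field_simp
      norm_num)
    (ContinuousOn.mul continuousOn_const (ContinuousOn.inv₀ (by fun_prop) fun x hx => by
      have : (1:ℝ) ≤ x := hx
      positivity))
  have e5 : ∫ x in (w / B)..w, -3 * (x ^ 4)⁻¹ * D1 a ρ γ x = -3 * ∫ x in (w / B)..w, (x ^ 4)⁻¹ * D1 a ρ γ x := by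
    rw [← intervalIntegral.integral_const_mul]
    simp only [mul_assoc]
  rw [e3, e4, hp, e5]
  field_simp
  ring

namespace Setup
variable {a χ : ℕ → ℝ} {q : ℕ} {ρ c : ℝ}

theorem K_bound (h : Setup a χ q ρ c) : ∃ C : ℝ, 0 ≤ C ∧ ∀ A z : ℝ, 1 ≤ A → A ≤ z →
    |∫ u in (1:ℝ)..A, u ^ 2 * D1 a ρ (-kap χ q / 2) (z / u)| ≤ C * (z ^ ((1:ℝ)/2) * A ^ ((5:ℝ)/2)) := by
  obtain ⟨C, hC, hD⟩ := h.D2_le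
  set γ := -kap χ q / 2
  refine ⟨6 * C, by positivity, fun A z hA hz => ?_⟩
  have hA0 : 0 < A := by linarith
  have hz0 : 0 < z := by linarith
  have h1 : 1 ≤ z / A := by rwa [le_div_iff₀ hA0, one_mul]
  have h2 : z / A ≤ z := div_le_self hz0.le hA
  have hpos : ∀ v ∈ Set.uIcc (z / A) z, 0 < v := fun v hv => by
    rw [Set.uIcc_of_le h2] at hv; linarith [hv.1]
  have e2 : ∫ u in (1:ℝ)..A, u ^ 2 * D1 a ρ γ (z / u) =
      ∫ u in (1:ℝ)..A, (fun v => (z / v) ^ 2 * D1 a ρ γ v) (z / u) := by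
    refine intervalIntegral.integral_congr fun t ht => ?_
    simp only
    rw [div_div_cancel₀ hz0.ne']
  have e4 : ∫ v in (z / A)..z, (z / v) ^ 2 * D1 a ρ γ v / v ^ 2 =
      z ^ 2 * ∫ v in (z / A)..z, (v ^ 4)⁻¹ * D1 a ρ γ v := by
    rw [← intervalIntegral.integral_const_mul]
    refine intervalIntegral.integral_congr fun v hv => ?_
    have := hpos v hv
    try simp only
    field_simp
  rw [e2, sub_inv (fun v => (z / v) ^ 2 * D1 a ρ γ v) hz0 one_pos hA, div_one, e4]
  have hp := D1_parts a ρ γ h1 h2 (fun v => (v ^ 4)⁻¹) (fun v => -4 * (v ^ 5)⁻¹)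
    (fun x hx => by
      have hx0 : x ≠ 0 := by linarith
      have := (hasDerivAt_pow 4 x).inv (pow_ne_zero 4 hx0)
      convert! this using 1
      field_simp
      norm_num)
    (ContinuousOn.mul continuousOn_const (ContinuousOn.inv₀ (by fun_prop) fun x hx => by
      have : (1:ℝ) ≤ x := hx
      positivity))
  have pw : ∀ (v : ℝ) (k : ℕ), 0 < v → (v ^ k)⁻¹ * v ^ ((3:ℝ)/2) = v ^ ((3:ℝ)/2 - k) := by
    intro v k hv
    rw [← Real.rpow_natCast, ← Real.rpow_neg hv.le, ← Real.rpow_add hv]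
    congr 1; ring
  have b1 : |(z ^ 4)⁻¹ * D2 a ρ γ z| ≤ C * (z / A) ^ (-(5:ℝ)/2) := by
    rw [abs_mul, abs_of_pos (by positivity)]
    calc (z ^ 4)⁻¹ * |D2 a ρ γ z| ≤ (z ^ 4)⁻¹ * (C * z ^ ((3:ℝ)/2)) := by gcongr; exact hD z (by linarith)
      _ = C * ((z ^ 4)⁻¹ * z ^ ((3:ℝ)/2)) := by ring
      _ = C * z ^ (-(5:ℝ)/2) := by rw [pw z 4 hz0]; norm_num
      _ ≤ _ := mul_le_mul_of_nonneg_left (Real.rpow_le_rpow_of_nonpos (by positivity) h2 (by norm_num)) hC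
  have b2 : |((z / A) ^ 4)⁻¹ * D2 a ρ γ (z / A)| ≤ C * (z / A) ^ (-(5:ℝ)/2) := by
    rw [abs_mul, abs_of_pos (by positivity)]
    calc ((z / A) ^ 4)⁻¹ * |D2 a ρ γ (z / A)| ≤ ((z / A) ^ 4)⁻¹ * (C * (z / A) ^ ((3:ℝ)/2)) := by gcongr; exact hD _ h1
      _ = C * (((z / A) ^ 4)⁻¹ * (z / A) ^ ((3:ℝ)/2)) := by ring
      _ = C * (z / A) ^ (-(5:ℝ)/2) := by rw [pw (z / A) 4 (by positivity)]; norm_num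
  have b3 : |∫ x in (z / A)..z, -4 * (x ^ 5)⁻¹ * D2 a ρ γ x| ≤ 2 * C * (z / A) ^ (-(5:ℝ)/2) := by
    have i1 : ‖∫ x in (z / A)..z, -4 * (x ^ 5)⁻¹ * D2 a ρ γ x‖ ≤ ∫ x in (z / A)..z, 4 * C * x ^ (-(7:ℝ)/2) := by
      refine intervalIntegral.norm_integral_le_of_norm_le h2 (Filter.Eventually.of_forall fun x hx => ?_) ?_
      · have hx0 : 0 < x := by linarith [hx.1]
        rw [Real.norm_eq_abs, abs_mul, abs_mul, abs_neg, abs_of_pos (by positivity : 0 < (x ^ 5)⁻¹)]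
        have h4 : |(4:ℝ)| = 4 := by norm_num
        rw [h4]
        calc 4 * (x ^ 5)⁻¹ * |D2 a ρ γ x| ≤ 4 * (x ^ 5)⁻¹ * (C * x ^ ((3:ℝ)/2)) := by
              gcongr; exact hD x (by linarith [hx.1])
          _ = 4 * C * ((x ^ 5)⁻¹ * x ^ ((3:ℝ)/2)) := by ring
          _ = _ := by rw [pw x 5 hx0]; norm_num
      · apply IntervalIntegrable.const_mul
        apply intervalIntegral.intervalIntegrable_rpow
        right
        intro h0
        exact absurd (hpos 0 h0) (lt_irrefl _)
    rw [Real.norm_eq_abs] at i1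
    refine i1.trans ?_
    rw [intervalIntegral.integral_const_mul, integral_rpow (Or.inr ⟨by norm_num, fun h0 => absurd (hpos 0 h0) (lt_irrefl _)⟩)]
    have e6 : -(7:ℝ)/2 + 1 = -(5:ℝ)/2 := by norm_num
    rw [e6]
    have p1 : 0 ≤ z ^ (-(5:ℝ)/2) := by positivity
    have p2 : 0 ≤ (z / A) ^ (-(5:ℝ)/2) := by positivity
    have e7 : (z ^ (-(5:ℝ)/2) - (z / A) ^ (-(5:ℝ)/2)) / (-5/2) = 2/5 * ((z / A) ^ (-(5:ℝ)/2) - z ^ (-(5:ℝ)/2)) := by ring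
    rw [e7]
    nlinarith [mul_nonneg hC p1, mul_nonneg hC p2]
  have e8 : z * z ^ 2 * (z / A) ^ (-(5:ℝ)/2) = z ^ ((1:ℝ)/2) * A ^ ((5:ℝ)/2) := by
    have e9 : -(5:ℝ)/2 = -(5/2) := by ring
    rw [Real.div_rpow hz0.le hA0.le, e9, Real.rpow_neg hA0.le, div_inv_eq_mul, ← mul_assoc]
    congr 1
    rw [← pow_succ', ← Real.rpow_natCast, ← Real.rpow_add hz0]
    norm_num
  rw [hp, ← mul_assoc, abs_mul, abs_of_pos (by positivity : 0 < z * z ^ 2), ← e8]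
  calc z * z ^ 2 * |(z ^ 4)⁻¹ * D2 a ρ γ z - ((z / A) ^ 4)⁻¹ * D2 a ρ γ (z / A)
        - ∫ x in (z / A)..z, -4 * (x ^ 5)⁻¹ * D2 a ρ γ x|
      ≤ z * z ^ 2 * (C * (z / A) ^ (-(5:ℝ)/2) + C * (z / A) ^ (-(5:ℝ)/2) + 2 * C * (z / A) ^ (-(5:ℝ)/2)) := by
        gcongr
        exact (abs_sub _ _).trans (add_le_add ((abs_sub _ _).trans (add_le_add b1 b2)) b3)
    _ ≤ _ := by
        have p2 : 0 ≤ z * z ^ 2 * (z / A) ^ (-(5:ℝ)/2) := by positivity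
        nlinarith [mul_nonneg hC p2]

theorem smooth_part (h : Setup a χ q ρ c) : ∃ C : ℝ, 0 ≤ C ∧ ∀ A B W : ℝ, 1 ≤ A → 1 ≤ B → A * B ≤ W →
    |∫ u in (1:ℝ)..A, u * ∫ t in (1:ℝ)..B, t * (EE a ρ (W / u / t) - (-kap χ q / 2))| ≤
      C * ((A * B) ^ ((5:ℝ)/2) * W ^ (-(1:ℝ)/2)) := by
  obtain ⟨C, hC, hK⟩ := h.K_bound
  set γ := -kap χ q / 2
  refine ⟨5 * C, by positivity, fun A B W hA hB hW => ?_⟩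
  have hA0 : 0 < A := by linarith
  have hB0 : 0 < B := by linarith
  have hW0 : 0 < W := lt_of_lt_of_le (by positivity) hW
  have hu : ∀ u ∈ Set.uIcc 1 A, 0 < u ∧ B ≤ W / u := fun u hu => by
    rw [Set.uIcc_of_le hA] at hu
    have : 0 < u := by linarith [hu.1]
    refine ⟨this, ?_⟩
    rw [le_div_iff₀ this]
    nlinarith [hu.2]
  set F : ℝ → ℝ → ℝ := fun u t => u ^ 2 * (t ^ 2 * D1 a ρ γ (W / u / t)) with hF
  have cF : ContinuousOn F.uncurry (Set.Icc 1 A ×ˢ Set.Icc 1 B) := by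
    have c1 : ContinuousOn (fun p : ℝ × ℝ => W / p.1 / p.2) (Set.Icc 1 A ×ˢ Set.Icc 1 B) := by
      refine ContinuousOn.div (ContinuousOn.div continuousOn_const continuousOn_fst ?_) continuousOn_snd ?_
      · rintro ⟨u, t⟩ ⟨h1, h2⟩; have := h1.1; simp only at this ⊢; linarith
      · rintro ⟨u, t⟩ ⟨h1, h2⟩; have := h2.1; simp only at this ⊢; linarith
    have c2 : ContinuousOn (fun p : ℝ × ℝ => D1 a ρ γ (W / p.1 / p.2)) (Set.Icc 1 A ×ˢ Set.Icc 1 B) := by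
      refine (D1_continuousOn a ρ γ).comp c1 ?_
      rintro ⟨u, t⟩ ⟨h1, h2⟩
      simp only [Set.mem_Icc] at h1 h2
      simp only [Set.mem_Ici]
      rw [le_div_iff₀ (by linarith), one_mul, le_div_iff₀ (by linarith)]
      nlinarith
    exact (continuousOn_fst.pow 2).mul ((continuousOn_snd.pow 2).mul c2)
  have iF : IntegrableOn F.uncurry (Set.uIoc 1 A ×ˢ Set.uIoc 1 B) := by
    refine (cF.integrableOn_compact (isCompact_Icc.prod isCompact_Icc)).mono_set ?_
    rw [Set.uIoc_of_le hA, Set.uIoc_of_le hB]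
    exact Set.prod_mono Set.Ioc_subset_Icc_self Set.Ioc_subset_Icc_self
  have iG : IntervalIntegrable (fun u => ∫ t in (1:ℝ)..B, F u t) volume 1 A := by
    rw [IntegrableOn, Measure.volume_eq_prod, ← Measure.prod_restrict] at iF
    have := iF.integral_prod_left
    rw [intervalIntegrable_iff, IntegrableOn]
    simpa [intervalIntegral.integral_of_le hB, Set.uIoc_of_le hB] using this
  have iD : ∀ z : ℝ, A ≤ z → IntervalIntegrable (fun u => u ^ 2 * D1 a ρ γ (z / u)) volume 1 A := by
    intro z hz
    apply ContinuousOn.intervalIntegrable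
    have c1 : ContinuousOn (fun u : ℝ => z / u) (Set.uIcc 1 A) :=
      continuousOn_const.div continuousOn_id fun u h1 => (hu u h1).1.ne'
    refine (continuousOn_id.pow 2).mul ((D1_continuousOn a ρ γ).comp c1 fun u h1 => ?_)
    have h2 := (hu u h1).1
    rw [Set.uIcc_of_le hA] at h1
    simp only [Set.mem_Ici]
    rw [le_div_iff₀ h2]; linarith [h1.2]
  have hWA : A ≤ W := by nlinarith
  have hWB : A ≤ W / B := by rwa [le_div_iff₀ hB0]
  have e1 : ∫ u in (1:ℝ)..A, u * ∫ t in (1:ℝ)..B, t * (EE a ρ (W / u / t) - γ) =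
      (1 / W) * (∫ u in (1:ℝ)..A, u ^ 2 * D1 a ρ γ (W / u)) -
      (B ^ 3 / W) * (∫ u in (1:ℝ)..A, u ^ 2 * D1 a ρ γ (W / B / u)) +
      (3 / W) * ∫ u in (1:ℝ)..A, ∫ t in (1:ℝ)..B, F u t := by
    rw [← intervalIntegral.integral_const_mul, ← intervalIntegral.integral_const_mul,
      ← intervalIntegral.integral_const_mul,
      ← intervalIntegral.integral_sub ((iD W hWA).const_mul _) ((iD _ hWB).const_mul _),
      ← intervalIntegral.integral_add (((iD W hWA).const_mul _).sub ((iD _ hWB).const_mul _)) (iG.const_mul _)]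
    refine intervalIntegral.integral_congr fun u h1 => ?_
    obtain ⟨hu0, hu1⟩ := hu u h1
    try simp only
    rw [inner_D a ρ γ hB hu1, hF]
    simp only
    rw [intervalIntegral.integral_const_mul]
    have : W / u / B = W / B / u := by rw [div_div, div_div, mul_comm]
    rw [this]
    field_simp
  have e2 : ∫ u in (1:ℝ)..A, ∫ t in (1:ℝ)..B, F u t = ∫ t in (1:ℝ)..B, ∫ u in (1:ℝ)..A, F u t :=
    intervalIntegral_intervalIntegral_swap iF
  have e3 : ∀ t ∈ Set.uIoc 1 B, ‖∫ u in (1:ℝ)..A, F u t‖ ≤ C * (W ^ ((1:ℝ)/2) * A ^ ((5:ℝ)/2)) * B ^ ((3:ℝ)/2) := by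
    intro t ht
    rw [Set.uIoc_of_le hB] at ht
    have ht0 : 0 < t := by linarith [ht.1]
    have e4 : ∫ u in (1:ℝ)..A, F u t = t ^ 2 * ∫ u in (1:ℝ)..A, u ^ 2 * D1 a ρ γ (W / t / u) := by
      rw [← intervalIntegral.integral_const_mul]
      refine intervalIntegral.integral_congr fun u _ => ?_
      have : W / u / t = W / t / u := by rw [div_div, div_div, mul_comm]
      simp only [hF]
      rw [this]; ring
    rw [e4, Real.norm_eq_abs, abs_mul, abs_of_pos (by positivity)]
    have hz : A ≤ W / t := by rw [le_div_iff₀ ht0]; nlinarith [ht.2]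
    calc t ^ 2 * |∫ u in (1:ℝ)..A, u ^ 2 * D1 a ρ γ (W / t / u)| ≤ t ^ 2 * (C * ((W / t) ^ ((1:ℝ)/2) * A ^ ((5:ℝ)/2))) := by
          gcongr; exact hK A _ hA hz
      _ = C * (W ^ ((1:ℝ)/2) * A ^ ((5:ℝ)/2)) * (t ^ 2 / t ^ ((1:ℝ)/2)) := by
          rw [Real.div_rpow hW0.le ht0.le]; ring
      _ = C * (W ^ ((1:ℝ)/2) * A ^ ((5:ℝ)/2)) * t ^ ((3:ℝ)/2) := by
          rw [← Real.rpow_natCast, ← Real.rpow_sub ht0]; norm_num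
      _ ≤ _ := by gcongr; exact ht.2
  have b3 : |∫ t in (1:ℝ)..B, ∫ u in (1:ℝ)..A, F u t| ≤ C * (W ^ ((1:ℝ)/2) * A ^ ((5:ℝ)/2)) * B ^ ((5:ℝ)/2) := by
    have := intervalIntegral.norm_integral_le_of_norm_le_const e3
    rw [Real.norm_eq_abs, abs_of_nonneg (by linarith : 0 ≤ B - 1)] at this
    calc _ ≤ _ := this
      _ ≤ C * (W ^ ((1:ℝ)/2) * A ^ ((5:ℝ)/2)) * B ^ ((3:ℝ)/2) * B := by gcongr; linarith
      _ = _ := by rw [mul_assoc, ← Real.rpow_add_one hB0.ne']; norm_num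
  have b1 := hK A W hA hWA
  have b2 := hK A (W / B) hA hWB
  have hW2 : W ^ (-(1:ℝ)/2) = W ^ ((1:ℝ)/2) / W := by
    rw [← Real.rpow_sub_one hW0.ne']; norm_num
  rw [e1, e2]
  set M := W ^ ((1:ℝ)/2) * A ^ ((5:ℝ)/2) * B ^ ((5:ℝ)/2) with hM
  have hB1 : 1 ≤ B ^ ((5:ℝ)/2) := Real.one_le_rpow hB (by norm_num)
  have c1 : |∫ u in (1:ℝ)..A, u ^ 2 * D1 a ρ γ (W / u)| ≤ C * M := by
    refine b1.trans ?_
    rw [hM]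
    have : 0 ≤ W ^ ((1:ℝ)/2) * A ^ ((5:ℝ)/2) := by positivity
    exact mul_le_mul_of_nonneg_left (le_mul_of_one_le_right this hB1) hC
  have c2 : B ^ 3 * |∫ u in (1:ℝ)..A, u ^ 2 * D1 a ρ γ (W / B / u)| ≤ C * M := by
    calc _ ≤ B ^ 3 * (C * ((W / B) ^ ((1:ℝ)/2) * A ^ ((5:ℝ)/2))) := by gcongr
      _ = C * (W ^ ((1:ℝ)/2) * A ^ ((5:ℝ)/2) * (B ^ 3 / B ^ ((1:ℝ)/2))) := by
          rw [Real.div_rpow hW0.le hB0.le]; ring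
      _ = _ := by
          rw [← Real.rpow_natCast, ← Real.rpow_sub hB0, hM]; norm_num
  have c3 : |∫ t in (1:ℝ)..B, ∫ u in (1:ℝ)..A, F u t| ≤ C * M := by
    refine b3.trans (le_of_eq ?_); rw [hM]; ring
  have e9 : 5 * C * ((A * B) ^ ((5:ℝ)/2) * W ^ (-(1:ℝ)/2)) = (1 / W) * (C * M) + (1 / W) * (C * M) + (3 / W) * (C * M) := by
    rw [hW2, Real.mul_rpow hA0.le hB0.le, hM]; ring
  rw [e9]
  refine (abs_add_le _ _).trans (add_le_add ((abs_sub _ _).trans (add_le_add ?_ ?_)) ?_)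
  · rw [abs_mul, abs_of_pos (by positivity)]; gcongr
  · rw [abs_mul, abs_of_pos (by positivity), div_mul_eq_mul_div, div_mul_eq_mul_div, one_mul]; gcongr
  · rw [abs_mul, abs_of_pos (by positivity)]; gcongr

end Setup
end RS

namespace RS
open Finset MeasureTheory

/-- weighted summatory function minus its main term -/
noncomputable def HH (a : ℕ → ℝ) (ρ z : ℝ) : ℝ := ∑ x ∈ Ioc 0 ⌊z⌋₊, a x * x - ρ * ((z ^ 2 - 1) / 2)

theorem HH_eq (a : ℕ → ℝ) (ρ : ℝ) {z : ℝ} (hz : 1 ≤ z) :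
    HH a ρ z = z * EE a ρ z + ρ - ∫ t in (1:ℝ)..z, EE a ρ t := by
  have h1 := (abelInt a hz (fun _ => 1) (by simp)).2
  have h2 : ∫ t in (1:ℝ)..z, EE a ρ t = (∫ t in (1:ℝ)..z, SA a t * 1) - ρ * ((z ^ 2 - 1) / 2) := by
    have e : ∀ t, EE a ρ t = SA a t * 1 - ρ * t := fun t => by rw [EE, mul_one]
    simp only [e]
    rw [intervalIntegral.integral_sub (by simpa using SA_intervalIntegrable a le_rfl hz)
      (by apply Continuous.intervalIntegrable; fun_prop), intervalIntegral.integral_const_mul, integral_id]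
    norm_num
  rw [h2, ← h1, HH, EE, SA]
  simp only [intervalIntegral.integral_const, smul_eq_mul, mul_one, mul_sub, sum_sub_distrib, ← sum_mul]
  ring

theorem int_cut (w : ℝ) {A : ℝ} (hA : 1 ≤ A) {n : ℕ} (hn : 0 < n) (hnw : (n:ℝ) ≤ w) :
    IntervalIntegrable (fun u : ℝ => if (n:ℝ) ≤ w / u then u else 0) volume 1 A ∧
    ∫ u in (1:ℝ)..A, (if (n:ℝ) ≤ w / u then u else 0) = ((min A (w / n)) ^ 2 - 1) / 2 := by
  have hn0 : (0:ℝ) < n := by exact_mod_cast hn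
  set m := min A (w / n) with hm
  have hm1 : 1 ≤ m := le_min hA (by rwa [le_div_iff₀ hn0, one_mul])
  have hmA : m ≤ A := min_le_left _ _
  have k1 : ∀ u ∈ Set.uIoc 1 m, (if (n:ℝ) ≤ w / u then u else 0) = u := fun u hu => by
    rw [Set.uIoc_of_le hm1] at hu
    have hu0 : 0 < u := by linarith [hu.1]
    have : u ≤ w / n := hu.2.trans (min_le_right _ _)
    rw [if_pos]
    rw [le_div_iff₀ hn0] at this
    rw [le_div_iff₀ hu0]; linarith
  have k2 : ∀ u ∈ Set.uIoc m A, (if (n:ℝ) ≤ w / u then u else 0) = 0 := fun u hu => by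
    rw [Set.uIoc_of_le hmA] at hu
    have hu0 : 0 < u := by linarith [hu.1]
    rw [if_neg]
    intro h1
    rw [le_div_iff₀ hu0] at h1
    have : u ≤ m := le_min hu.2 (by rw [le_div_iff₀ hn0]; linarith)
    linarith [hu.1]
  have i1 : IntervalIntegrable (fun u : ℝ => if (n:ℝ) ≤ w / u then u else 0) volume 1 m :=
    (intervalIntegrable_congr fun u hu => k1 u hu).2 (by apply Continuous.intervalIntegrable; fun_prop)
  have i2 : IntervalIntegrable (fun u : ℝ => if (n:ℝ) ≤ w / u then u else 0) volume m A :=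
    (intervalIntegrable_congr fun u hu => k2 u hu).2 (by simp)
  refine ⟨i1.trans i2, ?_⟩
  rw [← intervalIntegral.integral_add_adjacent_intervals i1 i2,
    intervalIntegral.integral_congr_ae (Filter.Eventually.of_forall k1),
    intervalIntegral.integral_congr_ae (Filter.Eventually.of_forall k2), integral_id]
  simp

theorem int_SA_div (a : ℕ → ℝ) {A w : ℝ} (hA : 1 ≤ A) (hw : A ≤ w) :
    IntervalIntegrable (fun u => u * SA a (w / u)) volume 1 A ∧
    ∫ u in (1:ℝ)..A, u * SA a (w / u) = ∑ n ∈ Ioc 0 ⌊w⌋₊, a n * (((min A (w / n)) ^ 2 - 1) / 2) := by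
  have hw0 : 0 ≤ w := by linarith
  have hn : ∀ n ∈ Ioc 0 ⌊w⌋₊, 0 < n ∧ (n:ℝ) ≤ w := fun n hn =>
    ⟨(mem_Ioc.1 hn).1, (Nat.le_floor_iff hw0).1 (mem_Ioc.1 hn).2⟩
  have e : ∀ u ∈ Set.uIoc 1 A, u * SA a (w / u) = ∑ n ∈ Ioc 0 ⌊w⌋₊, a n * (if (n:ℝ) ≤ w / u then u else 0) := by
    intro u hu
    rw [Set.uIoc_of_le hA] at hu
    have hu0 : 0 < u := by linarith [hu.1]
    have hle : w / u ≤ w := div_le_self hw0 hu.1.le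
    rw [SA, mul_sum]
    simp only [mul_ite, mul_zero]
    rw [← sum_filter]
    refine sum_congr ?_ fun n _ => mul_comm _ _
    ext n
    simp only [mem_Ioc, mem_filter]
    rw [Nat.le_floor_iff (by positivity), Nat.le_floor_iff hw0]
    constructor
    · rintro ⟨h1, h2⟩; exact ⟨⟨h1, h2.trans hle⟩, h2⟩
    · rintro ⟨⟨h1, _⟩, h2⟩; exact ⟨h1, h2⟩
  have ii : ∀ n ∈ Ioc 0 ⌊w⌋₊, IntervalIntegrable (fun u : ℝ => a n * (if (n:ℝ) ≤ w / u then u else 0)) volume 1 A :=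
    fun n h1 => (int_cut w hA (hn n h1).1 (hn n h1).2).1.const_mul _
  refine ⟨(intervalIntegrable_congr fun u hu => e u hu).2 ?_, ?_⟩
  · have := IntervalIntegrable.sum (Ioc 0 ⌊w⌋₊) ii
    convert! this using 1
    ext u; rw [Finset.sum_apply]
  · rw [intervalIntegral.integral_congr_ae (Filter.Eventually.of_forall e), intervalIntegral.integral_finsetSum ii]
    refine sum_congr rfl fun n h1 => ?_
    rw [intervalIntegral.integral_const_mul, (int_cut w hA (hn n h1).1 (hn n h1).2).2]

theorem sum_SA_div (a : ℕ → ℝ) {A w : ℝ} (hA : 1 ≤ A) (hw : A ≤ w) :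
    ∑ x ∈ Ioc 0 ⌊A⌋₊, a x * x * SA a (w / x) =
      ∑ n ∈ Ioc 0 ⌊w⌋₊, a n * ∑ x ∈ Ioc 0 ⌊min A (w / n)⌋₊, a x * x := by
  have hw0 : 0 ≤ w := by linarith
  simp only [SA, mul_sum]
  rw [sum_comm' (t' := Ioc 0 ⌊w⌋₊) (s' := fun n : ℕ => Ioc 0 ⌊min A (w / n)⌋₊)]
  · exact sum_congr rfl fun n _ => sum_congr rfl fun x _ => mul_comm _ _
  intro x n
  simp only [mem_Ioc]
  constructor
  · rintro ⟨⟨hx, hxA⟩, hn, hnw⟩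
    have hx0 : (0:ℝ) < x := by exact_mod_cast hx
    have hn0 : (0:ℝ) < n := by exact_mod_cast hn
    rw [Nat.le_floor_iff (by positivity), le_div_iff₀ hx0] at hnw
    rw [Nat.le_floor_iff (by linarith)] at hxA
    have hx1 : (1:ℝ) ≤ x := by exact_mod_cast hx
    refine ⟨⟨hx, Nat.le_floor (le_min hxA ?_)⟩, hn, Nat.le_floor (by nlinarith)⟩
    rw [le_div_iff₀ hn0]; linarith
  · rintro ⟨⟨hx, hxm⟩, hn, hnw⟩
    have hx0 : (0:ℝ) < x := by exact_mod_cast hx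
    have hn0 : (0:ℝ) < n := by exact_mod_cast hn
    rw [Nat.le_floor_iff (le_min (by linarith) (by positivity)), le_min_iff, le_div_iff₀ hn0] at hxm
    refine ⟨⟨hx, Nat.le_floor hxm.1⟩, hn, Nat.le_floor ?_⟩
    rw [le_div_iff₀ hx0]; linarith

/-- discrepancy between the sum over `x` and the corresponding integral -/
noncomputable def IA (a : ℕ → ℝ) (ρ A w : ℝ) : ℝ :=
  ∑ x ∈ Ioc 0 ⌊A⌋₊, a x * x * EE a ρ (w / x) - ρ * ∫ u in (1:ℝ)..A, u * EE a ρ (w / u)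

theorem int_EE_div (a : ℕ → ℝ) (ρ : ℝ) {A w : ℝ} (hA : 1 ≤ A) (hw : A ≤ w) :
    IntervalIntegrable (fun u => u * EE a ρ (w / u)) volume 1 A ∧
    ∫ u in (1:ℝ)..A, u * EE a ρ (w / u) = (∫ u in (1:ℝ)..A, u * SA a (w / u)) - ρ * w * (A - 1) := by
  have e : ∀ u ∈ Set.uIoc 1 A, u * EE a ρ (w / u) = u * SA a (w / u) - ρ * w := fun u hu => by
    rw [Set.uIoc_of_le hA] at hu
    have : u ≠ 0 := by linarith [hu.1]
    rw [EE]; field_simp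
  have i1 := (int_SA_div a hA hw).1
  refine ⟨(intervalIntegrable_congr fun u hu => e u hu).2 (i1.sub (by simp)), ?_⟩
  rw [intervalIntegral.integral_congr_ae (Filter.Eventually.of_forall e), intervalIntegral.integral_sub i1 (by simp)]
  simp
  ring

theorem IA_eq (a : ℕ → ℝ) (ρ : ℝ) {A w : ℝ} (hA : 1 ≤ A) (hw : A ≤ w) :
    IA a ρ A w = EE a ρ (w / A) * HH a ρ A + ρ * (w / A) * (-∫ t in (1:ℝ)..A, EE a ρ t)
      + ρ ^ 2 * (w / A) - ρ ^ 2 * w + ∑ n ∈ Ioc ⌊w / A⌋₊ ⌊w⌋₊, a n * HH a ρ (w / n) := by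
  have hA0 : 0 < A := by linarith
  have hw0 : 0 < w := by linarith
  have h1 : ∑ x ∈ Ioc 0 ⌊A⌋₊, a x * x * EE a ρ (w / x) = ∑ x ∈ Ioc 0 ⌊A⌋₊, a x * x * SA a (w / x) - ρ * w * SA a A := by
    rw [SA, mul_sum, ← sum_sub_distrib]
    refine sum_congr rfl fun x hx => ?_
    have : (x:ℝ) ≠ 0 := by exact_mod_cast (mem_Ioc.1 hx).1.ne'
    rw [EE]; field_simp
  have h2 : ∑ x ∈ Ioc 0 ⌊A⌋₊, a x * x * SA a (w / x) - ρ * (∫ u in (1:ℝ)..A, u * SA a (w / u)) =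
      ∑ n ∈ Ioc 0 ⌊w⌋₊, a n * HH a ρ (min A (w / n)) := by
    rw [sum_SA_div a hA hw, (int_SA_div a hA hw).2, mul_sum, ← sum_sub_distrib]
    refine sum_congr rfl fun n _ => ?_
    rw [HH]; ring
  have h3 : ∑ n ∈ Ioc 0 ⌊w⌋₊, a n * HH a ρ (min A (w / n)) = SA a (w / A) * HH a ρ A
      + ∑ n ∈ Ioc ⌊w / A⌋₊ ⌊w⌋₊, a n * HH a ρ (w / n) := by
    have hle : ⌊w / A⌋₊ ≤ ⌊w⌋₊ := Nat.floor_le_floor (div_le_self hw0.le hA)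
    rw [← sum_Ioc_consecutive _ (Nat.zero_le _) hle, SA, sum_mul]
    congr 1
    · refine sum_congr rfl fun n hn => ?_
      have hn0 : (0:ℝ) < n := by exact_mod_cast (mem_Ioc.1 hn).1
      have := (Nat.le_floor_iff (by positivity)).1 (mem_Ioc.1 hn).2
      rw [min_eq_left]
      rw [le_div_iff₀ hA0] at this
      rw [le_div_iff₀ hn0]; linarith
    · refine sum_congr rfl fun n hn => ?_
      have h5 := (mem_Ioc.1 hn).1
      have hn0 : (0:ℝ) < n := by exact_mod_cast (by omega : 0 < n)
      have := (Nat.floor_lt (by positivity)).1 h5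
      rw [min_eq_right]
      rw [div_lt_iff₀ hA0] at this
      rw [div_le_iff₀ hn0]; linarith
  rw [IA, h1, (int_EE_div a ρ hA hw).2]
  have h4 : SA a A = EE a ρ A + ρ * A := by rw [EE]; ring
  have h5 : SA a (w / A) = EE a ρ (w / A) + ρ * (w / A) := by rw [EE]; ring
  have h6 := HH_eq a ρ hA
  have h7 : SA a (w / A) * HH a ρ A = EE a ρ (w / A) * HH a ρ A + ρ * (w * EE a ρ A) + ρ * (w / A) * (ρ - ∫ t in (1:ℝ)..A, EE a ρ t) := by
    rw [h5, add_mul]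
    nth_rewrite 2 [h6]
    field_simp
    ring
  linear_combination h2 + h3 + h7 - ρ * w * h4

end RS

namespace RS
open Finset MeasureTheory
namespace Setup
variable {a χ : ℕ → ℝ} {q : ℕ} {ρ c : ℝ}

theorem sum_conv_le (h : Setup a χ q ρ c) {ε : ℝ} (hε : 0 < ε) : ∃ C : ℝ, 0 ≤ C ∧ ∀ S : Finset ℕ,
    ∑ n ∈ S, a n * (n:ℝ) ^ (-(1 + ε)) ≤ C :=
  ⟨∑' n : ℕ, a n * (n:ℝ) ^ (-(1 + ε)), tsum_nonneg fun n => mul_nonneg (h.nonneg n) (by positivity),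
    fun S => (h.summable (by linarith : 1 < 1 + ε)).sum_le_tsum S fun n _ => mul_nonneg (h.nonneg n) (by positivity)⟩

theorem intE_le (h : Setup a χ q ρ c) {ε : ℝ} (hε : 0 < ε) (hε1 : ε < 1) : ∃ C : ℝ, 0 ≤ C ∧ ∀ z : ℝ, 1 ≤ z →
    |∫ t in (1:ℝ)..z, EE a ρ t| ≤ C * z ^ ((5:ℝ)/4 + ε) := by
  obtain ⟨C, hC, hE⟩ := h.E_mean hε hε1
  have hc := h.cpos
  refine ⟨C, hC, fun z hz => ?_⟩
  have hz0 : 0 < z := by linarith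
  have i1 : ‖∫ t in (1:ℝ)..z, EE a ρ t‖ ≤ ∫ t in (1:ℝ)..z, z ^ ((5:ℝ)/4) * (|EE a ρ t| * t ^ (-(5:ℝ)/4)) := by
    refine intervalIntegral.norm_integral_le_of_norm_le hz (Filter.Eventually.of_forall fun t ht => ?_) ?_
    · have ht0 : 0 < t := by linarith [ht.1]
      have h1 : 1 ≤ z ^ ((5:ℝ)/4) * t ^ (-(5:ℝ)/4) := by
        calc (1:ℝ) = t ^ ((5:ℝ)/4) * t ^ (-(5:ℝ)/4) := by rw [← Real.rpow_add ht0]; norm_num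
          _ ≤ _ := by gcongr; exact ht.2
      rw [Real.norm_eq_abs]
      nlinarith [abs_nonneg (EE a ρ t)]
    · apply IntervalIntegrable.const_mul
      have : ContinuousOn (fun t : ℝ => t ^ (-(5:ℝ)/4)) (Set.uIcc 1 z) := by
        intro t ht
        rw [Set.uIcc_of_le hz] at ht
        exact (Real.continuousAt_rpow_const _ _ (Or.inl (by linarith [ht.1]))).continuousWithinAt
      exact (EE_intervalIntegrable a ρ le_rfl hz).abs.mul_continuousOn this
  rw [intervalIntegral.integral_const_mul, Real.norm_eq_abs] at i1
  calc _ ≤ _ := i1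
    _ ≤ z ^ ((5:ℝ)/4) * (C * z ^ ε) := by gcongr; exact hE z hz
    _ = _ := by rw [Real.rpow_add hz0]; ring

theorem IA_le (h : Setup a χ q ρ c) {ε : ℝ} (hε : 0 < ε) (hε1 : ε < 1) : ∃ C : ℝ, 0 ≤ C ∧ ∀ A w : ℝ, 1 ≤ A → A ≤ w →
    |IA a ρ A w| ≤ ∑ n ∈ Ioc ⌊w / A⌋₊ ⌊w⌋₊, a n * (w / n * |EE a ρ (w / n)|)
      + C * (w ^ (1 + ε) * A ^ ((1:ℝ)/4) + w ^ ((1:ℝ)/3) * A) := by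
  obtain ⟨K, hK, hI⟩ := h.intE_le (by positivity : 0 < ε / 2) (by linarith)
  obtain ⟨S, hS, hsum⟩ := h.sum_conv_le (by positivity : 0 < ε / 2)
  have hc := h.cpos
  have hρ := h.rho_nonneg
  refine ⟨c * (2 * c + ρ) + ρ * K + 2 * ρ ^ 2 + (ρ + K) * S, by positivity, fun A w hA hw => ?_⟩
  have hA0 : 0 < A := by linarith
  have hw0 : 0 < w := by linarith
  have hw1 : 1 ≤ w := by linarith
  have hwA : 1 ≤ w / A := by rwa [le_div_iff₀ hA0, one_mul]
  set R := w ^ (1 + ε) * A ^ ((1:ℝ)/4) with hR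
  have hA4 : 1 ≤ A ^ ((1:ℝ)/4) := Real.one_le_rpow hA (by norm_num)
  have hpw : w ^ (1 + ε) = w * (w ^ (ε/2) * w ^ (ε/2)) := by
    rw [← Real.rpow_add hw0, ← Real.rpow_one_add' hw0.le (by linarith)]; congr 1; ring
  have hwe : 1 ≤ w ^ (ε/2) := Real.one_le_rpow hw1 (by linarith)
  have hwR : w * w ^ (ε/2) * A ^ ((1:ℝ)/4) ≤ R := by
    rw [hR, hpw, ← mul_assoc]
    gcongr
    exact le_mul_of_one_le_right (by positivity) hwe
  have hwR0 : w ≤ R := by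
    refine le_trans ?_ hwR
    rw [mul_assoc]
    exact le_mul_of_one_le_right hw0.le (by nlinarith)
  rw [IA_eq a ρ hA hw]
  have t1 : |EE a ρ (w / A) * HH a ρ A| ≤ c * (2 * c + ρ) * (w ^ ((1:ℝ)/3) * A) := by
    have h1 := h.E_le hwA
    have h2 := h.E_le hA
    have h3 : |∫ t in (1:ℝ)..A, EE a ρ t| ≤ c * A ^ ((4:ℝ)/3) := by
      have := h.D1_le 0 hA
      rw [D1] at this
      simpa using this
    have hA43 : 1 ≤ A ^ ((4:ℝ)/3) := Real.one_le_rpow hA (by norm_num)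
    have e1 : A * A ^ ((1:ℝ)/3) = A ^ ((4:ℝ)/3) := by
      rw [← Real.rpow_one_add' hA0.le (by norm_num)]; norm_num
    have h4 : |HH a ρ A| ≤ (2 * c + ρ) * A ^ ((4:ℝ)/3) := by
      rw [HH_eq a ρ hA]
      calc _ ≤ |A * EE a ρ A + ρ| + |∫ t in (1:ℝ)..A, EE a ρ t| := abs_sub _ _
        _ ≤ |A * EE a ρ A| + |ρ| + c * A ^ ((4:ℝ)/3) := add_le_add (abs_add_le _ _) h3
        _ ≤ c * A ^ ((4:ℝ)/3) + ρ * A ^ ((4:ℝ)/3) + c * A ^ ((4:ℝ)/3) := by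
          rw [abs_mul, abs_of_pos hA0, abs_of_nonneg hρ]
          have : A * |EE a ρ A| ≤ c * A ^ ((4:ℝ)/3) := by
            rw [← e1]; nlinarith
          nlinarith
        _ = _ := by ring
    rw [abs_mul]
    calc _ ≤ c * (w / A) ^ ((1:ℝ)/3) * ((2 * c + ρ) * A ^ ((4:ℝ)/3)) := by gcongr
      _ = _ := by
        rw [Real.div_rpow hw0.le hA0.le, ← e1]
        have : A ^ ((1:ℝ)/3) ≠ 0 := by positivity
        field_simp
  have t2 : |ρ * (w / A) * (-∫ t in (1:ℝ)..A, EE a ρ t)| ≤ ρ * K * R := by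
    rw [abs_mul, abs_neg, abs_of_nonneg (by positivity : 0 ≤ ρ * (w / A))]
    calc _ ≤ ρ * (w / A) * (K * A ^ ((5:ℝ)/4 + ε/2)) := by gcongr; exact hI A hA
      _ = ρ * K * (w * A ^ (ε/2) * A ^ ((1:ℝ)/4)) := by
        have : A ^ ((5:ℝ)/4 + ε/2) = A * (A ^ (ε/2) * A ^ ((1:ℝ)/4)) := by
          rw [← Real.rpow_add hA0, ← Real.rpow_one_add' hA0.le (by linarith)]; congr 1; ring
        rw [this]; field_simp
      _ ≤ ρ * K * (w * w ^ (ε/2) * A ^ ((1:ℝ)/4)) := by gcongr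
      _ ≤ _ := by gcongr
  have t3 : |ρ ^ 2 * (w / A)| ≤ ρ ^ 2 * R := by
    rw [abs_of_nonneg (by positivity)]
    gcongr
    exact (div_le_self hw0.le hA).trans hwR0
  have t4 : |ρ ^ 2 * w| ≤ ρ ^ 2 * R := by
    rw [abs_of_nonneg (by positivity)]
    gcongr
  have t5 : |∑ n ∈ Ioc ⌊w / A⌋₊ ⌊w⌋₊, a n * HH a ρ (w / n)| ≤
      ∑ n ∈ Ioc ⌊w / A⌋₊ ⌊w⌋₊, a n * (w / n * |EE a ρ (w / n)|) + (ρ + K) * S * R := by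
    have h1 : ∀ n ∈ Ioc ⌊w / A⌋₊ ⌊w⌋₊, |a n * HH a ρ (w / n)| ≤ a n * (w / n * |EE a ρ (w / n)|) +
        (ρ + K) * R * (a n * (n:ℝ) ^ (-(1 + ε/2))) := by
      intro n hn
      have hn1 := (mem_Ioc.1 hn).1
      have hn0 : (0:ℝ) < n := by exact_mod_cast (by omega : 0 < n)
      have hnA := (Nat.floor_lt (by positivity)).1 hn1
      have hnw := (Nat.le_floor_iff hw0.le).1 (mem_Ioc.1 hn).2
      set z := w / n with hz
      have hz1 : 1 ≤ z := by rwa [hz, le_div_iff₀ hn0, one_mul]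
      have hzA : z ≤ A := by
        rw [div_lt_iff₀ hA0] at hnA
        rw [hz, div_le_iff₀ hn0]; linarith
      have hz0 : 0 < z := by linarith
      have han := h.nonneg n
      have hzz : 1 ≤ z ^ ((5:ℝ)/4 + ε/2) := Real.one_le_rpow hz1 (by positivity)
      have h2 : |HH a ρ z| ≤ z * |EE a ρ z| + (ρ + K) * z ^ ((5:ℝ)/4 + ε/2) := by
        rw [HH_eq a ρ hz1]
        calc _ ≤ |z * EE a ρ z + ρ| + |∫ t in (1:ℝ)..z, EE a ρ t| := abs_sub _ _
          _ ≤ |z * EE a ρ z| + |ρ| + K * z ^ ((5:ℝ)/4 + ε/2) := add_le_add (abs_add_le _ _) (hI z hz1)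
          _ ≤ _ := by
            rw [abs_mul, abs_of_pos hz0, abs_of_nonneg hρ]
            nlinarith
      have h3 : z ^ ((5:ℝ)/4 + ε/2) ≤ R * (n:ℝ) ^ (-(1 + ε/2)) := by
        calc z ^ ((5:ℝ)/4 + ε/2) = z ^ (1 + ε/2) * z ^ ((1:ℝ)/4) := by
              rw [← Real.rpow_add hz0]; congr 1; ring
          _ ≤ z ^ (1 + ε/2) * A ^ ((1:ℝ)/4) := by gcongr
          _ = (w * w ^ (ε/2) * A ^ ((1:ℝ)/4)) * (n:ℝ) ^ (-(1 + ε/2)) := by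
              rw [hz, Real.div_rpow hw0.le hn0.le, Real.rpow_one_add' hw0.le (by positivity), Real.rpow_neg hn0.le]
              field_simp
          _ ≤ _ := by gcongr
      rw [abs_mul, abs_of_nonneg han]
      calc _ ≤ a n * (z * |EE a ρ z| + (ρ + K) * (R * (n:ℝ) ^ (-(1 + ε/2)))) := by
            gcongr
            refine h2.trans ?_
            gcongr
        _ = _ := by ring
    refine (abs_sum_le_sum_abs _ _).trans ((sum_le_sum h1).trans ?_)
    rw [sum_add_distrib, ← mul_sum]
    have := hsum (Ioc ⌊w / A⌋₊ ⌊w⌋₊)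
    have hR0 : 0 ≤ R := by positivity
    have : (ρ + K) * R * ∑ n ∈ Ioc ⌊w / A⌋₊ ⌊w⌋₊, a n * (n:ℝ) ^ (-(1 + ε/2)) ≤ (ρ + K) * R * S := by gcongr
    linarith
  have p1 : 0 ≤ (ρ * K + 2 * ρ ^ 2 + (ρ + K) * S) * (w ^ ((1:ℝ)/3) * A) := by positivity
  have p2 : 0 ≤ c * (2 * c + ρ) * R := by positivity
  refine (abs_add_le _ _).trans (le_trans (add_le_add ((abs_sub _ _).trans (add_le_add ((abs_add_le _ _).trans
    (add_le_add ((abs_add_le _ _).trans (add_le_add t1 t2)) t3)) t4)) t5) ?_)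
  nlinarith

/-- the sum over `y` of the discrepancies -/
theorem sum_IA_le (h : Setup a χ q ρ c) {ε : ℝ} (hε : 0 < ε) (hε1 : ε < 1) : ∃ C : ℝ, 0 ≤ C ∧
    ∀ A B W : ℝ, 1 ≤ A → 1 ≤ B → A * B ≤ W → A ^ 2 ≤ W →
    |∑ y ∈ Ioc 0 ⌊B⌋₊, a y * y * IA a ρ A (W / y)| ≤
      C * (W ^ (1 + ε) * B * A ^ ((1:ℝ)/4) + W ^ ((1:ℝ)/3) * A * B ^ ((5:ℝ)/3)) := by
  obtain ⟨C0, hC0, hIA⟩ := h.IA_le hε hε1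
  obtain ⟨C1, hC1, hE⟩ := h.E_sum (by positivity : 0 < ε / 2) (by linarith)
  obtain ⟨C2, hC2, hr⟩ := h.rr_le (by positivity : 0 < ε / 2)
  have hc := h.cpos
  refine ⟨2 * C2 * C1 + C0 * (c + |ρ|), by positivity, fun A B W hA hB hW hAW => ?_⟩
  have hA0 : 0 < A := by linarith
  have hB0 : 0 < B := by linarith
  have hW1 : 1 ≤ W := by nlinarith
  have hW0 : 0 < W := by linarith
  have hy : ∀ y ∈ Ioc 0 ⌊B⌋₊, (1:ℝ) ≤ y ∧ (y:ℝ) ≤ B := fun y hy =>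
    ⟨by exact_mod_cast (mem_Ioc.1 hy).1, (Nat.le_floor_iff hB0.le).1 (mem_Ioc.1 hy).2⟩
  set P := ⌊W / A⌋₊ with hP
  set Q := ⌊W⌋₊ with hQ
  have hWA : A ≤ W / A := by rw [le_div_iff₀ hA0]; nlinarith
  have hP1 : 1 ≤ P := Nat.le_floor (by simpa using hA.trans hWA)
  have hPR : (1:ℝ) ≤ P := by exact_mod_cast hP1
  have hPlt : W / A < P + 1 := Nat.lt_floor_add_one _
  have hW2 : W ≤ 4 * (P:ℝ) ^ 2 := by
    have h1 : W ≤ (W / A) ^ 2 := by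
      rw [div_pow, le_div_iff₀ (by positivity)]; nlinarith
    have h2 : (W / A) ^ 2 ≤ (2 * P) ^ 2 := by gcongr; linarith
    nlinarith
  -- the double sum
  have s1 : ∑ y ∈ Ioc 0 ⌊B⌋₊, a y * y * ∑ n ∈ Ioc ⌊W / y / A⌋₊ ⌊W / y⌋₊, a n * (W / y / n * |EE a ρ (W / y / n)|) ≤
      ∑ m ∈ Ioc P Q, ∑ d ∈ m.divisors, a d * a (m / d) * (W * B / m * |EE a ρ (W / m)|) := by
    set S := (Ioc 0 ⌊B⌋₊ ×ˢ Ioc 0 Q).filter fun p => P < p.1 * p.2 ∧ p.1 * p.2 ≤ Q with hS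
    have hG := sum_regroup S P Q (fun p hp => (mem_filter.1 hp).2)
      (fun x y => a x * a y * (W * B / (x * y : ℕ) * |EE a ρ (W / (x * y : ℕ))|))
      (fun x y => mul_nonneg (mul_nonneg (h.nonneg x) (h.nonneg y)) (by positivity))
    refine le_trans ?_ (hG.trans (le_of_eq ?_))
    · rw [hS, sum_filter, sum_product]
      refine sum_le_sum fun y hyB => ?_
      obtain ⟨hy1, hyB'⟩ := hy y hyB
      have hy0 : (0:ℝ) < y := by linarith
      have hyN : 0 < y := (mem_Ioc.1 hyB).1
      rw [mul_sum, ← sum_filter]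
      refine (sum_le_sum (g := fun n => a y * a n * (W * B / (y * n : ℕ) * |EE a ρ (W / (y * n : ℕ))|)) fun n hn => ?_).trans (sum_le_sum_of_subset_of_nonneg ?_ ?_)
      · have hn0 : (0:ℝ) < n := by exact_mod_cast (by have := (mem_Ioc.1 hn).1; omega : 0 < n)
        have e : W / y / n = W / (y * n : ℕ) := by push_cast; rw [div_div]
        rw [e]
        have h1 : a y * y * (a n * (W / (y * n : ℕ) * |EE a ρ (W / (y * n : ℕ))|)) =
          a y * a n * (W * y / (y * n : ℕ) * |EE a ρ (W / (y * n : ℕ))|) := by ring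
        rw [h1]
        have := h.nonneg y
        have := h.nonneg n
        gcongr
      · intro n hn
        have hnp := (mem_Ioc.1 hn).1
        have hn00 : 0 < n := by omega
        have hn0 : (0:ℝ) < n := by exact_mod_cast hn00
        have h1 := (Nat.floor_lt (by positivity)).1 hnp
        have h2 := (Nat.le_floor_iff (by positivity)).1 (mem_Ioc.1 hn).2
        rw [le_div_iff₀ hy0] at h2
        rw [div_div, div_lt_iff₀ (by positivity)] at h1
        simp only [mem_filter, mem_Ioc]
        have h3 : (y * n : ℕ) ≤ Q := Nat.le_floor (by push_cast; linarith)
        refine ⟨⟨hn00, le_trans (Nat.le_mul_of_pos_left n hyN) h3⟩, (Nat.floor_lt (by positivity)).2 ?_, h3⟩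
        push_cast
        rw [div_lt_iff₀ hA0]; linarith
      · intro n _ _
        exact mul_nonneg (mul_nonneg (h.nonneg _) (h.nonneg _)) (by positivity)
    · refine sum_congr rfl fun n _ => sum_congr rfl fun d hd => ?_
      rw [Nat.mul_div_cancel' (Nat.dvd_of_mem_divisors hd)]
  have hWε : W ^ (ε/2) * W ^ (ε/2) = W ^ ε := by rw [← Real.rpow_add hW0]; ring_nf
  have s2 : ∑ m ∈ Ioc P Q, ∑ d ∈ m.divisors, a d * a (m / d) * (W * B / m * |EE a ρ (W / m)|) ≤
      2 * C2 * C1 * (W ^ (1 + ε) * B * A ^ ((1:ℝ)/4)) := by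
    have hQW : (Q:ℝ) ≤ W := Nat.floor_le hW0.le
    have h1 : ∀ m ∈ Ioc P Q, ∑ d ∈ m.divisors, a d * a (m / d) * (W * B / m * |EE a ρ (W / m)|) ≤
        C2 * W ^ (ε/2) * (W * B * ((A / W) ^ ((1:ℝ)/4))) * ((m:ℝ) ^ (-(3:ℝ)/4) * |EE a ρ (W / m)|) := by
      intro m hm
      rw [mem_Ioc] at hm
      have hm0 : (0:ℝ) < m := by exact_mod_cast (by omega : 0 < m)
      have hmW : (m:ℝ) ≤ W := le_trans (by exact_mod_cast hm.2) hQW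
      have h2 := hr m
      have h3 : (m:ℝ) ^ (ε/2) ≤ W ^ (ε/2) := Real.rpow_le_rpow hm0.le hmW (by positivity)
      have h4 : ∑ d ∈ m.divisors, a d * a (m / d) ≤ C2 * W ^ (ε/2) := h2.trans (by gcongr)
      have h5 : (m:ℝ)⁻¹ ≤ (A / W) ^ ((1:ℝ)/4) * (m:ℝ) ^ (-(3:ℝ)/4) := by
        have e : (m:ℝ)⁻¹ = ((m:ℝ)⁻¹) ^ ((1:ℝ)/4) * (m:ℝ) ^ (-(3:ℝ)/4) := by
          rw [Real.inv_rpow hm0.le, ← Real.rpow_neg hm0.le, ← Real.rpow_add hm0, ← Real.rpow_neg_one]; norm_num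
        rw [e]
        have hmA := (Nat.floor_lt (by positivity)).1 hm.1
        gcongr
        rw [inv_le_comm₀ hm0 (by positivity), inv_div]
        exact hmA.le
      rw [← sum_mul]
      calc _ ≤ C2 * W ^ (ε/2) * (W * B / m * |EE a ρ (W / m)|) := by gcongr
        _ = C2 * W ^ (ε/2) * (W * B * (m:ℝ)⁻¹ * |EE a ρ (W / m)|) := by rw [div_eq_mul_inv (W * B)]
        _ ≤ C2 * W ^ (ε/2) * (W * B * ((A / W) ^ ((1:ℝ)/4) * (m:ℝ) ^ (-(3:ℝ)/4)) * |EE a ρ (W / m)|) := by gcongr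
        _ = _ := by ring
    refine (sum_le_sum h1).trans ?_
    rw [← mul_sum]
    calc _ ≤ C2 * W ^ (ε/2) * (W * B * ((A / W) ^ ((1:ℝ)/4))) * (C1 * W ^ ((1:ℝ)/4 + ε/2)) := by
          gcongr; exact hE W hW1 P Q hP1 hW2 hQW
      _ = C2 * C1 * (W ^ (1 + ε) * B * A ^ ((1:ℝ)/4)) := by
          rw [Real.div_rpow hA0.le hW0.le, Real.rpow_one_add' hW0.le (by positivity), ← hWε, Real.rpow_add hW0]
          have : W ^ ((1:ℝ)/4) ≠ 0 := by positivity
          generalize W ^ ((1:ℝ)/4) = v at this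
          generalize W ^ (ε/2) = v'
          field_simp
      _ ≤ _ := by
          have : 0 ≤ C2 * C1 * (W ^ (1 + ε) * B * A ^ ((1:ℝ)/4)) := by positivity
          linarith
  have s3 : ∀ y ∈ Ioc 0 ⌊B⌋₊, |a y * y * IA a ρ A (W / y)| ≤
      a y * y * ∑ n ∈ Ioc ⌊W / y / A⌋₊ ⌊W / y⌋₊, a n * (W / y / n * |EE a ρ (W / y / n)|) +
      a y * (C0 * (W ^ (1 + ε) * A ^ ((1:ℝ)/4) + W ^ ((1:ℝ)/3) * A * B ^ ((2:ℝ)/3))) := by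
    intro y hyB
    obtain ⟨hy1, hyB'⟩ := hy y hyB
    have hy0 : (0:ℝ) < y := by linarith
    have := hIA A (W / y) hA (by rw [le_div_iff₀ hy0]; nlinarith)
    have hay := h.nonneg y
    rw [abs_mul, abs_of_nonneg (by positivity : 0 ≤ a y * y)]
    refine (mul_le_mul_of_nonneg_left this (by positivity)).trans ?_
    rw [mul_add]
    refine add_le_add le_rfl ?_
    rw [mul_assoc]
    refine mul_le_mul_of_nonneg_left ?_ hay
    have e1 : (y:ℝ) * (W / y) ^ (1 + ε) ≤ W ^ (1 + ε) := by
      rw [Real.div_rpow hW0.le hy0.le, mul_div_assoc', div_le_iff₀ (by positivity), Real.rpow_one_add' hy0.le (by positivity)]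
      have : 1 ≤ (y:ℝ) ^ ε := Real.one_le_rpow hy1 hε.le
      have h6 : 0 < W ^ (1 + ε) := by positivity
      nlinarith [mul_pos hy0 h6]
    have e2 : (y:ℝ) * (W / y) ^ ((1:ℝ)/3) ≤ W ^ ((1:ℝ)/3) * B ^ ((2:ℝ)/3) := by
      have : (y:ℝ) = (y:ℝ) ^ ((2:ℝ)/3) * (y:ℝ) ^ ((1:ℝ)/3) := by rw [← Real.rpow_add hy0]; norm_num
      calc (y:ℝ) * (W / y) ^ ((1:ℝ)/3) = W ^ ((1:ℝ)/3) * (y:ℝ) ^ ((2:ℝ)/3) := by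
            rw [Real.div_rpow hW0.le hy0.le]
            nth_rewrite 1 [this]
            field_simp
        _ ≤ _ := by gcongr
    calc _ = C0 * ((y * (W / y) ^ (1 + ε)) * A ^ ((1:ℝ)/4) + (y * (W / y) ^ ((1:ℝ)/3)) * A) := by ring
      _ ≤ C0 * (W ^ (1 + ε) * A ^ ((1:ℝ)/4) + (W ^ ((1:ℝ)/3) * B ^ ((2:ℝ)/3)) * A) := by gcongr
      _ = _ := by ring
  refine (abs_sum_le_sum_abs _ _).trans ((sum_le_sum s3).trans ?_)
  rw [sum_add_distrib, ← sum_mul]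
  have hSA : ∑ y ∈ Ioc 0 ⌊B⌋₊, a y ≤ (c + |ρ|) * B := h.SA_le hB
  have hB53 : B ^ ((5:ℝ)/3) = B * B ^ ((2:ℝ)/3) := by
    rw [← Real.rpow_one_add' hB0.le (by norm_num)]; norm_num
  have s4 : (∑ y ∈ Ioc 0 ⌊B⌋₊, a y) * (C0 * (W ^ (1 + ε) * A ^ ((1:ℝ)/4) + W ^ ((1:ℝ)/3) * A * B ^ ((2:ℝ)/3))) ≤
      (c + |ρ|) * B * (C0 * (W ^ (1 + ε) * A ^ ((1:ℝ)/4) + W ^ ((1:ℝ)/3) * A * B ^ ((2:ℝ)/3))) := by gcongr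
  have p1 : 0 ≤ 2 * C2 * C1 * (W ^ ((1:ℝ)/3) * A * B ^ ((5:ℝ)/3)) := by positivity
  have s5 := s1.trans s2
  have e9 : (c + |ρ|) * B * (C0 * (W ^ (1 + ε) * A ^ ((1:ℝ)/4) + W ^ ((1:ℝ)/3) * A * B ^ ((2:ℝ)/3))) =
    C0 * (c + |ρ|) * (W ^ (1 + ε) * B * A ^ ((1:ℝ)/4) + W ^ ((1:ℝ)/3) * A * B ^ ((5:ℝ)/3)) := by rw [hB53]; ring
  linarith

end Setup
end RS

namespace RS
open Finset MeasureTheory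

theorem EE_continuousAt (a : ℕ → ℝ) (ρ : ℝ) {x : ℝ} (hx : 0 < x) (hn : ∀ n : ℕ, x ≠ n) :
    ContinuousAt (EE a ρ) x := by
  have h1 : ContinuousAt (SA a) x := by
    have h2 : (⌊x⌋₊:ℝ) < x := lt_of_le_of_ne (Nat.floor_le hx.le) (hn _).symm
    have h3 : x < (⌊x⌋₊:ℝ) + 1 := Nat.lt_floor_add_one x
    have h4 : (fun _ => SA a x) =ᶠ[nhds x] SA a := by
      filter_upwards [Ioo_mem_nhds h2 h3] with y hy
      have : ⌊y⌋₊ = ⌊x⌋₊ := (Nat.floor_eq_iff (le_trans (by positivity) hy.1.le)).2 ⟨hy.1.le, hy.2⟩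
      rw [SA, SA, this]
    exact continuousAt_const.congr h4
  exact h1.sub (by fun_prop)

theorem pw23 {W s : ℝ} (hW : 0 < W) (hs : 0 < s) : s * (W / s) ^ ((1:ℝ)/3) = W ^ ((1:ℝ)/3) * s ^ ((2:ℝ)/3) := by
  have : s = s ^ ((2:ℝ)/3) * s ^ ((1:ℝ)/3) := by rw [← Real.rpow_add hs]; norm_num
  rw [Real.div_rpow hW.le hs.le]
  nth_rewrite 1 [this]
  field_simp

namespace Setup
variable {a χ : ℕ → ℝ} {q : ℕ} {ρ c : ℝ}

theorem sum_J_le (h : Setup a χ q ρ c) {A B W : ℝ} (hA : 1 ≤ A) (hB : 1 ≤ B) (hW : A * B ≤ W) :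
    IntervalIntegrable (fun t => t * ∫ u in (1:ℝ)..A, u * EE a ρ (W / t / u)) volume 1 B ∧
    |∑ y ∈ Ioc 0 ⌊B⌋₊, a y * y * (∫ u in (1:ℝ)..A, u * EE a ρ (W / y / u))
      - ρ * ∫ t in (1:ℝ)..B, t * ∫ u in (1:ℝ)..A, u * EE a ρ (W / t / u)| ≤
      (4 * c ^ 2 + ρ * c) * (W ^ ((1:ℝ)/3) * A ^ ((5:ℝ)/3) * B) := by
  have hc := h.cpos
  have hρ := h.rho_nonneg
  have hA0 : 0 < A := by linarith
  have hB0 : 0 < B := by linarith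
  have hAB1 : 1 ≤ A * B := by nlinarith
  have hW0 : 0 < W := by linarith
  set φ : ℝ → ℝ := fun s => s * EE a ρ (W / s) with hφ
  have φm : Measurable φ := measurable_id.mul ((EE_measurable a ρ).comp (measurable_const.div measurable_id))
  have φb : ∀ s r, 1 ≤ s → s ≤ r → r ≤ A * B → |φ s| ≤ c * (W ^ ((1:ℝ)/3) * r ^ ((2:ℝ)/3)) := by
    intro s r hs hsr hr
    have hs0 : 0 < s := by linarith
    have hE := h.E_le (t := W / s) (by rw [le_div_iff₀ hs0]; linarith)
    rw [hφ]; simp only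
    rw [abs_mul, abs_of_pos hs0]
    calc s * |EE a ρ (W / s)| ≤ s * (c * (W / s) ^ ((1:ℝ)/3)) := by gcongr
      _ = c * (s * (W / s) ^ ((1:ℝ)/3)) := by ring
      _ ≤ _ := by rw [pw23 hW0 hs0]; gcongr
  have φi : ∀ u v, 1 ≤ u → u ≤ A * B → 1 ≤ v → v ≤ A * B → IntervalIntegrable φ volume u v := by
    intro u v hu hu' hv hv'
    refine ii_of_bdd φm (M := c * (W ^ ((1:ℝ)/3) * (A * B) ^ ((2:ℝ)/3))) fun t ht => ?_
    rw [Set.uIoc, Set.mem_Ioc] at ht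
    exact φb t _ (le_trans (le_min hu hv) ht.1.le) (ht.2.trans (max_le hu' hv')) le_rfl
  set Φ : ℝ → ℝ := fun x => ∫ s in (1:ℝ)..x, φ s with hΦ
  set k : ℝ → ℝ := fun t => Φ (A * t) - Φ t with hk
  set k' : ℝ → ℝ := fun t => A * φ (A * t) - φ t with hk'
  set g : ℝ → ℝ := fun t => k t / t with hg
  set h' : ℝ → ℝ := fun t => k' t / t - k t / t ^ 2 with hh'
  have hAt : ∀ t, 1 ≤ t → t ≤ B → 1 ≤ A * t ∧ A * t ≤ A * B ∧ t ≤ A * t ∧ t ≤ A * B := fun t h1 h2 =>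
    ⟨by nlinarith, by gcongr, by nlinarith, by nlinarith⟩
  have keq : ∀ t, 1 ≤ t → t ≤ B → k t = ∫ s in t..(A * t), φ s := by
    intro t h1 h2
    obtain ⟨p1, p2, p3, p4⟩ := hAt t h1 h2
    rw [hk, hΦ]; simp only
    rw [intervalIntegral.integral_interval_sub_left (φi _ _ le_rfl hAB1 p1 p2) (φi _ _ le_rfl hAB1 h1 p4)]
  have geq : ∀ t, 1 ≤ t → t ≤ B → t * ∫ u in (1:ℝ)..A, u * EE a ρ (W / t / u) = g t := by
    intro t h1 h2
    have ht0 : t ≠ 0 := by linarith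
    have e := intervalIntegral.integral_comp_mul_left φ ht0 (a := 1) (b := A)
    rw [hg]; simp only
    rw [smul_eq_mul, mul_one] at e
    rw [keq t h1 h2, mul_comm A, div_eq_inv_mul (∫ s in t..(t * A), φ s) t]
    rw [← e, ← intervalIntegral.integral_const_mul]
    refine intervalIntegral.integral_congr fun u _ => ?_
    rw [hφ]; simp only
    rw [div_div]; ring
  have kb : ∀ t, 1 ≤ t → t ≤ B → |k t| ≤ c * (W ^ ((1:ℝ)/3) * (A * t) ^ ((2:ℝ)/3)) * (A * t) := by
    intro t h1 h2
    obtain ⟨p1, p2, p3, p4⟩ := hAt t h1 h2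
    rw [keq t h1 h2]
    have := intervalIntegral.norm_integral_le_of_norm_le_const (a := t) (b := A * t) (f := φ)
      (C := c * (W ^ ((1:ℝ)/3) * (A * t) ^ ((2:ℝ)/3))) (fun s hs => by
        rw [Set.uIoc_of_le p3] at hs
        exact φb s _ (by linarith [hs.1]) hs.2 p2)
    rw [Real.norm_eq_abs, abs_of_nonneg (by linarith : 0 ≤ A * t - t)] at this
    refine this.trans ?_
    gcongr
    linarith
  set S := W ^ ((1:ℝ)/3) * A ^ ((5:ℝ)/3) with hS
  have hA53 : A ^ ((5:ℝ)/3) = A * A ^ ((2:ℝ)/3) := by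
    rw [← Real.rpow_one_add' hA0.le (by norm_num)]; norm_num
  have gb : ∀ t, 1 ≤ t → t ≤ B → |g t| ≤ c * S * t ^ ((2:ℝ)/3) := by
    intro t h1 h2
    have ht0 : 0 < t := by linarith
    rw [hg]; simp only
    rw [abs_div, abs_of_pos ht0, div_le_iff₀ ht0]
    refine (kb t h1 h2).trans (le_of_eq ?_)
    rw [hS, hA53, Real.mul_rpow hA0.le ht0.le]; ring
  have k'b : ∀ t, 1 ≤ t → t ≤ B → |k' t| ≤ 2 * c * S * t ^ ((2:ℝ)/3) := by
    intro t h1 h2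
    obtain ⟨p1, p2, p3, p4⟩ := hAt t h1 h2
    have ht0 : 0 < t := by linarith
    rw [hk']; simp only
    refine (abs_sub _ _).trans ?_
    rw [abs_mul, abs_of_pos hA0]
    have q1 := φb (A * t) (A * t) p1 le_rfl p2
    have q2 := φb t (A * t) h1 p3 p2
    have e : A * (c * (W ^ ((1:ℝ)/3) * (A * t) ^ ((2:ℝ)/3))) = c * S * t ^ ((2:ℝ)/3) := by
      rw [hS, hA53, Real.mul_rpow hA0.le ht0.le]; ring
    have q0 : 0 ≤ c * (W ^ ((1:ℝ)/3) * (A * t) ^ ((2:ℝ)/3)) := by positivity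
    nlinarith
  have h'b : ∀ t, 1 ≤ t → t ≤ B → t ^ ((1:ℝ)/3) * |h' t| ≤ 3 * c * S := by
    intro t h1 h2
    have ht0 : 0 < t := by linarith
    have e : h' t = (k' t - g t) / t := by rw [hh', hg]; field_simp
    have e2 : t ^ ((1:ℝ)/3) * t ^ ((2:ℝ)/3) = t := by
      rw [← Real.rpow_add ht0]; norm_num
    rw [e, abs_div, abs_of_pos ht0, mul_div_assoc', div_le_iff₀ ht0]
    calc t ^ ((1:ℝ)/3) * |k' t - g t| ≤ t ^ ((1:ℝ)/3) * (2 * c * S * t ^ ((2:ℝ)/3) + c * S * t ^ ((2:ℝ)/3)) := by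
          gcongr
          exact (abs_sub _ _).trans (add_le_add (k'b t h1 h2) (gb t h1 h2))
      _ = 3 * c * S * (t ^ ((1:ℝ)/3) * t ^ ((2:ℝ)/3)) := by ring
      _ = _ := by rw [e2]
  -- continuity, derivatives
  have Φc : ContinuousOn Φ (Set.Icc 1 (A * B)) := by
    have := intervalIntegral.continuousOn_primitive_interval' (φi 1 (A * B) le_rfl hAB1 hAB1 le_rfl) Set.left_mem_uIcc
    rwa [Set.uIcc_of_le hAB1] at this
  have kc : ContinuousOn k (Set.Icc 1 B) := by
    refine ContinuousOn.sub (Φc.comp (by fun_prop) fun t ht => ?_) (Φc.mono fun t ht => ?_)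
    · obtain ⟨p1, p2, p3, p4⟩ := hAt t ht.1 ht.2; exact ⟨p1, p2⟩
    · obtain ⟨p1, p2, p3, p4⟩ := hAt t ht.1 ht.2; exact ⟨ht.1, p4⟩
  have gc : ContinuousOn g (Set.Icc 1 B) := kc.div continuousOn_id fun t ht => by
    have : 1 ≤ t := ht.1
    exact (by linarith : t ≠ 0)
  set N : Set ℝ := Set.range (fun n : ℕ => W / n) ∪ Set.range (fun n : ℕ => W / n / A) with hN
  have Nc : N.Countable := (Set.countable_range _).union (Set.countable_range _)
  have Φd : ∀ x, 1 ≤ x → x ≤ A * B → (∀ n : ℕ, x ≠ W / n) → HasDerivAt Φ (φ x) x := by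
    intro x h1 h2 h3
    have hx0 : 0 < x := by linarith
    refine intervalIntegral.integral_hasDerivAt_right (φi 1 x le_rfl hAB1 h1 h2)
      (φm.stronglyMeasurable.stronglyMeasurableAtFilter) ?_
    refine continuousAt_id.mul (ContinuousAt.comp (f := fun s => W / s) (EE_continuousAt a ρ (by positivity) fun n hn => ?_)
      (continuousAt_const.div continuousAt_id hx0.ne'))
    apply h3 n
    rw [← hn, div_div_cancel₀ hW0.ne']
  have kd : ∀ x ∈ Set.Ioo 1 B \ N, HasDerivAt k (k' x) x := by
    rintro x ⟨hx, hxN⟩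
    obtain ⟨p1, p2, p3, p4⟩ := hAt x hx.1.le hx.2.le
    have d1 := Φd x hx.1.le p4 fun n hn => hxN (Or.inl ⟨n, hn.symm⟩)
    have d2 := Φd (A * x) p1 p2 fun n hn => hxN (Or.inr ⟨n, by
      simp only; rw [← hn]; field_simp⟩)
    have d3 : HasDerivAt (fun t => A * t) A x := by simpa using (hasDerivAt_id x).const_mul A
    have := (HasDerivAt.comp x d2 d3).sub d1
    rw [hk']
    convert! this using 1
    simp only; ring
  have gd : ∀ x ∈ Set.Ioo 1 B \ N, HasDerivAt g (h' x) x := by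
    intro x hx
    have hx0 : x ≠ 0 := by have := hx.1.1; linarith
    have := (kd x hx).div (hasDerivAt_id x) hx0
    convert! this using 1
    rw [hh']; simp only [id]; field_simp
  have k'm : Measurable k' := (measurable_const.mul (φm.comp (measurable_const.mul measurable_id))).sub φm
  have k'i : ∀ u, 1 ≤ u → u ≤ B → IntervalIntegrable k' volume u B := fun u hu huB =>
    ii_of_bdd k'm (M := 2 * c * S * B ^ ((2:ℝ)/3)) fun t ht => by
      rw [Set.uIoc_of_le huB] at ht
      refine (k'b t (by linarith [ht.1]) ht.2).trans ?_
      have : 0 < t := by linarith [ht.1]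
      gcongr
      exact ht.2
  have kI : ∀ (m : ℕ) u, 1 ≤ u → u ≤ B → IntervalIntegrable (fun t => k t / t ^ m) volume u B := fun m u hu huB => by
    apply ContinuousOn.intervalIntegrable
    rw [Set.uIcc_of_le huB]
    refine (kc.mono (Set.Icc_subset_Icc_left hu)).div (by fun_prop) fun t ht => ?_
    have : 0 < t := by linarith [ht.1]
    positivity
  have h'i : ∀ u, 1 ≤ u → u ≤ B → IntervalIntegrable h' volume u B := fun u hu huB => by
    refine IntervalIntegrable.sub ?_ (kI 2 u hu huB)
    simp only [div_eq_mul_inv]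
    refine (k'i u hu huB).mul_continuousOn ?_
    rw [Set.uIcc_of_le huB]
    refine ContinuousOn.inv₀ continuousOn_id fun t ht => ?_
    have : 0 < t := by linarith [ht.1]
    exact this.ne'
  have gF : ∀ u, 1 ≤ u → u ≤ B → ∫ t in u..B, h' t = g B - g u := fun u hu huB =>
    integral_eq_of_hasDerivAt_off_countable_of_le g h' huB Nc (gc.mono (Set.Icc_subset_Icc_left hu))
      (fun x hx => gd x ⟨⟨by linarith [hx.1.1], hx.1.2⟩, hx.2⟩) (h'i u hu huB)
  have kF : ∫ t in (1:ℝ)..B, k' t = k B - k 1 :=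
    integral_eq_of_hasDerivAt_off_countable_of_le k k' hB Nc kc kd (k'i 1 le_rfl hB)
  obtain ⟨ab1, ab2⟩ := abelInt a hB h' (h'i 1 le_rfl hB)
  have gi : IntervalIntegrable g volume 1 B := by simpa using kI 1 1 le_rfl hB
  have e1 : ∑ y ∈ Ioc 0 ⌊B⌋₊, a y * y * (∫ u in (1:ℝ)..A, u * EE a ρ (W / y / u)) =
      SA a B * g B - ∫ s in (1:ℝ)..B, SA a s * h' s := by
    rw [← ab2, SA, sum_mul, ← sum_sub_distrib]
    refine sum_congr rfl fun y hy => ?_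
    have hy1 : (1:ℝ) ≤ y := by exact_mod_cast (mem_Ioc.1 hy).1
    have hy2 := (Nat.le_floor_iff hB0.le).1 (mem_Ioc.1 hy).2
    rw [mul_assoc, geq y hy1 hy2, gF y hy1 hy2]; ring
  have e2 : ∫ t in (1:ℝ)..B, t * ∫ u in (1:ℝ)..A, u * EE a ρ (W / t / u) = ∫ t in (1:ℝ)..B, g t := by
    refine intervalIntegral.integral_congr fun t ht => ?_
    rw [Set.uIcc_of_le hB] at ht
    exact geq t ht.1 ht.2
  have Ehm : IntervalIntegrable (fun s => EE a ρ s * h' s - ρ * g s) volume 1 B := by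
    have i3 : IntervalIntegrable (fun s => SA a s * h' s - ρ * k' s) volume 1 B := ab1.sub ((k'i 1 le_rfl hB).const_mul ρ)
    refine (intervalIntegrable_congr fun s hs => ?_).2 i3
    rw [Set.uIoc_of_le hB] at hs
    have : s ≠ 0 := by linarith [hs.1]
    simp only [hh', hg, EE]; field_simp; ring
  have Ehi : IntervalIntegrable (fun s => EE a ρ s * h' s) volume 1 B := by
    simpa using Ehm.add (gi.const_mul ρ)
  have e3 : ∫ s in (1:ℝ)..B, SA a s * h' s = (∫ s in (1:ℝ)..B, EE a ρ s * h' s) + ρ * (k B - k 1) - ρ * ∫ t in (1:ℝ)..B, g t := by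
    rw [← kF, ← intervalIntegral.integral_const_mul, ← intervalIntegral.integral_const_mul,
      ← intervalIntegral.integral_add Ehi ((k'i 1 le_rfl hB).const_mul ρ),
      ← intervalIntegral.integral_sub (Ehi.add ((k'i 1 le_rfl hB).const_mul ρ)) (gi.const_mul ρ)]
    refine intervalIntegral.integral_congr fun s hs => ?_
    rw [Set.uIcc_of_le hB] at hs
    have : s ≠ 0 := by linarith [hs.1]
    simp only [hh', hg, EE]; field_simp; ring
  have e4 : SA a B = EE a ρ B + ρ * B := by rw [EE]; ring
  have e5 : k B = B * g B := by rw [hg]; field_simp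
  have e6 : k 1 = g 1 := by simp [hg]
  have e7 : SA a B * g B - (∫ s in (1:ℝ)..B, SA a s * h' s) - ρ * ∫ t in (1:ℝ)..B, g t =
      EE a ρ B * g B - (∫ s in (1:ℝ)..B, EE a ρ s * h' s) + ρ * g 1 := by
    rw [e3, e4, e5, e6]; ring
  refine ⟨(intervalIntegrable_congr fun t ht => ?_).2 gi, ?_⟩
  · rw [Set.uIoc_of_le hB] at ht
    exact geq t ht.1.le ht.2
  rw [e1, e2, e7]
  have S0 : 0 ≤ S := by positivity
  have b1 : |EE a ρ B * g B| ≤ c ^ 2 * (S * B) := by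
    rw [abs_mul]
    calc _ ≤ c * B ^ ((1:ℝ)/3) * (c * S * B ^ ((2:ℝ)/3)) := by
          gcongr
          · exact h.E_le hB
          · exact gb B hB le_rfl
      _ = c ^ 2 * (S * (B ^ ((1:ℝ)/3) * B ^ ((2:ℝ)/3))) := by ring
      _ = _ := by rw [← Real.rpow_add hB0]; norm_num
  have b2 : |∫ s in (1:ℝ)..B, EE a ρ s * h' s| ≤ 3 * c ^ 2 * (S * B) := by
    have := intervalIntegral.norm_integral_le_of_norm_le_const (a := 1) (b := B) (f := fun s => EE a ρ s * h' s)
      (C := 3 * c ^ 2 * S) (fun s hs => by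
        rw [Set.uIoc_of_le hB] at hs
        rw [Real.norm_eq_abs, abs_mul]
        have q1 := h.E_le hs.1.le
        have q2 := h'b s hs.1.le hs.2
        calc _ ≤ c * s ^ ((1:ℝ)/3) * |h' s| := by gcongr
          _ = c * (s ^ ((1:ℝ)/3) * |h' s|) := by ring
          _ ≤ c * (3 * c * S) := by gcongr
          _ = _ := by ring)
    rw [Real.norm_eq_abs, abs_of_nonneg (by linarith : 0 ≤ B - 1)] at this
    refine this.trans ?_
    have : 0 ≤ 3 * c ^ 2 * S := by positivity
    nlinarith
  have b3 : |ρ * g 1| ≤ ρ * c * (S * B) := by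
    have := gb 1 le_rfl hB
    rw [Real.one_rpow, mul_one] at this
    rw [abs_mul, abs_of_nonneg hρ, mul_assoc]
    refine mul_le_mul_of_nonneg_left (this.trans ?_) hρ
    exact mul_le_mul_of_nonneg_left (le_mul_of_one_le_right S0 hB) hc.le
  refine (abs_add_le _ _).trans (le_trans (add_le_add ((abs_sub _ _).trans (add_le_add b1 b2)) b3) (le_of_eq ?_))
  ring

end Setup
end RS

namespace RS
open Finset MeasureTheory

namespace Setup
variable {a χ : ℕ → ℝ} {q : ℕ} {ρ c : ℝ}

set_option maxHeartbeats 1000000 in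
theorem refined (h : Setup a χ q ρ c) {ε : ℝ} (hε : 0 < ε) (hε1 : ε < 1) : ∃ C : ℝ, 0 ≤ C ∧
    ∀ A B W : ℝ, 1 ≤ A → 0 < B → A ^ 2 ≤ W → B ^ 2 ≤ W →
    |TT a ρ A B W - (-kap χ q / 2) * ρ ^ 2 / 4 * (A ^ 2 * B ^ 2)| ≤
      C * (W ^ (1 + ε) * B * A ^ ((1:ℝ)/4) + W ^ ((2:ℝ)/3) * (A * B)
        + (A * B) ^ ((5:ℝ)/2) * W ^ (-(1:ℝ)/2)) := by
  obtain ⟨C1, hC1, h1⟩ := h.sum_IA_le hε hε1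
  obtain ⟨C2, hC2, h2⟩ := h.smooth_part
  have hc := h.cpos
  have hρ := h.rho_nonneg
  set γ := -kap χ q / 2 with hγ
  set M := |γ * ρ ^ 2 / 4| with hM
  set C3 := 4 * c ^ 2 + ρ * c with hC3
  refine ⟨C1 + ρ * C3 + ρ ^ 2 * C2 + 2 * M, by positivity, fun A B W hA hB0 hAW hBW => ?_⟩
  have hA0 : 0 < A := by linarith
  have hW1 : 1 ≤ W := by nlinarith
  have hW0 : 0 < W := by linarith
  have hM0 : 0 ≤ M := abs_nonneg _
  have hC30 : 0 ≤ C3 := by positivity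
  set P := W ^ (1 + ε) * B * A ^ ((1:ℝ)/4) with hP
  set Q := W ^ ((2:ℝ)/3) * (A * B) with hQ
  set R := (A * B) ^ ((5:ℝ)/2) * W ^ (-(1:ℝ)/2) with hR
  have hP0 : 0 ≤ P := by positivity
  have hQ0 : 0 ≤ Q := by positivity
  have hR0 : 0 ≤ R := by positivity
  have hA14 : 1 ≤ A ^ ((1:ℝ)/4) := Real.one_le_rpow hA (by norm_num)
  rcases lt_or_ge B 1 with hB1 | hB
  · rw [TT_zero a ρ W (Or.inr hB1), zero_sub, abs_neg, abs_mul, ← hM, abs_of_nonneg (by positivity)]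
    have h3 : A ^ 2 * B ^ 2 ≤ P := by
      have : W ≤ W ^ (1 + ε) := Real.self_le_rpow_of_one_le hW1 (by linarith)
      calc A ^ 2 * B ^ 2 ≤ W * B := by
            apply mul_le_mul hAW (by nlinarith) (by positivity) hW0.le
        _ ≤ W ^ (1 + ε) * B := by gcongr
        _ ≤ P := le_mul_of_one_le_right (by positivity) hA14
    have : M * (A ^ 2 * B ^ 2) ≤ M * P := by gcongr
    have : 0 ≤ (C1 + ρ * C3 + ρ ^ 2 * C2 + M) * P := by positivity
    have : 0 ≤ (C1 + ρ * C3 + ρ ^ 2 * C2 + 2 * M) * (Q + R) := by positivity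
    nlinarith
  have hABW : A * B ≤ W := by nlinarith [sq_nonneg (A - B)]
  have hBAW : B * A ≤ W := by linarith
  obtain ⟨i3, h3⟩ := h.sum_J_le hA hB hABW
  have h1 := h1 A B W hA hB hABW hAW
  have h2 := h2 B A W hB hA hBAW
  rw [← hC3] at h3
  set J : ℝ → ℝ := fun t => ∫ u in (1:ℝ)..A, u * EE a ρ (W / t / u) with hJ
  have eT : TT a ρ A B W = ∑ y ∈ Ioc 0 ⌊B⌋₊, a y * y * IA a ρ A (W / y) + ρ * ∑ y ∈ Ioc 0 ⌊B⌋₊, a y * y * J y := by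
    rw [TT_comm, TT, mul_sum, ← sum_add_distrib]
    refine sum_congr rfl fun y _ => ?_
    rw [IA]
    have : a y * y * (∑ x ∈ Ioc 0 ⌊A⌋₊, a x * x * EE a ρ (W / y / x) - ρ * J y) + ρ * (a y * y * J y) =
      ∑ x ∈ Ioc 0 ⌊A⌋₊, a y * y * (a x * x * EE a ρ (W / y / x)) := by rw [← mul_sum]; ring
    rw [hJ] at this ⊢
    simp only at this ⊢
    rw [this]
    refine sum_congr rfl fun x _ => ?_
    rw [div_div]; ring
  have e1 : ∀ t, 1 ≤ t → t ≤ B → ∫ u in (1:ℝ)..A, u * (EE a ρ (W / t / u) - γ) = J t - γ * (A ^ 2 - 1) / 2 := by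
    intro t ht htB
    have ht0 : 0 < t := by linarith
    have hi := (int_EE_div a ρ (w := W / t) hA (by rw [le_div_iff₀ ht0]; nlinarith)).1
    have : ∫ u in (1:ℝ)..A, u * (EE a ρ (W / t / u) - γ) = ∫ u in (1:ℝ)..A, (u * EE a ρ (W / t / u) - γ * u) :=
      intervalIntegral.integral_congr fun u _ => by ring
    rw [this, intervalIntegral.integral_sub hi ((intervalIntegral.intervalIntegrable_id).const_mul γ),
      intervalIntegral.integral_const_mul]
    simp only [integral_id]
    ring
  have e2 : ∫ t in (1:ℝ)..B, t * ∫ u in (1:ℝ)..A, u * (EE a ρ (W / t / u) - γ) =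
      (∫ t in (1:ℝ)..B, t * J t) - γ * (A ^ 2 - 1) / 2 * ((B ^ 2 - 1) / 2) := by
    have : ∫ t in (1:ℝ)..B, t * ∫ u in (1:ℝ)..A, u * (EE a ρ (W / t / u) - γ) =
        ∫ t in (1:ℝ)..B, (t * J t - γ * (A ^ 2 - 1) / 2 * t) :=
      intervalIntegral.integral_congr fun t ht => by
        rw [Set.uIcc_of_le hB] at ht
        beta_reduce
        rw [e1 t ht.1 ht.2]; ring
    rw [this, intervalIntegral.integral_sub i3 ((intervalIntegral.intervalIntegrable_id).const_mul _),
      intervalIntegral.integral_const_mul]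
    simp only [integral_id]
    ring
  rw [e2] at h2
  have hpow : ∀ D, 0 < D → D ^ 2 ≤ W → D ^ ((2:ℝ)/3) ≤ W ^ ((1:ℝ)/3) := fun D hD hDW => by
    calc D ^ ((2:ℝ)/3) = (D ^ 2) ^ ((1:ℝ)/3) := by rw [← Real.rpow_natCast D 2, ← Real.rpow_mul hD.le]; norm_num
      _ ≤ _ := by gcongr
  have h53 : ∀ D : ℝ, 0 < D → D ^ ((5:ℝ)/3) = D * D ^ ((2:ℝ)/3) := fun D hD => by
    rw [← Real.rpow_one_add' hD.le (by norm_num)]; norm_num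
  have hW23 : W ^ ((2:ℝ)/3) = W ^ ((1:ℝ)/3) * W ^ ((1:ℝ)/3) := by rw [← Real.rpow_add hW0]; norm_num
  have q1 : W ^ ((1:ℝ)/3) * A * B ^ ((5:ℝ)/3) ≤ Q := by
    rw [h53 B hB0, hQ, hW23]
    have := hpow B hB0 hBW
    calc _ = W ^ ((1:ℝ)/3) * B ^ ((2:ℝ)/3) * (A * B) := by ring
      _ ≤ _ := by gcongr
  have q2 : W ^ ((1:ℝ)/3) * A ^ ((5:ℝ)/3) * B ≤ Q := by
    rw [h53 A hA0, hQ, hW23]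
    have := hpow A hA0 hAW
    calc _ = W ^ ((1:ℝ)/3) * A ^ ((2:ℝ)/3) * (A * B) := by ring
      _ ≤ _ := by gcongr
  have hD : ∀ D : ℝ, 0 < D → D ^ 2 ≤ W → D ≤ W ^ ((2:ℝ)/3) := fun D hD hDW => by
    have : D ≤ W ^ ((1:ℝ)/2) := by
      rw [← Real.sqrt_eq_rpow]; exact Real.le_sqrt_of_sq_le hDW
    exact this.trans (Real.rpow_le_rpow_of_exponent_le hW1 (by norm_num))
  have q3 : A ^ 2 + B ^ 2 ≤ 2 * Q := by
    have g1 := hD A hA0 hAW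
    have g2 := hD B hB0 hBW
    have g3 : A * (A * B) ≤ Q := by rw [hQ]; gcongr
    have g4 : B * (A * B) ≤ Q := by rw [hQ]; gcongr
    have g5 := mul_nonneg (sq_nonneg A) (sub_nonneg.2 hB)
    have g6 := mul_nonneg (sq_nonneg B) (sub_nonneg.2 hA)
    linarith
  set I := ∫ t in (1:ℝ)..B, t * J t with hI
  set S1 := ∑ y ∈ Ioc 0 ⌊B⌋₊, a y * y * IA a ρ A (W / y) with hS1
  set S2 := ∑ y ∈ Ioc 0 ⌊B⌋₊, a y * y * J y with hS2
  have eq : TT a ρ A B W - γ * ρ ^ 2 / 4 * (A ^ 2 * B ^ 2) = S1 + ρ * (S2 - ρ * I)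
      + ρ ^ 2 * (I - γ * (A ^ 2 - 1) / 2 * ((B ^ 2 - 1) / 2)) + (γ * ρ ^ 2 / 4) * (1 - A ^ 2 - B ^ 2) := by
    rw [eT]; ring
  have hRR : (B * A) ^ ((5:ℝ)/2) * W ^ (-(1:ℝ)/2) = R := by rw [hR, mul_comm B]
  rw [hRR] at h2
  rw [eq]
  have t1 : |S1| ≤ C1 * (P + Q) := h1.trans (by gcongr)
  have t2 : |ρ * (S2 - ρ * I)| ≤ ρ * (C3 * Q) := by
    rw [abs_mul, abs_of_nonneg hρ]
    exact mul_le_mul_of_nonneg_left (h3.trans (by gcongr)) hρ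
  have t3 : |ρ ^ 2 * (I - γ * (A ^ 2 - 1) / 2 * ((B ^ 2 - 1) / 2))| ≤ ρ ^ 2 * (C2 * R) := by
    rw [abs_mul, abs_of_nonneg (sq_nonneg ρ)]
    exact mul_le_mul_of_nonneg_left h2 (sq_nonneg ρ)
  have t4 : |(γ * ρ ^ 2 / 4) * (1 - A ^ 2 - B ^ 2)| ≤ M * (2 * Q) := by
    rw [abs_mul, ← hM]
    refine mul_le_mul_of_nonneg_left (le_trans ?_ q3) hM0
    have g1 : 1 ≤ A ^ 2 := one_le_pow₀ hA
    have g2 : 0 ≤ B ^ 2 := sq_nonneg B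
    rw [abs_le]; constructor <;> linarith
  refine (abs_add_le _ _).trans (le_trans (add_le_add ((abs_add_le _ _).trans (add_le_add
    ((abs_add_le _ _).trans (add_le_add t1 t2)) t3)) t4) ?_)
  have := mul_nonneg hC1 hR0
  have := mul_nonneg (mul_nonneg hρ hC30) (add_nonneg hP0 hR0)
  have := mul_nonneg (mul_nonneg (sq_nonneg ρ) hC2) (add_nonneg hP0 hQ0)
  have := mul_nonneg hM0 (add_nonneg hP0 hR0)
  linarith

end Setup
end RS

namespace RS
open Finset MeasureTheory

namespace Setup
variable {a χ : ℕ → ℝ} {q : ℕ} {ρ c : ℝ}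

set_option maxHeartbeats 4000000 in
/-- Bound for a single term of the quadruple sum. -/
theorem term_bound (h : Setup a χ q ρ c) : ∃ C : ℝ, 0 ≤ C ∧ ∀ X Y : ℝ, 1 ≤ X → X ^ 2 ≤ Y →
    ∀ e f k l : ℝ, 1 ≤ e → 1 ≤ f → 1 ≤ k → 1 ≤ l → l ≤ X →
    (e * f) ^ 2 * |TT a ρ (X / (e * f * k)) (X / (e * f * l)) (Y / (e * f ^ 2)) -
      (-kap χ q / 2) * ρ ^ 2 / 4 * ((X / (e * f * k)) ^ 2 * (X / (e * f * l)) ^ 2)| ≤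
    C * ((X ^ ((24:ℝ)/5) * Y ^ (-(2:ℝ)/5) + X ^ ((3:ℝ)/2) * Y) *
      (e ^ (-(1 + 1/1000 : ℝ)) * f ^ (-(1 + 1/1000 : ℝ)) * k ^ (-(1 + 1/1000 : ℝ)) * l ^ (-(1 + 1/1000 : ℝ)))) := by
  obtain ⟨C0, hC0, h0⟩ := h.triv0
  obtain ⟨C1, hC1, h1⟩ := h.triv (ε := 1/1000) (by norm_num) (by norm_num)
  obtain ⟨C2, hC2, h2⟩ := h.refined (ε := 1/1000) (by norm_num) (by norm_num)
  set G := (-kap χ q / 2) * ρ ^ 2 / 4 with hG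
  refine ⟨C0 + 2 * C1 + 3 * C2 + |G|, by positivity, fun X Y hX hXY e f k l he hf hk hl hlX => ?_⟩
  have hX0 : 0 < X := by linarith
  have hY0 : 0 < Y := lt_of_lt_of_le (by positivity) hXY
  have he0 : 0 < e := by linarith
  have hf0 : 0 < f := by linarith
  have hk0 : 0 < k := by linarith
  have hl0 : 0 < l := by linarith
  set A := X / (e * f * k) with hA
  set B := X / (e * f * l) with hB
  set W := Y / (e * f ^ 2) with hW
  set V := e ^ (-(1 + 1/1000 : ℝ)) * f ^ (-(1 + 1/1000 : ℝ)) * k ^ (-(1 + 1/1000 : ℝ)) * l ^ (-(1 + 1/1000 : ℝ)) with hV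
  have hA0 : 0 < A := by positivity
  have hB0 : 0 < B := by positivity
  have hW0 : 0 < W := by positivity
  have hV0 : 0 < V := by positivity
  set E1 := X ^ ((24:ℝ)/5) * Y ^ (-(2:ℝ)/5) with hE1
  set E2 := X ^ ((3:ℝ)/2) * Y with hE2
  have hE10 : 0 < E1 := by positivity
  have hE20 : 0 < E2 := by positivity
  have w1 : E1 * V ≤ (E1 + E2) * V := by gcongr; linarith
  have w2 : E2 * V ≤ (E1 + E2) * V := by gcongr; linarith
  -- all monomial inequalities, in logarithmic coordinates
  obtain ⟨x, hx⟩ : ∃ x, X = Real.exp x := ⟨Real.log X, (Real.exp_log hX0).symm⟩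
  obtain ⟨y, hy⟩ : ∃ x, Y = Real.exp x := ⟨Real.log Y, (Real.exp_log hY0).symm⟩
  obtain ⟨e', he'⟩ : ∃ x, e = Real.exp x := ⟨Real.log e, (Real.exp_log he0).symm⟩
  obtain ⟨f', hf'⟩ : ∃ x, f = Real.exp x := ⟨Real.log f, (Real.exp_log hf0).symm⟩
  obtain ⟨k', hk'⟩ : ∃ x, k = Real.exp x := ⟨Real.log k, (Real.exp_log hk0).symm⟩
  obtain ⟨l', hl'⟩ : ∃ x, l = Real.exp x := ⟨Real.log l, (Real.exp_log hl0).symm⟩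
  have px : 0 ≤ x := by rwa [hx, Real.one_le_exp_iff] at hX
  have pe : 0 ≤ e' := by rwa [he', Real.one_le_exp_iff] at he
  have pf : 0 ≤ f' := by rwa [hf', Real.one_le_exp_iff] at hf
  have pk : 0 ≤ k' := by rwa [hk', Real.one_le_exp_iff] at hk
  have pl : 0 ≤ l' := by rwa [hl', Real.one_le_exp_iff] at hl
  have plx : l' ≤ x := by rwa [hl', hx, Real.exp_le_exp] at hlX
  have pxy : 2 * x ≤ y := by
    rw [hx, hy, ← Real.exp_nat_mul, Real.exp_le_exp] at hXY; exact_mod_cast hXY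
  have lA : A = Real.exp (x - (e' + f' + k')) := by
    rw [hA, hx, he', hf', hk', Real.exp_sub, Real.exp_add, Real.exp_add]
  have lB : B = Real.exp (x - (e' + f' + l')) := by
    rw [hB, hx, he', hf', hl', Real.exp_sub, Real.exp_add, Real.exp_add]
  have lW : W = Real.exp (y - (e' + 2 * f')) := by
    rw [hW, hy, he', hf', Real.exp_sub, Real.exp_add, ← Real.exp_nat_mul]; norm_num
  have lef : (e * f) ^ 2 = Real.exp (2 * (e' + f')) := by
    rw [he', hf', ← Real.exp_add, ← Real.exp_nat_mul]; norm_num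
  have lV : V = Real.exp (-(1001/1000) * (e' + f' + k' + l')) := by
    rw [hV, he', hf', hk', hl']
    simp only [← Real.exp_mul, ← Real.exp_add]
    congr 1; ring
  have lE1 : E1 * V = Real.exp (24 / 5 * x - 2 / 5 * y - 1001/1000 * (e' + f' + k' + l')) := by
    rw [hE1, lV, hx, hy]
    simp only [← Real.exp_mul, ← Real.exp_add]
    congr 1; ring
  have lE2 : E2 * V = Real.exp (3 / 2 * x + y - 1001/1000 * (e' + f' + k' + l')) := by
    rw [hE2, lV, hx, hy]
    simp only [← Real.exp_mul, ← Real.exp_add]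
    congr 1; ring
  have lM : (e * f) ^ 2 * (A ^ 2 * B ^ 2) = Real.exp (4 * x - 2 * (e' + f' + k' + l')) := by
    rw [lef, lA, lB, ← Real.exp_nat_mul, ← Real.exp_nat_mul]
    simp only [← Real.exp_add]
    congr 1; push_cast; ring
  have hABW : A * B ≤ W := by
    rw [lA, lB, lW, ← Real.exp_add, Real.exp_le_exp]; linarith
  have hef0 : 0 ≤ (e * f) ^ 2 := by positivity
  have triv_case : ∀ t, |TT a ρ A B W| ≤ t → (e * f) ^ 2 * t ≤ (C0 + 2 * C1) * ((E1 + E2) * V) →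
      (e * f) ^ 2 * (A ^ 2 * B ^ 2) ≤ (E1 + E2) * V →
      (e * f) ^ 2 * |TT a ρ A B W - G * (A ^ 2 * B ^ 2)| ≤ (C0 + 2 * C1 + 3 * C2 + |G|) * ((E1 + E2) * V) := by
    intro t ht h1 h2
    have h3 : |TT a ρ A B W - G * (A ^ 2 * B ^ 2)| ≤ t + |G| * (A ^ 2 * B ^ 2) := by
      refine (abs_sub _ _).trans (add_le_add ht (le_of_eq ?_))
      rw [abs_mul, abs_of_nonneg (by positivity : 0 ≤ A ^ 2 * B ^ 2)]
    have h4 := mul_le_mul_of_nonneg_left h3 hef0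
    have h5 := mul_le_mul_of_nonneg_left h2 (abs_nonneg G)
    have h6 : 0 ≤ 3 * C2 * ((E1 + E2) * V) := by positivity
    linarith
  rcases le_total (11/4 * x) y with hbig | hsmall
  · refine triv_case _ (h0 A B W hA0 hB0 hABW) ?_ ?_
    · have : (e * f) ^ 2 * ((A * B) ^ ((5:ℝ)/3) * W ^ ((1:ℝ)/3)) ≤ E2 * V := by
        rw [lE2, lef, lA, lB, lW]
        simp only [← Real.exp_mul, ← Real.exp_add, Real.exp_le_exp]
        linarith
      have := mul_le_mul_of_nonneg_left (this.trans w2) hC0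
      have : 0 ≤ 2 * C1 * ((E1 + E2) * V) := by positivity
      linarith
    · refine le_trans ?_ w2
      rw [lM, lE2, Real.exp_le_exp]; linarith
  rcases le_total (8/25 * x) (e' + f' + k') with hK | hK
  · have m1 : (e * f) ^ 2 * (W ^ ((1:ℝ)/1000) * ((A * B) ^ ((7:ℝ)/4) * W ^ ((1:ℝ)/4))) ≤ (E1 + E2) * V := by
      rcases le_total (33/14 * x) y with hm | hm
      · refine le_trans ?_ w2
        rw [lE2, lef, lA, lB, lW]
        simp only [← Real.exp_mul, ← Real.exp_add, Real.exp_le_exp]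
        linarith
      · refine le_trans ?_ w1
        rw [lE1, lef, lA, lB, lW]
        simp only [← Real.exp_mul, ← Real.exp_add, Real.exp_le_exp]
        linarith
    have m2 : (e * f) ^ 2 * (W ^ ((1:ℝ)/1000) * ((A * B) ^ ((5:ℝ)/4) * W ^ ((13:ℝ)/24))) ≤ (E1 + E2) * V := by
      rcases le_total (33/14 * x) y with hm | hm
      · refine le_trans ?_ w2
        rw [lE2, lef, lA, lB, lW]
        simp only [← Real.exp_mul, ← Real.exp_add, Real.exp_le_exp]
        linarith
      · refine le_trans ?_ w1
        rw [lE1, lef, lA, lB, lW]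
        simp only [← Real.exp_mul, ← Real.exp_add, Real.exp_le_exp]
        linarith
    have m3 : (e * f) ^ 2 * (A ^ 2 * B ^ 2) ≤ (E1 + E2) * V := by
      rcases le_total (33/14 * x) y with hm | hm
      · refine le_trans ?_ w2
        rw [lM, lE2, Real.exp_le_exp]; linarith
      · refine le_trans ?_ w1
        rw [lM, lE1, Real.exp_le_exp]; linarith
    refine triv_case _ (h1 A B W hA0 hB0 hABW) ?_ m3
    have n1 := mul_le_mul_of_nonneg_left m1 hC1
    have n2 := mul_le_mul_of_nonneg_left m2 hC1
    have : 0 ≤ C0 * ((E1 + E2) * V) := by positivity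
    linarith
  · have hA1 : 1 ≤ A := by rw [lA, Real.one_le_exp_iff]; linarith
    have hAW : A ^ 2 ≤ W := by
      rw [lA, lW, ← Real.exp_nat_mul, Real.exp_le_exp]; push_cast; linarith
    have hBW : B ^ 2 ≤ W := by
      rw [lB, lW, ← Real.exp_nat_mul, Real.exp_le_exp]; push_cast; linarith
    have m1 : (e * f) ^ 2 * (W ^ (1 + (1:ℝ)/1000) * B * A ^ ((1:ℝ)/4)) ≤ (E1 + E2) * V := by
      refine le_trans ?_ w2
      rw [lE2, lef, lA, lB, lW]
      simp only [← Real.exp_mul, ← Real.exp_add, Real.exp_le_exp]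
      linarith
    have m2 : (e * f) ^ 2 * (W ^ ((2:ℝ)/3) * (A * B)) ≤ (E1 + E2) * V := by
      refine le_trans ?_ w2
      rw [lE2, lef, lA, lB, lW]
      simp only [← Real.exp_mul, ← Real.exp_add, Real.exp_le_exp]
      linarith
    have m3 : (e * f) ^ 2 * ((A * B) ^ ((5:ℝ)/2) * W ^ (-(1:ℝ)/2)) ≤ (E1 + E2) * V := by
      refine le_trans ?_ w1
      rw [lE1, lef, lA, lB, lW]
      simp only [← Real.exp_mul, ← Real.exp_add, Real.exp_le_exp]
      linarith
    have n0 := mul_le_mul_of_nonneg_left (h2 A B W hA1 hB0 hAW hBW) hef0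
    have n1 := mul_le_mul_of_nonneg_left m1 hC2
    have n2 := mul_le_mul_of_nonneg_left m2 hC2
    have n3 := mul_le_mul_of_nonneg_left m3 hC2
    have : 0 ≤ (C0 + 2 * C1 + |G|) * ((E1 + E2) * V) := by positivity
    linarith

end Setup
end RS

namespace RS
open Finset MeasureTheory

/-- Partial sums of `v n / n²`. -/
noncomputable def PS (v : ℕ → ℝ) (N : ℕ) : ℝ := ∑ n ∈ Ioc 0 N, v n * (n:ℝ) ^ (-(2:ℝ))

namespace Setup
variable {a χ u v : ℕ → ℝ} {q : ℕ} {ρ c : ℝ}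

theorem summable_of_le (h : Setup a χ q ρ c) (hv : ∀ n, |v n| ≤ a n) :
    Summable fun n : ℕ => v n * (n:ℝ) ^ (-(2:ℝ)) := by
  refine Summable.of_norm_bounded (h.summable (s := 2) (by norm_num)) fun n => ?_
  rw [Real.norm_eq_abs, abs_mul, abs_of_nonneg (by positivity : (0:ℝ) ≤ (n:ℝ) ^ (-(2:ℝ)))]
  gcongr
  exact hv n

theorem tendsto_PS (h : Setup a χ q ρ c) (hv : ∀ n, |v n| ≤ a n) :
    Filter.Tendsto (PS v) Filter.atTop (nhds (∑' n : ℕ, v n * (n:ℝ) ^ (-(2:ℝ)))) := by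
  have h1 := tendsto_partial (fun n : ℕ => v n * (n:ℝ) ^ (-(2:ℝ))) (by simp) (h.summable_of_le hv)
  have h2 := h1.comp tendsto_natCast_atTop_atTop
  refine h2.congr fun n => ?_
  simp [PS]

/-- Rankin bound for the tail. -/
theorem tail_le (h : Setup a χ q ρ c) : ∃ C : ℝ, 0 ≤ C ∧ ∀ v : ℕ → ℝ, (∀ n, |v n| ≤ a n) → ∀ X : ℝ, 0 < X →
    |PS v ⌊X⌋₊ - ∑' n : ℕ, v n * (n:ℝ) ^ (-(2:ℝ))| ≤ C * X ^ (-(1:ℝ)/2) := by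
  obtain ⟨C, hC, hS⟩ := h.sum_conv_le (ε := 1/2) (by norm_num)
  refine ⟨C, hC, fun v hv X hX => ?_⟩
  refine le_of_tendsto ((tendsto_const_nhds.sub (h.tendsto_PS hv)).abs) ?_
  filter_upwards [Filter.eventually_ge_atTop ⌊X⌋₊] with M hM
  have e : PS v ⌊X⌋₊ - PS v M = -∑ n ∈ Ioc ⌊X⌋₊ M, v n * (n:ℝ) ^ (-(2:ℝ)) := by
    rw [PS, PS, ← sum_Ioc_consecutive _ (Nat.zero_le _) hM]; ring
  rw [e, abs_neg]
  refine (abs_sum_le_sum_abs _ _).trans ?_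
  calc ∑ n ∈ Ioc ⌊X⌋₊ M, |v n * (n:ℝ) ^ (-(2:ℝ))| ≤ ∑ n ∈ Ioc ⌊X⌋₊ M, X ^ (-(1:ℝ)/2) * (a n * (n:ℝ) ^ (-(1 + 1/2 : ℝ))) := by
        refine sum_le_sum fun n hn => ?_
        have hn1 := Nat.lt_of_floor_lt (mem_Ioc.1 hn).1
        have hn0 : (0:ℝ) < n := hX.trans hn1
        have p1 : (n:ℝ) ^ (-(2:ℝ)) = (n:ℝ) ^ (-(1:ℝ)/2) * (n:ℝ) ^ (-(1 + 1/2 : ℝ)) := by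
          rw [← Real.rpow_add hn0]; norm_num
        have p2 : (n:ℝ) ^ (-(1:ℝ)/2) ≤ X ^ (-(1:ℝ)/2) :=
          Real.rpow_le_rpow_of_nonpos hX hn1.le (by norm_num)
        have := h.nonneg n
        rw [abs_mul, abs_of_nonneg (by positivity : (0:ℝ) ≤ (n:ℝ) ^ (-(2:ℝ))), p1]
        calc |v n| * ((n:ℝ) ^ (-(1:ℝ)/2) * (n:ℝ) ^ (-(1 + 1/2 : ℝ))) ≤
            a n * (X ^ (-(1:ℝ)/2) * (n:ℝ) ^ (-(1 + 1/2 : ℝ))) := by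
              gcongr
              exact hv n
          _ = _ := by ring
    _ = X ^ (-(1:ℝ)/2) * ∑ n ∈ Ioc ⌊X⌋₊ M, (a n * (n:ℝ) ^ (-(1 + 1/2 : ℝ))) := by rw [mul_sum]
    _ ≤ X ^ (-(1:ℝ)/2) * C := by gcongr; exact hS _
    _ = _ := mul_comm _ _

/-- `ζ(2)·Σ μ(n)/n² = 1`. -/
theorem delta (h : Setup a χ q ρ c) (hu : USetup a u) :
    (∑' n : ℕ, a n * (n:ℝ) ^ (-(2:ℝ))) * (∑' n : ℕ, u n * (n:ℝ) ^ (-(2:ℝ))) = 1 := by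
  obtain ⟨C, hC, hT⟩ := h.tail_le
  obtain ⟨C', hC', hS⟩ := h.sum_conv_le (ε := 1/2) (by norm_num)
  have ha : ∀ n, |a n| ≤ a n := fun n => (abs_of_nonneg (h.nonneg n)).le
  set z := ∑' n : ℕ, a n * (n:ℝ) ^ (-(2:ℝ)) with hz
  set d := ∑' n : ℕ, u n * (n:ℝ) ^ (-(2:ℝ)) with hd
  have key : ∀ N : ℕ, 1 ≤ N → |z * PS u N - 1| ≤ C * C' * (N:ℝ) ^ (-(1:ℝ)/2) := by
    intro N hN
    have hN0 : (0:ℝ) < N := by exact_mod_cast hN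
    have e1 : ∑ f ∈ Ioc 0 N, u f * (f:ℝ) ^ (-(2:ℝ)) * PS a (N / f) = 1 := by
      have := hu.inv N hN fun n => (n:ℝ) ^ (-(2:ℝ))
      rw [Nat.cast_one, Real.one_rpow] at this
      rw [← this]
      refine sum_congr rfl fun f _ => ?_
      rw [PS, mul_assoc, mul_sum]
      congr 1
      refine sum_congr rfl fun x _ => ?_
      rw [Nat.cast_mul, Real.mul_rpow (by positivity) (by positivity)]; ring
    have e2 : z * PS u N - 1 = ∑ f ∈ Ioc 0 N, u f * (f:ℝ) ^ (-(2:ℝ)) * (z - PS a (N / f)) := by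
      nth_rewrite 1 [← e1]
      rw [PS, mul_sum, ← sum_sub_distrib]
      exact sum_congr rfl fun f _ => by ring
    rw [e2]
    refine (abs_sum_le_sum_abs _ _).trans ?_
    calc _ ≤ ∑ f ∈ Ioc 0 N, C * (N:ℝ) ^ (-(1:ℝ)/2) * (a f * (f:ℝ) ^ (-(1 + 1/2 : ℝ))) := by
          refine sum_le_sum fun f hf => ?_
          have hf0 : (0:ℝ) < f := by exact_mod_cast (mem_Ioc.1 hf).1
          have := hT a ha ((N:ℝ) / f) (by positivity)
          rw [floor_div_eq, Nat.floor_natCast, ← hz, abs_sub_comm, Real.div_rpow hN0.le hf0.le] at this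
          have e3 : (f:ℝ) ^ (-(2:ℝ)) = (f:ℝ) ^ (-(1 + 1/2 : ℝ)) * (f:ℝ) ^ (-(1:ℝ)/2) := by
            rw [← Real.rpow_add hf0]; norm_num
          have hfp : 0 < (f:ℝ) ^ (-(1:ℝ)/2) := by positivity
          have := h.nonneg f
          rw [abs_mul, abs_mul, abs_of_nonneg (by positivity : (0:ℝ) ≤ (f:ℝ) ^ (-(2:ℝ)))]
          calc _ ≤ a f * (f:ℝ) ^ (-(2:ℝ)) * (C * ((N:ℝ) ^ (-(1:ℝ)/2) / (f:ℝ) ^ (-(1:ℝ)/2))) := by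
                gcongr
                exact hu.le f
            _ = _ := by rw [e3]; generalize (f:ℝ) ^ (-(1:ℝ)/2) = w at *; field_simp
      _ = C * (N:ℝ) ^ (-(1:ℝ)/2) * ∑ f ∈ Ioc 0 N, (a f * (f:ℝ) ^ (-(1 + 1/2 : ℝ))) := by rw [mul_sum]
      _ ≤ C * (N:ℝ) ^ (-(1:ℝ)/2) * C' := by gcongr; exact hS _
      _ = _ := by ring
  have t1 : Filter.Tendsto (fun N : ℕ => |z * PS u N - 1|) Filter.atTop (nhds |z * d - 1|) :=
    (((h.tendsto_PS hu.le).const_mul z).sub_const 1).abs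
  have t2 : Filter.Tendsto (fun N : ℕ => C * C' * (N:ℝ) ^ (-(1:ℝ)/2)) Filter.atTop (nhds 0) := by
    have := ((tendsto_rpow_neg_atTop (by norm_num : (0:ℝ) < 1/2)).comp tendsto_natCast_atTop_atTop).const_mul (C * C')
    rw [mul_zero] at this
    refine this.congr fun n => ?_
    simp only [Function.comp]; norm_num
  have := le_of_tendsto_of_tendsto t1 t2 (by
    filter_upwards [Filter.eventually_ge_atTop 1] with N hN using key N hN)
  have := abs_eq_zero.1 (le_antisymm this (abs_nonneg _))
  linarith

theorem PS_bdd (h : Setup a χ q ρ c) : ∃ M : ℝ, 0 ≤ M ∧ ∀ v : ℕ → ℝ, (∀ n, |v n| ≤ a n) →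
    (∀ N, |PS v N| ≤ M) ∧ |∑' n : ℕ, v n * (n:ℝ) ^ (-(2:ℝ))| ≤ M := by
  obtain ⟨C, hC, hS⟩ := h.sum_conv_le (ε := 1) (by norm_num)
  refine ⟨C, hC, fun v hv => ?_⟩
  have h1 : ∀ N, |PS v N| ≤ C := fun N => by
    refine (abs_sum_le_sum_abs _ _).trans (le_trans (sum_le_sum fun n _ => ?_) (hS (Ioc 0 N)))
    rw [abs_mul, abs_of_nonneg (by positivity : (0:ℝ) ≤ (n:ℝ) ^ (-(2:ℝ)))]
    have e : -(2:ℝ) = -(1 + 1) := by norm_num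
    rw [e]
    gcongr
    exact hv n
  exact ⟨h1, le_of_tendsto (h.tendsto_PS hv).abs (Filter.Eventually.of_forall h1)⟩

/-- `Σ_{e ≤ x} a(e)e = ρx²/2 + O(x^{4/3})`. -/
theorem sum_id_le (h : Setup a χ q ρ c) {x : ℝ} (hx : 1 ≤ x) :
    |∑ e ∈ Ioc 0 ⌊x⌋₊, a e * e - ρ / 2 * x ^ 2| ≤ (2 * c + ρ) * x ^ ((4:ℝ)/3) := by
  have hc := h.cpos
  have hρ := h.rho_nonneg
  have hx0 : 0 < x := by linarith
  have h1 := HH_eq a ρ hx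
  rw [HH] at h1
  have h2 := h.E_le hx
  have h3 := intervalIntegral.norm_integral_le_of_norm_le_const (a := 1) (b := x) (f := fun t => EE a ρ t)
    (C := c * x ^ ((1:ℝ)/3)) (fun t ht => by
      rw [Set.uIoc_of_le hx] at ht
      have : 0 < t := by linarith [ht.1]
      refine (h.E_le ht.1.le).trans ?_
      gcongr
      exact ht.2)
  rw [Real.norm_eq_abs, abs_of_nonneg (by linarith : 0 ≤ x - 1)] at h3
  have e43 : x ^ ((4:ℝ)/3) = x ^ ((1:ℝ)/3) * x := by
    rw [← Real.rpow_add_one' hx0.le (by norm_num)]; norm_num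
  have o43 : 1 ≤ x ^ ((4:ℝ)/3) := Real.one_le_rpow hx (by norm_num)
  have p : 0 < x ^ ((1:ℝ)/3) := by positivity
  have e : ∑ e ∈ Ioc 0 ⌊x⌋₊, a e * e - ρ / 2 * x ^ 2 = x * EE a ρ x + ρ / 2 - ∫ t in (1:ℝ)..x, EE a ρ t := by linarith
  rw [e]
  refine (abs_sub _ _).trans ?_
  have h4 : |x * EE a ρ x + ρ / 2| ≤ c * x ^ ((4:ℝ)/3) + ρ * x ^ ((4:ℝ)/3) := by
    refine (abs_add_le _ _).trans (add_le_add ?_ ?_)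
    · rw [abs_mul, abs_of_pos hx0, e43]; nlinarith
    · rw [abs_of_nonneg (by positivity)]; nlinarith
  have h5 : |∫ t in (1:ℝ)..x, EE a ρ t| ≤ c * x ^ ((4:ℝ)/3) := by
    refine h3.trans ?_
    rw [e43]
    have : 0 < c * x ^ ((1:ℝ)/3) := by positivity
    nlinarith
  linarith

/-- The `ρ`-part. -/
theorem rho_part (h : Setup a χ q ρ c) (hu : USetup a u) : ∃ C : ℝ, 0 ≤ C ∧ ∀ X : ℝ, 1 ≤ X →
    |∑ f ∈ Ioc 0 ⌊X⌋₊, u f * ∑ e ∈ Ioc 0 (⌊X⌋₊ / f), a e * e -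
      ρ / 2 * (∑' n : ℕ, u n * (n:ℝ) ^ (-(2:ℝ))) * X ^ 2| ≤ C * X ^ ((3:ℝ)/2) := by
  obtain ⟨C, hC, hT⟩ := h.tail_le
  obtain ⟨C', hC', hS⟩ := h.sum_conv_le (ε := 1/3) (by norm_num)
  have hc := h.cpos
  have hρ := h.rho_nonneg
  set d := ∑' n : ℕ, u n * (n:ℝ) ^ (-(2:ℝ)) with hd
  refine ⟨(2 * c + ρ) * C' + ρ / 2 * C, by positivity, fun X hX => ?_⟩
  have hX0 : 0 < X := by linarith
  have hT := hT u hu.le X hX0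
  rw [← hd] at hT
  have e1 : ∑ f ∈ Ioc 0 ⌊X⌋₊, u f * ∑ e ∈ Ioc 0 (⌊X⌋₊ / f), a e * e - ρ / 2 * d * X ^ 2 =
      ∑ f ∈ Ioc 0 ⌊X⌋₊, u f * (∑ e ∈ Ioc 0 ⌊X / f⌋₊, a e * e - ρ / 2 * (X / f) ^ 2) +
        ρ / 2 * X ^ 2 * (PS u ⌊X⌋₊ - d) := by
    have : ∑ f ∈ Ioc 0 ⌊X⌋₊, u f * (∑ e ∈ Ioc 0 ⌊X / f⌋₊, a e * e - ρ / 2 * (X / f) ^ 2) =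
        ∑ f ∈ Ioc 0 ⌊X⌋₊, u f * ∑ e ∈ Ioc 0 (⌊X⌋₊ / f), a e * e - ρ / 2 * X ^ 2 * PS u ⌊X⌋₊ := by
      rw [PS, mul_sum, ← sum_sub_distrib]
      refine sum_congr rfl fun f hf => ?_
      rw [floor_div_eq, Real.rpow_neg (by positivity), Real.rpow_two]
      ring
    rw [this]; ring
  rw [e1]
  have b1 : |∑ f ∈ Ioc 0 ⌊X⌋₊, u f * (∑ e ∈ Ioc 0 ⌊X / f⌋₊, a e * e - ρ / 2 * (X / f) ^ 2)| ≤
      (2 * c + ρ) * C' * X ^ ((3:ℝ)/2) := by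
    refine (abs_sum_le_sum_abs _ _).trans ?_
    calc _ ≤ ∑ f ∈ Ioc 0 ⌊X⌋₊, (2 * c + ρ) * X ^ ((4:ℝ)/3) * (a f * (f:ℝ) ^ (-(1 + 1/3 : ℝ))) := by
          refine sum_le_sum fun f hf => ?_
          have hf0 : (0:ℝ) < f := by exact_mod_cast (mem_Ioc.1 hf).1
          have hfX := (Nat.le_floor_iff hX0.le).1 (mem_Ioc.1 hf).2
          have := h.sum_id_le (x := X / f) (by rw [le_div_iff₀ hf0]; linarith)
          rw [Real.div_rpow hX0.le hf0.le, div_eq_mul_inv (X ^ ((4:ℝ)/3)), ← Real.rpow_neg hf0.le] at this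
          have hn := h.nonneg f
          rw [abs_mul]
          calc _ ≤ a f * ((2 * c + ρ) * (X ^ ((4:ℝ)/3) * (f:ℝ) ^ (-((4:ℝ)/3)))) := by
                gcongr
                exact hu.le f
            _ = _ := by norm_num; ring
      _ = (2 * c + ρ) * X ^ ((4:ℝ)/3) * ∑ f ∈ Ioc 0 ⌊X⌋₊, (a f * (f:ℝ) ^ (-(1 + 1/3 : ℝ))) := by rw [mul_sum]
      _ ≤ (2 * c + ρ) * X ^ ((3:ℝ)/2) * C' := by
          have p1 : X ^ ((4:ℝ)/3) ≤ X ^ ((3:ℝ)/2) := Real.rpow_le_rpow_of_exponent_le hX (by norm_num)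
          exact mul_le_mul (mul_le_mul_of_nonneg_left p1 (by positivity)) (hS _)
            (sum_nonneg fun f _ => mul_nonneg (h.nonneg f) (by positivity)) (by positivity)
      _ = _ := by ring
  have b2 : |ρ / 2 * X ^ 2 * (PS u ⌊X⌋₊ - d)| ≤ ρ / 2 * C * X ^ ((3:ℝ)/2) := by
    rw [abs_mul, abs_of_nonneg (by positivity)]
    have : X ^ ((3:ℝ)/2) = X ^ 2 * X ^ (-(1:ℝ)/2) := by
      rw [← Real.rpow_two, ← Real.rpow_add hX0]; norm_num
    rw [this]
    calc _ ≤ ρ / 2 * X ^ 2 * (C * X ^ (-(1:ℝ)/2)) := by gcongr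
      _ = _ := by ring
  refine (abs_add_le _ _).trans ((add_le_add b1 b2).trans (le_of_eq ?_))
  ring

end Setup
end RS

namespace RS
open Finset MeasureTheory

namespace Setup
variable {a χ u : ℕ → ℝ} {q : ℕ} {ρ c : ℝ}

theorem prod4 (N : ℕ) (w1 w2 w3 w4 : ℕ → ℝ) :
    ∑ e ∈ Ioc 0 N, ∑ f ∈ Ioc 0 N, ∑ k ∈ Ioc 0 N, ∑ l ∈ Ioc 0 N, w1 e * w2 f * w3 k * w4 l =
      (∑ e ∈ Ioc 0 N, w1 e) * (∑ e ∈ Ioc 0 N, w2 e) * (∑ e ∈ Ioc 0 N, w3 e) * (∑ e ∈ Ioc 0 N, w4 e) := by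
  simp only [← mul_sum, ← sum_mul]

theorem E_part (h : Setup a χ q ρ c) (hu : USetup a u) : ∃ C : ℝ, 0 ≤ C ∧ ∀ X Y : ℝ, 1 ≤ X → X ^ 2 ≤ Y →
    |∑ e ∈ Ioc 0 ⌊X⌋₊, ∑ f ∈ Ioc 0 ⌊X⌋₊, ∑ k ∈ Ioc 0 ⌊X⌋₊, ∑ l ∈ Ioc 0 ⌊X⌋₊,
      a e * u f * u k * u l * (e * f : ℝ) ^ 2 *
        TT a ρ (X / (e * f * k)) (X / (e * f * l)) (Y / (e * f ^ 2)) -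
      (-kap χ q / 2) * ρ ^ 2 / 4 * X ^ 4 * (PS a ⌊X⌋₊ * PS u ⌊X⌋₊ ^ 3)| ≤
    C * (X ^ ((24:ℝ)/5) * Y ^ (-(2:ℝ)/5) + X ^ ((3:ℝ)/2) * Y) := by
  obtain ⟨C, hC, hT⟩ := h.term_bound
  obtain ⟨C', hC', hS⟩ := h.sum_conv_le (ε := 1/1000) (by norm_num)
  set G := (-kap χ q / 2) * ρ ^ 2 / 4 with hG
  refine ⟨C * C' ^ 4, by positivity, fun X Y hX hXY => ?_⟩
  have hX0 : 0 < X := by linarith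
  have hY0 : 0 < Y := lt_of_lt_of_le (by positivity) hXY
  set N := ⌊X⌋₊ with hN
  set E := X ^ ((24:ℝ)/5) * Y ^ (-(2:ℝ)/5) + X ^ ((3:ℝ)/2) * Y with hE
  have hE0 : 0 ≤ E := by positivity
  set w : ℕ → ℝ := fun n => a n * (n:ℝ) ^ (-(1 + 1/1000 : ℝ)) with hw
  set T : ℕ → ℕ → ℕ → ℕ → ℝ := fun e f k l => TT a ρ (X / (e * f * k)) (X / (e * f * l)) (Y / (e * f ^ 2)) with hTd
  have e1 : G * X ^ 4 * (PS a N * PS u N ^ 3) =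
      ∑ e ∈ Ioc 0 N, ∑ f ∈ Ioc 0 N, ∑ k ∈ Ioc 0 N, ∑ l ∈ Ioc 0 N,
        a e * u f * u k * u l * (e * f : ℝ) ^ 2 * (G * ((X / (e * f * k : ℝ)) ^ 2 * (X / (e * f * l : ℝ)) ^ 2)) := by
    have p := prod4 N (fun n => a n * (n:ℝ) ^ (-(2:ℝ))) (fun n => u n * (n:ℝ) ^ (-(2:ℝ)))
      (fun n => u n * (n:ℝ) ^ (-(2:ℝ))) (fun n => u n * (n:ℝ) ^ (-(2:ℝ)))
    have p' : G * X ^ 4 * (PS a N * PS u N ^ 3) = G * X ^ 4 * ((∑ e ∈ Ioc 0 N, a e * (e:ℝ) ^ (-(2:ℝ))) *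
      (∑ e ∈ Ioc 0 N, u e * (e:ℝ) ^ (-(2:ℝ))) * (∑ e ∈ Ioc 0 N, u e * (e:ℝ) ^ (-(2:ℝ))) *
      (∑ e ∈ Ioc 0 N, u e * (e:ℝ) ^ (-(2:ℝ)))) := by rw [PS, PS]; ring
    rw [p', ← p]
    simp only [mul_sum]
    refine sum_congr rfl fun e he => sum_congr rfl fun f hf => sum_congr rfl fun k hk => sum_congr rfl fun l hl => ?_
    have he0 : (e:ℝ) ≠ 0 := by exact_mod_cast (mem_Ioc.1 he).1.ne'
    have hf0 : (f:ℝ) ≠ 0 := by exact_mod_cast (mem_Ioc.1 hf).1.ne'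
    have hk0 : (k:ℝ) ≠ 0 := by exact_mod_cast (mem_Ioc.1 hk).1.ne'
    have hl0 : (l:ℝ) ≠ 0 := by exact_mod_cast (mem_Ioc.1 hl).1.ne'
    rw [Real.rpow_neg (by positivity), Real.rpow_neg (by positivity), Real.rpow_neg (by positivity),
      Real.rpow_neg (by positivity), Real.rpow_two, Real.rpow_two, Real.rpow_two, Real.rpow_two]
    field_simp
  rw [e1]
  simp only [← sum_sub_distrib]
  have b : ∀ e ∈ Ioc 0 N, ∀ f ∈ Ioc 0 N, ∀ k ∈ Ioc 0 N, ∀ l ∈ Ioc 0 N,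
      |a e * u f * u k * u l * (e * f : ℝ) ^ 2 * T e f k l -
        a e * u f * u k * u l * (e * f : ℝ) ^ 2 * (G * ((X / (e * f * k : ℝ)) ^ 2 * (X / (e * f * l : ℝ)) ^ 2))| ≤
      C * E * (w e * w f * w k * w l) := by
    intro e he f hf k hk l hl
    have he0 : (1:ℝ) ≤ e := by exact_mod_cast (mem_Ioc.1 he).1
    have hf0 : (1:ℝ) ≤ f := by exact_mod_cast (mem_Ioc.1 hf).1
    have hk0 : (1:ℝ) ≤ k := by exact_mod_cast (mem_Ioc.1 hk).1
    have hl0 : (1:ℝ) ≤ l := by exact_mod_cast (mem_Ioc.1 hl).1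
    have hlX := (Nat.le_floor_iff hX0.le).1 (mem_Ioc.1 hl).2
    have hb := hT X Y hX hXY e f k l he0 hf0 hk0 hl0 hlX
    have ne := h.nonneg e
    have nf := h.nonneg f
    have nk := h.nonneg k
    have nl := h.nonneg l
    have hw4 : w e * w f * w k * w l = a e * a f * a k * a l * ((e:ℝ) ^ (-(1 + 1/1000 : ℝ)) * (f:ℝ) ^ (-(1 + 1/1000 : ℝ)) *
        (k:ℝ) ^ (-(1 + 1/1000 : ℝ)) * (l:ℝ) ^ (-(1 + 1/1000 : ℝ))) := by rw [hw]; ring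
    rw [hw4, ← mul_sub, mul_assoc, abs_mul, abs_mul ((e * f : ℝ) ^ 2), abs_of_nonneg (by positivity : 0 ≤ (e * f : ℝ) ^ 2)]
    have hc : |a e * u f * u k * u l| ≤ a e * a f * a k * a l := by
      rw [abs_mul, abs_mul, abs_mul, abs_of_nonneg ne]
      have := hu.le f
      have := hu.le k
      have := hu.le l
      gcongr
    calc _ ≤ (a e * a f * a k * a l) * _ := mul_le_mul hc hb (by positivity) (by positivity)
      _ = _ := by ring
  refine (abs_sum_le_sum_abs _ _).trans ?_
  calc _ ≤ ∑ e ∈ Ioc 0 N, ∑ f ∈ Ioc 0 N, ∑ k ∈ Ioc 0 N, ∑ l ∈ Ioc 0 N, C * E * (w e * w f * w k * w l) := by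
        refine sum_le_sum fun e he => (abs_sum_le_sum_abs _ _).trans ?_
        refine sum_le_sum fun f hf => (abs_sum_le_sum_abs _ _).trans ?_
        refine sum_le_sum fun k hk => (abs_sum_le_sum_abs _ _).trans ?_
        exact sum_le_sum fun l hl => b e he f hf k hk l hl
    _ = C * E * (∑ n ∈ Ioc 0 N, w n) ^ 4 := by
        have p := prod4 N w w w w
        simp only [← mul_sum] at p ⊢
        rw [p]; ring
    _ ≤ C * E * C' ^ 4 := by
        gcongr
        · exact sum_nonneg fun n _ => mul_nonneg (h.nonneg n) (by positivity)
        · exact hS _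
    _ = _ := by ring

theorem CC_asymp (h : Setup a χ q ρ c) (hu : USetup a u) : ∃ C : ℝ, 0 ≤ C ∧ ∀ X Y : ℝ, 1 ≤ X → X ^ 2 ≤ Y →
    |CC a u X Y - (ρ ^ 2 / 2 * (∑' n : ℕ, u n * (n:ℝ) ^ (-(2:ℝ))) * X ^ 2 * Y +
      (-kap χ q / 2) * ρ ^ 2 / 4 * (∑' n : ℕ, u n * (n:ℝ) ^ (-(2:ℝ))) ^ 2 * X ^ 4)| ≤
    C * (X ^ ((24:ℝ)/5) * Y ^ (-(2:ℝ)/5) + X ^ ((3:ℝ)/2) * Y) := by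
  obtain ⟨C1, hC1, h1⟩ := h.rho_part hu
  obtain ⟨C2, hC2, h2⟩ := h.E_part hu
  obtain ⟨C3, hC3, h3⟩ := h.tail_le
  obtain ⟨M, hM, h4⟩ := h.PS_bdd
  have hzd := h.delta hu
  have hρ := h.rho_nonneg
  have ha : ∀ n, |a n| ≤ a n := fun n => (abs_of_nonneg (h.nonneg n)).le
  set z := ∑' n : ℕ, a n * (n:ℝ) ^ (-(2:ℝ)) with hz
  set d := ∑' n : ℕ, u n * (n:ℝ) ^ (-(2:ℝ)) with hd
  set G := (-kap χ q / 2) * ρ ^ 2 / 4 with hG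
  refine ⟨ρ * C1 + C2 + |G| * (4 * M ^ 3 * C3), by positivity, fun X Y hX hXY => ?_⟩
  have hX0 : 0 < X := by linarith
  have hY0 : 0 < Y := lt_of_lt_of_le (by positivity) hXY
  have h1 := h1 X hX
  have h2 := h2 X Y hX hXY
  have hza := h3 a ha X hX0
  have hzu := h3 u hu.le X hX0
  have ma := (h4 a ha).2
  have mu := (h4 u hu.le).2
  have mu' := (h4 u hu.le).1 ⌊X⌋₊
  rw [← hz] at hza ma
  rw [← hd] at hzu mu
  rw [CC_split hu ρ X Y]
  set S1 := ∑ f ∈ Ioc 0 ⌊X⌋₊, u f * ∑ e ∈ Ioc 0 (⌊X⌋₊ / f), a e * e with hS1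
  set S2 := ∑ e ∈ Ioc 0 ⌊X⌋₊, ∑ f ∈ Ioc 0 ⌊X⌋₊, ∑ k ∈ Ioc 0 ⌊X⌋₊, ∑ l ∈ Ioc 0 ⌊X⌋₊,
      a e * u f * u k * u l * (e * f : ℝ) ^ 2 *
        TT a ρ (X / (e * f * k)) (X / (e * f * l)) (Y / (e * f ^ 2)) with hS2
  set p := PS a ⌊X⌋₊ with hp
  set r := PS u ⌊X⌋₊ with hr
  have hd2 : d ^ 2 = z * d ^ 3 := by
    calc d ^ 2 = (z * d) * d ^ 2 := by rw [hzd, one_mul]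
      _ = _ := by ring
  have e1 : ρ * Y * S1 + S2 - (ρ ^ 2 / 2 * d * X ^ 2 * Y + G * d ^ 2 * X ^ 4) =
      ρ * Y * (S1 - ρ / 2 * d * X ^ 2) + (S2 - G * X ^ 4 * (p * r ^ 3)) + G * X ^ 4 * (p * r ^ 3 - z * d ^ 3) := by
    rw [hd2]; ring
  rw [e1]
  set E1 := X ^ ((24:ℝ)/5) * Y ^ (-(2:ℝ)/5) with hE1
  set E2 := X ^ ((3:ℝ)/2) * Y with hE2
  have hE10 : 0 ≤ E1 := by positivity
  have hE20 : 0 ≤ E2 := by positivity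
  have b1 : |ρ * Y * (S1 - ρ / 2 * d * X ^ 2)| ≤ ρ * C1 * E2 := by
    rw [abs_mul, abs_of_nonneg (by positivity)]
    calc _ ≤ ρ * Y * (C1 * X ^ ((3:ℝ)/2)) := by gcongr
      _ = _ := by rw [hE2]; ring
  set t := X ^ (-(1:ℝ)/2) with ht
  have ht0 : 0 < t := by positivity
  have b3 : |p * r ^ 3 - z * d ^ 3| ≤ 4 * M ^ 3 * C3 * t := by
    have e : p * r ^ 3 - z * d ^ 3 = (p - z) * r ^ 3 + z * ((r - d) * (r * r + r * d + d * d)) := by ring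
    rw [e]
    have g1 : |(p - z) * r ^ 3| ≤ (C3 * t) * M ^ 3 := by
      rw [abs_mul, abs_pow]; gcongr
    have g2 : |r * r + r * d + d * d| ≤ M * M + M * M + M * M := by
      refine (abs_add_le _ _).trans (add_le_add ((abs_add_le _ _).trans (add_le_add ?_ ?_)) ?_)
      · rw [abs_mul]; gcongr
      · rw [abs_mul]; gcongr
      · rw [abs_mul]; gcongr
    have g3 : |z * ((r - d) * (r * r + r * d + d * d))| ≤ M * ((C3 * t) * (M * M + M * M + M * M)) := by
      rw [abs_mul, abs_mul]; gcongr
    refine (abs_add_le _ _).trans ((add_le_add g1 g3).trans (le_of_eq ?_))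
    ring
  have b4 : X ^ 4 * t ≤ E2 := by
    have e : X ^ 4 * t = X ^ ((3:ℝ)/2) * X ^ 2 := by
      rw [ht, ← Real.rpow_natCast X 4, ← Real.rpow_natCast X 2, ← Real.rpow_add hX0, ← Real.rpow_add hX0]; norm_num
    rw [e, hE2]; gcongr
  have b5 : |G * X ^ 4 * (p * r ^ 3 - z * d ^ 3)| ≤ |G| * (4 * M ^ 3 * C3) * E2 := by
    rw [abs_mul, abs_mul, abs_of_nonneg (by positivity : 0 ≤ X ^ 4)]
    calc _ ≤ |G| * X ^ 4 * (4 * M ^ 3 * C3 * t) := by gcongr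
      _ = |G| * (4 * M ^ 3 * C3) * (X ^ 4 * t) := by ring
      _ ≤ _ := by gcongr
  refine (abs_add_le _ _).trans ((add_le_add ((abs_add_le _ _).trans (add_le_add b1 h2)) b5).trans ?_)
  have n1 : 0 ≤ ρ * C1 * E1 := by positivity
  have n2 : 0 ≤ |G| * (4 * M ^ 3 * C3) * E1 := by positivity
  linarith

end Setup

theorem C2_main (F : Type) [Field F] [NumberField F]
    (hdeg : Module.finrank ℚ F = 2) (ρ : ℝ)
    (hρ : ∃ c : ℝ, ∀ x : ℝ, 1 ≤ x →
      |(Nat.card {I : Ideal (𝓞 F) // I ≠ 0 ∧ (Ideal.absNorm I : ℝ) ≤ x} : ℝ) - ρ * x|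
        ≤ c * x ^ ((1 : ℝ) / 3))
    (Z : ℂ → ℂ) (hZ : IsDedekindZeta F Z) :
    ∃ C : ℝ, 0 < C ∧ ∀ X Y : ℝ, 3 ≤ X → X < Y → X ^ 2 < Y →
      ‖(C2 F X Y : ℂ) -
          ((ρ : ℂ) ^ 2 / (2 * Z 2) * (X : ℂ) ^ 2 * (Y : ℂ) +
            Z 0 * (ρ : ℂ) ^ 2 / (4 * Z 2 ^ 2) * (X : ℂ) ^ 4)‖
        ≤ C * (X ^ ((24 : ℝ) / 5) * Y ^ (-(2 : ℝ) / 5) +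
            X ^ 2 * Y ^ ((2 : ℝ) / 3) * Real.log Y ^ 5 +
            X ^ ((3 : ℝ) / 2) * Y * Real.log Y ^ 3) := by
  obtain ⟨χ, q, c, h⟩ := exists_setup hdeg ρ hρ
  have hu := usetup_aR F
  have hZs : ∀ s : ℝ, 1 < s → Z s = ((∑' n : ℕ, aR F n * (n:ℝ) ^ (-s) : ℝ) : ℂ) := fun s hs => by
    rw [hZ.2 s (by simpa using hs), dzeta_real h hs]
  have hZ0 := h.zeta_zero Z hZ.1 hZs
  have hZ2 := hZs 2 (by norm_num)
  have hzd := h.delta hu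
  obtain ⟨C, hC, hb⟩ := h.CC_asymp hu
  set γ := -kap χ q / 2
  set z := ∑' n : ℕ, aR F n * (n:ℝ) ^ (-(2:ℝ)) with hz
  set d := ∑' n : ℕ, uR F n * (n:ℝ) ^ (-(2:ℝ)) with hd
  have hz0 : z ≠ 0 := fun h0 => by rw [h0, zero_mul] at hzd; exact zero_ne_one hzd
  have hdz : d = z⁻¹ := eq_inv_of_mul_eq_one_right hzd
  refine ⟨C + 1, by linarith, fun X Y hX hXY hXY2 => ?_⟩
  have hX0 : 0 < X := by linarith
  have hY0 : 0 < Y := by linarith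
  have hb := hb X Y (by linarith) hXY2.le
  have hc2 := C2_eq_CC (F := F) hX0.le hY0.le
  have e : (C2 F X Y : ℂ) - ((ρ : ℂ) ^ 2 / (2 * Z 2) * (X : ℂ) ^ 2 * (Y : ℂ) +
            Z 0 * (ρ : ℂ) ^ 2 / (4 * Z 2 ^ 2) * (X : ℂ) ^ 4) =
      ((CC (aR F) (uR F) X Y - (ρ ^ 2 / 2 * d * X ^ 2 * Y + γ * ρ ^ 2 / 4 * d ^ 2 * X ^ 4) : ℝ) : ℂ) := by
    have e2 : (C2 F X Y : ℂ) = ((CC (aR F) (uR F) X Y : ℝ) : ℂ) := by rw [← hc2]; push_cast; rfl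
    have e3 : Z 2 = (z : ℂ) := by rw [← hZ2]; norm_num
    have hzc : (z:ℂ) ≠ 0 := by exact_mod_cast hz0
    rw [e2, e3, hZ0, hdz]
    push_cast
    field_simp
  rw [e, Complex.norm_real, Real.norm_eq_abs]
  have hl : 1 ≤ Real.log Y := by
    rw [Real.le_log_iff_exp_le hY0]
    exact Real.exp_one_lt_d9.le.trans (by norm_num; linarith)
  have hl3 : 1 ≤ Real.log Y ^ 3 := one_le_pow₀ hl
  have t1 : 0 ≤ X ^ 2 * Y ^ ((2 : ℝ) / 3) * Real.log Y ^ 5 := by positivity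
  have t2 : X ^ ((3 : ℝ) / 2) * Y ≤ X ^ ((3 : ℝ) / 2) * Y * Real.log Y ^ 3 :=
    le_mul_of_one_le_right (by positivity) hl3
  have t3 : 0 ≤ X ^ ((24 : ℝ) / 5) * Y ^ (-(2 : ℝ) / 5) := by positivity
  have t4 : 0 ≤ X ^ ((3 : ℝ) / 2) * Y := by positivity
  refine hb.trans (mul_le_mul (by linarith) (by linarith) (by linarith) (by linarith))

end RS

theorem C2_asymptotic (F : Type) [Field F] [NumberField F]
    (hdeg : Module.finrank ℚ F = 2) (ρ : ℝ)
    (hρ : ∃ c : ℝ, ∀ x : ℝ, 1 ≤ x →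
      |(Nat.card {I : Ideal (𝓞 F) // I ≠ 0 ∧ (Ideal.absNorm I : ℝ) ≤ x} : ℝ) - ρ * x|
        ≤ c * x ^ ((1 : ℝ) / 3))
    (Z : ℂ → ℂ) (hZ : IsDedekindZeta F Z) :
    ∃ C : ℝ, 0 < C ∧ ∀ X Y : ℝ, 3 ≤ X → X < Y → X ^ 2 < Y →
      ‖(C2 F X Y : ℂ) -
          ((ρ : ℂ) ^ 2 / (2 * Z 2) * (X : ℂ) ^ 2 * (Y : ℂ) +
            Z 0 * (ρ : ℂ) ^ 2 / (4 * Z 2 ^ 2) * (X : ℂ) ^ 4)‖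
        ≤ C * (X ^ ((24 : ℝ) / 5) * Y ^ (-(2 : ℝ) / 5) +
            X ^ 2 * Y ^ ((2 : ℝ) / 3) * Real.log Y ^ 5 +
            X ^ ((3 : ℝ) / 2) * Y * Real.log Y ^ 3) := by
  exact RS.C2_main F hdeg ρ hρ Z hZ
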